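/- Let r,s ∈ (4/3,∞] with 1 ≤ 5/(3r) + 2/s < 1 + 1/(3r), and let ν₀ > 0. Then the following are equivalent: (a) the set of data u₀ ∈ L²_σ for which there exist T > 0 and a weak solution u ∈ W_{ν₀}(u₀) with ‖u‖_{L^r(0,T;L^s)} < ∞ is non-meagre in L²_σ; (b) there exists C > 0 such that for every ν > 0 and every u₀ ∈ L²_σ there exists u ∈ W_ν(u₀) with ‖u‖_{L^∞(0,∞;L²)} + √ν ‖∇u‖_{L²(0,∞;L²)} ≤ C ‖u₀‖_{L²} and ‖u‖_{L^r(0,∞;L^s)} ≤ C ν^{−3(5/(3r)+2/s−1)} ‖u₀‖_{L²}^{2(2/r+3/s−1)}. -/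

import Mathlib

open MeasureTheory ENNReal Set Filter

noncomputable section

abbrev E3 : Type := EuclideanSpace ℝ (Fin 3)

/-- Spatial partial derivative of a scalar function in the `j`-th coordinate direction. -/
def pd (f : E3 → ℝ) (j : Fin 3) (x : E3) : ℝ :=
  fderiv ℝ f x (EuclideanSpace.single j 1)

/-- Divergence-free in the sense of distributions. -/
def IsDivFree (v : E3 → E3) : Prop :=
  ∀ φ : E3 → ℝ, ContDiff ℝ (⊤ : ℕ∞) φ → HasCompactSupport φ →
    ∫ x : E3, ∑ i, v x i * pd φ i x = 0

/-- The space-time measure on `(0,∞) × ℝ³`. -/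
def μST : Measure (ℝ × E3) := (volume.restrict (Ioi (0:ℝ))).prod volume

/-- Mixed norm `L^r(I; L^s)`. -/
def mixedNorm (r s : ℝ≥0∞) (I : Set ℝ) (u : ℝ → E3 → E3) : ℝ≥0∞ :=
  if r = ∞ then essSup (fun t => eLpNorm (u t) s volume) (volume.restrict I)
  else (∫⁻ t in I, (eLpNorm (u t) s volume) ^ r.toReal) ^ (1 / r.toReal)

/-- Squared spatial `L²` norm of the (matrix-valued) gradient at time `t`. -/
def gradSq (G : ℝ → E3 → Fin 3 → Fin 3 → ℝ) (t : ℝ) : ℝ≥0∞ :=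
  ∫⁻ x : E3, ∑ i, ∑ j, ENNReal.ofReal ((G t x i j) ^ 2)

/-- `L²((0,∞); L²)` norm of the gradient. -/
def gradL2 (G : ℝ → E3 → Fin 3 → Fin 3 → ℝ) : ℝ≥0∞ :=
  (∫⁻ t in Ioi (0:ℝ), gradSq G t) ^ (1/2 : ℝ)

/-- `G` is the distributional spatial gradient of `u` on `ℝ³ × (0,∞)`. -/
def IsDistGrad (u : ℝ → E3 → E3) (G : ℝ → E3 → Fin 3 → Fin 3 → ℝ) : Prop :=
  ∀ ψ : ℝ × E3 → ℝ, ContDiff ℝ (⊤ : ℕ∞) ψ → HasCompactSupport ψ →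
    tsupport ψ ⊆ {p | 0 < p.1} → ∀ i j,
    (∫ p, u p.1 p.2 i * pd (fun y => ψ (p.1, y)) j p.2 ∂μST)
      = - ∫ p, G p.1 p.2 i j * ψ p ∂μST

/-- Admissible space-time test function: smooth, compactly supported in `ℝ³ × [0,∞)`
and divergence-free. -/
def IsTest (φ : ℝ × E3 → E3) : Prop :=
  ContDiff ℝ (⊤ : ℕ∞) φ ∧ HasCompactSupport φ ∧
    ∀ p : ℝ × E3, ∑ i, pd (fun y => φ (p.1, y) i) i p.2 = 0

def timeDeriv (φ : ℝ × E3 → E3) (p : ℝ × E3) (i : Fin 3) : ℝ :=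
  deriv (fun τ => φ (τ, p.2) i) p.1

def spaceLap (φ : ℝ × E3 → E3) (p : ℝ × E3) (i : Fin 3) : ℝ :=
  ∑ j, pd (fun y => pd (fun z => φ (p.1, z) i) j y) j p.2

def spaceGrad (φ : ℝ × E3 → E3) (p : ℝ × E3) (i j : Fin 3) : ℝ :=
  pd (fun y => φ (p.1, y) i) j p.2

/-- Weak solution of the Navier–Stokes equations on `ℝ³ × (0,∞)` with viscosity `ν`,
datum `u₀` and distributional spatial gradient `G`. -/
def IsWeakNS (ν : ℝ) (u₀ : E3 → E3) (u : ℝ → E3 → E3)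
    (G : ℝ → E3 → Fin 3 → Fin 3 → ℝ) : Prop :=
  AEStronglyMeasurable (Function.uncurry u) μST ∧
  mixedNorm ∞ 2 (Ioi 0) u < ∞ ∧
  (∀ᵐ t ∂(volume.restrict (Ioi (0:ℝ))), IsDivFree (u t)) ∧
  AEStronglyMeasurable (Function.uncurry G) μST ∧
  (∫⁻ t in Ioi (0:ℝ), gradSq G t) < ∞ ∧
  IsDistGrad u G ∧
  ∀ φ : ℝ × E3 → E3, IsTest φ →
    (∫ p,
        ((∑ i, u p.1 p.2 i * (timeDeriv φ p i + ν * spaceLap φ p i)) +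
         ∑ i, ∑ j, u p.1 p.2 i * u p.1 p.2 j * spaceGrad φ p i j) ∂μST)
      = - ∫ x : E3, ∑ i, u₀ x i * φ (0, x) i

/-- Leray–Hopf solution: weak solution satisfying the energy inequality. -/
def IsLerayHopf (ν : ℝ) (u₀ : E3 → E3) (u : ℝ → E3 → E3)
    (G : ℝ → E3 → Fin 3 → Fin 3 → ℝ) : Prop :=
  IsWeakNS ν u₀ u G ∧
  ∀ᵐ t ∂(volume.restrict (Ioi (0:ℝ))),
    ENNReal.ofReal (1/2) * (eLpNorm (u t) 2 volume) ^ (2:ℕ)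
        + ENNReal.ofReal ν * ∫⁻ τ in Ioc (0:ℝ) t, gradSq G τ
      ≤ ENNReal.ofReal (1/2) * (eLpNorm u₀ 2 volume) ^ (2:ℕ)

/-- `L²_σ`: divergence-free fields in `L²(ℝ³;ℝ³)`, as a subset of `L²`. -/
def L2σ : Set (Lp E3 2 (volume : Measure E3)) := {v | IsDivFree ⇑v}

/-- Space-time. -/
notation "ST" => ℝ × E3

/-- Time-dependent vector fields. -/
notation "Flow" => ℝ → E3 → E3

/-- Time-dependent matrix fields. -/
notation "GFlow" => ℝ → E3 → Fin 3 → Fin 3 → ℝ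

/-- Positive times. -/
notation "R₊" => Ioi (0:ℝ)

/-- Lebesgue measure on positive times. -/
notation "μT" => volume.restrict R₊

notation "C3" => Fin 3 → ℂ

notation "L2E" => Lp E3 2 (volume : Measure E3)

notation "Smooth" => ContDiff ℝ (⊤ : ℕ∞)

open Complex (imCLM norm_real ofRealCLM ofReal_sum reCLM real_smul)
open Continuous (aestronglyMeasurable)
open ContinuousLinearMap (coe_fst' coe_snd' comp_apply)
open ENNReal (ofReal pow_le_pow_left_iff)
open EuclideanSpace (inner_single_right norm_sq_eq single)
open Filter.Eventually (of_forall)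
open Finset (abs_sum_le_sum_abs measurable_sum mul_sum sum_add_distrib sum_comm sum_congr
  sum_eq_zero sum_le_sum sum_mul sum_nonneg sum_sub_distrib)
open Function (comp_def uncurry)
open Homeomorph (addRight mulLeft₀ smulOfNeZero)
open Measurable (lintegral_prod_right')
open MeasureTheory.L2 (inner_def)
open MeasureTheory.Measure (ae_ae_of_ae_prod prod_restrict restrict_mono restrict_restrict
  restrict_univ)
open MeasureTheory.QuasiMeasurePreserving (prodMap)
open Metric (ball closedBall mem_ball mem_closedBall)
open PiLp (inner_apply norm_apply_le)
open Real (dist_eq exp fourierChar log_div log_mul norm_eq_abs pi_pos sq_sqrt sqrt_eq_rpow sqrt_mul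
  sqrt_sq)
open Real.HolderConjugate (two_two)
open SchwartzMap (smulLeftCLM_apply_apply)
open TopologicalSpace.IsSeparable (of_separableSpace)
open WithLp (toLp)
open scoped Real FourierTransform SchwartzMap Laplacian LineDeriv

section

variable {φ : ST → E3} {u : Flow} {A : ST → ℝ≥0∞} {b : E3 → C3} {ψ : E3 → ℝ} {c : ℝ} {a : ST → C3}
  {D N : ℝ≥0∞} {f : ST → ℝ} {v : E3 → E3} {u₀ : E3 → E3} {t : ℝ} {M : ℝ≥0∞} {g : ST → ℝ}
  {r s : ℝ≥0∞} {G : GFlow} {ν : ℝ}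

/-- The `j`-th coordinate vector of `ℝ³`. -/
def e3 (j : Fin 3) : E3 := single j 1

lemma norm_e3 (j : Fin 3) : ‖e3 j‖ = 1 := by simp [e3]

lemma inner_eq_sum (v w : E3) : inner ℝ v w = ∑ i, v i * w i := by simp [inner_apply, mul_comm]

lemma abs_coord_le (v : E3) (i : Fin 3) : |v i| ≤ ‖v‖ := by simpa using norm_apply_le v i

/-- Spatial derivative of a function of space-time. -/
def dX (j : Fin 3) (f : ST → ℝ) (p : ST) : ℝ := fderiv ℝ f p (0, e3 j)

/-- Time derivative of a function of space-time. -/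
def dT (f : ST → ℝ) (p : ST) : ℝ := fderiv ℝ f p (1, 0)

section calculus
variable {f : ST → ℝ}

lemma pd_slice_eq_dX (hf : Differentiable ℝ f) (j : Fin 3) (t : ℝ) (x : E3) :
    pd (fun y => f (t, y)) j x = dX j f (t, x) := by
  have h1 : HasFDerivAt (fun y : E3 => (t, y)) (ContinuousLinearMap.inr ℝ ℝ E3) x :=
    hasFDerivAt_prodMk_right t x
  have h2 := (hf (t, x)).hasFDerivAt.comp x h1
  have : fderiv ℝ (fun y => f (t, y)) x = (fderiv ℝ f (t, x)).comp (ContinuousLinearMap.inr ℝ ℝ E3) :=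
    h2.fderiv
  simp [pd, dX, this, e3]

lemma deriv_slice_eq_dT (hf : Differentiable ℝ f) (t : ℝ) (x : E3) :
    deriv (fun τ => f (τ, x)) t = dT f (t, x) := by
  have h1 : HasFDerivAt (fun τ : ℝ => (τ, x)) (ContinuousLinearMap.inl ℝ ℝ E3) t :=
    hasFDerivAt_prodMk_left t x
  have h2 := (hf (t, x)).hasFDerivAt.comp t h1
  have := h2.hasDerivAt.deriv
  simpa [dT, comp_def] using this

lemma ContDiff.dX (hf : Smooth f) (j : Fin 3) : Smooth (dX j f) :=
  (hf.fderiv_right (m := (⊤ : ℕ∞)) (by simp)).clm_apply contDiff_const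

lemma ContDiff.dT (hf : Smooth f) : Smooth (dT f) :=
  (hf.fderiv_right (m := (⊤ : ℕ∞)) (by simp)).clm_apply contDiff_const

lemma HasCompactSupport.dX (hf : HasCompactSupport f) (j : Fin 3) : HasCompactSupport (dX j f) :=
  hf.fderiv_apply (𝕜 := ℝ) (0, e3 j)

lemma HasCompactSupport.dT (hf : HasCompactSupport f) : HasCompactSupport (dT f) :=
  hf.fderiv_apply (𝕜 := ℝ) (1, 0)

lemma ContDiff.pd {g : E3 → ℝ} (hg : Smooth g) (j : Fin 3) : Smooth (pd g j) :=
  (hg.fderiv_right (m := (⊤ : ℕ∞)) (by simp)).clm_apply contDiff_const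

lemma HasCompactSupport.pd {g : E3 → ℝ} (hg : HasCompactSupport g) (j : Fin 3) :
    HasCompactSupport (pd g j) :=
  hg.fderiv_apply (𝕜 := ℝ) (e3 j)

end calculus

/-- Smooth compactly supported scalar functions. -/
def Cc {X : Type*} [NormedAddCommGroup X] [NormedSpace ℝ X] (f : X → ℝ) : Prop :=
  Smooth f ∧ HasCompactSupport f

namespace Cc
variable {X : Type*} [NormedAddCommGroup X] [NormedSpace ℝ X]

lemma continuous {f : X → ℝ} (h : Cc f) : Continuous f := h.1.continuous
lemma differentiable {f : X → ℝ} (h : Cc f) : Differentiable ℝ f := h.1.differentiable (by simp)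
lemma dX (h : Cc f) (j : Fin 3) : Cc (dX j f) := ⟨h.1.dX j, h.2.dX j⟩
lemma dT (h : Cc f) : Cc (dT f) := ⟨h.1.dT, h.2.dT⟩
lemma pd {f : E3 → ℝ} (h : Cc f) (j : Fin 3) : Cc (pd f j) := ⟨h.1.pd j, h.2.pd j⟩
lemma add {f g : X → ℝ} (hf : Cc f) (hg : Cc g) : Cc (fun x => f x + g x) :=
  ⟨hf.1.add hg.1, hf.2.add hg.2⟩
lemma neg {f : X → ℝ} (hf : Cc f) : Cc (fun x => - f x) := ⟨hf.1.neg, hf.2.neg⟩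
lemma sub {f g : X → ℝ} (hf : Cc f) (hg : Cc g) : Cc (fun x => f x - g x) := by
  simpa [sub_eq_add_neg] using hf.add hg.neg
lemma const_mul {f : X → ℝ} (hf : Cc f) (c : ℝ) : Cc (fun x => c * f x) :=
  ⟨contDiff_const.mul hf.1, hf.2.mul_left⟩
lemma mul_left {f g : X → ℝ} (hg : Smooth g) (hf : Cc f) : Cc (fun x => g x * f x) :=
  ⟨hg.mul hf.1, hf.2.mul_left⟩
lemma zero : Cc (fun _ : X => (0 : ℝ)) := ⟨contDiff_const, HasCompactSupport.zero⟩
lemma sum {ι : Type*} (s : Finset ι) {f : ι → X → ℝ} (h : ∀ i ∈ s, Cc (f i)) :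
    Cc (fun x => ∑ i ∈ s, f i x) := by
  classical
  induction s using Finset.induction_on with
  | empty => simpa using zero
  | insert a s ha ih =>
    simp only [Finset.sum_insert ha]
    exact (h a (by simp)).add (ih fun i hi => h i (by simp [hi]))
lemma slice (h : Cc f) (t : ℝ) : Cc (fun x => f (t, x)) := by
  refine ⟨h.1.comp (contDiff_const.prodMk contDiff_id), ?_⟩
  refine HasCompactSupport.intro (h.2.isCompact.image continuous_snd) fun x hx => ?_
  by_contra hne
  exact hx ⟨(t, x), subset_tsupport _ hne, rfl⟩
lemma bounded {f : X → ℝ} (h : Cc f) : ∃ C, 0 < C ∧ ∀ x, |f x| ≤ C := by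
  obtain ⟨C, hC⟩ := h.continuous.bounded_above_of_compact_support h.2
  exact ⟨max C 1, by positivity, fun x => (hC x).trans (le_max_left _ _)⟩
lemma comp {Y : Type*} [NormedAddCommGroup Y] [NormedSpace ℝ Y] {f : X → ℝ} (h : Cc f)
    (g : Y ≃ₜ X) (hg : Smooth g) : Cc (fun y => f (g y)) :=
  ⟨h.1.comp hg, h.2.comp_homeomorph g⟩
end Cc

lemma IsTest.cc (h : IsTest φ) (i : Fin 3) : Cc (fun p => φ p i) := by
  refine ⟨contDiff_euclidean.1 h.1 i, ?_⟩
  exact h.2.1.comp_left (g := fun v : E3 => v i) rfl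

lemma isTest_iff : IsTest φ ↔
    (∀ i, Cc (fun p => φ p i)) ∧ ∀ p, ∑ i, dX i (fun q => φ q i) p = 0 := by
  constructor
  · intro h
    refine ⟨h.cc, fun p => ?_⟩
    rw [← h.2.2 p]
    exact sum_congr rfl fun i _ => (pd_slice_eq_dX (h.cc i).differentiable i p.1 p.2).symm
  · rintro ⟨h1, h2⟩
    refine ⟨contDiff_euclidean.2 fun i => (h1 i).1, ?_, fun p => ?_⟩
    · have : HasCompactSupport (fun p => ∑ i, |φ p i|) := by
        refine HasCompactSupport.intro ((h1 0).2.isCompact.union ((h1 1).2.isCompact.union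
          (h1 2).2.isCompact)) fun x hx => ?_
        simp only [mem_union, not_or] at hx
        simp [Fin.sum_univ_three, image_eq_zero_of_notMem_tsupport hx.1,
          image_eq_zero_of_notMem_tsupport hx.2.1, image_eq_zero_of_notMem_tsupport hx.2.2]
      refine this.mono fun x hx => ?_
      contrapose! hx
      have hx' : ∑ i, |φ x i| = 0 := by simpa using hx
      rw [Finset.sum_eq_zero_iff_of_nonneg (by simp)] at hx'
      simp only [Function.mem_support, not_not]
      ext i
      simpa using hx' i
    · rw [← h2 p]
      exact sum_congr rfl fun i _ => (pd_slice_eq_dX (h1 i).differentiable i p.1 p.2)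

lemma timeDeriv_eq (h : IsTest φ) (p : ST) (i : Fin 3) : timeDeriv φ p i = dT (fun q => φ q i) p :=
  deriv_slice_eq_dT (h.cc i).differentiable p.1 p.2

lemma spaceGrad_eq (h : IsTest φ) (p : ST) (i j : Fin 3) :
    spaceGrad φ p i j = dX j (fun q => φ q i) p :=
  pd_slice_eq_dX (h.cc i).differentiable j p.1 p.2

lemma spaceLap_eq (h : IsTest φ) (p : ST) (i : Fin 3) :
    spaceLap φ p i = ∑ j, dX j (dX j (fun q => φ q i)) p := by
  unfold spaceLap
  refine sum_congr rfl fun j _ => ?_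
  have : (fun y => pd (fun z => φ (p.1, z) i) j y) = fun y => dX j (fun q => φ q i) (p.1, y) := by
    funext y; exact pd_slice_eq_dX (h.cc i).differentiable j p.1 y
  rw [this]
  exact pd_slice_eq_dX ((h.cc i).dX j).differentiable j p.1 p.2

/-- The coefficient of `u_i` in the weak formulation. -/
def nsA (ν : ℝ) (φ : ST → E3) (i : Fin 3) (p : ST) : ℝ :=
  dT (fun q => φ q i) p + ν * ∑ j, dX j (dX j (fun q => φ q i)) p

/-- The coefficient of `u_i u_j` in the weak formulation. -/
def nsB (φ : ST → E3) (i j : Fin 3) (p : ST) : ℝ := dX j (fun q => φ q i) p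

/-- The integrand of the weak formulation. -/
def nsI (ν : ℝ) (φ : ST → E3) (u : Flow) (p : ST) : ℝ :=
  (∑ i, u p.1 p.2 i * nsA ν φ i p) + ∑ i, ∑ j, u p.1 p.2 i * u p.1 p.2 j * nsB φ i j p

lemma nsA_cc (h : IsTest φ) (ν : ℝ) (i : Fin 3) : Cc (nsA ν φ i) := by
  unfold nsA
  exact (h.cc i).dT.add ((Cc.sum _ fun j _ => ((h.cc i).dX j).dX j).const_mul ν)

lemma nsB_cc (h : IsTest φ) (i j : Fin 3) : Cc (nsB φ i j) := (h.cc i).dX j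

lemma nsI_eq (h : IsTest φ) (ν : ℝ) (u : Flow) (p : ST) :
    ((∑ i, u p.1 p.2 i * (timeDeriv φ p i + ν * spaceLap φ p i)) +
         ∑ i, ∑ j, u p.1 p.2 i * u p.1 p.2 j * spaceGrad φ p i j) = nsI ν φ u p := by
  simp only [nsI, nsA, nsB, timeDeriv_eq h, spaceLap_eq h, spaceGrad_eq h]

lemma mixedNorm_top_le_iff (I : Set ℝ) (u : Flow) (s M : ℝ≥0∞) :
    mixedNorm ∞ s I u ≤ M ↔ ∀ᵐ t ∂(volume.restrict I), eLpNorm (u t) s volume ≤ M := by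
  rw [mixedNorm, if_pos rfl]
  constructor
  · intro h
    filter_upwards [ENNReal.ae_le_essSup (fun t => eLpNorm (u t) s volume)] with t ht
    exact ht.trans h
  · exact essSup_le_of_ae_le M

lemma lintegral_enorm_sq {α F : Type*} [MeasurableSpace α] [NormedAddCommGroup F] (f : α → F)
    (μ : Measure α) : ∫⁻ x, ‖f x‖ₑ ^ 2 ∂μ = eLpNorm f 2 μ ^ 2 := by
  have := eLpNorm_nnreal_pow_eq_lintegral (μ := μ) (f := f) (p := 2) (by norm_num)
  simpa using this.symm

instance : SFinite μST := by unfold μST; infer_instance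

lemma μST_eq : μST = (volume : Measure ST).restrict (Ioi 0 ×ˢ univ) := by
  rw [μST, Measure.volume_eq_prod, ← prod_restrict, restrict_univ]

lemma μST_le : μST ≤ (volume : Measure ST) := by rw [μST_eq]; exact Measure.restrict_le_self

instance : IsFiniteMeasureOnCompacts μST :=
  ⟨fun _ hK => (μST_le _).trans_lt hK.measure_lt_top⟩

/-- A measurable field bounded in `L^∞(0,∞;L²)` by `M`. -/
structure BddU (u : Flow) (M : ℝ≥0∞) : Prop where
  aesm : AEStronglyMeasurable (uncurry u) μST
  bdd : ∀ᵐ t ∂μT, eLpNorm (u t) 2 volume ≤ M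

lemma IsWeakNS.bddU (h : IsWeakNS ν u₀ u G) : BddU u (mixedNorm ∞ 2 (Ioi 0) u) :=
  ⟨h.1, (mixedNorm_top_le_iff _ _ _ _).1 le_rfl⟩

namespace BddU
variable {u : Flow} {M : ℝ≥0∞}

lemma slice_aesm (h : BddU u M) : ∀ᵐ t ∂μT, AEStronglyMeasurable (u t) volume :=
  h.aesm.prodMk_left

lemma slice_memLp (h : BddU u M) (hM : M < ∞) : ∀ᵐ t ∂μT, MemLp (u t) 2 volume := by
  filter_upwards [h.slice_aesm, h.bdd] with t h1 h2 using ⟨h1, h2.trans_lt hM⟩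

lemma aem (h : BddU u M) : AEMeasurable (fun p : ST => ‖u p.1 p.2‖ₑ ^ 2) μST :=
  h.aesm.enorm.pow_const 2

/-- Energy in a bounded time interval. -/
lemma lintegral_time_le (h : BddU u M) (R : ℝ) :
    ∫⁻ p in {p : ST | p.1 < R}, ‖u p.1 p.2‖ₑ ^ 2 ∂μST ≤ ofReal R * M ^ 2 := by
  have e : ({p : ST | p.1 < R}) = (Iio R) ×ˢ univ := by ext; simp
  have e2 : μST.restrict {p : ST | p.1 < R} = ((μT).restrict (Iio R)).prod volume := by
    rw [e, μST, ← prod_restrict, restrict_univ]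
  have hm := h.aem.restrict (s := {p : ST | p.1 < R})
  rw [e2] at hm ⊢
  rw [lintegral_prod _ hm]
  have : ∀ᵐ t ∂((μT).restrict (Iio R)), ∫⁻ y, ‖u t y‖ₑ ^ 2 ≤ M ^ 2 := by
    filter_upwards [ae_restrict_of_ae h.bdd] with t ht
    rw [lintegral_enorm_sq]
    gcongr
  refine (lintegral_mono_ae this).trans ?_
  rw [lintegral_const, mul_comm, restrict_restrict measurableSet_Iio]
  gcongr
  rw [Measure.restrict_apply_univ, Iio_inter_Ioi]
  simp

lemma memLp_time (h : BddU u M) (hM : M < ∞) (R : ℝ) :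
    MemLp (uncurry u) 2 (μST.restrict {p : ST | p.1 < R}) := by
  refine ⟨h.aesm.restrict, ?_⟩
  have h1 := h.lintegral_time_le R
  have h2 : ofReal R * M ^ 2 < ∞ := mul_lt_top ofReal_lt_top (pow_lt_top hM)
  have h3 := lintegral_enorm_sq (uncurry u) (μST.restrict {p : ST | p.1 < R})
  have h4 : eLpNorm (uncurry u) 2 (μST.restrict {p : ST | p.1 < R}) ^ 2 < ∞ := by
    rw [← h3]; exact h1.trans_lt h2
  by_contra hc
  simp [hc] at h4

lemma memLp_compact (h : BddU u M) (hM : M < ∞) {K : Set ST} (hK : IsCompact K) :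
    MemLp (uncurry u) 2 (μST.restrict K) := by
  obtain ⟨R, hR⟩ := (hK.image continuous_fst).bddAbove
  refine (h.memLp_time hM (R + 1)).mono_measure (restrict_mono ?_ le_rfl)
  intro p hp
  have := hR ⟨p, hp, rfl⟩
  show p.1 < R + 1
  linarith

lemma memLp_coord (h : BddU u M) (hM : M < ∞) {K : Set ST} (hK : IsCompact K) (i : Fin 3) :
    MemLp (fun p : ST => u p.1 p.2 i) 2 (μST.restrict K) :=
  (h.memLp_compact hM hK).of_le
    ((EuclideanSpace.proj (𝕜 := ℝ) i).continuous.comp_aestronglyMeasurable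
      (h.memLp_compact hM hK).1)
    (.of_forall fun p => abs_coord_le (u p.1 p.2) i)

end BddU

lemma integrable_mul_cc {X : Type*} [NormedAddCommGroup X] [NormedSpace ℝ X] [MeasurableSpace X]
    [BorelSpace X] {μ : Measure X} {f g : X → ℝ} (hg : Cc g)
    (hf : IntegrableOn f (tsupport g) μ) : Integrable (fun p => f p * g p) μ := by
  have hs : Function.support (fun p => f p * g p) ⊆ tsupport g := fun p hp =>
    subset_tsupport g fun h0 => hp (by simp [h0])
  rw [← integrableOn_iff_integrable_of_support_subset hs]
  obtain ⟨C, -, hC⟩ := hg.bounded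
  have hsm : AEStronglyMeasurable g (μ.restrict (tsupport g)) :=
    (hg.continuous.measurable.aestronglyMeasurable)
  have := Integrable.bdd_mul (c := C) hf hsm (.of_forall fun x => by simpa using hC x)
  unfold IntegrableOn
  simpa [mul_comm] using this

namespace BddU
variable {u : Flow} {M : ℝ≥0∞}

lemma integrable_lin (h : BddU u M) (hM : M < ∞) (hg : Cc g) (i : Fin 3) :
    Integrable (fun p => u p.1 p.2 i * g p) μST := by
  refine integrable_mul_cc hg ?_
  have : IsFiniteMeasure (μST.restrict (tsupport g)) := ⟨by
    rw [Measure.restrict_apply_univ]; exact hg.2.isCompact.measure_lt_top⟩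
  exact (h.memLp_coord hM hg.2.isCompact i).integrable (by norm_num)

lemma integrable_quad (h : BddU u M) (hM : M < ∞) (hg : Cc g) (i j : Fin 3) :
    Integrable (fun p => u p.1 p.2 i * u p.1 p.2 j * g p) μST := by
  refine integrable_mul_cc hg ?_
  exact (h.memLp_coord hM hg.2.isCompact i).integrable_mul (h.memLp_coord hM hg.2.isCompact j)

lemma integrable_nsI (h : BddU u M) (hM : M < ∞) (hφ : IsTest φ) (ν : ℝ) :
    Integrable (nsI ν φ u) μST := by
  refine Integrable.add (integrable_finsetSum _ fun i _ => h.integrable_lin hM (nsA_cc hφ ν i) i) ?_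
  exact integrable_finsetSum _ fun i _ => integrable_finsetSum _ fun j _ =>
    h.integrable_quad hM (nsB_cc hφ i j) i j

end BddU

/-- Pairing of a field with a test field at time `t`. -/
def pairT (u : Flow) (φ : ST → E3) (t : ℝ) : ℝ := ∫ x, ∑ i, u t x i * φ (t, x) i

/-- Time density of the weak formulation. -/
def nsK (ν : ℝ) (φ : ST → E3) (u : Flow) (t : ℝ) : ℝ := ∫ x, nsI ν φ u (t, x)

section

lemma Cc.time_mul (hf : Cc f) {θ : ℝ → ℝ} (hθ : Smooth θ) :
    Cc (fun p => θ p.1 * f p) := Cc.mul_left (hθ.comp contDiff_fst) hf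

lemma dX_time_mul (hf : Differentiable ℝ f) {θ : ℝ → ℝ} (hθ : Differentiable ℝ θ)
    (j : Fin 3) (p : ST) : dX j (fun p => θ p.1 * f p) p = θ p.1 * dX j f p := by
  have h1 : HasFDerivAt (fun p : ST => θ p.1)
      ((fderiv ℝ θ p.1).comp (ContinuousLinearMap.fst ℝ ℝ E3)) p :=
    (hθ p.1).hasFDerivAt.comp p hasFDerivAt_fst
  have h2 : fderiv ℝ (fun p => θ p.1 * f p) p = _ := (h1.mul (hf p).hasFDerivAt).fderiv
  unfold dX
  rw [h2]
  simp

lemma dT_time_mul (hf : Differentiable ℝ f) {θ : ℝ → ℝ} (hθ : Differentiable ℝ θ)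
    (p : ST) : dT (fun p => θ p.1 * f p) p = deriv θ p.1 * f p + θ p.1 * dT f p := by
  have h1 : HasFDerivAt (fun p : ST => θ p.1)
      ((fderiv ℝ θ p.1).comp (ContinuousLinearMap.fst ℝ ℝ E3)) p :=
    (hθ p.1).hasFDerivAt.comp p hasFDerivAt_fst
  have h2 : fderiv ℝ (fun p => θ p.1 * f p) p = _ := (h1.mul (hf p).hasFDerivAt).fderiv
  unfold dT
  rw [h2]
  simp
  ring

lemma IsTest.time_mul (hφ : IsTest φ) {θ : ℝ → ℝ}
    (hθ : Smooth θ) : IsTest (fun p => θ p.1 • φ p) := by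
  rw [isTest_iff] at hφ ⊢
  refine ⟨fun i => by simpa using (hφ.1 i).time_mul hθ, fun p => ?_⟩
  have : ∀ i, dX i (fun q => (θ q.1 • φ q) i) p = θ p.1 * dX i (fun q => φ q i) p := fun i => by
    simpa using dX_time_mul (hφ.1 i).differentiable (hθ.differentiable (by simp)) i p
  simp only [this, ← mul_sum, hφ.2 p, mul_zero]

lemma nsI_time_mul (hφ : IsTest φ) {θ : ℝ → ℝ} (hθ : Smooth θ) (ν : ℝ) (u : Flow) (p : ST) :
    nsI ν (fun p => θ p.1 • φ p) u p =
      deriv θ p.1 * (∑ i, u p.1 p.2 i * φ p i) + θ p.1 * nsI ν φ u p := by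
  have hd := hθ.differentiable (by simp)
  have hX : ∀ i j, dX j (fun q => (θ q.1 • φ q) i) = fun q => θ q.1 * dX j (fun q => φ q i) q :=
    fun i j => funext fun q => by simpa using dX_time_mul (hφ.cc i).differentiable hd j q
  have hXX : ∀ i j q, dX j (dX j (fun q => (θ q.1 • φ q) i)) q
      = θ q.1 * dX j (dX j (fun q => φ q i)) q := fun i j q => by
    rw [hX]; exact dX_time_mul ((hφ.cc i).dX j).differentiable hd j q
  have hT : ∀ i q, dT (fun q => (θ q.1 • φ q) i) q = deriv θ q.1 * φ q i
      + θ q.1 * dT (fun q => φ q i) q := fun i q => by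
    simpa using dT_time_mul (hφ.cc i).differentiable hd q
  simp only [nsI, nsA, nsB, hXX, hT]
  simp only [hX]
  simp only [mul_add, Fin.sum_univ_three]
  ring

end

/-- Smooth primitive of a smooth compactly supported function. -/
lemma contDiff_primitive {η : ℝ → ℝ} (hη : Smooth η) (c : ℝ) :
    Smooth (fun t => (∫ s in (0:ℝ)..t, η s) - c) ∧
      ∀ t, deriv (fun t => (∫ s in (0:ℝ)..t, η s) - c) t = η t := by
  have hd : ∀ t, HasDerivAt (fun t => (∫ s in (0:ℝ)..t, η s) - c) (η t) t := fun t =>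
    (intervalIntegral.integral_hasDerivAt_right (hη.continuous.intervalIntegrable _ _)
      (hη.continuous.stronglyMeasurableAtFilter _ _) hη.continuous.continuousAt).sub_const c
  have h2 : deriv (fun t => (∫ s in (0:ℝ)..t, η s) - c) = η := funext fun t => (hd t).deriv
  refine ⟨contDiff_infty_iff_deriv.2 ⟨fun t => (hd t).differentiableAt, ?_⟩, fun t => (hd t).deriv⟩
  rw [h2]; exact hη

/-- The weak identity of the Navier–Stokes system for one test field. -/
def WeakId (ν c : ℝ) (u : Flow) (φ : ST → E3) : Prop := ∫ p, nsI ν φ u p ∂μST = - c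

lemma integral_Ioc_swap {k η : ℝ → ℝ} (hk : IntegrableOn k (Ioi 0)) (hη : Integrable η) :
    ∫ t in R₊, (∫ s in Ioi t, η s) * k t = ∫ s in R₊, η s * ∫ t in Ioc 0 s, k t := by
  have h1 : ∀ t ∈ R₊, (∫ s in Ioi t, η s) * k t = ∫ s in R₊, (if t ≤ s then η s * k t else 0) := by
    intro t ht
    have e : (fun s => if t ≤ s then η s * k t else 0) = (Ici t).indicator (fun s => η s * k t) := by
      ext s; simp [indicator]
    rw [e, setIntegral_indicator measurableSet_Ici]
    have : R₊ ∩ Ici t = Ici t := inter_eq_right.2 fun s hs =>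
      mem_Ioi.2 (lt_of_lt_of_le (mem_Ioi.1 ht) (mem_Ici.1 hs))
    rw [this, integral_Ici_eq_integral_Ioi, integral_mul_const]
  have h2 : ∀ s ∈ R₊, η s * ∫ t in Ioc 0 s, k t = ∫ t in R₊, (if t ≤ s then η s * k t else 0) := by
    intro s hs
    have e : (fun t => if t ≤ s then η s * k t else 0) = (Iic s).indicator (fun t => η s * k t) := by
      ext s; simp [indicator]
    rw [e, setIntegral_indicator measurableSet_Iic, Ioi_inter_Iic, integral_const_mul]
  rw [setIntegral_congr_fun measurableSet_Ioi h1, setIntegral_congr_fun measurableSet_Ioi h2]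
  refine integral_integral_swap ?_
  have hi : Integrable (fun p : ℝ × ℝ => k p.1 * η p.2)
      ((volume.restrict (Ioi 0)).prod (volume.restrict (Ioi 0))) :=
    Integrable.mul_prod hk hη.integrableOn
  have hset : MeasurableSet {p : ℝ × ℝ | p.1 ≤ p.2} := measurableSet_le measurable_fst measurable_snd
  have := hi.indicator hset
  refine this.congr (.of_forall fun p => ?_)
  by_cases hp : p.1 ≤ p.2 <;> simp [indicator, uncurry, hp, mul_comm]

theorem pairT_eq (h : BddU u M) (hM : M < ∞) (hφ : IsTest φ)
    (hw : ∀ θ : ℝ → ℝ, Smooth θ → WeakId ν (θ 0 * c) u (fun p => θ p.1 • φ p)) :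
    ∀ᵐ t ∂μT, pairT u φ t = c + ∫ τ in Ioc 0 t, nsK ν φ u τ := by
  have ih : Integrable (fun p : ST => ∑ i, u p.1 p.2 i * φ p i) μST :=
    integrable_finsetSum _ fun i _ => h.integrable_lin hM (hφ.cc i) i
  have ihp : Integrable (pairT u φ) μT := ih.integral_prod_left
  have ik : Integrable (nsI ν φ u) μST := h.integrable_nsI hM hφ ν
  have ikp : Integrable (nsK ν φ u) μT := ik.integral_prod_left
  set H : ℝ → ℝ := fun t => c + ∫ τ in Ioc 0 t, nsK ν φ u τ with hH
  have Hcont : ContinuousOn H (Ioi 0) := by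
    have : ContinuousOn (fun t => c + ∫ τ in (0:ℝ)..t, R₊.indicator (nsK ν φ u) τ) (Ioi 0) := by
      refine Continuous.continuousOn (continuous_const.add ?_)
      refine intervalIntegral.continuous_primitive (fun a b => ?_) 0
      exact ((integrable_indicator_iff measurableSet_Ioi).2 ikp).intervalIntegrable
    refine this.congr fun t ht => ?_
    simp only [hH]
    rw [intervalIntegral.integral_of_le (le_of_lt ht), setIntegral_indicator measurableSet_Ioi]
    simp
  have key : ∀ᵐ t ∂μT, pairT u φ t - H t = 0 := by
    have Hbdd : ∀ t, ‖H t‖ ≤ |c| + ∫ τ in R₊, ‖nsK ν φ u τ‖ := fun t => by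
      refine (norm_add_le _ _).trans ?_
      gcongr
      · rfl
      · refine (norm_integral_le_integral_norm _).trans ?_
        exact setIntegral_mono_set ikp.norm (.of_forall fun _ => norm_nonneg _)
          (.of_forall fun x hx => hx.1)
    have Hmeas : AEStronglyMeasurable H μT := Hcont.aestronglyMeasurable measurableSet_Ioi
    have Hloc : LocallyIntegrable H μT := by
      have h1 : LocallyIntegrable (fun _ : ℝ => |c| + ∫ τ in R₊, ‖nsK ν φ u τ‖)
        μT := locallyIntegrable_const _
      refine h1.mono Hmeas (.of_forall fun t => (Hbdd t).trans (le_abs_self _))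
    refine ae_eq_zero_of_integral_contDiff_smul_eq_zero (ihp.locallyIntegrable.sub Hloc) ?_
    intro η hη hηc
    have hηi : Integrable η := hη.continuous.integrable_of_hasCompactSupport hηc
    obtain ⟨hθ, hθ'⟩ := contDiff_primitive hη (∫ s in R₊, η s)
    set θ : ℝ → ℝ := fun t => (∫ s in (0:ℝ)..t, η s) - ∫ s in R₊, η s with hθdef
    have hθt : ∀ t ∈ R₊, θ t = - ∫ s in Ioi t, η s := by
      intro t ht
      have : (∫ s in R₊, η s) = (∫ s in (0:ℝ)..t, η s) + ∫ s in Ioi t, η s := by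
        rw [intervalIntegral.integral_of_le (le_of_lt ht), ← setIntegral_union _ measurableSet_Ioi
          hηi.integrableOn hηi.integrableOn, Ioc_union_Ioi_eq_Ioi (le_of_lt ht)]
        simp
      linarith
    have hw' := hw θ hθ
    unfold WeakId at hw'
    have e1 : ∀ p, nsI ν (fun p => θ p.1 • φ p) u p =
      η p.1 * (∑ i, u p.1 p.2 i * φ p i) + θ p.1 * nsI ν φ u p := fun p => by
      rw [nsI_time_mul hφ hθ, hθ']
    have hηb : ∃ C, ∀ t, ‖η t‖ ≤ C := hη.continuous.bounded_above_of_compact_support hηc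
    obtain ⟨C, hC⟩ := hηb
    have hθb : ∀ p : ST, p.1 ∈ R₊ → ‖θ p.1‖ ≤ ∫ s, ‖η s‖ := fun p hp => by
      rw [hθt _ hp, norm_neg]
      exact (norm_integral_le_integral_norm _).trans
        (setIntegral_le_integral hηi.norm (.of_forall fun _ => norm_nonneg _))
    have hae : ∀ᵐ p ∂μST, p.1 ∈ R₊ := by
      rw [μST_eq]
      filter_upwards [ae_restrict_mem (measurableSet_Ioi.prod MeasurableSet.univ)] with p hp using hp.1
    have i1 : Integrable (fun p : ST => η p.1 * (∑ i, u p.1 p.2 i * φ p i)) μST :=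
      ih.bdd_mul (c := C) (hη.continuous.comp continuous_fst).measurable.aestronglyMeasurable
        (.of_forall fun p => hC p.1)
    have i2 : Integrable (fun p : ST => θ p.1 * nsI ν φ u p) μST := ik.bdd_mul (c := ∫ s, ‖η s‖)
        (hθ.continuous.comp continuous_fst).measurable.aestronglyMeasurable
        (by filter_upwards [hae] with p hp using hθb p hp)
    simp only [e1] at hw'
    rw [integral_add i1 i2, μST, integral_prod _ i1, integral_prod _ i2] at hw'
    simp only [integral_const_mul] at hw'
    change (∫ t in R₊, η t * pairT u φ t) + (∫ t in R₊, θ t * nsK ν φ u t) = _ at hw'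
    have e2 : ∫ t in R₊, θ t * nsK ν φ u t = - ∫ s in R₊, η s * ∫ t in Ioc 0 s, nsK ν φ u t := by
      rw [← integral_Ioc_swap ikp hηi, ← integral_neg]
      refine setIntegral_congr_fun measurableSet_Ioi fun t ht => ?_
      grind
    have e3 : θ 0 = - ∫ s in R₊, η s := by simp [hθdef]
    rw [e2, e3] at hw'
    have i3 : Integrable (fun t => η t * pairT u φ t) μT :=
      ihp.bdd_mul (c := C) hη.continuous.measurable.aestronglyMeasurable (.of_forall hC)
    have i4 : Integrable (fun t => η t * ∫ τ in Ioc 0 t, nsK ν φ u τ)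
        μT := by
      have hHm : AEStronglyMeasurable (fun t => ∫ τ in Ioc 0 t, nsK ν φ u τ)
          μT := by
        have := Hmeas.sub (aestronglyMeasurable_const (b := c))
        refine this.congr (.of_forall fun t => by simp [hH])
      have : Integrable (fun t => (∫ τ in Ioc 0 t, nsK ν φ u τ) * η t)
          μT := by
        refine Integrable.bdd_mul (c := ∫ τ in R₊, ‖nsK ν φ u τ‖) hηi.integrableOn hHm
          (.of_forall fun t => ?_)
        refine (norm_integral_le_integral_norm _).trans ?_
        exact setIntegral_mono_set ikp.norm (.of_forall fun _ => norm_nonneg _)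
          (.of_forall fun x hx => hx.1)
      simpa [mul_comm] using this
    have e5 : ∀ t, η t • (pairT u φ t - H t) = η t * pairT u φ t - (c * η t +
        η t * ∫ τ in Ioc 0 t, nsK ν φ u τ) := fun t => by
      simp only [hH, smul_eq_mul]; ring
    simp only [e5]
    have i5 : Integrable (fun t => c * η t) μT := hηi.integrableOn.const_mul c
    have i6 : Integrable (fun t => c * η t + η t * ∫ τ in Ioc 0 t, nsK ν φ u τ)
      μT := i5.add i4
    rw [integral_sub i3 i6, integral_add i5 i4, integral_const_mul]
    linarith
  filter_upwards [key] with t ht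
  linarith

/-- Riesz representation for a functional on a space of `L²` test functions. -/
lemma exists_riesz {X F : Type*} [MeasurableSpace X] [NormedAddCommGroup F]
    [InnerProductSpace ℝ F] [CompleteSpace F] {μ : Measure X} (S : Submodule ℝ (X → F))
    (hS : ∀ f ∈ S, MemLp f 2 μ) (L : S →ₗ[ℝ] ℝ) {C : ℝ} (hC : 0 ≤ C)
    (hL : ∀ f : S, L f ≤ C * (eLpNorm (f : X → F) 2 μ).toReal) :
    ∃ g : Lp F 2 μ, ‖g‖ ≤ C ∧ ∀ f : S, L f = ∫ x, inner ℝ (g x) ((f : X → F) x) ∂μ := by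
  let T : S →ₗ[ℝ] Lp F 2 μ :=
    { toFun := fun f => (hS f f.2).toLp f
      map_add' := fun f g => rfl
      map_smul' := fun c f => rfl }
  have hT : ∀ f : S, ‖T f‖ = (eLpNorm (f : X → F) 2 μ).toReal := fun f => Lp.norm_toLp _ (hS f f.2)
  have hL' : ∀ f : S, |L f| ≤ C * ‖T f‖ := fun f => by
    rw [abs_le]
    constructor
    · have := hL (-f)
      rw [← hT, map_neg, map_neg, norm_neg] at this
      linarith
    · rw [hT]; exact hL f
  have hker : LinearMap.ker T ≤ LinearMap.ker L := fun f hf => by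
    have h1 := hL' f
    rw [LinearMap.mem_ker.1 hf, norm_zero, mul_zero] at h1
    exact LinearMap.mem_ker.2 (abs_nonpos_iff.1 h1)
  let L1 : LinearMap.range T →ₗ[ℝ] ℝ :=
    ((LinearMap.ker T).liftQ L hker).comp T.quotKerEquivRange.symm.toLinearMap
  have hL1 : ∀ f : S, L1 ⟨T f, LinearMap.mem_range_self T f⟩ = L f := fun f => by
    simp only [L1, LinearMap.comp_apply, LinearEquiv.coe_coe]
    rw [LinearMap.quotKerEquivRange_symm_apply_image]
    simp
  let L2 : StrongDual ℝ (LinearMap.range T) := L1.mkContinuous C (by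
    rintro ⟨_, f, rfl⟩
    rw [hL1]
    exact hL' f)
  obtain ⟨Λ, hΛ, hΛn⟩ := _root_.exists_extension_norm_eq _ L2
  refine ⟨(InnerProductSpace.toDual ℝ _).symm Λ, ?_, fun f => ?_⟩
  · rw [LinearIsometryEquiv.norm_map, hΛn]
    exact LinearMap.mkContinuous_norm_le _ hC _
  · have h1 : L f = Λ (T f) := by
      rw [hΛ ⟨T f, LinearMap.mem_range_self T f⟩]
      exact (hL1 f).symm
    rw [h1, ← InnerProductSpace.toDual_symm_apply, inner_def]
    refine integral_congr_ae ?_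
    filter_upwards [(hS f f.2).coeFn_toLp] with x hx
    change inner ℝ _ (((hS f f.2).toLp f : Lp F 2 μ) x) = _
    rw [hx]

/-- If a time-dependent vector is, for each member of a set, orthogonal to it at almost every
time, then at almost every time it is orthogonal to the whole set. -/
lemma ae_forall_inner_eq_zero {H : Type*} [NormedAddCommGroup H] [InnerProductSpace ℝ H]
    [SecondCountableTopology H] {X : Type*} [MeasurableSpace X] {μ : Measure X} (f : X → H)
    (T : Set H) (h : ∀ v ∈ T, ∀ᵐ t ∂μ, inner ℝ (f t) v = 0) :
    ∀ᵐ t ∂μ, ∀ v ∈ T, inner ℝ (f t) v = 0 := by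
  obtain ⟨D, hDT, hDc, hD⟩ := (of_separableSpace T).exists_countable_dense_subset
  have : ∀ᵐ t ∂μ, ∀ v ∈ D, inner ℝ (f t) v = 0 := (ae_ball_iff hDc).2 fun v hv => h v (hDT hv)
  filter_upwards [this] with t ht v hv
  have hcl : IsClosed {v | inner ℝ (f t) v = 0} :=
    isClosed_eq (continuous_const.inner continuous_id) continuous_const
  exact hcl.closure_subset_iff.2 (fun v hv => ht v hv) (hD hv)

/-- Test functions supported in positive times. -/
def Spt (ψ : ST → ℝ) : Prop := Cc ψ ∧ tsupport ψ ⊆ {p | 0 < p.1}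

lemma Spt.add (hf : Spt f) (hg : Spt g) : Spt (fun p => f p + g p) :=
  ⟨hf.1.add hg.1, (tsupport_add f g).trans (union_subset hf.2 hg.2)⟩

lemma Spt.const_mul (hf : Spt f) (c : ℝ) : Spt (fun p => c * f p) :=
  ⟨hf.1.const_mul c, (tsupport_mul_subset_right (f := fun _ => c)).trans hf.2⟩

lemma Spt.zero : Spt (fun _ => (0:ℝ)) := ⟨Cc.zero, by
  have : tsupport (fun _ : ST => (0:ℝ)) = ∅ := tsupport_eq_empty_iff.2 rfl
  simp [this]⟩

/-- The time-space test function `χ(t) ψ(x)`. -/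
lemma Spt.tensor {χ : ℝ → ℝ} (hχ : Cc χ) (hχs : tsupport χ ⊆ Ioi 0) (hψ : Cc ψ) :
    Spt (fun p => χ p.1 * ψ p.2) := by
  refine ⟨⟨(hχ.1.comp contDiff_fst).mul (hψ.1.comp contDiff_snd), ?_⟩, ?_⟩
  · refine HasCompactSupport.intro (hχ.2.isCompact.prod hψ.2.isCompact) fun p hp => ?_
    simp only [mem_prod, not_and_or] at hp
    rcases hp with hp | hp
    · simp [image_eq_zero_of_notMem_tsupport hp]
    · simp [image_eq_zero_of_notMem_tsupport hp]
  · have h1 : tsupport (fun p : ST => χ p.1 * ψ p.2) ⊆ Prod.fst ⁻¹' tsupport χ := by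
      refine closure_minimal (fun p hp => ?_) ((isClosed_tsupport χ).preimage continuous_fst)
      refine subset_tsupport χ fun h0 => hp ?_
      simp [h0]
    exact h1.trans fun p hp => hχs hp

lemma Cc.tensor {χ : ℝ → ℝ} (hχ : Cc χ) (hψ : Cc ψ) : Cc (fun p : ST => χ p.1 * ψ p.2) := by
  refine ⟨(hχ.1.comp contDiff_fst).mul (hψ.1.comp contDiff_snd), ?_⟩
  refine HasCompactSupport.intro (hχ.2.isCompact.prod hψ.2.isCompact) fun p hp => ?_
  simp only [mem_prod, not_and_or] at hp
  rcases hp with hp | hp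
  · simp [image_eq_zero_of_notMem_tsupport hp]
  · simp [image_eq_zero_of_notMem_tsupport hp]

lemma dX_comp_snd (hψ : Differentiable ℝ ψ) (j : Fin 3) (p : ST) :
    dX j (fun p => ψ p.2) p = pd ψ j p.2 := by
  have : HasFDerivAt (fun p : ST => ψ p.2)
      ((fderiv ℝ ψ p.2).comp (ContinuousLinearMap.snd ℝ ℝ E3)) p :=
    (hψ p.2).hasFDerivAt.comp p hasFDerivAt_snd
  simp [dX, this.fderiv, pd, e3]

lemma dX_tensor {χ : ℝ → ℝ} (hχ : Differentiable ℝ χ) (hψ : Differentiable ℝ ψ)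
    (j : Fin 3) (p : ST) : dX j (fun p => χ p.1 * ψ p.2) p = χ p.1 * pd ψ j p.2 := by
  rw [dX_time_mul (f := fun p => ψ p.2) (hψ.comp differentiable_snd) hχ, dX_comp_snd hψ]

/-- The fundamental lemma of the calculus of variations on `(0,∞)`. -/
lemma ae_eq_zero_of_time_tests {h : ℝ → ℝ} (hi : LocallyIntegrableOn h (Ioi 0))
    (h0 : ∀ χ : ℝ → ℝ, Cc χ → tsupport χ ⊆ Ioi 0 → ∫ t in R₊, χ t * h t = 0) :
    ∀ᵐ t ∂μT, h t = 0 := by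
  rw [ae_restrict_iff' measurableSet_Ioi]
  refine IsOpen.ae_eq_zero_of_integral_contDiff_smul_eq_zero isOpen_Ioi hi fun χ hχ hχc hχs => ?_
  rw [← h0 χ ⟨hχ, hχc⟩ hχs]
  refine (setIntegral_eq_integral_of_forall_compl_eq_zero fun t ht => ?_).symm
  rw [image_eq_zero_of_notMem_tsupport fun h => ht (hχs h)]
  simp

instance : Fact ((2:ℝ≥0∞) ≠ ∞) := ⟨by simp⟩

lemma integral_inner_le {X F : Type*} [MeasurableSpace X] [NormedAddCommGroup F]
    [InnerProductSpace ℝ F] {μ : Measure X} {f g : X → F} (hf : MemLp f 2 μ) (hg : MemLp g 2 μ) :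
    |∫ x, inner ℝ (f x) (g x) ∂μ| ≤ (eLpNorm f 2 μ).toReal * (eLpNorm g 2 μ).toReal := by
  have h := abs_real_inner_le_norm (hf.toLp f) (hg.toLp g)
  rw [Lp.norm_toLp, Lp.norm_toLp, L2.inner_def] at h
  refine le_trans (le_of_eq ?_) h
  congr 1
  refine integral_congr_ae ?_
  filter_upwards [hf.coeFn_toLp, hg.coeFn_toLp] with x h1 h2
  rw [h1, h2]

lemma MemLp.integrable_inner' {X F : Type*} [MeasurableSpace X] [NormedAddCommGroup F]
    [InnerProductSpace ℝ F] {μ : Measure X} {f g : X → F} (hf : MemLp f 2 μ) (hg : MemLp g 2 μ) :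
    Integrable (fun x => inner ℝ (f x) (g x)) μ := by
  have h := L2.integrable_inner (𝕜 := ℝ) (hf.toLp f) (hg.toLp g)
  refine h.congr ?_
  filter_upwards [hf.coeFn_toLp, hg.coeFn_toLp] with x h1 h2
  rw [h1, h2]

lemma μST_restrict_lt (R : ℝ) : μST.restrict {p : ST | p.1 < R} =
    ((μT).restrict (Iio R)).prod volume := by
  have e : ({p : ST | p.1 < R}) = (Iio R) ×ˢ univ := by ext; simp
  rw [e, μST, ← prod_restrict, restrict_univ]

instance (R : ℝ) : IsFiniteMeasure ((μT).restrict (Iio R)) := ⟨by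
  rw [restrict_restrict measurableSet_Iio, Measure.restrict_apply_univ, Iio_inter_Ioi]
  simp⟩

lemma ae_memLp_slice {F : Type*} [NormedAddCommGroup F] {w : ℝ → E3 → F}
    (hw : ∀ R : ℝ, MemLp (uncurry w) 2 (μST.restrict {p | p.1 < R})) :
    ∀ᵐ t ∂μT, MemLp (w t) 2 volume := by
  have : ∀ n : ℕ, ∀ᵐ (t : ℝ) ∂((volume : Measure ℝ).restrict R₊), t < (n:ℝ) → MemLp (w t) 2 volume := by
    intro n
    have h1 := hw n
    rw [μST_restrict_lt] at h1
    have h2 : ∀ᵐ t ∂((μT).restrict (Iio (n:ℝ))),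
        AEStronglyMeasurable (w t) volume := h1.1.prodMk_left
    have h3 : ∫⁻ t in Iio (n:ℝ), ∫⁻ x, ‖w t x‖ₑ ^ 2 ∂volume ∂μT < ∞ := by
      have h4 := lintegral_enorm_sq (uncurry w) (((μT).restrict (Iio (n:ℝ))).prod volume)
      rw [lintegral_prod _ (h1.1.enorm.pow_const 2)] at h4
      refine (le_of_eq h4).trans_lt (pow_lt_top h1.2)
    have hm : AEMeasurable (fun t => ∫⁻ x, ‖w t x‖ₑ ^ 2 ∂volume) ((μT).restrict (Iio (n:ℝ))) :=
      (h1.1.enorm.pow_const 2).lintegral_prod_right'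
    have h5 := ae_lt_top' hm h3.ne
    have h6 : ∀ᵐ t ∂((μT).restrict (Iio (n:ℝ))), MemLp (w t) 2 volume := by
      filter_upwards [h2, h5] with t ht ht'
      refine ⟨ht, ?_⟩
      rw [lintegral_enorm_sq] at ht'
      by_contra hc
      simp [hc] at ht'
    exact (ae_restrict_iff' measurableSet_Iio).1 h6
  filter_upwards [ae_all_iff.2 this] with t ht
  obtain ⟨n, hn⟩ := exists_nat_gt t
  exact ht n hn

section slice
variable {F : Type*} [NormedAddCommGroup F] [InnerProductSpace ℝ F]

lemma integrable_slice_pair {w : ℝ → E3 → F} {v : E3 → F} (hv : MemLp v 2 volume) {R : ℝ}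
    (hw : MemLp (uncurry w) 2 (μST.restrict {p | p.1 < R})) :
    Integrable (fun p : ST => inner ℝ (w p.1 p.2) (v p.2)) (μST.restrict {p | p.1 < R}) := by
  refine MemLp.integrable_inner' hw ?_
  rw [μST_restrict_lt]
  exact hv.comp_snd _

/-- Space-time weak identities against products `χ(t) v(x)` hold on almost all time slices,
simultaneously for all `v`. -/
lemma ae_forall_slice [TopologicalSpace.SeparableSpace F] {w : ℝ → E3 → F}
    (hw : ∀ R : ℝ, MemLp (uncurry w) 2 (μST.restrict {p | p.1 < R})) (T : Set (E3 → F))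
    (hT : ∀ v ∈ T, MemLp v 2 volume)
    (h : ∀ v ∈ T, ∀ χ : ℝ → ℝ, Cc χ → tsupport χ ⊆ Ioi 0 →
      ∫ p, χ p.1 * inner ℝ (w p.1 p.2) (v p.2) ∂μST = 0) :
    ∀ᵐ t ∂μT, ∀ v ∈ T, ∫ x, inner ℝ (w t x) (v x) = 0 := by
  classical
  have hm := ae_memLp_slice hw
  let f : ℝ → Lp F 2 (volume : Measure E3) := fun t =>
    if ht : MemLp (w t) 2 volume then ht.toLp else 0
  let T' : Set (Lp F 2 (volume : Measure E3)) := {V | ∃ v, ∃ hv : v ∈ T, V = (hT v hv).toLp v}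
  have hf : ∀ t, MemLp (w t) 2 volume → ∀ v (hv : v ∈ T), inner ℝ (f t) ((hT v hv).toLp v)
      = ∫ x, inner ℝ (w t x) (v x) := fun t ht v hv => by
    simp only [f, dif_pos ht, L2.inner_def]
    refine integral_congr_ae ?_
    filter_upwards [ht.coeFn_toLp, (hT v hv).coeFn_toLp] with x h1 h2
    rw [h1, h2]
  have key := ae_forall_inner_eq_zero (μ := μT) f T' (by
    rintro _ ⟨v, hv, rfl⟩
    have hloc : LocallyIntegrableOn (fun t => ∫ x, inner ℝ (w t x) (v x)) (Ioi 0) := by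
      rw [locallyIntegrableOn_iff isOpen_Ioi.isLocallyClosed]
      intro K hK hKc
      obtain ⟨R, hR⟩ := hKc.bddAbove
      have h1 := integrable_slice_pair (hT v hv) (hw (R + 1))
      rw [μST_restrict_lt] at h1
      have h2 := h1.integral_prod_left
      rw [restrict_restrict measurableSet_Iio] at h2
      exact IntegrableOn.mono_set h2 fun t ht => ⟨by
        have := hR ht; exact mem_Iio.2 (by linarith), hK ht⟩
    have h0 := ae_eq_zero_of_time_tests hloc (fun χ hχ hχs => by
      refine Eq.trans ?_ (h v hv χ hχ hχs)
      have hi : Integrable (fun p : ST => χ p.1 * inner ℝ (w p.1 p.2) (v p.2)) μST := by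
        obtain ⟨R, hR⟩ := hχ.2.isCompact.bddAbove
        obtain ⟨C, -, hC⟩ := hχ.bounded
        have h1 := (integrable_slice_pair (hT v hv) (hw (R + 1))).bdd_mul (c := C)
          (f := fun p : ST => χ p.1)
          (hχ.continuous.comp continuous_fst).measurable.aestronglyMeasurable
          (.of_forall fun p => hC p.1)
        refine (integrableOn_iff_integrable_of_support_subset ?_).1 h1
        intro p hp
        have : p.1 ∈ tsupport χ := subset_tsupport χ fun h0 => hp (by simp [h0])
        have := hR this
        show p.1 < R + 1
        linarith
      rw [μST, integral_prod _ hi]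
      simp only [integral_const_mul])
    filter_upwards [hm, h0] with t ht ht0
    rw [hf t ht v hv, ht0])
  filter_upwards [hm, key] with t ht ht0 v hv
  rw [← hf t ht v hv]
  exact ht0 _ ⟨v, hv, rfl⟩

end slice

/-- Matrix fields are valued in this Euclidean space. -/
abbrev E9 : Type := EuclideanSpace ℝ (Fin 3 × Fin 3)

/-- The pairing of `u` with the divergence of the matrix field `f`. -/
def gp (u : Flow) (f : ST → E9) : ℝ :=
  ∫ p, ∑ k : Fin 3 × Fin 3, u p.1 p.2 k.1 * dX k.2 (fun q => f q k) p ∂μST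

/-- Smooth matrix fields compactly supported in positive times. -/
def SptM (f : ST → E9) : Prop := ∀ k, Spt (fun p => f p k)

/-- The distributional gradient of `u` is bounded by `C` in space-time `L²`. -/
def GradBd (u : Flow) (C : ℝ) : Prop :=
  ∀ f, SptM f → gp u f ≤ C * (eLpNorm f 2 μST).toReal

lemma SptM.cc {f : ST → E9} (h : SptM f) (k) : Cc (fun p => f p k) := (h k).1

lemma SptM.continuous {f : ST → E9} (h : SptM f) : Continuous f :=
  (contDiff_euclidean.2 fun i => (h.cc i).1).continuous

lemma hasCompactSupport_euclidean {X ι : Type*} [TopologicalSpace X] [R1Space X] [Fintype ι]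
    {f : X → EuclideanSpace ℝ ι}
    (h : ∀ k, HasCompactSupport (fun x => f x k)) : HasCompactSupport f := by
  have hc : IsCompact (⋃ k, tsupport (fun x => f x k)) := isCompact_iUnion fun k => (h k).isCompact
  refine HasCompactSupport.of_support_subset_isCompact hc fun x hx => ?_
  by_contra hn
  simp only [mem_iUnion, not_exists] at hn
  exact hx (PiLp.ext fun k =>
    image_eq_zero_of_notMem_tsupport (f := fun x => f x k) (hn k))

lemma SptM.memLp {f : ST → E9} (h : SptM f) : MemLp f 2 μST :=
  h.continuous.memLp_of_hasCompactSupport (hasCompactSupport_euclidean fun k => (h.cc k).2)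

lemma SptM.single {ψ : ST → ℝ} (h : Spt ψ) (k : Fin 3 × Fin 3) :
    SptM (fun p => single k (ψ p)) := fun l => by
  by_cases hl : l = k
  · subst hl; simpa using h
  · simpa [hl] using Spt.zero

lemma dX_zero (j : Fin 3) (p : ST) : dX j (fun _ => 0) p = 0 := by simp [dX]

lemma gp_single (ψ : ST → ℝ) (k : Fin 3 × Fin 3) :
    gp u (fun p => single k (ψ p)) = ∫ p, u p.1 p.2 k.1 * dX k.2 ψ p ∂μST := by
  unfold gp
  congr 1; funext p
  rw [Finset.sum_eq_single k]
  · simp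
  · intro l _ hl
    simp [hl, dX_zero]
  · simp

lemma enorm_sq_E9 (v : E9) : ‖v‖ₑ ^ 2 = ∑ i, ∑ j, ofReal ((v (i, j)) ^ 2) := by
  rw [← ofReal_norm, ← ofReal_pow (norm_nonneg _), norm_sq_eq,
    ofReal_sum_of_nonneg (fun _ _ => by positivity), Fintype.sum_prod_type]
  simp

/-- The matrix field as a Euclidean-valued function. -/
def toE9 (G : GFlow) (p : ST) : E9 :=
  toLp 2 fun k => G p.1 p.2 k.1 k.2

lemma aesm_toE9_iff : AEStronglyMeasurable (toE9 G) μST ↔ AEStronglyMeasurable (uncurry G) μST := by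
  constructor
  · intro h
    have hc : Continuous fun v : E9 => fun i j : Fin 3 => v (i, j) := by fun_prop
    exact hc.comp_aestronglyMeasurable h
  · intro h
    have hc : Continuous fun v : Fin 3 → Fin 3 → ℝ =>
      (toLp 2 fun k : Fin 3 × Fin 3 => v k.1 k.2 : E9) := by fun_prop
    exact hc.comp_aestronglyMeasurable h

lemma lintegral_gradSq (h : AEStronglyMeasurable (uncurry G) μST) :
    ∫⁻ t in R₊, gradSq G t = eLpNorm (toE9 G) 2 μST ^ 2 := by
  rw [← lintegral_enorm_sq, μST, lintegral_prod _ (((aesm_toE9_iff.2 h).enorm.pow_const 2))]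
  simp only [gradSq, enorm_sq_E9]
  rfl

section
variable {u : Flow} {M : ℝ≥0∞}

lemma BddU.integrable_gp (h : BddU u M) (hM : M < ∞) {f : ST → E9} (hf : SptM f) :
    Integrable (fun p => ∑ k : Fin 3 × Fin 3, u p.1 p.2 k.1 * dX k.2 (fun q => f q k) p) μST :=
  integrable_finsetSum _ fun k _ => h.integrable_lin hM ((hf.cc k).dX k.2) k.1

lemma Spt.dX_eq {ψ : ST → ℝ} (h : Spt ψ) (j : Fin 3) (p : ST) :
    pd (fun y => ψ (p.1, y)) j p.2 = _root_.dX j ψ p :=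
  pd_slice_eq_dX h.1.differentiable j p.1 p.2

theorem GradBd.exists_isDistGrad {C : ℝ} (hu : BddU u M) (hM : M < ∞) (hC : 0 ≤ C)
    (h : GradBd u C) : ∃ G, AEStronglyMeasurable (uncurry G) μST ∧ IsDistGrad u G ∧
      ∫⁻ t in R₊, gradSq G t ≤ ofReal C ^ 2 := by
  let S : Submodule ℝ (ST → E9) :=
    { carrier := {f | SptM f}
      add_mem' := fun {f g} hf hg k => (hf k).add (hg k)
      zero_mem' := fun k => Spt.zero
      smul_mem' := fun c f hf k => (hf k).const_mul c }
  let L : S →ₗ[ℝ] ℝ :=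
    { toFun := fun f => gp u f
      map_add' := fun f g => by
        unfold gp
        rw [← integral_add (hu.integrable_gp hM f.2) (hu.integrable_gp hM g.2)]
        congr 1; funext p
        rw [← sum_add_distrib]
        refine sum_congr rfl fun k _ => ?_
        have : dX k.2 (fun q => ((f + g : S) : ST → E9) q k) p =
            dX k.2 (fun q => (f : ST → E9) q k) p + dX k.2 (fun q => (g : ST → E9) q k) p := by
          unfold dX
          have : (fun q => ((f + g : S) : ST → E9) q k) =
            (fun q => (f : ST → E9) q k) + (fun q => (g : ST → E9) q k) := rfl
          rw [this, fderiv_add ((SptM.cc f.2 k).differentiable p) ((SptM.cc g.2 k).differentiable p)]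
          rfl
        rw [this, mul_add]
      map_smul' := fun c f => by
        simp only [gp, RingHom.id_apply, smul_eq_mul]
        rw [← integral_const_mul]
        congr 1; funext p
        rw [mul_sum]
        refine sum_congr rfl fun k _ => ?_
        have : dX k.2 (fun q => ((c • f : S) : ST → E9) q k) p =
            c * dX k.2 (fun q => (f : ST → E9) q k) p := by
          unfold dX
          have : (fun q => ((c • f : S) : ST → E9) q k) = (c • fun q => (f : ST → E9) q k) := rfl
          rw [this, fderiv_const_smul ((SptM.cc f.2 k).differentiable p)]
          rfl
        rw [this]; ring }
  obtain ⟨g, hg, hgL⟩ := exists_riesz S (fun f hf => SptM.memLp hf) L hC (fun f => h f f.2)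
  have hm : AEStronglyMeasurable (uncurry fun t x i j => - (g (t, x)) (i, j)) μST := by
    have hc : Continuous fun v : E9 => fun i j : Fin 3 => - v (i, j) := by fun_prop
    exact hc.comp_aestronglyMeasurable (Lp.aestronglyMeasurable g)
  refine ⟨fun t x i j => - (g (t, x)) (i, j), hm, fun ψ h1 h2 h3 i j => ?_, ?_⟩
  · have hψ : Spt ψ := ⟨⟨h1, h2⟩, h3⟩
    have := hgL ⟨_, SptM.single hψ (i, j)⟩
    have e : L ⟨_, SptM.single hψ (i, j)⟩ = gp u (fun p => single (i, j) (ψ p)) := rfl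
    rw [e, gp_single] at this
    simp only [hψ.dX_eq]
    rw [this]
    simp [inner_single_right, integral_neg, mul_comm]
  · rw [lintegral_gradSq hm]
    gcongr
    have : eLpNorm (toE9 fun t x i j => - (g (t, x)) (i, j)) 2 μST = eLpNorm g 2 μST :=
      eLpNorm_congr_norm_ae (.of_forall fun p => by rw [← norm_neg]; congr 1; ext k; simp [toE9])
    rw [this, ← ofReal_toReal (Lp.eLpNorm_ne_top g)]
    exact ofReal_le_ofReal hg

theorem IsDistGrad.gradBd {C : ℝ} (hC : 0 ≤ C) (hu : BddU u M) (hM : M < ∞) (hG : IsDistGrad u G)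
    (hm : AEStronglyMeasurable (uncurry G) μST)
    (hb : ∫⁻ t in R₊, gradSq G t ≤ ofReal C ^ 2) : GradBd u C := by
  intro f hf
  rw [lintegral_gradSq hm] at hb
  have hb' : eLpNorm (toE9 G) 2 μST ≤ ofReal C := (pow_le_pow_left_iff two_ne_zero).1 hb
  have hGm : MemLp (toE9 G) 2 μST := ⟨aesm_toE9_iff.2 hm, hb'.trans_lt ofReal_lt_top⟩
  have e : gp u f = - ∫ p, inner ℝ (toE9 G p) (f p) ∂μST := by
    have h1 : gp u f = ∑ k : Fin 3 × Fin 3, ∫ p, u p.1 p.2 k.1 * dX k.2 (fun q => f q k) p ∂μST :=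
      integral_finsetSum _ fun k _ => hu.integrable_lin hM ((hf.cc k).dX k.2) k.1
    have h2 : ∫ p, inner ℝ (toE9 G p) (f p) ∂μST
        = ∑ k : Fin 3 × Fin 3, ∫ p, G p.1 p.2 k.1 k.2 * f p k ∂μST := by
      rw [← integral_finsetSum]
      · congr 1; funext p
        simp [inner_apply, toE9, mul_comm]
      · intro k _
        have := MemLp.integrable_inner' hGm (SptM.single (hf k) k).memLp
        refine this.congr (.of_forall fun p => ?_)
        simp [inner_single_right, toE9, mul_comm]
    rw [h1, h2, ← Finset.sum_neg_distrib]
    refine sum_congr rfl fun k _ => ?_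
    rw [← hG _ (hf k).1.1 (hf k).1.2 (hf k).2 k.1 k.2]
    simp only [(hf k).dX_eq]
  rw [e]
  have h3 := integral_inner_le hGm hf.memLp
  calc _ ≤ _ := neg_le_abs _
    _ ≤ _ := h3
    _ ≤ C * (eLpNorm f 2 μST).toReal := by
      gcongr
      exact toReal_le_of_le_ofReal hC hb'
end

lemma MemLp.coord {X ι : Type*} [MeasurableSpace X] [Fintype ι] {μ : Measure X} {p : ℝ≥0∞}
    {f : X → EuclideanSpace ℝ ι} (h : MemLp f p μ) (i : ι) : MemLp (fun x => f x i) p μ :=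
  h.of_le ((EuclideanSpace.proj (𝕜 := ℝ) i).continuous.comp_aestronglyMeasurable h.1)
    (.of_forall fun x => norm_apply_le (f x) i)

lemma Cc.memLp {X : Type*} [NormedAddCommGroup X] [NormedSpace ℝ X] [MeasurableSpace X]
    [BorelSpace X] {μ : Measure X} [IsFiniteMeasureOnCompacts μ] {f : X → ℝ} (h : Cc f)
    {p : ℝ≥0∞} : MemLp f p μ :=
  h.continuous.memLp_of_hasCompactSupport h.2

lemma memLp_euclidean {X ι : Type*} [MeasurableSpace X] [Fintype ι] {μ : Measure X} {p : ℝ≥0∞}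
    {f : X → ι → ℝ} (h : ∀ i, MemLp (fun x => f x i) p μ) :
    MemLp (fun x => (toLp 2 (f x) : EuclideanSpace ℝ ι)) p μ := by
  classical
  have e : (fun x => (toLp 2 (f x) : EuclideanSpace ℝ ι))
      = fun x => ∑ i, f x i • single i (1:ℝ) := by
    funext x; ext j; simp [Finset.sum_apply, Pi.single_apply]
  rw [e]
  refine memLp_finsetSum _ fun i _ => ?_
  refine ((h i).norm).of_le ((h i).1.smul_const _) (.of_forall fun x => ?_)
  rw [norm_smul]; simp

/-- The spatial gradient of a scalar function. -/
def grad3 (ψ : E3 → ℝ) (x : E3) : E3 := toLp 2 fun i => pd ψ i x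

lemma memLp_grad3 (h : Cc ψ) : MemLp (grad3 ψ) 2 volume :=
  memLp_euclidean fun i => (h.pd i).memLp

lemma sum_mul_pd (v : E3) (ψ : E3 → ℝ) (x : E3) : ∑ i, v i * pd ψ i x = inner ℝ v (grad3 ψ x) := by
  rw [inner_eq_sum]; rfl

section
variable {u : Flow} {M : ℝ≥0∞}

/-- Divergence-free in the sense of space-time distributions. -/
def DivFreeST (u : Flow) : Prop :=
  ∀ ψ, Spt ψ → ∫ p, ∑ i, u p.1 p.2 i * dX i ψ p ∂μST = 0

lemma DivFreeST.slice (h : BddU u M) (hM : M < ∞) (hd : DivFreeST u) :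
    ∀ᵐ t ∂μT, IsDivFree (u t) := by
  have := ae_forall_slice (w := u) (h.memLp_time hM) {v | ∃ ψ, Cc ψ ∧ v = grad3 ψ}
    (by rintro _ ⟨ψ, hψ, rfl⟩; exact memLp_grad3 hψ) (by
      rintro _ ⟨ψ, hψ, rfl⟩ χ hχ hχs
      rw [← hd _ (Spt.tensor hχ hχs hψ)]
      congr 1; funext p
      rw [← sum_mul_pd, mul_sum]
      refine sum_congr rfl fun i _ => ?_
      rw [dX_tensor hχ.differentiable hψ.differentiable]; ring)
  filter_upwards [this] with t ht φ h1 h2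
  simp only [sum_mul_pd]
  exact ht _ ⟨φ, ⟨h1, h2⟩, rfl⟩

lemma DivFreeST.of_slice (h : BddU u M) (hM : M < ∞)
    (hd : ∀ᵐ t ∂μT, IsDivFree (u t)) : DivFreeST u := by
  intro ψ hψ
  have hi : Integrable (fun p => ∑ i, u p.1 p.2 i * dX i ψ p) μST :=
    integrable_finsetSum _ fun i _ => h.integrable_lin hM (hψ.1.dX i) i
  rw [μST, integral_prod _ hi]
  refine integral_eq_zero_of_ae ?_
  filter_upwards [hd] with t ht
  rw [Pi.zero_apply, ← ht _ (hψ.1.slice t).1 (hψ.1.slice t).2]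
  congr 1; funext x
  simp only [pd_slice_eq_dX hψ.1.differentiable]

/-- `G` is, at almost all times, the distributional gradient of `u`. -/
lemma IsDistGrad.slice (hu : BddU u M) (hM : M < ∞)
    (hG : IsDistGrad u G) (hGm : MemLp (toE9 G) 2 μST) :
    ∀ᵐ t ∂μT, ∀ i j, ∀ ψ : E3 → ℝ, Cc ψ → ∫ x, u t x i * pd ψ j x = - ∫ x, G t x i j * ψ x := by
  rw [ae_all_iff]; intro i
  rw [ae_all_iff]; intro j
  have hu' := fun R => (hu.memLp_time hM R)
  have hw : ∀ R : ℝ, MemLp (uncurry fun t x =>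
      (toLp 2 ![u t x i, G t x i j] : EuclideanSpace ℝ (Fin 2))) 2
      (μST.restrict {p | p.1 < R}) := fun R => memLp_euclidean fun k => by
    fin_cases k
    · exact MemLp.coord (hu' R) i
    · exact (MemLp.coord hGm (i, j)).restrict _
  have hsl := ae_forall_slice hw {v | ∃ ψ, Cc ψ ∧ v = fun x => toLp 2 ![pd ψ j x, ψ x]} (by
      rintro _ ⟨ψ, hψ, rfl⟩
      refine memLp_euclidean fun k => ?_
      fin_cases k
      · exact (hψ.pd j).memLp
      · exact hψ.memLp)
    (by
      rintro _ ⟨ψ, hψ, rfl⟩ χ hχ hχs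
      have hs := Spt.tensor hχ hχs hψ
      have := hG _ hs.1.1 hs.1.2 hs.2 i j
      rw [eq_neg_iff_add_eq_zero, ← integral_add] at this
      · rw [← this]
        congr 1; funext p
        rw [hs.dX_eq, dX_tensor hχ.differentiable hψ.differentiable]
        simp [inner_apply]; ring
      · simp only [hs.dX_eq]
        exact hu.integrable_lin hM (hs.1.dX j) i
      · exact (MemLp.coord hGm (i, j)).integrable_mul (hs.1.memLp (p := 2)))
  have hus := hu.slice_memLp hM
  have hGs : ∀ᵐ t ∂μT, MemLp (fun x => toE9 G (t, x)) 2 volume :=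
    ae_memLp_slice (w := fun t x => toE9 G (t, x)) fun R => hGm.restrict _
  filter_upwards [hsl, hus, hGs] with t ht h1 h2 ψ hψ
  have := ht _ ⟨ψ, hψ, rfl⟩
  rw [eq_neg_iff_add_eq_zero, ← integral_add, ← this]
  · congr 1; funext x; simp [inner_apply]; ring
  · exact (MemLp.coord h1 i).integrable_mul ((hψ.pd j).memLp (p := 2))
  · exact (MemLp.coord h2 (i, j)).integrable_mul (hψ.memLp (p := 2))

/-- A function with slicewise gradients has a space-time gradient. -/
lemma IsDistGrad.of_slice (hu : BddU u M) (hM : M < ∞) (hGm : MemLp (toE9 G) 2 μST)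
    (h : ∀ᵐ t ∂μT, ∀ i j, ∀ ψ : E3 → ℝ, Cc ψ →
      ∫ x, u t x i * pd ψ j x = - ∫ x, G t x i j * ψ x) : IsDistGrad u G := by
  intro ψ h1 h2 h3 i j
  have hψ : Spt ψ := ⟨⟨h1, h2⟩, h3⟩
  have i1 : Integrable (fun p => u p.1 p.2 i * pd (fun y => ψ (p.1, y)) j p.2) μST := by
    simp only [hψ.dX_eq]
    exact hu.integrable_lin hM (hψ.1.dX j) i
  have i2 : Integrable (fun p => G p.1 p.2 i j * ψ p) μST :=
    (MemLp.coord hGm (i, j)).integrable_mul (hψ.1.memLp (p := 2))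
  rw [μST, integral_prod _ i1, integral_prod _ i2, ← integral_neg]
  refine integral_congr_ae ?_
  filter_upwards [h] with t ht
  exact ht i j _ (hψ.1.slice t)

end

/-- A weak solution with quantitative energy bounds, the gradient being implicit. -/
structure Sol (ν : ℝ) (u₀ : E3 → E3) (u : Flow) (M C : ℝ) : Prop where
  bddU : BddU u (ofReal M)
  divFree : DivFreeST u
  gradBd : GradBd u C
  weak : ∀ φ, IsTest φ → ∫ p, nsI ν φ u p ∂μST = - ∫ x, ∑ i, u₀ x i * φ (0, x) i

lemma Sol.exists_isWeakNS {M C : ℝ} (hC : 0 ≤ C)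
    (h : Sol ν u₀ u M C) : ∃ G, IsWeakNS ν u₀ u G ∧ mixedNorm ∞ 2 (Ioi 0) u ≤ ofReal M ∧
      gradL2 G ≤ ofReal C := by
  obtain ⟨G, h1, h2, h3⟩ := h.gradBd.exists_isDistGrad h.bddU ofReal_lt_top hC
  have hM : mixedNorm ∞ 2 (Ioi 0) u ≤ ofReal M := (mixedNorm_top_le_iff _ _ _ _).2 h.bddU.bdd
  refine ⟨G, ⟨h.bddU.aesm, hM.trans_lt ofReal_lt_top, h.divFree.slice h.bddU ofReal_lt_top, h1,
    h3.trans_lt (pow_lt_top ofReal_lt_top), h2, fun φ hφ => ?_⟩, hM, ?_⟩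
  · simp only [nsI_eq hφ]; exact h.weak φ hφ
  · unfold gradL2
    calc _ ≤ (ofReal C ^ 2) ^ (1/2 : ℝ) := by gcongr
      _ = _ := by rw [← rpow_natCast, ← rpow_mul]; norm_num

lemma IsWeakNS.sol (h : IsWeakNS ν u₀ u G) : ∃ M C, 0 ≤ M ∧ 0 ≤ C ∧ Sol ν u₀ u M C := by
  have hb := h.bddU
  obtain ⟨-, h2, h3, h4, h5, h6, h7⟩ := h
  have eM : ofReal (mixedNorm ∞ 2 (Ioi 0) u).toReal = mixedNorm ∞ 2 (Ioi 0) u := ofReal_toReal h2.ne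
  refine ⟨(mixedNorm ∞ 2 (Ioi 0) u).toReal, (eLpNorm (toE9 G) 2 μST).toReal, toReal_nonneg,
    toReal_nonneg, ⟨by rwa [eM], DivFreeST.of_slice hb h2 h3,
      h6.gradBd toReal_nonneg hb h2 h4 ?_, fun φ hφ => ?_⟩⟩
  · rw [lintegral_gradSq h4] at h5 ⊢
    rw [ofReal_toReal]
    intro hc
    simp [hc] at h5
  · rw [← h7 φ hφ]; simp only [nsI_eq hφ]

lemma eLpNorm_toE9_le {C : ℝ} (hm : AEStronglyMeasurable (uncurry G) μST)
    (hb : ∫⁻ t in R₊, gradSq G t ≤ ofReal C ^ 2) :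
    MemLp (toE9 G) 2 μST ∧ eLpNorm (toE9 G) 2 μST ≤ ofReal C := by
  rw [lintegral_gradSq hm] at hb
  have hb' : eLpNorm (toE9 G) 2 μST ≤ ofReal C := (pow_le_pow_left_iff two_ne_zero).1 hb
  exact ⟨⟨aesm_toE9_iff.2 hm, hb'.trans_lt ofReal_lt_top⟩, hb'⟩

section pdcalc
variable {f g : E3 → ℝ}

lemma pd_mul (hf : Differentiable ℝ f) (hg : Differentiable ℝ g) (j : Fin 3) (x : E3) :
    pd (fun y => f y * g y) j x = f x * pd g j x + g x * pd f j x := by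
  have : fderiv ℝ (fun y => f y * g y) x = f x • fderiv ℝ g x + g x • fderiv ℝ f x :=
    fderiv_fun_mul (hf x) (hg x)
  simp [pd, this]

lemma pd_add (hf : Differentiable ℝ f) (hg : Differentiable ℝ g) (j : Fin 3) (x : E3) :
    pd (fun y => f y + g y) j x = pd f j x + pd g j x := by
  have : fderiv ℝ (fun y => f y + g y) x = fderiv ℝ f x + fderiv ℝ g x :=
    fderiv_fun_add (hf x) (hg x)
  simp [pd, this]

lemma pd_sub (hf : Differentiable ℝ f) (hg : Differentiable ℝ g) (j : Fin 3) (x : E3) :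
    pd (fun y => f y - g y) j x = pd f j x - pd g j x := by
  have : fderiv ℝ (fun y => f y - g y) x = fderiv ℝ f x - fderiv ℝ g x :=
    fderiv_fun_sub (hf x) (hg x)
  simp [pd, this]

lemma pd_const_mul (hf : Differentiable ℝ f) (c : ℝ) (j : Fin 3) (x : E3) :
    pd (fun y => c * f y) j x = c * pd f j x := by
  have : fderiv ℝ (fun y => c * f y) x = c • fderiv ℝ f x := fderiv_const_mul (hf x) c
  simp [pd, this]

lemma pd_sum {ι : Type*} (s : Finset ι) {f : ι → E3 → ℝ} (hf : ∀ i ∈ s, Differentiable ℝ (f i))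
    (j : Fin 3) (x : E3) : pd (fun y => ∑ i ∈ s, f i y) j x = ∑ i ∈ s, pd (f i) j x := by
  have : fderiv ℝ (fun y => ∑ i ∈ s, f i y) x = ∑ i ∈ s, fderiv ℝ (f i) x :=
    fderiv_fun_sum fun i hi => hf i hi x
  simp [pd, this]

lemma pd_comp_affine (hf : Differentiable ℝ f) (c : ℝ) (b : E3) (j : Fin 3) (x : E3) :
    pd (fun y => f (c • y + b)) j x = c * pd f j (c • x + b) := by
  have h1 : HasFDerivAt (fun y : E3 => c • y + b) (c • ContinuousLinearMap.id ℝ E3) x := by fun_prop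
  have h2 := ((hf (c • x + b)).hasFDerivAt.comp x h1).fderiv
  have : fderiv ℝ (fun y => f (c • y + b)) x = _ := h2
  simp [pd, this]

lemma pd_comm (hf : Smooth f) (i j : Fin 3) (x : E3) : pd (pd f i) j x = pd (pd f j) i x := by
  have hd : Differentiable ℝ (fderiv ℝ f) :=
    (hf.fderiv_right (m := (⊤ : ℕ∞)) (by simp)).differentiable (by simp)
  have key : ∀ a b : Fin 3, pd (pd f a) b x =
      fderiv ℝ (fderiv ℝ f) x (single b 1) (single a 1) := by
    intro a b
    have : fderiv ℝ (pd f a) x = _ :=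
      ((hd x).hasFDerivAt.clm_apply (hasFDerivAt_const (single a (1:ℝ)) x)).fderiv
    simp [pd, this]
  rw [key, key]
  exact (hf.contDiffAt.isSymmSndFDerivAt
    (by simp; exact WithTop.coe_le_coe.2 (le_top (a := (2 : ℕ∞))))).eq _ _

end pdcalc

/-- The Laplacian on `ℝ³`. -/
def lap (f : E3 → ℝ) (x : E3) : ℝ := ∑ j, pd (pd f j) j x

lemma Cc.lap {f : E3 → ℝ} (hf : Cc f) : Cc (lap f) := Cc.sum _ fun j _ => (hf.pd j).pd j

lemma ContDiff.lap {f : E3 → ℝ} (hf : Smooth f) : Smooth (lap f) :=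
  ContDiff.sum fun j _ => (hf.pd j).pd j

lemma exists_cutoff : ∃ χ : E3 → ℝ, Cc χ ∧ χ 0 = 1 := by
  let b : ContDiffBump (0 : E3) := ⟨1, 2, by norm_num, by norm_num⟩
  exact ⟨b, ⟨b.contDiff, b.hasCompactSupport⟩, b.one_of_mem_closedBall (by simpa using b.rIn_pos.le)⟩

lemma Cc.comp_affine {f : E3 → ℝ} (hf : Cc f) (hc : c ≠ 0) (b : E3) : Cc (fun x => f (c • x + b)) :=
  hf.comp ((smulOfNeZero c hc).trans (addRight b)) ((contDiff_id.const_smul c).add contDiff_const)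

lemma lap_mul {f g : E3 → ℝ} (hf : Smooth f) (hg : Smooth g) (x : E3) : lap (fun y => f y * g y) x
      = f x * lap g x + 2 * ∑ j, pd f j x * pd g j x + g x * lap f x := by
  unfold lap
  have hfd := hf.differentiable (by simp)
  have hgd := hg.differentiable (by simp)
  have : ∀ j, pd (pd (fun y => f y * g y) j) j x =
      f x * pd (pd g j) j x + 2 * (pd f j x * pd g j x) + g x * pd (pd f j) j x := by
    intro j
    have e : pd (fun y => f y * g y) j = fun y => f y * pd g j y + g y * pd f j y := by
      funext y; exact pd_mul hfd hgd j y
    have d1 := (hg.pd j).differentiable (by simp)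
    have d2 := (hf.pd j).differentiable (by simp)
    rw [e, pd_add (f := fun y => f y * pd g j y) (g := fun y => g y * pd f j y) (hfd.mul d1) (hgd.mul d2), pd_mul hfd d1, pd_mul hgd d2]
    ring
  simp only [this, sum_add_distrib, mul_sum]

/-- An `L²` function that is weakly harmonic against compactly supported tests is weakly harmonic
against all smooth functions with enough derivatives in `L²`. -/
lemma weakly_harmonic_of_cc {f g : E3 → ℝ} (hf : MemLp f 2 volume)
    (h : ∀ g, Cc g → ∫ x, f x * lap g x = 0) (hg : Smooth g)
    (h0 : MemLp g 2 volume) (h1 : ∀ j, MemLp (pd g j) 2 volume)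
    (h2 : MemLp (lap g) 2 volume) : ∫ x, f x * lap g x = 0 := by
  obtain ⟨χ, hχ, hχ0⟩ := exists_cutoff
  let c : ℕ → ℝ := fun n => 1 / ((n:ℝ) + 1)
  have hc0 : ∀ n, 0 < c n := fun n => by positivity
  have hc1 : ∀ n, c n ≤ 1 := fun n => by
    have : (1:ℝ) ≤ (n:ℝ) + 1 := by linarith
    exact (div_le_one (by positivity)).2 this
  have hcl : Tendsto c atTop (nhds 0) := tendsto_one_div_add_atTop_nhds_zero_nat
  obtain ⟨K0, hK0, hχb⟩ := hχ.bounded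
  choose K1 hK1 hpb using fun j => (hχ.pd j).bounded
  obtain ⟨K2, hK2, hlb⟩ := hχ.lap.bounded
  have hcc : ∀ n, Cc (fun x => χ (c n • x)) := fun n => by simpa using hχ.comp_affine (hc0 n).ne' 0
  have hpd : ∀ n j x, pd (fun x => χ (c n • x)) j x = c n * pd χ j (c n • x) := fun n j x => by
    simpa using pd_comp_affine hχ.differentiable (c n) 0 j x
  have hlap : ∀ n x, lap (fun x => χ (c n • x)) x = c n ^ 2 * lap χ (c n • x) := fun n x => by
    unfold lap
    rw [mul_sum]
    refine sum_congr rfl fun j _ => ?_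
    have e : pd (fun x => χ (c n • x)) j = fun x => c n * pd χ j (c n • x + 0) := by
      funext x; simpa using hpd n j x
    rw [e, pd_const_mul, pd_comp_affine (hχ.pd j).differentiable]
    · simp; ring
    · exact ((hχ.pd j).comp_affine (hc0 n).ne' 0).differentiable
  let F : ℕ → E3 → ℝ := fun n x => f x * (χ (c n • x) * lap g x +
    2 * ∑ j, (c n * pd χ j (c n • x)) * pd g j x + g x * (c n ^ 2 * lap χ (c n • x)))
  have hF0 : ∀ n, ∫ x, F n x = 0 := fun n => by
    rw [← h (fun x => g x * χ (c n • x)) (Cc.mul_left hg (hcc n))]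
    congr 1; funext x
    have e : (fun x => g x * χ (c n • x)) = fun x => χ (c n • x) * g x := by grind
    rw [e, lap_mul (hcc n).1 hg, hlap]
    simp only [hpd, F]
  have hlim : Tendsto (fun n => ∫ x, F n x) atTop (nhds (∫ x, f x * lap g x)) := by
    refine tendsto_integral_of_dominated_convergence (fun x => |f x| * (K0 * |lap g x| +
      2 * ∑ j, K1 j * |pd g j x| + |g x| * K2)) (fun n => ?_) ?_ (fun n => ?_) ?_
    · have hlc := hg.lap.continuous
      have hpc := fun j => (hg.pd j).continuous
      have hxc := hχ.continuous
      have hxl := hχ.lap.continuous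
      have hxp := fun j => (hχ.pd j).continuous
      refine hf.1.mul (aestronglyMeasurable ?_)
      fun_prop
    · have : MemLp (fun x => K0 * |lap g x| + 2 * ∑ j, K1 j * |pd g j x| + |g x| * K2) 2 volume :=
        ((h2.abs.const_mul K0).add ((memLp_finsetSum _ fun j _ =>
          ((h1 j).abs.const_mul (K1 j))).const_mul 2)).add (h0.abs.mul_const K2)
      exact hf.abs.integrable_mul this
    · refine of_forall fun x => ?_
      simp only [F, norm_eq_abs, abs_mul]
      have hcn := hc1 n
      have hcn0 := (hc0 n).le
      gcongr
      refine (abs_add_le _ _).trans (add_le_add ((abs_add_le _ _).trans (add_le_add ?_ ?_)) ?_)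
      · rw [abs_mul]; gcongr; exact hχb _
      · rw [abs_mul, abs_two]
        gcongr
        refine (abs_sum_le_sum_abs _ _).trans (sum_le_sum fun j _ => ?_)
        rw [abs_mul, abs_mul, abs_of_nonneg hcn0]
        gcongr
        calc c n * |pd χ j (c n • x)| ≤ 1 * K1 j := by gcongr; exact hpb j _
          _ = K1 j := one_mul _
      · rw [abs_mul, abs_mul]
        gcongr
        calc |c n ^ 2| * |lap χ (c n • x)| ≤ 1 * K2 := by
              gcongr
              · rw [abs_of_nonneg (by positivity)]; exact pow_le_one₀ hcn0 hcn
              · exact hlb _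
          _ = K2 := one_mul _
    · refine of_forall fun x => ?_
      have hcx : Tendsto (fun n => c n • x) atTop (nhds 0) := by simpa using hcl.smul_const x
      have t0 : Tendsto (fun n => χ (c n • x)) atTop (nhds 1) := by
        rw [← hχ0]; exact (hχ.continuous.tendsto 0).comp hcx
      have t1 : ∀ j, Tendsto (fun n => pd χ j (c n • x)) atTop (nhds (pd χ j 0)) := fun j =>
        ((hχ.pd j).continuous.tendsto 0).comp hcx
      have t2 : Tendsto (fun n => lap χ (c n • x)) atTop (nhds (lap χ 0)) :=
        (hχ.lap.continuous.tendsto 0).comp hcx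
      have T := (((t0.mul_const (lap g x)).add ((tendsto_finsetSum Finset.univ fun j _ =>
        ((hcl.mul (t1 j)).mul_const (pd g j x))).const_mul 2)).add
        (((hcl.pow 2).mul t2).const_mul (g x))).const_mul (f x)
      simpa [F] using T
  simp only [hF0] at hlim
  exact (tendsto_nhds_unique hlim tendsto_const_nhds)

lemma integral_mul_fourierInv (f : Lp ℂ 2 (volume : Measure E3)) (k : 𝓢(E3, ℂ)) :
    ∫ x, k x * (𝓕⁻ f) x = ∫ x, (𝓕⁻ k) x * f x := by
  have h := congrArg (fun T : 𝓢'(E3, ℂ) => T k) (Lp.fourierInv_toTemperedDistribution_eq f)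
  simp only [TemperedDistribution.fourierInv_apply, Lp.toTemperedDistribution_apply,
    smul_eq_mul] at h
  exact h.symm

lemma pd_clm_comp (L : ℂ →L[ℝ] ℝ) (g : 𝓢(E3, ℂ)) (j : Fin 3) :
    pd (fun x => L (g x)) j = fun x => L ((∂_{single j (1:ℝ)} g) x) := by
  funext x
  unfold pd
  rw [SchwartzMap.lineDerivOp_apply_eq_fderiv]
  have : HasFDerivAt (fun x => L (g x)) (L ∘L fderiv ℝ g x) x :=
    L.hasFDerivAt.comp x (g.differentiableAt.hasFDerivAt)
  rw [this.fderiv]; rfl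

lemma lap_clm_comp (L : ℂ →L[ℝ] ℝ) (g : 𝓢(E3, ℂ)) :
    lap (fun x => L (g x)) = fun x => L ((Δ g) x) := by
  funext x
  unfold lap
  rw [SchwartzMap.laplacian_eq_sum (EuclideanSpace.basisFun (Fin 3) ℝ) g]
  simp only [pd_clm_comp, EuclideanSpace.basisFun_apply, sum_apply, map_sum]

lemma integral_mul_laplacian_eq_zero {f : E3 → ℝ} (hf : MemLp f 2 volume)
    (h : ∀ g, Cc g → ∫ x, f x * lap g x = 0) (g : 𝓢(E3, ℂ)) :
    ∫ x, (Δ g) x * (f x : ℂ) = 0 := by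
  have key : ∀ L : ℂ →L[ℝ] ℝ, ∫ x, f x * L ((Δ g) x) = 0 := fun L => by
    have := weakly_harmonic_of_cc (g := fun x => L (g x)) hf h (L.contDiff.comp (g.smooth _))
      (L.comp_memLp' (g.memLp 2 volume)) (fun j => by
        rw [pd_clm_comp]; exact L.comp_memLp' (SchwartzMap.memLp _ 2 volume))
      (by rw [lap_clm_comp]; exact L.comp_memLp' (SchwartzMap.memLp _ 2 volume))
    simpa only [lap_clm_comp] using this
  have hfc : MemLp (fun x => (f x : ℂ)) 2 volume := hf.ofReal
  have hi : Integrable (fun x => (Δ g) x * (f x : ℂ)) :=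
    (SchwartzMap.memLp (Δ g) 2).integrable_mul hfc
  apply Complex.ext
  · have := reCLM.integral_comp_comm hi
    rw [Complex.reCLM_apply] at this
    rw [← this, Complex.zero_re, ← key reCLM]
    simp [mul_comm]
  · have := imCLM.integral_comp_comm hi
    rw [Complex.imCLM_apply] at this
    rw [← this, Complex.zero_im, ← key imCLM]
    simp [mul_comm]

/-- Liouville: a weakly harmonic function in `L²` vanishes. -/
lemma ae_eq_zero_of_weakly_harmonic {f : E3 → ℝ} (hf : MemLp f 2 volume)
    (h : ∀ g, Cc g → ∫ x, f x * lap g x = 0) : ∀ᵐ x, f x = 0 := by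
  have hfc : MemLp (fun x => (f x : ℂ)) 2 volume := hf.ofReal
  let F : Lp ℂ 2 (volume : Measure E3) := hfc.toLp _
  have hF : F =ᵐ[volume] fun x => (f x : ℂ) := hfc.coeFn_toLp
  have hnorm : (fun x : E3 => ‖x‖ ^ 2).HasTemperateGrowth := by fun_prop
  have h0 : ∀ k : 𝓢(E3, ℂ), ∫ x, (‖x‖ ^ 2 • k x) * (𝓕⁻ F) x = 0 := by
    intro k
    let m := SchwartzMap.smulLeftCLM ℂ (fun x : E3 => ‖x‖ ^ 2) k
    have e : ∀ x, m x = ‖x‖ ^ 2 • k x := fun x =>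
      smulLeftCLM_apply_apply hnorm k x
    simp_rw [← e]
    rw [integral_mul_fourierInv]
    have e2 := SchwartzMap.laplacian_eq_fourierMultiplierCLM (𝓕⁻ k)
    rw [SchwartzMap.fourierMultiplierCLM_apply, FourierTransform.fourier_fourierInv_eq] at e2
    have e3 := integral_mul_laplacian_eq_zero hf h (𝓕⁻ k)
    rw [e2] at e3
    have e4 : ∫ x, (𝓕⁻ m) x * F x = ∫ x, (𝓕⁻ m) x * (f x : ℂ) :=
      integral_congr_ae (hF.mono fun x hx => by simp only [hx])
    rw [e4]
    simp only [smul_apply, smul_mul_assoc, integral_smul] at e3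
    have hp : (-(2 * π) ^ 2 : ℝ) ≠ 0 := by
      have := pi_pos
      simp [this.ne']
    exact (smul_eq_zero.1 e3).resolve_left hp
  have h1 : ∀ᵐ x : E3, ((‖x‖ ^ 2 : ℝ) : ℂ) * (𝓕⁻ F) x = 0 := by
    refine ae_eq_zero_of_integral_contDiff_smul_eq_zero ?_ fun g hg hgc => ?_
    · have : LocallyIntegrable (fun x => (𝓕⁻ F) x) volume :=
        (Lp.memLp (𝓕⁻ F)).locallyIntegrable (by norm_num)
      have hc : Continuous fun x : E3 => ((‖x‖ ^ 2 : ℝ) : ℂ) := by fun_prop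
      rw [← locallyIntegrableOn_univ] at this ⊢
      exact this.continuousOn_mul hc.continuousOn isOpen_univ.isLocallyClosed
    · have hgC : Smooth fun x => (g x : ℂ) := ofRealCLM.contDiff.comp hg
      have hgS : HasCompactSupport fun x => (g x : ℂ) :=
        hgc.comp_left (g := fun y : ℝ => (y : ℂ)) (by simp)
      have := h0 (hgS.toSchwartzMap hgC)
      rw [← this]
      congr 1; funext x
      simp only [HasCompactSupport.toSchwartzMap_toFun, real_smul]
      ring
  have h2 : 𝓕⁻ F = 0 := by
    rw [Lp.eq_zero_iff_ae_eq_zero]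
    have hz : ∀ᵐ x : E3, x ≠ 0 := by simp [ae_iff]
    filter_upwards [h1, hz] with x hx hx0
    have : ((‖x‖ ^ 2 : ℝ) : ℂ) ≠ 0 := by simpa using hx0
    exact (mul_eq_zero.1 hx).resolve_left this
  have h3 : F = 0 := by
    have e : 𝓕 (𝓕⁻ F) = F := FourierTransform.fourier_fourierInv_eq F
    rw [← e, h2]
    exact FourierTransform.fourier_zero
  rw [Lp.eq_zero_iff_ae_eq_zero] at h3
  filter_upwards [h3, hF] with x a b
  rw [a] at b
  simpa using b.symm

/-- Divergence-free test field on `ℝ³`. -/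
def DfTest (ψ : E3 → E3) : Prop :=
  (∀ i, Cc (fun x => ψ x i)) ∧ ∀ x, ∑ i, pd (fun y => ψ y i) i x = 0

/-- The divergence-free test field `∇∂ᵢf - eᵢΔf`. -/
def dfField (f : E3 → ℝ) (i : Fin 3) (x : E3) : E3 :=
  toLp 2 fun k => pd (pd f i) k x - if k = i then lap f x else 0

lemma dfField_dfTest {f : E3 → ℝ} (hf : Cc f) (i : Fin 3) : DfTest (dfField f i) := by
  have h : ∀ k, (fun x => dfField f i x k) =
      if k = i then (fun x => pd (pd f i) k x - lap f x) else pd (pd f i) k := by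
    intro k; funext x; by_cases hk : k = i <;> simp [dfField, hk]
  refine ⟨fun k => ?_, fun x => ?_⟩
  · rw [h]; split_ifs
    · exact ((hf.pd i).pd k).sub hf.lap
    · exact (hf.pd i).pd k
  · have e : ∀ k, pd (fun y => dfField f i y k) k x =
        pd (pd (pd f i) k) k x - if k = i then pd (lap f) k x else 0 := by
      intro k
      rw [h]
      split_ifs with hk
      · exact pd_sub ((hf.pd i).pd k).differentiable hf.lap.differentiable k x
      · simp
    simp only [e, sum_sub_distrib, Finset.sum_ite_eq', Finset.mem_univ, if_true]
    rw [sub_eq_zero]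
    have : lap f = fun x => ∑ j, pd (pd f j) j x := rfl
    rw [this, pd_sum _ (f := fun j => pd (pd f j) j) (fun j _ => ((hf.pd j).pd j).differentiable)]
    refine sum_congr rfl fun j _ => ?_
    have c1 : pd (pd f i) j = pd (pd f j) i := funext fun y => pd_comm hf.1 i j y
    rw [c1]
    exact pd_comm (hf.pd j).1 i j x

/-- A divergence-free `L²` field orthogonal to all divergence-free test fields vanishes. -/
lemma ae_eq_zero_of_dfTest {w : E3 → E3} (hw : MemLp w 2 volume) (hd : IsDivFree w)
    (h : ∀ ψ, DfTest ψ → ∫ x, ∑ i, w x i * ψ x i = 0) : ∀ᵐ x, w x = 0 := by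
  have hwi := fun i => MemLp.coord hw i
  have key : ∀ i, ∀ᵐ x, w x i = 0 := by
    intro i
    refine ae_eq_zero_of_weakly_harmonic (hwi i) fun f hf => ?_
    have h1 := h _ (dfField_dfTest hf i)
    have h2 := hd (pd f i) (hf.pd i).1 (hf.pd i).2
    have I1 : Integrable (fun x => ∑ k, w x k * pd (pd f i) k x) :=
      integrable_finsetSum _ fun k _ =>
        (hwi k).integrable_mul (Cc.memLp (p := 2) ((hf.pd i).pd k))
    have I2 : Integrable (fun x => w x i * lap f x) :=
      (hwi i).integrable_mul (Cc.memLp (p := 2) hf.lap)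
    have e : ∀ x, ∑ k, w x k * dfField f i x k
        = ∑ k, w x k * pd (pd f i) k x - w x i * lap f x := by
      intro x
      simp [dfField, mul_sub, sum_sub_distrib]
    simp only [e] at h1
    rw [integral_sub I1 I2, h2, zero_sub, neg_eq_zero] at h1
    exact h1
  filter_upwards [ae_all_iff.2 key] with x hx
  ext i; simpa using hx i

lemma MemLp.integrable_mul_fun {X : Type*} [MeasurableSpace X] {μ : Measure X} {f g : X → ℝ}
    (hf : MemLp f 2 μ) (hg : MemLp g 2 μ) : Integrable (fun x => f x * g x) μ :=
  hf.integrable_mul hg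

/-- A square-integrable function bounded as a functional on smooth test functions. -/
lemma eLpNorm_le_of_dual {h : E3 → ℝ} (hh : MemLp h 2 volume) {B : ℝ} (hB : 0 ≤ B)
    (H : ∀ ψ, Cc ψ → ∫ x, h x * ψ x ≤ B * (eLpNorm ψ 2 volume).toReal) :
    eLpNorm h 2 volume ≤ ofReal B := by
  let S : Submodule ℝ (E3 → ℝ) :=
    { carrier := {ψ | Cc ψ}
      add_mem' := fun ha hb => ha.add hb
      zero_mem' := Cc.zero
      smul_mem' := fun c _ hf => hf.const_mul c }
  have hi : ∀ ψ, Cc ψ → Integrable (fun x => h x * ψ x) := fun ψ hψ =>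
    hh.integrable_mul (Cc.memLp (p := 2) hψ)
  let L : S →ₗ[ℝ] ℝ :=
    { toFun := fun f => ∫ x, h x * (f : E3 → ℝ) x
      map_add' := fun f g => by
        rw [← integral_add (hi _ f.2) (hi _ g.2)]
        congr 1; funext x; simp [mul_add]
      map_smul' := fun c f => by
        simp only [RingHom.id_apply, smul_eq_mul]
        rw [← integral_const_mul]
        congr 1; funext x; simp; ring }
  obtain ⟨g, hg, hgL⟩ := exists_riesz S (fun f hf => Cc.memLp (p := 2) hf) L hB fun f => H f f.2
  have hd : MemLp (fun x => g x - h x) 2 volume := (Lp.memLp g).sub hh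
  have : ∀ᵐ x, g x - h x = 0 := by
    refine ae_eq_zero_of_integral_contDiff_smul_eq_zero (hd.locallyIntegrable (by norm_num))
      fun ψ hψ hψc => ?_
    have e := hgL ⟨ψ, hψ, hψc⟩
    simp only [L, LinearMap.coe_mk, AddHom.coe_mk, RCLike.inner_apply, conj_trivial] at e
    have i2 := MemLp.integrable_mul_fun (Lp.memLp g) (Cc.memLp (p := 2) ⟨hψ, hψc⟩ : MemLp ψ 2 volume)
    have : ∀ x, ψ x • (g x - h x) = g x * ψ x - h x * ψ x := fun x => by rw [smul_eq_mul]; ring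
    simp only [this]
    rw [integral_sub i2 (hi _ ⟨hψ, hψc⟩), e]
    simp [mul_comm]
  have e : eLpNorm h 2 volume = eLpNorm g 2 volume :=
    eLpNorm_congr_ae (this.mono fun x hx => by linarith)
  rw [e, ← Lp.enorm_def, ← ofReal_norm]
  exact ofReal_le_ofReal hg

/-- `g` is the weak gradient of the scalar function `w` on `ℝ³`. -/
def WGrad (w : E3 → ℝ) (g : Fin 3 → E3 → ℝ) : Prop :=
  ∀ j ψ, Cc ψ → ∫ x, w x * pd ψ j x = - ∫ x, g j x * ψ x

lemma abs_integral_mul_le {f g : E3 → ℝ} (hf : MemLp f 2 volume) (hg : MemLp g 2 volume) :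
    |∫ x, f x * g x| ≤ (eLpNorm f 2 volume).toReal * (eLpNorm g 2 volume).toReal := by
  have h1 := integral_inner_le hf hg
  simpa only [RCLike.inner_apply, conj_trivial, mul_comm (g _)] using h1

lemma hasDerivAt_shift (hψ : Differentiable ℝ ψ) (x y : E3) (θ : ℝ) :
    HasDerivAt (fun θ : ℝ => ψ (x + θ • y)) (∑ j, y j * pd ψ j (x + θ • y)) θ := by
  have h1 : HasDerivAt (fun θ : ℝ => x + θ • y) y θ := by
    simpa using ((hasDerivAt_id θ).smul_const y).const_add x
  have h2 := (hψ (x + θ • y)).hasFDerivAt.comp_hasDerivAt θ h1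
  have e : fderiv ℝ ψ (x + θ • y) y = ∑ j, y j * pd ψ j (x + θ • y) := by
    unfold pd
    have hy := (EuclideanSpace.basisFun (Fin 3) ℝ).sum_repr y
    generalize fderiv ℝ ψ (x + θ • y) = L at *
    conv_lhs => rw [← hy]
    simp [map_sum]
  rw [← e]; exact h2

lemma eLpNorm_shift {F : Type*} [NormedAddCommGroup F] {f : E3 → F}
    (hf : AEStronglyMeasurable f volume) (y : E3) (p : ℝ≥0∞) :
    eLpNorm (fun x => f (x + y)) p volume = eLpNorm f p volume :=
  eLpNorm_comp_measurePreserving hf (measurePreserving_add_right volume y)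

lemma WGrad.shift_pairing_le {w : E3 → ℝ} {g : Fin 3 → E3 → ℝ} (h : WGrad w g)
    (hw : MemLp w 2 volume) (hg : ∀ j, MemLp (g j) 2 volume) (hψ : Cc ψ) (y : E3) :
    |(∫ x, w x * ψ (x + y)) - ∫ x, w x * ψ x| ≤
      ‖y‖ * (∑ j, (eLpNorm (g j) 2 volume).toReal) * (eLpNorm ψ 2 volume).toReal := by
  have hsh : ∀ θ : ℝ, Cc (fun x => ψ (x + θ • y)) := fun θ => by
    simpa using hψ.comp_affine one_ne_zero (θ • y)
  have hpsh : ∀ (θ : ℝ) j x, pd (fun x => ψ (x + θ • y)) j x = pd ψ j (x + θ • y) := fun θ j x => by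
    simpa using pd_comp_affine hψ.differentiable 1 (θ • y) j x
  have hder : ∀ θ ∈ Icc (0:ℝ) 1, HasDerivAt (fun θ : ℝ => ∫ x, w x * ψ (x + θ • y))
      (∫ x, w x * ∑ j, y j * pd ψ j (x + θ • y)) θ := by
    intro θ₀ hθ₀
    choose K hK0 hK using fun j => (hψ.pd j).bounded
    obtain ⟨R, hR⟩ := hψ.2.isCompact.isBounded.subset_closedBall (0 : E3)
    let Z := closedBall (0 : E3) (R + 2 * ‖y‖)
    have hZ : MemLp (Z.indicator fun _ => ‖y‖ * ∑ j, K j) 2 volume :=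
      memLp_indicator_const 2 Metric.isClosed_closedBall.measurableSet _
        (Or.inr (isCompact_closedBall _ _).measure_lt_top.ne)
    refine (hasDerivAt_integral_of_dominated_loc_of_deriv_le
      (F' := fun θ x => w x * ∑ j, y j * pd ψ j (x + θ • y))
      (bound := fun x => |w x| * Z.indicator (fun _ => ‖y‖ * ∑ j, K j) x) (Metric.ball_mem_nhds θ₀ one_pos)
      (.of_forall fun θ => hw.1.mul (hsh θ).continuous.aestronglyMeasurable)
      (hw.integrable_mul (Cc.memLp (p := 2) (hsh θ₀))) (hw.1.mul ?_) (.of_forall fun x θ hθ => ?_)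
      (hw.abs.integrable_mul hZ) (.of_forall fun x θ hθ => ?_)).2
    · have : ∀ j, Continuous (pd ψ j) := fun j => (hψ.pd j).continuous
      fun_prop
    · rw [norm_mul, norm_eq_abs]
      gcongr
      have hθ2 : |θ| ≤ 2 := by
        rw [mem_ball, dist_eq, abs_lt] at hθ
        grind
      by_cases hx : x ∈ Z
      · rw [indicator_of_mem hx]
        refine (norm_sum_le _ _).trans ?_
        rw [mul_sum]
        refine sum_le_sum fun j _ => ?_
        rw [norm_mul]
        exact mul_le_mul (norm_apply_le y j) (hK j _) (norm_nonneg _) (norm_nonneg _)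
      · rw [indicator_of_notMem hx]
        have : ∀ j, pd ψ j (x + θ • y) = 0 := fun j => by
          have hj : tsupport (pd ψ j) ⊆ tsupport ψ := by
            refine closure_minimal (fun z hz => ?_) (isClosed_tsupport _)
            by_contra hc
            apply hz
            have : fderiv ℝ ψ z = 0 := image_eq_zero_of_notMem_tsupport fun h' => hc (tsupport_fderiv_subset ℝ h')
            simp [pd, this]
          refine image_eq_zero_of_notMem_tsupport fun h' => hx ?_
          have h3 := hR (hj h')
          simp only [mem_closedBall, dist_zero_right, Z] at h3 ⊢
          calc ‖x‖ = ‖(x + θ • y) - θ • y‖ := by simp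
            _ ≤ ‖x + θ • y‖ + ‖θ • y‖ := norm_sub_le _ _
            _ ≤ R + 2 * ‖y‖ := by rw [norm_smul, norm_eq_abs]; gcongr
        simp [this]
    · exact (hasDerivAt_shift hψ.differentiable x y θ).const_mul (w x)
  have hbd : ∀ θ ∈ Ico (0:ℝ) 1, ‖∫ x, w x * ∑ j, y j * pd ψ j (x + θ • y)‖ ≤
      ‖y‖ * (∑ j, (eLpNorm (g j) 2 volume).toReal) * (eLpNorm ψ 2 volume).toReal := by
    intro θ _
    have e : ∫ x, w x * ∑ j, y j * pd ψ j (x + θ • y) = ∑ j, y j * (- ∫ x, g j x * ψ (x + θ • y)) := by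
      simp only [mul_sum]
      rw [integral_finsetSum]
      · refine sum_congr rfl fun j _ => ?_
        rw [← h j _ (hsh θ), ← integral_const_mul]
        congr 1; funext x; rw [hpsh]; ring
      · intro j _
        have := (hw.integrable_mul (Cc.memLp (p := 2) ((hsh θ).pd j))).const_mul (y j)
        refine this.congr (.of_forall fun x => ?_)
        simp only [Pi.mul_apply, hpsh]; ring
    rw [e, mul_assoc, sum_mul, mul_sum]
    refine (norm_sum_le _ _).trans (sum_le_sum fun j _ => ?_)
    rw [norm_mul, norm_neg, norm_eq_abs (∫ x, _)]
    refine mul_le_mul (norm_apply_le y j) ?_ (abs_nonneg _) (norm_nonneg _)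
    have := abs_integral_mul_le (hg j) (Cc.memLp (p := 2) (hsh θ))
    rwa [eLpNorm_shift hψ.continuous.aestronglyMeasurable] at this
  have := norm_image_sub_le_of_norm_deriv_le_segment_01' (fun θ hθ => (hder θ hθ).hasDerivWithinAt) hbd
  simpa using this

/-- Translations are Lipschitz in `L²` on functions with square-integrable weak gradient. -/
lemma WGrad.eLpNorm_shift_sub_le {w : E3 → ℝ} {g : Fin 3 → E3 → ℝ} (h : WGrad w g)
    (hw : MemLp w 2 volume) (hg : ∀ j, MemLp (g j) 2 volume) (y : E3) :
    eLpNorm (fun x => w x - w (x - y)) 2 volume ≤ ‖y‖ₑ * ∑ j, eLpNorm (g j) 2 volume := by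
  have hws : MemLp (fun x => w (x - y)) 2 volume :=
    hw.comp_measurePreserving (measurePreserving_sub_right volume y)
  have := eLpNorm_le_of_dual (hw.sub hws)
    (B := ‖y‖ * ∑ j, (eLpNorm (g j) 2 volume).toReal) (by positivity) fun ψ hψ => by
      have i1 := MemLp.integrable_mul_fun hw (Cc.memLp (p := 2) hψ)
      have i2 := MemLp.integrable_mul_fun hws (Cc.memLp (p := 2) hψ)
      have e : ∫ x, w (x - y) * ψ x = ∫ x, w x * ψ (x + y) := by
        rw [← integral_add_right_eq_self _ y]; simp
      have e2 : ∫ x, (w - fun x => w (x - y)) x * ψ x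
          = (∫ x, w x * ψ x) - ∫ x, w x * ψ (x + y) := by
        rw [← e, ← integral_sub i1 i2]; congr 1; funext x; simp; ring
      have := abs_le.1 (h.shift_pairing_le hw hg hψ y)
      linarith
  refine this.trans (le_of_eq ?_)
  rw [ofReal_mul (norm_nonneg _), ofReal_norm, ofReal_sum_of_nonneg fun _ _ => toReal_nonneg]
  congr 1
  exact sum_congr rfl fun j _ => ofReal_toReal (hg j).2.ne

lemma exists_mollifier {h : ℝ} (hh : 0 < h) : ∃ ρ : E3 → ℝ, Cc ρ ∧ (∀ z, 0 ≤ ρ z) ∧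
    ∫ z, ρ z = 1 ∧ ∀ z, ρ z ≠ 0 → ‖z‖ ≤ h := by
  let b : ContDiffBump (0 : E3) := ⟨h / 2, h, by positivity, by linarith⟩
  refine ⟨b.normed volume, ⟨b.contDiff_normed, b.hasCompactSupport_normed⟩, b.nonneg_normed,
    b.integral_normed, fun z hz => ?_⟩
  have : z ∈ Function.support (b.normed volume) := hz
  rw [b.support_normed_eq] at this
  simpa using (mem_ball.1 this).le

/-- Convolution of `w` with the kernel `ρ`. -/
def moll (ρ w : E3 → ℝ) (x : E3) : ℝ := ∫ y, w y * ρ (x - y)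

lemma Cc.reflect {ρ : E3 → ℝ} (hρ : Cc ρ) (x : E3) : Cc (fun y => ρ (x - y)) := by
  have := hρ.comp_affine (c := -1) (by norm_num) x
  simpa [sub_eq_neg_add] using this

lemma WGrad.lintegral_sub_moll_le {w : E3 → ℝ} {g : Fin 3 → E3 → ℝ} (h : WGrad w g)
    (hw : MemLp w 2 volume) (hg : ∀ j, MemLp (g j) 2 volume) {ρ : E3 → ℝ} {r : ℝ} (hρ : Cc ρ)
    (h0 : ∀ z, 0 ≤ ρ z) (h1 : ∫ z, ρ z = 1) (hr : ∀ z, ρ z ≠ 0 → ‖z‖ ≤ r) :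
    ∫⁻ x, ‖w x - moll ρ w x‖ₑ ^ 2 ≤ (ofReal r * ∑ j, eLpNorm (g j) 2 volume) ^ 2 := by
  let m : Measure E3 := volume.withDensity fun z => ofReal (ρ z)
  have hρm : Measurable fun z => ofReal (ρ z) := measurable_ofReal.comp hρ.continuous.measurable
  have hm1 : m univ = 1 := by
    rw [withDensity_apply _ MeasurableSet.univ, setLIntegral_univ,
      ← ofReal_integral_eq_lintegral_ofReal (hρ.continuous.integrable_of_hasCompactSupport hρ.2)
        (.of_forall h0), h1, ofReal_one]
  have : IsProbabilityMeasure m := ⟨hm1⟩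
  have hInt : ∀ f : E3 → ℝ, ∫ z, f z ∂m = ∫ z, ρ z * f z := fun f => by
    rw [integral_withDensity_eq_integral_toReal_smul hρm (.of_forall fun _ => ofReal_lt_top)]
    simp [toReal_ofReal (h0 _)]
  have hshift : ∀ x, MemLp (fun z => w (x - z)) 2 volume := fun x =>
    hw.comp_measurePreserving (volume.measurePreserving_sub_left x)
  have hrep : ∀ x, w x - moll ρ w x = ∫ z, (w x - w (x - z)) ∂m := by
    intro x
    have i1 : Integrable (fun z => ρ z * w x) :=
      (hρ.continuous.integrable_of_hasCompactSupport hρ.2).mul_const _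
    have i2 : Integrable (fun z => ρ z * w (x - z)) :=
      MemLp.integrable_mul_fun (Cc.memLp (p := 2) hρ) (hshift x)
    have e : moll ρ w x = ∫ z, ρ z * w (x - z) := by
      unfold moll
      rw [← integral_sub_left_eq_self _ volume x]
      congr 1; funext z; rw [_root_.sub_sub_cancel]; ring
    rw [hInt]
    simp only [mul_sub]
    rw [integral_sub i1 i2, integral_mul_const, h1, one_mul, e]
  have hac : m ≪ volume := withDensity_absolutelyContinuous _ _
  have hjm : AEStronglyMeasurable (fun p : E3 × E3 => w p.1 - w (p.1 - p.2)) (volume.prod m) := by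
    have q1 : AEStronglyMeasurable (fun p : E3 × E3 => w p.1) (volume.prod m) := hw.1.comp_fst
    have q2 : AEStronglyMeasurable (fun p : E3 × E3 => w (p.1 - p.2)) (volume.prod volume) :=
      hw.1.comp_quasiMeasurePreserving (quasiMeasurePreserving_sub volume volume)
    exact q1.sub (q2.mono_ac (Measure.AbsolutelyContinuous.rfl.prod hac))
  have hjen : ∀ x, ‖w x - moll ρ w x‖ₑ ^ 2 ≤ ∫⁻ z, ‖w x - w (x - z)‖ₑ ^ 2 ∂m := by
    intro x
    have hm : AEStronglyMeasurable (fun z => w x - w (x - z)) m :=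
      (aestronglyMeasurable_const.sub (hshift x).1).mono_ac hac
    rw [hrep, lintegral_enorm_sq]
    gcongr
    calc ‖∫ z, (w x - w (x - z)) ∂m‖ₑ ≤ ∫⁻ z, ‖w x - w (x - z)‖ₑ ∂m := enorm_integral_le_lintegral_enorm _
      _ = eLpNorm (fun z => w x - w (x - z)) 1 m := (eLpNorm_one_eq_lintegral_enorm).symm
      _ ≤ eLpNorm (fun z => w x - w (x - z)) 2 m := eLpNorm_le_eLpNorm_of_exponent_le (by norm_num) hm
  calc ∫⁻ x, ‖w x - moll ρ w x‖ₑ ^ 2 ≤ ∫⁻ x, ∫⁻ z, ‖w x - w (x - z)‖ₑ ^ 2 ∂m ∂volume := lintegral_mono hjen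
    _ = ∫⁻ z, ∫⁻ x, ‖w x - w (x - z)‖ₑ ^ 2 ∂volume ∂m := lintegral_lintegral_swap
        (f := fun x z => ‖w x - w (x - z)‖ₑ ^ 2) (hjm.enorm.pow_const 2)
    _ = ∫⁻ z, ofReal (ρ z) * ∫⁻ x, ‖w x - w (x - z)‖ₑ ^ 2 := by
      refine lintegral_withDensity_eq_lintegral_mul₀' hρm.aemeasurable
        (g := fun z => ∫⁻ x, ‖w x - w (x - z)‖ₑ ^ 2) ?_
      exact ((hjm.enorm.pow_const 2).prod_swap).lintegral_prod_right'
    _ ≤ ∫⁻ z, ofReal (ρ z) * (ofReal r * ∑ j, eLpNorm (g j) 2 volume) ^ 2 := by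
      refine lintegral_mono fun z => ?_
      by_cases hz : ρ z = 0
      · simp [hz]
      · dsimp only
        gcongr
        rw [lintegral_enorm_sq]
        gcongr
        refine (h.eLpNorm_shift_sub_le hw hg z).trans ?_
        gcongr
        rw [← ofReal_norm]
        exact ofReal_le_ofReal (hr z hz)
    _ = (ofReal r * ∑ j, eLpNorm (g j) 2 volume) ^ 2 := by
      rw [lintegral_mul_const _ hρm,
        ← ofReal_integral_eq_lintegral_ofReal (hρ.continuous.integrable_of_hasCompactSupport hρ.2)
        (.of_forall h0), h1, ofReal_one, one_mul]

/-- A finite measure on space-time equivalent to `μST`. -/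
def wST : Measure ST := μST.withDensity fun p => ofReal ((1 + ‖p‖) ^ (-5:ℝ))

lemma measurable_wST : Measurable fun p : ST => ofReal ((1 + ‖p‖) ^ (-5:ℝ)) := by fun_prop

instance : IsFiniteMeasure wST := by
  have : Measure.IsAddHaarMeasure (volume : Measure ST) := by
    rw [Measure.volume_eq_prod]; infer_instance
  have h : Integrable (fun p : ST => (1 + ‖p‖) ^ (-5:ℝ)) volume :=
    integrable_one_add_norm (by simp; norm_num)
  refine isFiniteMeasure_withDensity_ofReal (h.mono_measure μST_le).2

lemma wST_le : wST ≤ μST := by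
  conv_rhs => rw [← withDensity_one (μ := μST)]
  refine withDensity_mono (.of_forall fun p => ?_)
  refine ofReal_le_one.2 (Real.rpow_le_one_of_one_le_of_nonpos ?_ (by norm_num))
  linarith [norm_nonneg p]

lemma μST_ac : μST ≪ wST :=
  withDensity_absolutelyContinuous' measurable_wST.aemeasurable (.of_forall fun p => by
    have : 0 < (1 + ‖p‖) ^ (-5:ℝ) := by positivity
    simpa using this)

lemma exists_restrict_le {K : Set ST} (hK : IsCompact K) :
    ∃ c : ℝ≥0∞, c ≠ ∞ ∧ μST.restrict K ≤ c • wST := by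
  obtain ⟨R, hR⟩ := hK.isBounded.subset_closedBall (0 : ST)
  let c : ℝ := (1 + |R|) ^ (5:ℝ)
  refine ⟨ofReal c, ofReal_ne_top, ?_⟩
  have hKm := hK.measurableSet
  have e : μST.restrict K = (μST.restrict K).withDensity 1 := withDensity_one.symm
  have h1 : μST.restrict K ≤ ofReal c •
      (μST.restrict K).withDensity fun p => ofReal ((1 + ‖p‖) ^ (-5:ℝ)) := by
    rw [← withDensity_smul _ measurable_wST]
    conv_lhs => rw [e]
    refine withDensity_mono ?_
    rw [EventuallyLE, ae_restrict_iff' hKm]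
    refine of_forall fun p hp => ?_
    have hp' : ‖p‖ ≤ |R| := by
      have := hR hp
      simp only [mem_closedBall, dist_zero_right] at this
      exact this.trans (le_abs_self R)
    have : 1 ≤ c * (1 + ‖p‖) ^ (-5:ℝ) := by
      rw [Real.rpow_neg (by positivity), ← div_eq_mul_inv, one_le_div (by positivity)]
      exact Real.rpow_le_rpow (by positivity) (by linarith) (by norm_num)
    simp only [Pi.one_apply, Pi.smul_apply, smul_eq_mul]
    rw [← ofReal_mul (by positivity)]
    exact one_le_ofReal.2 this
  refine h1.trans ?_
  gcongr
  rw [← restrict_withDensity hKm]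
  exact Measure.restrict_le_self

lemma enorm_euclidean_le {ι : Type*} [Fintype ι] (v : EuclideanSpace ℝ ι) :
    ‖v‖ₑ ^ 2 = ∑ i, ‖v i‖ₑ ^ 2 := by
  rw [← ofReal_norm, ← ofReal_pow (norm_nonneg _), norm_sq_eq,
    ofReal_sum_of_nonneg (fun _ _ => by positivity)]
  exact sum_congr rfl fun i _ => by rw [ofReal_pow (norm_nonneg _), ofReal_norm]

/-- Spatial mollification of a vector field. -/
def mollST (ρ : E3 → ℝ) (u : Flow) (p : ST) : E3 :=
  toLp 2 fun i => moll ρ (fun y => u p.1 y i) p.2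

lemma BddU.aesm_mollST (h : BddU u M) {ρ : E3 → ℝ} (hρ : Cc ρ) :
    AEStronglyMeasurable (mollST ρ u) μST := by
  have hq : Measure.QuasiMeasurePreserving (fun q : ST × E3 => (q.1.1, q.2))
      (μST.prod volume) μST := by
    refine prodMap (f := Prod.fst) (g := id) ?_ (Measure.QuasiMeasurePreserving.id _)
    exact Measure.quasiMeasurePreserving_fst
  have hi : ∀ i : Fin 3, AEStronglyMeasurable
      (fun p : ST => moll ρ (fun y => u p.1 y i) p.2) μST := by
    intro i
    have h1 : AEStronglyMeasurable (fun p : ST => u p.1 p.2 i) μST :=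
      (EuclideanSpace.proj (𝕜 := ℝ) i).continuous.comp_aestronglyMeasurable h.aesm
    have h2 := h1.comp_quasiMeasurePreserving hq
    have hc := hρ.continuous
    have h3 : AEStronglyMeasurable (fun q : ST × E3 => ρ (q.1.2 - q.2)) (μST.prod volume) :=
      aestronglyMeasurable (by fun_prop)
    exact (h2.mul h3).integral_prod_right'
  have h2 : AEMeasurable (fun p => fun i => moll ρ (fun y => u p.1 y i) p.2) μST :=
    aemeasurable_pi_lambda _ fun i => (hi i).aemeasurable
  exact ((PiLp.continuous_toLp 2 _).measurable.comp_aemeasurable h2).aestronglyMeasurable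

lemma BddU.lintegral_sub_mollST_le {C : ℝ} (h : BddU u M)
    (hM : M < ∞) (hC : 0 ≤ C) (hG : GradBd u C) {ρ : E3 → ℝ} {r : ℝ} (hρ : Cc ρ)
    (h0 : ∀ z, 0 ≤ ρ z) (h1 : ∫ z, ρ z = 1) (hr : ∀ z, ρ z ≠ 0 → ‖z‖ ≤ r) :
    ∫⁻ p, ‖u p.1 p.2 - mollST ρ u p‖ₑ ^ 2 ∂μST ≤ 27 * (ofReal r * ofReal C) ^ 2 := by
  obtain ⟨G, hGm, hGd, hGb⟩ := hG.exists_isDistGrad h hM hC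
  have hGL := (eLpNorm_toE9_le hGm hGb).1
  have hGs : ∀ᵐ t ∂μT, MemLp (fun x => toE9 G (t, x)) 2 volume :=
    ae_memLp_slice (w := fun t x => toE9 G (t, x)) fun R => hGL.restrict _
  have hm : AEStronglyMeasurable (fun p : ST => u p.1 p.2 - mollST ρ u p) μST :=
    h.aesm.sub (h.aesm_mollST hρ)
  rw [μST, lintegral_prod _ (hm.enorm.pow_const 2)]
  calc ∫⁻ t in R₊, ∫⁻ x, ‖u t x - mollST ρ u (t, x)‖ₑ ^ 2
      ≤ ∫⁻ t in R₊, 27 * (ofReal r ^ 2 * gradSq G t) := by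
        refine lintegral_mono_ae ?_
        filter_upwards [hGs, h.slice_memLp hM, hGd.slice h hM hGL] with t hg hu hs
        have hgi : ∀ i j, MemLp (fun x => G t x i j) 2 volume := fun i j => MemLp.coord hg (i, j)
        have hle : ∀ i j, eLpNorm (fun x => G t x i j) 2 volume ≤ eLpNorm (fun x => toE9 G (t, x)) 2 volume :=
          fun i j => eLpNorm_mono fun x => norm_apply_le (toE9 G (t, x)) (i, j)
        have hgs : gradSq G t = eLpNorm (fun x => toE9 G (t, x)) 2 volume ^ 2 := by
          rw [← lintegral_enorm_sq]
          simp only [gradSq, enorm_sq_E9]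
          rfl
        have hi : ∀ i, ∫⁻ x, ‖u t x i - moll ρ (fun y => u t y i) x‖ₑ ^ 2
            ≤ 9 * (ofReal r ^ 2 * gradSq G t) := fun i => by
          have hw : WGrad (fun x => u t x i) (fun j x => G t x i j) := fun j ψ hψ => hs i j ψ hψ
          refine (hw.lintegral_sub_moll_le (MemLp.coord hu i) (hgi i) hρ h0 h1 hr).trans ?_
          calc (ofReal r * ∑ j, eLpNorm (fun x => G t x i j) 2 volume) ^ 2
              ≤ (ofReal r * ∑ _j : Fin 3, eLpNorm (fun x => toE9 G (t, x)) 2 volume) ^ 2 := by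
                gcongr; exact hle _ _
            _ = 9 * (ofReal r ^ 2 * gradSq G t) := by rw [hgs]; simp; ring
        have e : ∀ x, ‖u t x - mollST ρ u (t, x)‖ₑ ^ 2
            = ∑ i, ‖u t x i - moll ρ (fun y => u t y i) x‖ₑ ^ 2 := fun x => by
          rw [enorm_euclidean_le]; rfl
        simp only [e]
        rw [lintegral_finsetSum']
        · calc _ ≤ ∑ _i : Fin 3, 9 * (ofReal r ^ 2 * gradSq G t) := sum_le_sum fun i _ => hi i
            _ = 27 * (ofReal r ^ 2 * gradSq G t) := by simp; ring
        · intro i _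
          have hc : AEStronglyMeasurable (fun x => moll ρ (fun y => u t y i) x) volume := by
            have hcρ := hρ.continuous
            have a1 : AEStronglyMeasurable (fun q : E3 × E3 => u t q.2 i) (volume.prod volume) :=
              (MemLp.coord hu i).1.comp_snd
            have a2 : AEStronglyMeasurable (fun q : E3 × E3 => ρ (q.1 - q.2)) (volume.prod volume) :=
              aestronglyMeasurable (by fun_prop)
            exact (a1.mul a2).integral_prod_right'
          exact (((MemLp.coord hu i).1.sub hc).enorm.pow_const 2)
    _ = 27 * (ofReal r ^ 2 * ∫⁻ t in R₊, gradSq G t) := by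
        rw [lintegral_const_mul' _ _ (by simp), lintegral_const_mul' _ _ (by simp)]
    _ ≤ 27 * (ofReal r ^ 2 * ofReal C ^ 2) := by gcongr
    _ = _ := by ring

lemma abs_moll_le {w ρ : E3 → ℝ} (hw : MemLp w 2 volume) (hρ : Cc ρ) (x : E3) :
    |moll ρ w x| ≤ (eLpNorm w 2 volume).toReal * (eLpNorm ρ 2 volume).toReal := by
  have h := abs_integral_mul_le hw ((hρ.reflect x).memLp (p := 2))
  have e : eLpNorm (fun y => ρ (x - y)) 2 volume = eLpNorm ρ 2 volume :=
    eLpNorm_comp_measurePreserving (g := ρ) hρ.continuous.aestronglyMeasurable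
      (Measure.measurePreserving_sub_left volume x)
  rw [e] at h
  exact h

lemma norm_le_of_coord_le {v : E3} {B : ℝ} (h : ∀ i, |v i| ≤ B) : ‖v‖ ≤ 2 * B := by
  have hB : 0 ≤ B := (abs_nonneg _).trans (h 0)
  refine abs_le_of_sq_le_sq' ?_ (by positivity) |>.2
  rw [norm_sq_eq]
  calc ∑ i, ‖v i‖ ^ 2 ≤ ∑ _i : Fin 3, B ^ 2 := by gcongr with i; exact h i
    _ ≤ _ := by simp; nlinarith [sq_nonneg B]

lemma BddU.norm_mollST_le {M : ℝ} (h : BddU u (ofReal M)) {ρ : E3 → ℝ} (hρ : Cc ρ) (hM : 0 ≤ M) :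
    ∀ᵐ p ∂μST, ‖mollST ρ u p‖ ≤ 2 * (M * (eLpNorm ρ 2 volume).toReal) := by
  have h1 := (h.slice_memLp ofReal_lt_top).and h.bdd
  have h2 : ∀ᵐ p ∂μST, MemLp (u p.1) 2 volume ∧ eLpNorm (u p.1) 2 volume ≤ ofReal M :=
    Measure.quasiMeasurePreserving_fst.ae h1
  filter_upwards [h2] with p hp
  refine norm_le_of_coord_le fun i => ?_
  refine (abs_moll_le (MemLp.coord hp.1 i) hρ p.2).trans ?_
  gcongr
  refine toReal_le_of_le_ofReal hM (le_trans ?_ hp.2)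
  exact eLpNorm_mono fun x => norm_apply_le (u p.1 x) i

/-- Slicewise weak convergence against smooth functions. -/
def WeakConv (u : ℕ → Flow) : Prop :=
  ∀ᵐ t ∂μT, ∀ f, Cc f → ∀ i, ∃ l, Tendsto (fun k => ∫ x, u k t x i * f x) atTop (nhds l)

lemma WeakConv.exists_tendsto_mollST {u : ℕ → Flow} {M : ℝ} (hw : WeakConv u)
    (h : ∀ k, BddU (u k) (ofReal M)) (hM : 0 ≤ M) {ρ : E3 → ℝ} (hρ : Cc ρ) :
    ∃ L : ST → E3, Measurable L ∧
      Tendsto (fun k => eLpNorm (mollST ρ (u k) - L) 2 wST) atTop (nhds 0) := by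
  have hac : wST ≪ μST := wST_le.absolutelyContinuous
  have hm : ∀ k, AEStronglyMeasurable (mollST ρ (u k)) wST := fun k =>
    ((h k).aesm_mollST hρ).mono_ac hac
  have hlim : ∀ᵐ p ∂wST, ∃ l, Tendsto (fun k => mollST ρ (u k) p) atTop (nhds l) := by
    refine hac.ae_le ?_
    have h1 : ∀ᵐ p : ST ∂μST, ∀ f, Cc f → ∀ i, ∃ l,
        Tendsto (fun k => ∫ x, u k p.1 x i * f x) atTop (nhds l) :=
      Measure.quasiMeasurePreserving_fst.ae hw
    filter_upwards [h1] with p hp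
    choose l hl using fun i => hp _ (hρ.reflect p.2) i
    refine ⟨toLp 2 l, ?_⟩
    exact ((PiLp.continuous_toLp 2 _).tendsto l).comp (tendsto_pi_nhds.2 hl)
  obtain ⟨L, hLm, hL⟩ := measurable_limit_of_tendsto_metrizable_ae (fun k => (hm k).aemeasurable) hlim
  refine ⟨L, hLm, ?_⟩
  set B := 2 * (M * (eLpNorm ρ 2 volume).toReal)
  have hB : ∀ᵐ p ∂wST, ∀ k, ‖mollST ρ (u k) p‖ ≤ B :=
    ae_all_iff.2 fun k => hac.ae_le ((h k).norm_mollST_le hρ hM)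
  have hz : Tendsto (fun k => ∫⁻ p, ‖(mollST ρ (u k) - L) p‖ₑ ^ 2 ∂wST) atTop (nhds 0) := by
    have := tendsto_lintegral_of_dominated_convergence' (μ := wST) (f := fun _ => 0)
      (F := fun k p => ‖(mollST ρ (u k) - L) p‖ₑ ^ 2)
      (fun _ => ofReal (2 * B) ^ 2)
      (fun k => ((hm k).sub hLm.aestronglyMeasurable).enorm.pow_const 2)
      (fun k => by
        filter_upwards [hB, hL] with p hp hl
        have : ‖L p‖ ≤ B := le_of_tendsto hl.norm (.of_forall hp)
        have h3 : ‖(mollST ρ (u k) - L) p‖ ≤ 2 * B := by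
          refine (norm_sub_le _ _).trans ?_
          grind
        rw [← ofReal_norm]
        gcongr)
      (by simp [lintegral_const, mul_eq_top, measure_ne_top])
      (by
        filter_upwards [hL] with p hl
        have : Tendsto (fun k => ‖(mollST ρ (u k) - L) p‖ₑ) atTop (nhds 0) := by
          have h3 := (hl.sub_const (L p)).enorm
          simpa using h3
        simpa using ENNReal.Tendsto.pow (n := 2) this)
    simpa using this
  simp only [lintegral_enorm_sq] at hz
  have := hz.ennrpow_const (1/2)
  simp only [← rpow_natCast, ← rpow_mul] at this
  simpa using this

lemma WeakConv.exists_strong_limit {u : ℕ → Flow} {M C : ℝ} (hw : WeakConv u)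
    (h : ∀ k, BddU (u k) (ofReal M)) (hM : 0 ≤ M) (hC : 0 ≤ C)
    (hG : ∀ k, GradBd (u k) C) :
    ∃ (v : Flow) (σ : ℕ → ℕ), StrictMono σ ∧ BddU v (ofReal M) ∧
      (∀ᵐ p ∂μST, Tendsto (fun k => u (σ k) p.1 p.2) atTop (nhds (v p.1 p.2))) ∧
      ∀ K, IsCompact K → Tendsto (fun k => eLpNorm (uncurry (u (σ k)) - uncurry v) 2
        (μST.restrict K)) atTop (nhds 0) := by
  have hac : wST ≪ μST := wST_le.absolutelyContinuous
  have hum : ∀ k, AEStronglyMeasurable (uncurry (u k)) wST := fun k => (h k).aesm.mono_ac hac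
  have approx : ∀ ε : ℝ≥0∞, 0 < ε → ∃ ρ : E3 → ℝ, Cc ρ ∧
      ∀ k, eLpNorm (uncurry (u k) - mollST ρ (u k)) 2 wST ≤ ε := by
    intro ε hε
    have : ∃ r : ℝ, 0 < r ∧ 6 * (ofReal r * ofReal C) ≤ ε := by
      have hc : Tendsto (fun r : ℝ => 6 * (ofReal r * ofReal C)) (nhdsWithin 0 (Ioi 0))
          (nhds 0) := by
        have : Tendsto (fun r : ℝ => 6 * (ofReal (r * C))) (nhds 0) (nhds (6 * ofReal (0 * C))) :=
          ENNReal.Tendsto.const_mul ((continuous_ofReal.tendsto _).comp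
            ((continuous_id.mul continuous_const).tendsto 0)) (Or.inr (by simp))
        simp only [zero_mul, ofReal_zero, mul_zero] at this
        refine (this.mono_left nhdsWithin_le_nhds).congr' ?_
        filter_upwards [self_mem_nhdsWithin] with r hr
        rw [ofReal_mul (le_of_lt hr)]
      obtain ⟨r, h1, h2⟩ := ((hc.eventually (eventually_le_nhds hε)).and self_mem_nhdsWithin).exists
      grind
    obtain ⟨r, hr, hrε⟩ := this
    obtain ⟨ρ, hρ, h0, h1, h2⟩ := exists_mollifier hr
    refine ⟨ρ, hρ, fun k => ?_⟩
    refine le_trans ?_ hrε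
    refine (eLpNorm_mono_measure _ wST_le).trans ?_
    have h3 := (h k).lintegral_sub_mollST_le ofReal_lt_top hC (hG k) hρ h0 h1 h2
    have h4 : eLpNorm (uncurry (u k) - mollST ρ (u k)) 2 μST ^ 2
        ≤ (6 * (ofReal r * ofReal C)) ^ 2 := by
      rw [← lintegral_enorm_sq]
      refine le_trans h3 ?_
      have h36 : (27:ℝ≥0∞) ≤ 6 ^ 2 := by norm_num
      rw [mul_pow 6]
      exact mul_le_mul' h36 le_rfl
    exact (pow_le_pow_left_iff (by norm_num)).1 h4
  have hL : ∀ k, MemLp (uncurry (u k)) 2 wST := by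
    intro k
    obtain ⟨ρ, hρ, hk⟩ := approx 1 one_pos
    have hmm := ((h k).aesm_mollST hρ).mono_ac hac
    have h1 : MemLp (uncurry (u k) - mollST ρ (u k)) 2 wST :=
      ⟨(hum k).sub hmm, (hk k).trans_lt one_lt_top⟩
    have h2 : MemLp (mollST ρ (u k)) 2 wST :=
      MemLp.of_bound hmm _ (hac.ae_le ((h k).norm_mollST_le hρ hM))
    simpa using h1.add h2
  have hcau : CauchySeq fun k => (hL k).toLp := by
    rw [EMetric.cauchySeq_iff]
    intro ε hε
    obtain ⟨δ, hδ, hδε⟩ : ∃ δ : ℝ≥0∞, 0 < δ ∧ 4 * δ < ε := by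
      rcases eq_or_ne ε ∞ with rfl | hε'
      · exact ⟨1, one_pos, by simp⟩
      refine ⟨ε / 5, ENNReal.div_pos hε.ne' (by simp), ?_⟩
      rw [← mul_div_assoc, ENNReal.div_lt_iff (Or.inl (by norm_num)) (Or.inl (by norm_num)), mul_comm]
      exact ENNReal.mul_lt_mul_right hε.ne' hε' (by norm_num)
    obtain ⟨ρ, hρ, hk⟩ := approx δ hδ
    obtain ⟨L, hLm, hLt⟩ := hw.exists_tendsto_mollST h hM hρ
    obtain ⟨N, hN⟩ := eventually_atTop.1 (hLt.eventually (eventually_le_nhds hδ))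
    have key : ∀ m ≥ N, eLpNorm (uncurry (u m) - L) 2 wST ≤ 2 * δ := by
      intro m hm
      have hmm := ((h m).aesm_mollST hρ).mono_ac hac
      have : uncurry (u m) - L = (uncurry (u m) - mollST ρ (u m)) + (mollST ρ (u m) - L) := by abel
      rw [this, two_mul]
      exact (eLpNorm_add_le ((hum m).sub hmm) (hmm.sub hLm.aestronglyMeasurable) (by norm_num)).trans
        (add_le_add (hk m) (hN m hm))
    refine ⟨N, fun m hm n hn => ?_⟩
    rw [Lp.edist_toLp_toLp]
    refine lt_of_le_of_lt ?_ hδε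
    have : uncurry (u m) - uncurry (u n) = (uncurry (u m) - L) - (uncurry (u n) - L) := by abel
    rw [this]
    refine (eLpNorm_sub_le ((hum m).sub hLm.aestronglyMeasurable)
      ((hum n).sub hLm.aestronglyMeasurable) (by norm_num)).trans ?_
    refine (add_le_add (key m hm) (key n hn)).trans (le_of_eq ?_)
    ring
  obtain ⟨V, hV⟩ := cauchySeq_tendsto_of_complete hcau
  have hV' : Tendsto (fun k => eLpNorm (uncurry (u k) - ⇑V) 2 wST) atTop (nhds 0) := by
    have := (Lp.tendsto_Lp_iff_tendsto_eLpNorm' _ _).1 hV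
    refine this.congr fun k => eLpNorm_congr_ae ?_
    filter_upwards [(hL k).coeFn_toLp] with p hp
    simp [hp]
  obtain ⟨σ, hσ, hae⟩ := (tendstoInMeasure_of_tendsto_eLpNorm (by norm_num) hum
    (Lp.aestronglyMeasurable V) hV').exists_seq_tendsto_ae
  have hae' := μST_ac.ae_le hae
  refine ⟨fun t x => V (t, x), σ, hσ, ⟨?_, ?_⟩, hae', fun K hK => ?_⟩
  · fun_prop
  · have h1 : ∀ᵐ t ∂μT, ∀ᵐ x,
        Tendsto (fun k => u (σ k) t x) atTop (nhds (V (t, x))) := ae_ae_of_ae_prod hae'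
    filter_upwards [h1, ae_all_iff.2 fun k => (h k).bdd,
      ae_all_iff.2 fun k => (h k).slice_memLp ofReal_lt_top] with t ht hb hm
    refine (Lp.eLpNorm_lim_le_liminf_eLpNorm (fun k => (hm (σ k)).1) _ ht).trans ?_
    refine (liminf_le_liminf (.of_forall fun k => hb (σ k))).trans ?_
    simp
  · obtain ⟨c, hc, hle⟩ := exists_restrict_le hK
    have h1 := ENNReal.Tendsto.const_mul (a := c ^ (1 / (2:ℝ≥0∞)).toReal) (hV'.comp hσ.tendsto_atTop)
      (Or.inr (by simp [hc]))
    rw [mul_zero] at h1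
    refine tendsto_of_tendsto_of_tendsto_of_le_of_le tendsto_const_nhds h1 (fun _ => zero_le) fun k => ?_
    refine (eLpNorm_mono_measure _ hle).trans ?_
    rw [eLpNorm_smul_measure_of_ne_top (by norm_num)]
    rfl

lemma tendsto_integral_mul_of_eLpNorm {X : Type*} [MeasurableSpace X] {μ : Measure X}
    {f g : ℕ → X → ℝ} {f' g' : X → ℝ} (hf : ∀ k, MemLp (f k) 2 μ) (hg : ∀ k, MemLp (g k) 2 μ)
    (hf' : MemLp f' 2 μ) (hg' : MemLp g' 2 μ)
    (h1 : Tendsto (fun k => eLpNorm (f k - f') 2 μ) atTop (nhds 0))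
    (h2 : Tendsto (fun k => eLpNorm (g k - g') 2 μ) atTop (nhds 0)) :
    Tendsto (fun k => ∫ x, f k x * g k x ∂μ) atTop (nhds (∫ x, f' x * g' x ∂μ)) := by
  have e : ∀ {a b : X → ℝ} (ha : MemLp a 2 μ) (hb : MemLp b 2 μ),
      inner ℝ (hb.toLp) (ha.toLp) = ∫ x, a x * b x ∂μ := by
    intro a b ha hb
    rw [L2.inner_def]
    refine integral_congr_ae ?_
    filter_upwards [ha.coeFn_toLp, hb.coeFn_toLp] with x h1 h2
    simp [h1, h2]
  have := ((Lp.tendsto_Lp_iff_tendsto_eLpNorm'' g hg g' hg').2 h2).inner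
    (𝕜 := ℝ) ((Lp.tendsto_Lp_iff_tendsto_eLpNorm'' f hf f' hf').2 h1)
  simpa only [e] using this

/-- Strong convergence in `L²` on compact subsets of space-time. -/
def StrongConv (w : ℕ → Flow) (v : Flow) : Prop :=
  ∀ K, IsCompact K → Tendsto (fun k => eLpNorm (uncurry (w k) - uncurry v) 2
        (μST.restrict K)) atTop (nhds 0)

section
variable {w : ℕ → Flow} {v : Flow} {M : ℝ}

lemma StrongConv.coord (h : StrongConv w v) {K : Set ST} (hK : IsCompact K) (i : Fin 3) :
    Tendsto (fun k => eLpNorm ((fun p : ST => w k p.1 p.2 i) - fun p => v p.1 p.2 i) 2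
        (μST.restrict K)) atTop (nhds 0) := by
  refine tendsto_of_tendsto_of_tendsto_of_le_of_le tendsto_const_nhds (h K hK) (fun _ => zero_le)
    fun k => eLpNorm_mono fun p => ?_
  exact norm_apply_le (w k p.1 p.2 - v p.1 p.2) i

lemma integral_restrict_tsupport : ∫ p in tsupport g, f p * g p ∂μST = ∫ p, f p * g p ∂μST := by
  refine setIntegral_eq_integral_of_forall_compl_eq_zero fun p hp => ?_
  rw [image_eq_zero_of_notMem_tsupport hp, mul_zero]

lemma StrongConv.tendsto_lin (h : StrongConv w v) (hw : ∀ k, BddU (w k) (ofReal M))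
    (hv : BddU v (ofReal M)) (hg : Cc g) (i : Fin 3) :
    Tendsto (fun k => ∫ p, w k p.1 p.2 i * g p ∂μST) atTop (nhds (∫ p, v p.1 p.2 i * g p ∂μST)) := by
  simp only [← integral_restrict_tsupport (g := g)]
  have hK : IsCompact (tsupport g) := hg.2
  exact tendsto_integral_mul_of_eLpNorm
    (fun k => MemLp.coord ((hw k).memLp_compact ofReal_lt_top hK) i)
    (fun _ => hg.memLp.restrict _) (MemLp.coord (hv.memLp_compact ofReal_lt_top hK) i)
    (hg.memLp.restrict _) (h.coord hK i) (by simp)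

lemma StrongConv.tendsto_quad (h : StrongConv w v) (hw : ∀ k, BddU (w k) (ofReal M))
    (hv : BddU v (ofReal M)) (hg : Cc g) (i j : Fin 3) :
    Tendsto (fun k => ∫ p, w k p.1 p.2 i * w k p.1 p.2 j * g p ∂μST) atTop
      (nhds (∫ p, v p.1 p.2 i * v p.1 p.2 j * g p ∂μST)) := by
  have hK : IsCompact (tsupport g) := hg.2
  obtain ⟨B, -, hB⟩ := hg.bounded
  have hm : ∀ {f : ST → ℝ}, MemLp f 2 (μST.restrict (tsupport g)) →
      MemLp (fun p => f p * g p) 2 (μST.restrict (tsupport g)) := fun {f} hf => by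
    refine hf.of_le_mul (c := B) (hf.1.mul hg.continuous.aestronglyMeasurable)
      (.of_forall fun p => ?_)
    rw [norm_mul, mul_comm]
    gcongr
    exact hB p
  have := tendsto_integral_mul_of_eLpNorm (μ := μST.restrict (tsupport g))
    (fun k => MemLp.coord ((hw k).memLp_compact ofReal_lt_top hK) i)
    (fun k => hm (MemLp.coord ((hw k).memLp_compact ofReal_lt_top hK) j))
    (MemLp.coord (hv.memLp_compact ofReal_lt_top hK) i)
    (hm (MemLp.coord (hv.memLp_compact ofReal_lt_top hK) j)) (h.coord hK i) ?_
  · simp only [uncurry, ← mul_assoc] at this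
    rw [integral_restrict_tsupport (f := fun p : ST => v p.1 p.2 i * v p.1 p.2 j)] at this
    exact this.congr fun k =>
      integral_restrict_tsupport (f := fun p : ST => w k p.1 p.2 i * w k p.1 p.2 j)
  · have h1 := ENNReal.Tendsto.const_mul (a := ofReal B) (h.coord hK j) (Or.inr ofReal_ne_top)
    rw [mul_zero] at h1
    refine tendsto_of_tendsto_of_tendsto_of_le_of_le tendsto_const_nhds h1 (fun _ => zero_le) fun k => ?_
    refine eLpNorm_le_mul_eLpNorm_of_ae_le_mul (.of_forall fun p => ?_) 2
    simp only [Pi.sub_apply, uncurry, ← sub_mul, norm_mul]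
    rw [mul_comm]
    gcongr
    exact hB p

lemma StrongConv.tendsto_nsI (h : StrongConv w v) (hw : ∀ k, BddU (w k) (ofReal M))
    (hv : BddU v (ofReal M)) (hφ : IsTest φ) (ν : ℝ) :
    Tendsto (fun k => ∫ p, nsI ν φ (w k) p ∂μST) atTop (nhds (∫ p, nsI ν φ v p ∂μST)) := by
  have e : ∀ {u : Flow}, BddU u (ofReal M) → ∫ p, nsI ν φ u p ∂μST
      = (∑ i, ∫ p, u p.1 p.2 i * nsA ν φ i p ∂μST)
        + ∑ i, ∑ j, ∫ p, u p.1 p.2 i * u p.1 p.2 j * nsB φ i j p ∂μST := by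
    intro u hu
    have i1 := fun i => hu.integrable_lin ofReal_lt_top (nsA_cc hφ ν i) i
    have i2 := fun i j => hu.integrable_quad ofReal_lt_top (nsB_cc hφ i j) i j
    unfold nsI
    rw [integral_add (integrable_finsetSum _ fun i _ => i1 i)
      (integrable_finsetSum _ fun i _ => integrable_finsetSum _ fun j _ => i2 i j),
      integral_finsetSum _ fun i _ => i1 i,
      integral_finsetSum _ fun i _ => integrable_finsetSum _ fun j _ => i2 i j]
    congr 1
    exact sum_congr rfl fun i _ => integral_finsetSum _ fun j _ => i2 i j
  rw [e hv]
  simp only [e (hw _)]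
  exact (tendsto_finsetSum _ fun i _ => h.tendsto_lin hw hv (nsA_cc hφ ν i) i).add
    (tendsto_finsetSum _ fun i _ => tendsto_finsetSum _ fun j _ =>
      h.tendsto_quad hw hv (nsB_cc hφ i j) i j)

lemma StrongConv.gradBd (h : StrongConv w v) (hw : ∀ k, BddU (w k) (ofReal M))
    (hv : BddU v (ofReal M)) {f : ST → E9} (hf : SptM f) :
    Tendsto (fun k => gp (w k) f) atTop (nhds (gp v f)) := by
  have e : ∀ {u : Flow}, BddU u (ofReal M) → gp u f
      = ∑ k : Fin 3 × Fin 3, ∫ p, u p.1 p.2 k.1 * dX k.2 (fun q => f q k) p ∂μST := fun hu =>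
    integral_finsetSum _ fun k _ => hu.integrable_lin ofReal_lt_top ((hf.cc k).dX k.2) k.1
  rw [e hv]
  simp only [e (hw _)]
  exact tendsto_finsetSum _ fun k _ => h.tendsto_lin hw hv ((hf.cc k).dX k.2) k.1

lemma StrongConv.sol (h : StrongConv w v) {C : ℝ} {d : ℕ → E3 → E3}
    (hw : ∀ k, Sol ν (d k) (w k) M C) (hv : BddU v (ofReal M))
    (hd : ∀ ψ, DfTest ψ → Tendsto (fun k => ∫ x, ∑ i, d k x i * ψ x i) atTop
      (nhds (∫ x, ∑ i, u₀ x i * ψ x i))) : Sol ν u₀ v M C := by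
  have hb := fun k => (hw k).bddU
  refine ⟨hv, fun ψ hψ => ?_, fun f hf => ?_, fun φ hφ => ?_⟩
  · have e : ∀ {u : Flow}, BddU u (ofReal M) →
        ∫ p, ∑ i, u p.1 p.2 i * dX i ψ p ∂μST = ∑ i, ∫ p, u p.1 p.2 i * dX i ψ p ∂μST := fun hu =>
      integral_finsetSum _ fun i _ => hu.integrable_lin ofReal_lt_top (hψ.1.dX i) i
    have ht : Tendsto (fun k => ∑ i, ∫ p, w k p.1 p.2 i * dX i ψ p ∂μST) atTop
        (nhds (∑ i, ∫ p, v p.1 p.2 i * dX i ψ p ∂μST)) :=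
      tendsto_finsetSum _ fun i _ => h.tendsto_lin hb hv (hψ.1.dX i) i
    rw [e hv]
    simp only [← e (hb _), (hw _).divFree ψ hψ] at ht
    exact (tendsto_nhds_unique ht tendsto_const_nhds)
  · exact le_of_tendsto (h.gradBd hb hv hf) (.of_forall fun k => (hw k).gradBd f hf)
  · have h1 := h.tendsto_nsI hb hv hφ ν
    simp only [(hw _).weak φ hφ] at h1
    refine tendsto_nhds_unique h1 (hd (fun x => φ (0, x)) ⟨fun i => ?_, fun x => hφ.2.2 (0, x)⟩).neg
    exact (hφ.cc i).slice 0

end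

lemma DfTest.memLp {ψ : E3 → E3} (h : DfTest ψ) : MemLp ψ 2 volume :=
  memLp_euclidean fun i => (h.1 i).memLp

lemma integral_sum_eq_inner {f g : E3 → E3} (hf : MemLp f 2 volume) (hg : MemLp g 2 volume) :
    ∫ x, ∑ i, f x i * g x i = inner ℝ hf.toLp hg.toLp := by
  refine integral_congr_ae ?_
  filter_upwards [hf.coeFn_toLp, hg.coeFn_toLp] with x h1 h2
  rw [h1, h2, inner_eq_sum]

lemma exists_dfTest_seq : ∃ ψ : ℕ → E3 → E3, (∀ j, DfTest (ψ j)) ∧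
    ∀ φ (h : DfTest φ), h.memLp.toLp ∈ closure
      {g : L2E | ∃ j, g =ᵐ[volume] ψ j} := by
  let S : Set (L2E) := {g | ∃ ψ, DfTest ψ ∧ g =ᵐ[volume] ψ}
  obtain ⟨D, hDS, hDc, hd⟩ := (of_separableSpace S).exists_countable_dense_subset
  have h0 : DfTest (fun _ => (0:E3)) := ⟨fun i => by simpa using Cc.zero, fun x => by simp [pd]⟩
  have hSn : S.Nonempty := ⟨h0.memLp.toLp, _, h0, h0.memLp.coeFn_toLp⟩
  have hDn : D.Nonempty := by
    obtain ⟨g, hg⟩ := hSn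
    exact closure_nonempty_iff.1 ⟨g, hd hg⟩
  obtain ⟨e, he⟩ := hDc.exists_eq_range hDn
  have hmem : ∀ j, e j ∈ S := fun j => hDS (he ▸ mem_range_self j)
  choose ψ hψ hae using hmem
  refine ⟨ψ, hψ, fun φ h => ?_⟩
  refine closure_mono ?_ (hd ⟨φ, h, h.memLp.coeFn_toLp⟩)
  rw [he]
  rintro _ ⟨j, rfl⟩
  exact ⟨j, hae j⟩

/-- A countable family of divergence-free test fields, dense in `L²` among all of them. -/
def dfSeq : ℕ → E3 → E3 := exists_dfTest_seq.choose

lemma dfSeq_dfTest (j : ℕ) : DfTest (dfSeq j) := exists_dfTest_seq.choose_spec.1 j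

/-- A bounded family of divergence-free fields converges weakly to zero as soon as it does so when
tested against `dfSeq`. -/
lemma tendsto_weak_zero {ι : Type*} {l : Filter ι} {a : ι → E3 → E3} {B : ℝ}
    (ha : ∀ i, MemLp (a i) 2 volume) (hB : ∀ i, eLpNorm (a i) 2 volume ≤ ofReal B)
    (hB0 : 0 ≤ B) (hd : ∀ i, IsDivFree (a i))
    (h : ∀ j, Tendsto (fun i => ∫ x, ∑ k, a i x k * dfSeq j x k) l (nhds 0))
    {g : E3 → E3} (hg : MemLp g 2 volume) :
    Tendsto (fun i => ∫ x, ∑ k, a i x k * g x k) l (nhds 0) := by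
  let A := fun i => (ha i).toLp
  have hA : ∀ i, ‖A i‖ ≤ B := fun i => by rw [Lp.norm_toLp]; exact toReal_le_of_le_ofReal hB0 (hB i)
  let K : Submodule ℝ (L2E) :=
    { carrier := {g | Tendsto (fun i => inner ℝ (A i) g) l (nhds 0)}
      add_mem' := fun {x y} hx hy => by
        simp only [mem_ofPred_eq, inner_add_right] at *
        simpa using hx.add hy
      zero_mem' := by simpa using tendsto_const_nhds
      smul_mem' := fun c x hx => by
        simp only [mem_ofPred_eq, inner_smul_right] at *
        simpa using hx.const_mul c }
  have hKc : IsClosed (K : Set (L2E)) := by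
    refine isClosed_of_closure_subset fun g hg => ?_
    change Tendsto (fun i => inner ℝ (A i) g) l (nhds 0)
    rw [Metric.tendsto_nhds]
    intro ε hε
    obtain ⟨b, hb, hgb⟩ := Metric.mem_closure_iff.1 hg (ε / (2 * (B + 1))) (by positivity)
    filter_upwards [Metric.tendsto_nhds.1 (show Tendsto (fun i => inner ℝ (A i) b) l (nhds 0) from hb)
      (ε / 2) (by positivity)] with i hi
    rw [dist_zero_right, norm_eq_abs] at hi ⊢
    have e : inner ℝ (A i) g = inner ℝ (A i) b + inner ℝ (A i) (g - b) := by
      rw [← inner_add_right]; congr 1; abel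
    have h2 : |inner ℝ (A i) (g - b)| ≤ B * (ε / (2 * (B + 1))) :=
      (abs_real_inner_le_norm _ _).trans (mul_le_mul (hA i) (by rw [← dist_eq_norm]; exact hgb.le)
        (norm_nonneg _) hB0)
    have h3 : B * (ε / (2 * (B + 1))) ≤ ε / 2 := by
      rw [mul_div_assoc', div_le_div_iff₀ (by positivity) (by positivity)]
      nlinarith
    rw [e]
    exact (abs_add_le _ _).trans_lt (by linarith)
  have hdf : ∀ φ (hφ : DfTest φ), hφ.memLp.toLp ∈ K := by
    intro φ hφ
    refine closure_minimal ?_ hKc (exists_dfTest_seq.choose_spec.2 φ hφ)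
    rintro f ⟨j, hj⟩
    change Tendsto (fun i => inner ℝ (A i) f) l (nhds 0)
    have : f = (dfSeq_dfTest j).memLp.toLp := by
      ext1
      exact hj.trans (dfSeq_dfTest j).memLp.coeFn_toLp.symm
    rw [this]
    simpa only [A, ← integral_sum_eq_inner] using h j
  have hgr : ∀ f (hf : Cc f), (memLp_grad3 hf).toLp ∈ K := by
    intro f hf
    change Tendsto (fun i => inner ℝ (A i) _) l (nhds 0)
    have : ∀ i, inner ℝ (A i) (memLp_grad3 hf).toLp = 0 := fun i => by
      rw [← integral_sum_eq_inner]
      exact hd i f hf.1 hf.2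
    simpa [this] using tendsto_const_nhds
  have hK : K = ⊤ := by
    have h1 : K.topologicalClosure = K := IsClosed.submodule_topologicalClosure_eq hKc
    rw [← h1, Submodule.topologicalClosure_eq_top_iff, Submodule.eq_bot_iff]
    intro w hw
    have hwL := Lp.memLp w
    have e : hwL.toLp = w := by simp
    have h3 := ae_eq_zero_of_dfTest hwL (fun f hf hc => by
      rw [show (∫ x, ∑ i, w x i * pd f i x) = ∫ x, ∑ i, w x i * grad3 f x i from rfl,
        integral_sum_eq_inner hwL (memLp_grad3 ⟨hf, hc⟩), real_inner_comm, e]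
      exact hw _ (hgr f ⟨hf, hc⟩)) (fun φ hφ => by
      rw [integral_sum_eq_inner hwL hφ.memLp, real_inner_comm, e]
      exact hw _ (hdf φ hφ))
    ext1
    filter_upwards [h3, Lp.coeFn_zero E3 2 (volume : Measure E3)] with x hx hz
    rw [hx, hz]; rfl
  have : hg.toLp ∈ K := hK ▸ Submodule.mem_top
  simpa only [A, ← integral_sum_eq_inner] using
    (show Tendsto (fun i => inner ℝ (A i) hg.toLp) l (nhds 0) from this)

/-- The test field `χ(t) ψ(x)`. -/
def tens (χ : ℝ → ℝ) (ψ : E3 → E3) (p : ST) : E3 := χ p.1 • ψ p.2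

lemma isTest_tens {χ : ℝ → ℝ} {ψ : E3 → E3} (hχ : Cc χ) (hψ : DfTest ψ) : IsTest (tens χ ψ) := by
  refine isTest_iff.2 ⟨fun i => by simpa [tens] using hχ.tensor (hψ.1 i), fun p => ?_⟩
  have : ∀ i, dX i (fun q => tens χ ψ q i) p = χ p.1 * pd (fun y => ψ y i) i p.2 := fun i =>
    dX_tensor hχ.differentiable (hψ.1 i).differentiable i p
  simp only [this, ← mul_sum, hψ.2, mul_zero]

lemma Cc.exists_slice_bound (hg : Cc g) :
    ∃ B : ℝ, 0 ≤ B ∧ ∀ t, (eLpNorm (fun x => g (t, x)) 2 volume).toReal ≤ B := by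
  obtain ⟨b, hb0, hb⟩ := hg.bounded
  let K := Prod.snd '' tsupport g
  have hK : IsCompact K := IsCompact.image (show IsCompact (tsupport g) from hg.2) continuous_snd
  have hfin : volume K ≠ ∞ := hK.measure_lt_top.ne
  refine ⟨((volume K) ^ (2:ℝ≥0∞).toReal⁻¹ * ofReal b).toReal, toReal_nonneg, fun t => ?_⟩
  have hne : (volume K) ^ (2:ℝ≥0∞).toReal⁻¹ * ofReal b ≠ ∞ :=
    mul_ne_top (rpow_ne_top_of_nonneg (by simp) hfin) ofReal_ne_top
  refine toReal_mono hne ?_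
  rw [← eLpNorm_restrict_eq_of_support_subset (s := K)]
  · refine (eLpNorm_le_of_ae_bound (C := b) (.of_forall fun x => hb (t, x))).trans ?_
    simp
  · intro x hx
    exact ⟨(t, x), subset_tsupport _ hx, rfl⟩

lemma exists_nsK_bound (hφ : IsTest φ) (ν M : ℝ) (hM : 0 ≤ M) :
    ∃ L : ℝ, 0 ≤ L ∧ ∀ u, BddU u (ofReal M) → ∀ᵐ t ∂μT, |nsK ν φ u t| ≤ L := by
  choose A hA0 hA using fun i => (nsA_cc hφ ν i).exists_slice_bound
  choose B hB0 hB using fun i j => (nsB_cc hφ i j).bounded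
  refine ⟨(∑ i, M * A i) + ∑ i, ∑ j, M * (B i j * M), ?_, fun u hu => ?_⟩
  · have : ∀ i j, 0 ≤ M * (B i j * M) := fun i j => by have := (hB0 i j).le; positivity
    exact add_nonneg (sum_nonneg fun i _ => mul_nonneg hM (hA0 i))
      (sum_nonneg fun i _ => sum_nonneg fun j _ => this i j)
  filter_upwards [hu.slice_memLp ofReal_lt_top, hu.bdd] with t hm hb
  have hmi : ∀ i, MemLp (fun x => u t x i) 2 volume := fun i => MemLp.coord hm i
  have hn : ∀ i, (eLpNorm (fun x => u t x i) 2 volume).toReal ≤ M := fun i =>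
    toReal_le_of_le_ofReal hM ((eLpNorm_mono fun x => norm_apply_le (u t x) i).trans hb)
  have hAc := fun i => ((nsA_cc hφ ν i).slice t).memLp (μ := volume) (p := 2)
  have hBm : ∀ i j, MemLp (fun x => u t x j * nsB φ i j (t, x)) 2 volume ∧
      (eLpNorm (fun x => u t x j * nsB φ i j (t, x)) 2 volume).toReal ≤ B i j * M := fun i j => by
    have hle : ∀ᵐ x, ‖u t x j * nsB φ i j (t, x)‖ ≤ B i j * ‖u t x j‖ := of_forall fun x => by
      rw [norm_mul, mul_comm]
      gcongr
      exact hB i j (t, x)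
    refine ⟨(hmi j).of_le_mul ((hmi j).1.mul
      ((nsB_cc hφ i j).slice t).continuous.aestronglyMeasurable) hle, ?_⟩
    have h1 := eLpNorm_le_mul_eLpNorm_of_ae_le_mul hle 2
    have h2 : eLpNorm (fun x => u t x j) 2 volume ≤ ofReal M :=
      (eLpNorm_mono fun x => norm_apply_le (u t x) j).trans hb
    refine toReal_le_of_le_ofReal (mul_nonneg (hB0 i j).le hM) (h1.trans ?_)
    rw [ofReal_mul (hB0 i j).le]
    gcongr
  have i1 : ∀ i, Integrable (fun x => u t x i * nsA ν φ i (t, x)) := fun i =>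
    MemLp.integrable_mul_fun (hmi i) (hAc i)
  have i2 : ∀ i j, Integrable (fun x => u t x i * u t x j * nsB φ i j (t, x)) := fun i j => by
    simpa only [mul_assoc] using MemLp.integrable_mul_fun (hmi i) (hBm i j).1
  unfold nsK nsI
  rw [integral_add (integrable_finsetSum _ fun i _ => i1 i)
      (integrable_finsetSum _ fun i _ => integrable_finsetSum _ fun j _ => i2 i j),
      integral_finsetSum _ fun i _ => i1 i,
      integral_finsetSum _ fun i _ => integrable_finsetSum _ fun j _ => i2 i j]
  refine (abs_add_le _ _).trans (add_le_add ?_ ?_)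
  · refine (abs_sum_le_sum_abs _ _).trans (sum_le_sum fun i _ => ?_)
    refine (abs_integral_mul_le (hmi i) (hAc i)).trans ?_
    gcongr
    exacts [hn i, hA i t]
  · refine (abs_sum_le_sum_abs _ _).trans (sum_le_sum fun i _ => ?_)
    rw [integral_finsetSum _ fun j _ => i2 i j]
    refine (abs_sum_le_sum_abs _ _).trans (sum_le_sum fun j _ => ?_)
    simp only [mul_assoc]
    refine (abs_integral_mul_le (hmi i) (hBm i j).1).trans ?_
    gcongr
    exacts [hn i, (hBm i j).2]

/-- The continuous representative of `pairT u φ` for a solution with initial pairing `c`. -/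
def hT (ν c : ℝ) (φ : ST → E3) (u : Flow) (t : ℝ) : ℝ :=
  c + ∫ τ in Ioc 0 t, nsK ν φ u τ

lemma Sol.pairT_eq {M C : ℝ} (h : Sol ν u₀ u M C) (hφ : IsTest φ) : ∀ᵐ t ∂μT,
      pairT u φ t = hT ν (∫ x, ∑ i, u₀ x i * φ (0, x) i) φ u t := by
  refine _root_.pairT_eq h.bddU ofReal_lt_top hφ fun θ hθ => ?_
  unfold WeakId
  rw [h.weak _ (hφ.time_mul hθ), ← integral_const_mul]
  congr 2
  funext x
  rw [mul_sum]
  exact sum_congr rfl fun i _ => by simp; ring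

lemma BddU.integrableOn_nsK (h : BddU u M) (hM : M < ∞) (hφ : IsTest φ) (ν : ℝ) : IntegrableOn
    (nsK ν φ u) (Ioi 0) :=
  (h.integrable_nsI hM hφ ν).integral_prod_left

lemma hT_sub_le (h : BddU u M) (hM : M < ∞) (hφ : IsTest φ) {L : ℝ} (hL0 : 0 ≤ L)
    (hL : ∀ᵐ t ∂μT, |nsK ν φ u t| ≤ L) (c s t : ℝ) :
    |hT ν c φ u t - hT ν c φ u s| ≤ L * |t - s| := by
  wlog hst : s ≤ t generalizing s t with H
  · rw [abs_sub_comm, abs_sub_comm t]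
    grind
  have hsub : Ioc 0 s ⊆ Ioc 0 t := by grind
  have hi : IntegrableOn (nsK ν φ u) (Ioc 0 t) :=
    (h.integrableOn_nsK hM hφ ν).mono_set Ioc_subset_Ioi_self
  have e : hT ν c φ u t - hT ν c φ u s = ∫ τ in Ioc 0 t \ Ioc 0 s, nsK ν φ u τ := by
    rw [setIntegral_sdiff measurableSet_Ioc hi hsub]
    unfold hT; ring
  have hss : Ioc 0 t \ Ioc 0 s ⊆ Ioc s t := fun τ hτ => by grind
  have hv : volume (Ioc 0 t \ Ioc 0 s) ≤ ofReal (t - s) := by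
    rw [← Real.volume_Ioc]; exact measure_mono hss
  rw [e, abs_of_nonneg (sub_nonneg.2 hst)]
  refine (norm_setIntegral_le_of_norm_le_const_ae (f := nsK ν φ u) (C := L) (hv.trans_lt ofReal_lt_top)
    (hL.filter_mono (ae_mono (restrict_mono (sdiff_subset.trans Ioc_subset_Ioi_self) le_rfl)))).trans ?_
  gcongr
  exact toReal_le_of_le_ofReal (sub_nonneg.2 hst) hv

lemma integrable_sum_mul {f g : E3 → E3} (hf : MemLp f 2 volume) (hg : MemLp g 2 volume) :
    Integrable (fun x => ∑ i, f x i * g x i) :=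
  integrable_finsetSum _ fun i _ => MemLp.integrable_mul_fun (MemLp.coord hf i) (MemLp.coord hg i)

lemma IsDivFree.sub {w : E3 → E3} (hv : IsDivFree v) (hw : IsDivFree w) (hvm : MemLp v 2 volume)
    (hwm : MemLp w 2 volume) : IsDivFree (fun x => v x - w x) := by
  intro f hf hc
  have hg := memLp_grad3 ⟨hf, hc⟩
  have e : (fun x => ∑ i, (v x - w x) i * pd f i x)
      = fun x => (∑ i, v x i * grad3 f x i) - ∑ i, w x i * grad3 f x i := by
    funext x
    rw [← sum_sub_distrib]
    exact sum_congr rfl fun i _ => by simp [grad3]; ring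
  rw [e, integral_sub (integrable_sum_mul hvm hg) (integrable_sum_mul hwm hg)]
  have h1 : ∫ x, ∑ i, v x i * grad3 f x i = 0 := hv f hf hc
  have h2 : ∫ x, ∑ i, w x i * grad3 f x i = 0 := hw f hf hc
  linarith

lemma cauchySeq_of_equiLipschitz {f : ℕ → ℝ → ℝ} {L : ℝ} (hL : 0 ≤ L)
    (hf : ∀ k s t, |f k t - f k s| ≤ L * |t - s|) (hq : ∀ q : ℚ, CauchySeq fun k => f k q) (t : ℝ) :
    CauchySeq fun k => f k t := by
  rw [Metric.cauchySeq_iff]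
  intro ε hε
  obtain ⟨q, hq1, hq2⟩ := exists_rat_btwn (show t < t + ε / (4 * (L + 1)) by
    have : 0 < ε / (4 * (L + 1)) := by positivity
    linarith)
  obtain ⟨N, hN⟩ := Metric.cauchySeq_iff.1 (hq q) (ε / 2) (by positivity)
  have hL' : ∀ k, |f k t - f k q| ≤ ε / 4 := fun k => by
    refine (hf k q t).trans ?_
    have h1 : |t - q| ≤ ε / (4 * (L + 1)) := by grind
    calc L * |t - q| ≤ (L + 1) * (ε / (4 * (L + 1))) := by gcongr; linarith
      _ = ε / 4 := by field_simp
  refine ⟨N, fun m hm n hn => ?_⟩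
  have h1 := hN m hm n hn
  rw [dist_eq, abs_lt] at *
  have h2 := abs_le.1 (hL' m)
  have h3 := abs_le.1 (hL' n)
  constructor <;> linarith [h2.1, h2.2, h3.1, h3.2, h1.1, h1.2]

lemma exists_time_cutoff (R : ℝ) (hR : 0 ≤ R) :
    ∃ χ : ℝ → ℝ, Cc χ ∧ (∀ t, |t| ≤ R → χ t = 1) ∧ ∀ t, |χ t| ≤ 1 := by
  let b : ContDiffBump (0 : ℝ) := ⟨R + 1, R + 2, by linarith, by linarith⟩
  refine ⟨b, ⟨b.contDiff, b.hasCompactSupport⟩, fun t ht => b.one_of_mem_closedBall ?_, fun t => ?_⟩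
  · simp only [mem_closedBall, dist_zero_right, norm_eq_abs]
    linarith
  · rw [abs_of_nonneg b.nonneg]; exact b.le_one

/-- A time cutoff equal to one on `[-n, n]`. -/
def cutT (n : ℕ) : ℝ → ℝ := (exists_time_cutoff n n.cast_nonneg).choose

lemma cutT_cc (n : ℕ) : Cc (cutT n) := (exists_time_cutoff n n.cast_nonneg).choose_spec.1

lemma cutT_eq_one {n : ℕ} (h : |t| ≤ n) : cutT n t = 1 :=
  (exists_time_cutoff n n.cast_nonneg).choose_spec.2.1 t h

lemma IsTest.dfTest (h : IsTest φ) (t : ℝ) : DfTest (fun x => φ (t, x)) :=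
  ⟨fun i => (h.cc i).slice t, fun x => h.2.2 (t, x)⟩

lemma pairT_tens {n : ℕ} (h : |t| ≤ n) (ψ : E3 → E3) :
    pairT u (tens (cutT n) ψ) t = ∫ x, ∑ i, u t x i * ψ x i := by
  unfold pairT tens
  simp [cutT_eq_one h]

lemma hT_zero : hT ν c φ u 0 = c := by simp [hT]

theorem exists_weakConv {M C : ℝ} {d : ℕ → E3 → E3} {u : ℕ → Flow}
    (h : ∀ k, Sol ν (d k) (u k) M C) (hM : 0 ≤ M)
    (hd : ∀ ψ, DfTest ψ → ∃ l, Tendsto (fun k => ∫ x, ∑ i, d k x i * ψ x i) atTop (nhds l)) :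
    ∃ σ : ℕ → ℕ, StrictMono σ ∧ WeakConv (fun k => u (σ k)) := by
  let φ : ℕ × ℕ → ST → E3 := fun i => tens (cutT i.1) (dfSeq i.2)
  have hφ : ∀ i, IsTest (φ i) := fun i => isTest_tens (cutT_cc _) (dfSeq_dfTest _)
  let c : ℕ → ℕ × ℕ → ℝ := fun k i => ∫ x, ∑ m, d k x m * φ i (0, x) m
  choose L hL0 hL using fun i => exists_nsK_bound (hφ i) ν M hM
  have hcB : ∀ i, ∃ B, ∀ k, |c k i| ≤ B := fun i => by
    obtain ⟨l, hl⟩ := hd _ ((hφ i).dfTest 0)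
    obtain ⟨B, hB⟩ := (Metric.isBounded_range_of_tendsto _ hl).exists_norm_le
    exact ⟨B, fun k => hB _ (mem_range_self k)⟩
  choose B hB using hcB
  let H : ℕ → ℕ × ℕ → ℝ → ℝ := fun k i t => hT ν (c k i) (φ i) (u k) t
  have hlip : ∀ k i s t, |H k i t - H k i s| ≤ L i * |t - s| := fun k i s t =>
    hT_sub_le (h k).bddU ofReal_lt_top (hφ i) (hL0 i) (hL i _ (h k).bddU) _ s t
  obtain ⟨a, -, σ, hσ, ha⟩ := IsCompact.tendsto_subseq
    (isCompact_univ_pi fun i : (ℕ × ℕ) × ℚ => isCompact_Icc (a := -(B i.1 + L i.1 * |(i.2:ℝ)|))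
      (b := B i.1 + L i.1 * |(i.2:ℝ)|)) (x := fun k i => H k i.1 i.2) (fun k => by
      intro i _
      have h1 := hlip k i.1 0 i.2
      have h2 := hB i.1 k
      have h3 : H k i.1 0 = c k i.1 := hT_zero
      rw [h3, sub_zero] at h1
      rw [mem_Icc, ← abs_le]
      calc |H k i.1 i.2| = |c k i.1 + (H k i.1 i.2 - c k i.1)| := by ring_nf
        _ ≤ _ := (abs_add_le _ _).trans (by linarith))
  have hcau : ∀ i t, CauchySeq fun k => H (σ k) i t := fun i t =>
    cauchySeq_of_equiLipschitz (f := fun k t => H (σ k) i t) (hL0 i) (fun k s t => hlip _ i s t)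
      (fun q => (tendsto_pi_nhds.1 ha (i, q)).cauchySeq) t
  refine ⟨σ, hσ, ?_⟩
  filter_upwards [ae_all_iff.2 fun k => ae_all_iff.2 fun i => (h k).pairT_eq (hφ i),
    ae_all_iff.2 fun k => (h k).bddU.bdd, ae_all_iff.2 fun k => (h k).bddU.slice_memLp ofReal_lt_top,
    ae_all_iff.2 fun k => (h k).divFree.slice (h k).bddU ofReal_lt_top] with t hp hb hm hdiv f hf i
  have hc : ∀ j, CauchySeq fun k => ∫ x, ∑ m, u (σ k) t x m * dfSeq j x m := fun j => by
    obtain ⟨n, hn⟩ := exists_nat_ge |t|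
    have := hcau (n, j) t
    simp only [H, c, ← hp] at this
    simpa only [φ, pairT_tens hn] using this
  have hInt : ∀ m n {g : E3 → E3}, MemLp g 2 volume →
      ∫ x, ∑ i, (u (σ m) t x - u (σ n) t x) i * g x i
      = (∫ x, ∑ i, u (σ m) t x i * g x i) - ∫ x, ∑ i, u (σ n) t x i * g x i := fun m n g hg => by
    rw [← integral_sub (integrable_sum_mul (hm _) hg) (integrable_sum_mul (hm _) hg)]
    congr 1; funext x
    rw [← sum_sub_distrib]
    exact sum_congr rfl fun i _ => by simp; ring
  have hg : MemLp (fun x => single i (f x)) 2 (volume : Measure E3) := by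
    refine memLp_euclidean (f := fun x k => (Pi.single i (f x) : Fin 3 → ℝ) k) fun k => ?_
    by_cases hk : k = i
    · subst hk; simpa using hf.memLp
    · simp [hk]
  have key := tendsto_weak_zero (l := (atTop : Filter (ℕ × ℕ))) (B := M + M)
    (a := fun p x => u (σ p.1) t x - u (σ p.2) t x)
    (fun p => (hm _).sub (hm _)) (fun p => by
      refine (eLpNorm_sub_le (hm _).1 (hm _).1 (by norm_num)).trans ?_
      rw [ofReal_add hM hM]
      exact add_le_add (hb _) (hb _)) (by linarith)
    (fun p => (hdiv _).sub (hdiv _) (hm _) (hm _)) (fun j => by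
      have := cauchySeq_iff_tendsto_dist_atTop_0.1 (hc j)
      simp only [hInt _ _ (dfSeq_dfTest j).memLp]
      exact (tendsto_zero_iff_norm_tendsto_zero).2 this) hg
  simp only [hInt _ _ hg] at key
  refine cauchySeq_tendsto_of_complete (cauchySeq_iff_tendsto_dist_atTop_0.2 ?_)
  have := (tendsto_zero_iff_norm_tendsto_zero).1 key
  refine this.congr fun p => ?_
  have e : ∀ v : E3 → E3, ∀ x, ∑ k, v x k * (single i (f x) : E3) k = v x i * f x := by simp
  simp only [e, dist_eq, norm_eq_abs]

lemma aemeasurable_eLpNorm_slice (h : AEStronglyMeasurable (uncurry u) μST) : AEMeasurable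
    (fun t => eLpNorm (u t) s volume) μT := by
  obtain ⟨u', hu', hae⟩ := h
  have h1 : ∀ᵐ t ∂μT, ∀ᵐ x, u t x = u' (t, x) := ae_ae_of_ae_prod hae
  have h2 : Measurable fun t => eLpNorm (fun x => u' (t, x)) s (volume : Measure E3) := by
    rcases eq_or_ne s 0 with rfl | h0
    · simp
    rcases eq_or_ne s ∞ with rfl | h3
    · simp only [eLpNorm_exponent_top]
      refine measurable_of_Iic fun c => ?_
      have : (fun t => eLpNormEssSup (fun x => u' (t, x)) volume) ⁻¹' Iic c
          = {t | (volume : Measure E3) (Prod.mk t ⁻¹' {p | c < ‖u' p‖ₑ}) = 0} := by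
        ext t
        constructor
        · intro hle
          have : ∀ᵐ x, ‖u' (t, x)‖ₑ ≤ c := (ENNReal.ae_le_essSup (fun x => ‖u' (t, x)‖ₑ)).mono fun x hx => hx.trans hle
          simpa [ae_iff] using this
        · intro h0
          refine essSup_le_of_ae_le c ?_
          rw [EventuallyLE, ae_iff]
          simpa using h0
      rw [this]
      exact measurable_measure_prodMk_left (measurableSet_lt measurable_const hu'.enorm)
        (measurableSet_singleton 0)
    · simp only [eLpNorm_eq_lintegral_rpow_enorm_toReal h0 h3]
      fun_prop
  refine ⟨_, h2, ?_⟩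
  filter_upwards [h1] with t ht
  exact eLpNorm_congr_ae ht

lemma mixedNorm_le_of_tendsto {w : ℕ → Flow} {v : Flow} {I : Set ℝ}
    (hr : r ≠ ∞) (hr0 : r ≠ 0) (hI : I ⊆ Ioi 0)
    (hm : ∀ k, AEStronglyMeasurable (uncurry (w k)) μST)
    (hae : ∀ᵐ p ∂μST, Tendsto (fun k => w k p.1 p.2) atTop (nhds (v p.1 p.2)))
    (hN : ∀ k, mixedNorm r s I (w k) ≤ N) : mixedNorm r s I v ≤ N := by
  have hpos : 0 < r.toReal := toReal_pos hr0 hr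
  have hle : volume.restrict I ≤ μT := restrict_mono hI le_rfl
  have e : ∀ u : Flow, mixedNorm r s I u ≤ N ↔
      ∫⁻ t in I, (eLpNorm (u t) s volume) ^ r.toReal ≤ N ^ r.toReal := fun u => by
    rw [mixedNorm, if_neg hr, one_div, rpow_inv_le_iff hpos]
  simp only [e] at hN ⊢
  have h1 : ∀ᵐ t ∂μT, ∀ᵐ x, Tendsto (fun k => w k t x) atTop (nhds (v t x)) := ae_ae_of_ae_prod hae
  have h2 : ∀ᵐ t ∂μT, ∀ k, AEStronglyMeasurable (w k t) volume :=
    ae_all_iff.2 fun k => (hm k).prodMk_left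
  have h3 : ∀ᵐ t ∂(volume.restrict I), (eLpNorm (v t) s volume) ^ r.toReal
      ≤ liminf (fun k => (eLpNorm (w k t) s volume) ^ r.toReal) atTop := by
    refine (ae_mono hle) ?_
    filter_upwards [h1, h2] with t a b
    have h5 := Lp.eLpNorm_lim_le_liminf_eLpNorm (p := s) b _ a
    refine (rpow_le_rpow h5 hpos.le).trans (le_of_eq ?_)
    exact (orderIsoRpow r.toReal hpos).liminf_apply
  refine (lintegral_mono_ae h3).trans ((lintegral_liminf_le' fun k => ?_).trans ?_)
  · exact ((aemeasurable_eLpNorm_slice (hm k)).mono_measure hle).pow_const _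
  · refine (liminf_le_liminf (.of_forall hN)).trans (by simp)

/-- Compactness of the set of solutions. -/
theorem exists_limit_solution {M C : ℝ} {d : ℕ → E3 → E3} {u : ℕ → Flow} {I : Set ℝ} (hr : r ≠ ∞)
    (hr0 : r ≠ 0) (hI : I ⊆ Ioi 0)
    (h : ∀ k, Sol ν (d k) (u k) M C) (hM : 0 ≤ M) (hC : 0 ≤ C)
    (hd : ∀ ψ, DfTest ψ → Tendsto (fun k => ∫ x, ∑ i, d k x i * ψ x i) atTop
      (nhds (∫ x, ∑ i, u₀ x i * ψ x i)))
    (hN : ∀ k, mixedNorm r s I (u k) ≤ N) :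
    ∃ (v : Flow) (σ : ℕ → ℕ), StrictMono σ ∧ Sol ν u₀ v M C ∧ mixedNorm r s I v ≤ N ∧
      StrongConv (fun k => u (σ k)) v := by
  obtain ⟨σ, hσ, hw⟩ := exists_weakConv h hM fun ψ hψ => ⟨_, hd ψ hψ⟩
  obtain ⟨v, τ, hτ, hv, hae, hst⟩ := hw.exists_strong_limit (fun k => (h (σ k)).bddU) hM hC
    (fun k => (h (σ k)).gradBd)
  have hστ := hσ.comp hτ
  refine ⟨v, σ ∘ τ, hστ, ?_, mixedNorm_le_of_tendsto hr hr0 hI (fun k => (h _).bddU.aesm) hae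
    (fun k => hN _), hst⟩
  exact StrongConv.sol (w := fun k => u (σ (τ k))) hst (fun k => h _) hv
    fun ψ hψ => (hd ψ hψ).comp hστ.tendsto_atTop

/-- The space-time scaling `(t, x) ↦ (α t, l x + b)`. -/
def scl (α l : ℝ) (b : E3) (p : ST) : ST := (α * p.1, l • p.2 + b)

section
variable {α l : ℝ}

/-- Scaling as a homeomorphism. -/
def sclH (hα : α ≠ 0) (hl : l ≠ 0) (b : E3) : ST ≃ₜ ST :=
  (mulLeft₀ α hα).prodCongr ((smulOfNeZero l hl).trans (addRight b))

lemma coe_sclH (hα : α ≠ 0) (hl : l ≠ 0) (b : E3) : ⇑(sclH hα hl b) = scl α l b := rfl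

lemma scl_inv (hα : α ≠ 0) (hl : l ≠ 0) (b : E3) (p : ST) :
    scl α⁻¹ l⁻¹ (-(l⁻¹ • b)) (scl α l b p) = p := by
  ext1
  · simp [scl, hα]
  · simp [scl, smul_smul, hl]

lemma measurableEmbedding_scl (hα : α ≠ 0) (hl : l ≠ 0) (b : E3) :
    MeasurableEmbedding (scl α l b) := by
  rw [← coe_sclH hα hl b]; exact (sclH hα hl b).measurableEmbedding

lemma map_mul_restrict_Ioi (hα : 0 < α) :
    (μT).map (α * ·) = ofReal α⁻¹ • volume.restrict (Ioi 0) := by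
  have e : R₊ = (α * ·) ⁻¹' Ioi 0 := by ext x; simp [hα]
  conv_lhs => rw [e]
  rw [← Measure.restrict_map (measurable_const_mul α) measurableSet_Ioi,
    Real.map_volume_mul_left hα.ne', abs_of_pos (inv_pos.2 hα), Measure.restrict_smul]

lemma map_affine (hl : 0 < l) (b : E3) :
    (volume : Measure E3).map (fun x => l • x + b) = ofReal (l ^ 3)⁻¹ • volume := by
  have e : (fun x : E3 => l • x + b) = (· + b) ∘ (l • ·) := rfl
  rw [e, ← Measure.map_map (measurable_add_const b) (measurable_const_smul l),
    Measure.map_addHaar_smul _ hl.ne', Measure.map_smul, map_add_right_eq_self]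
  simp [abs_of_pos hl]

lemma map_scl (hα : 0 < α) (hl : 0 < l) (b : E3) :
    μST.map (scl α l b) = ofReal (α⁻¹ * (l ^ 3)⁻¹) • μST := by
  have e : scl α l b = Prod.map (α * ·) (fun x => l • x + b) := rfl
  rw [e, μST, ← Measure.map_prod_map _ _ (measurable_const_mul α)
    ((measurable_const_smul l).add_const b), map_mul_restrict_Ioi hα, map_affine hl,
    Measure.prod_smul_left, Measure.prod_smul_right, smul_smul,
    ← ofReal_mul (by positivity)]

lemma integral_scl (hα : 0 < α) (hl : 0 < l) (b : E3) (f : ST → ℝ) :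
    ∫ p, f (scl α l b p) ∂μST = α⁻¹ * (l ^ 3)⁻¹ * ∫ p, f p ∂μST := by
  rw [← (measurableEmbedding_scl hα.ne' hl.ne' b).integral_map, map_scl hα hl,
    integral_smul_measure, toReal_ofReal (by positivity), smul_eq_mul]

lemma eLpNorm_scl {F : Type*} [NormedAddCommGroup F] (hα : 0 < α) (hl : 0 < l) (b : E3)
    (f : ST → F) :
    (eLpNorm (fun p => f (scl α l b p)) 2 μST).toReal
      = √(α⁻¹ * (l ^ 3)⁻¹) * (eLpNorm f 2 μST).toReal := by
  have h := (measurableEmbedding_scl hα.ne' hl.ne' b).eLpNorm_map_measure (p := 2) (μ := μST) (g := f)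
  rw [map_scl hα hl, eLpNorm_smul_measure_of_ne_top (by norm_num)] at h
  have h' : eLpNorm (fun p => f (scl α l b p)) 2 μST = _ := h.symm
  rw [h', smul_eq_mul, toReal_mul, ← toReal_rpow, toReal_ofReal (by positivity), sqrt_eq_rpow]
  simp

lemma integral_affine (hl : 0 < l) (b : E3) (f : E3 → ℝ) :
    ∫ x, f (l • x + b) = (l ^ 3)⁻¹ * ∫ x, f x := by
  have e : MeasurableEmbedding fun x : E3 => l • x + b :=
    ((smulOfNeZero l hl.ne').trans (addRight b)).measurableEmbedding
  rw [← e.integral_map, map_affine hl, integral_smul_measure, toReal_ofReal (by positivity),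
    smul_eq_mul]

lemma eLpNorm_affine {F : Type*} [NormedAddCommGroup F] (hl : 0 < l) (b : E3) (f : E3 → F) :
    eLpNorm (fun x => f (l • x + b)) s volume
      = ofReal ((l ^ 3)⁻¹ ^ (1 / s).toReal) * eLpNorm f s volume := by
  have e : MeasurableEmbedding fun x : E3 => l • x + b :=
    ((smulOfNeZero l hl.ne').trans (addRight b)).measurableEmbedding
  have h := e.eLpNorm_map_measure (p := s) (μ := volume) (g := f)
  rw [map_affine hl, eLpNorm_smul_measure_of_ne_zero (by simpa using pow_pos hl 3)] at h
  rw [← ofReal_rpow_of_nonneg (by positivity) (by positivity)]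
  exact h.symm

lemma contDiff_scl (α l : ℝ) (b : E3) {n : WithTop ℕ∞} : ContDiff ℝ n (scl α l b) :=
  (contDiff_const.mul contDiff_fst).prodMk ((contDiff_snd.const_smul l).add contDiff_const)

lemma hasFDerivAt_scl (α l : ℝ) (b : E3) (p : ST) :
    HasFDerivAt (scl α l b) ((α • ContinuousLinearMap.fst ℝ ℝ E3).prod
      (l • ContinuousLinearMap.snd ℝ ℝ E3)) p :=
  (hasFDerivAt_fst.const_mul α).prodMk ((hasFDerivAt_snd.const_smul l).add_const b)

lemma dX_scl (hf : Differentiable ℝ f) (b : E3) (j : Fin 3) (p : ST) :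
    dX j (fun q => f (scl α l b q)) p = l * dX j f (scl α l b p) := by
  have h : fderiv ℝ (fun q => f (scl α l b q)) p = _ :=
    ((hf _).hasFDerivAt.comp p (hasFDerivAt_scl α l b p)).fderiv
  have e : (α * (0:ℝ), l • e3 j) = l • ((0:ℝ), e3 j) := by simp
  simp only [dX, h, comp_apply, ContinuousLinearMap.prod_apply, smul_apply, coe_fst', coe_snd',
    smul_eq_mul, e, map_smul]

lemma dT_scl (hf : Differentiable ℝ f) (b : E3) (p : ST) :
    dT (fun q => f (scl α l b q)) p = α * dT f (scl α l b p) := by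
  have h : fderiv ℝ (fun q => f (scl α l b q)) p = _ :=
    ((hf _).hasFDerivAt.comp p (hasFDerivAt_scl α l b p)).fderiv
  have e : (α * (1:ℝ), l • (0:E3)) = α • ((1:ℝ), (0:E3)) := by simp
  simp only [dT, h, comp_apply, ContinuousLinearMap.prod_apply, smul_apply, coe_fst', coe_snd',
    smul_eq_mul, e, map_smul]

lemma Cc.scl (hf : Cc f) (hα : α ≠ 0) (hl : l ≠ 0) (b : E3) : Cc (fun p => f (scl α l b p)) :=
  hf.comp (sclH hα hl b) (contDiff_scl α l b)

lemma Spt.scl (hf : Spt f) (hα : 0 < α) (hl : l ≠ 0) (b : E3) : Spt (fun p => f (scl α l b p)) := by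
  refine ⟨hf.1.scl hα.ne' hl b, fun p hp => ?_⟩
  have h : p ∈ _root_.scl α l b ⁻¹' tsupport f :=
    tsupport_comp_subset_preimage f (contDiff_scl α l b (n := 0)).continuous hp
  have : 0 < α * p.1 := hf.2 h
  exact pos_of_mul_pos_right this hα.le

lemma IsTest.scl (hφ : IsTest φ) (hα : α ≠ 0) (hl : l ≠ 0) (b : E3) :
    IsTest (fun p => φ (scl α l b p)) := by
  refine isTest_iff.2 ⟨fun i => (hφ.cc i).scl hα hl b, fun p => ?_⟩
  simp only [fun i => dX_scl (α := α) (l := l) (hφ.cc i).differentiable b i p, ← mul_sum,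
    (isTest_iff.1 hφ).2, mul_zero]

/-- Rescaled field. -/
def rsc (a l : ℝ) (b : E3) (u : Flow) : Flow :=
  fun t x => a • u (a * l * t) (l • x + b)

lemma nsI_rsc {a : ℝ} (hl : l ≠ 0) (hφ : IsTest φ) (b : E3) (u : Flow) (p : ST) :
    nsI (ν * a / l) (fun q => φ (scl (a * l) l b q)) (rsc a l b u) p
      = a ^ 2 * l * nsI ν φ u (scl (a * l) l b p) := by
  have h1 : ∀ i j, dX j (fun q => φ (scl (a * l) l b q) i) p
      = l * dX j (fun q => φ q i) (scl (a * l) l b p) := fun i j =>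
    dX_scl (hφ.cc i).differentiable b j p
  have h2 : ∀ i j, dX j (dX j fun q => φ (scl (a * l) l b q) i) p
      = l ^ 2 * dX j (dX j fun q => φ q i) (scl (a * l) l b p) := fun i j => by
    have e : (dX j fun q => φ (scl (a * l) l b q) i)
        = fun q => l * dX j (fun q => φ q i) (scl (a * l) l b q) := by
      funext q; exact dX_scl (hφ.cc i).differentiable b j q
    rw [e, dX_scl (f := fun q => l * dX j (fun q => φ q i) q)
      (((hφ.cc i).dX j).const_mul l).differentiable b j p]
    have e' : dX j (fun q => l * dX j (fun q => φ q i) q) (scl (a * l) l b p)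
        = l * dX j (dX j fun q => φ q i) (scl (a * l) l b p) := by
      have : fderiv ℝ (fun q => l * dX j (fun q => φ q i) q) (scl (a * l) l b p) = _ :=
        fderiv_const_mul (((hφ.cc i).dX j).differentiable _) l
      rw [dX, this]; rfl
    rw [e']; ring
  have h3 : ∀ i, dT (fun q => φ (scl (a * l) l b q) i) p
      = a * l * dT (fun q => φ q i) (scl (a * l) l b p) := fun i =>
    dT_scl (hφ.cc i).differentiable b p
  have h4 : ∀ i, rsc a l b u p.1 p.2 i
      = a * u (scl (a * l) l b p).1 (scl (a * l) l b p).2 i := fun i => rfl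
  simp only [nsI, nsA, nsB, h1, h2, h3, h4, mul_add, mul_sum]
  congr 1
  · grind
  · grind

end

lemma uncurry_rsc (a l : ℝ) (b : E3) (u : Flow) :
    uncurry (rsc a l b u) = fun p => a • uncurry u (scl (a * l) l b p) := rfl

lemma quasiMeasurePreserving_mul {α : ℝ} (hα : 0 < α) : Measure.QuasiMeasurePreserving (α * ·) μT
      μT :=
  ⟨measurable_const_mul α, by rw [map_mul_restrict_Ioi hα]; exact Measure.smul_absolutelyContinuous⟩

lemma quasiMeasurePreserving_scl {α l : ℝ} (hα : 0 < α) (hl : 0 < l) (b : E3) :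
    Measure.QuasiMeasurePreserving (scl α l b) μST μST :=
  ⟨(contDiff_scl α l b (n := 0)).continuous.measurable, by
    rw [map_scl hα hl]; exact Measure.smul_absolutelyContinuous⟩

/-- The scaling symmetry of the Navier–Stokes equations. -/
lemma Sol.rescale {M C : ℝ} (h : Sol ν u₀ u M C)
    {a l : ℝ} (ha : 0 < a) (hl : 0 < l) (b : E3) :
    Sol (ν * a / l) (fun x => a • u₀ (l • x + b)) (rsc a l b u)
      (a * √(l ^ 3)⁻¹ * M) (√a * l⁻¹ * C) := by
  have hα : 0 < a * l := mul_pos ha hl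
  refine ⟨⟨?_, ?_⟩, ?_, ?_, ?_⟩
  · exact (h.bddU.aesm.comp_quasiMeasurePreserving (quasiMeasurePreserving_scl hα hl b)).const_smul a
  · filter_upwards [(quasiMeasurePreserving_mul hα).ae h.bddU.bdd] with t ht
    have e : rsc a l b u t = a • fun x => u (a * l * t) (l • x + b) := rfl
    rw [e, eLpNorm_const_smul, eLpNorm_affine hl b, ofReal_mul (by positivity),
      ofReal_mul ha.le, sqrt_eq_rpow, Real.enorm_of_nonneg ha.le, mul_assoc]
    have : ((1:ℝ≥0∞) / 2).toReal = 1 / 2 := by simp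
    rw [this, ← mul_assoc a l t, mul_assoc (ofReal a)]
    exact mul_le_mul_right (mul_le_mul_right ht _) _
  · intro ψ hψ
    have hψ' := hψ.scl (inv_pos.2 hα) (inv_ne_zero hl.ne') (-(l⁻¹ • b))
    have := h.divFree _ hψ'
    let F : ST → ℝ := fun q => ∑ i, u q.1 q.2 i *
        dX i (fun p => ψ (scl (a * l)⁻¹ l⁻¹ (-(l⁻¹ • b)) p)) q
    have e : ∀ p, ∑ i, rsc a l b u p.1 p.2 i * dX i ψ p = a * l * F (scl (a * l) l b p) := fun p => by
      simp only [F, mul_sum, dX_scl hψ.1.differentiable, scl_inv hα.ne' hl.ne']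
      simp only [rsc, scl, PiLp.smul_apply, smul_eq_mul]
      field_simp
    simp only [e]
    rw [integral_const_mul, integral_scl hα hl b F]
    simp only [F, this, mul_zero]
  · intro f hf
    have hf' : SptM fun p => f (scl (a * l)⁻¹ l⁻¹ (-(l⁻¹ • b)) p) := fun k =>
      (hf k).scl (inv_pos.2 hα) (inv_ne_zero hl.ne') (-(l⁻¹ • b))
    have := h.gradBd _ hf'
    have e : gp (rsc a l b u) f = (l ^ 3)⁻¹ *
        gp u fun p => f (scl (a * l)⁻¹ l⁻¹ (-(l⁻¹ • b)) p) := by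
      unfold gp
      let F : ST → ℝ := fun q => ∑ k : Fin 3 × Fin 3, u q.1 q.2 k.1 *
          dX k.2 (fun p => f (scl (a * l)⁻¹ l⁻¹ (-(l⁻¹ • b)) p) k) q
      have e : ∀ p, ∑ k : Fin 3 × Fin 3, rsc a l b u p.1 p.2 k.1 * dX k.2 (fun q => f q k) p
          = a * l * F (scl (a * l) l b p) := fun p => by
        simp only [F, mul_sum, dX_scl (hf.cc _).differentiable, scl_inv hα.ne' hl.ne']
        simp only [rsc, scl, PiLp.smul_apply, smul_eq_mul]
        field_simp
      simp only [e]
      rw [integral_const_mul, integral_scl hα hl b F]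
      generalize ∫ p, F p ∂μST = z
      field_simp
    rw [e]
    rw [eLpNorm_scl (inv_pos.2 hα) (inv_pos.2 hl)] at this
    have h2 : (l ^ 3)⁻¹ * √((a * l)⁻¹⁻¹ * (l⁻¹ ^ 3)⁻¹) = √a * l⁻¹ := by
      have : (a * l)⁻¹⁻¹ * (l⁻¹ ^ 3)⁻¹ = a * (l ^ 2) ^ 2 := by field_simp
      rw [this, sqrt_mul ha.le, sqrt_sq (by positivity)]
      field_simp
    calc _ ≤ (l ^ 3)⁻¹ * (C * (√((a * l)⁻¹⁻¹ * (l⁻¹ ^ 3)⁻¹) * (eLpNorm f 2 μST).toReal)) := by gcongr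
      _ = (l ^ 3)⁻¹ * √((a * l)⁻¹⁻¹ * (l⁻¹ ^ 3)⁻¹) * C * (eLpNorm f 2 μST).toReal := by ring
      _ = _ := by rw [h2]
  · intro φ hφ
    have hφ' := hφ.scl (inv_ne_zero hα.ne') (inv_ne_zero hl.ne') (-(l⁻¹ • b))
    have h1 := h.weak _ hφ'
    have e : φ = fun q => (fun p => φ (scl (a * l)⁻¹ l⁻¹ (-(l⁻¹ • b)) p)) (scl (a * l) l b q) := by
      funext q; simp only [scl_inv hα.ne' hl.ne']
    let F : E3 → ℝ := fun y => ∑ i, u₀ y i * φ (scl (a * l)⁻¹ l⁻¹ (-(l⁻¹ • b)) (0, y)) i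
    have e2 : ∀ x : E3, ∑ i, (a • u₀ (l • x + b)) i * φ (0, x) i = a * F (l • x + b) := fun x => by
      have : scl (a * l)⁻¹ l⁻¹ (-(l⁻¹ • b)) (0, l • x + b) = (0, x) := by
        simpa [scl] using scl_inv hα.ne' hl.ne' b (0, x)
      simp only [F, mul_sum, this, PiLp.smul_apply, smul_eq_mul, mul_assoc]
    simp only [e2]
    rw [integral_const_mul, integral_affine hl b F]
    conv_lhs => rw [e]
    simp only [nsI_rsc hl.ne' hφ']
    rw [integral_const_mul, integral_scl hα hl b (nsI ν _ u), h1]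
    generalize ∫ p, F p = z
    field_simp

lemma mixedNorm_rsc (hr : r ≠ ∞) (hr0 : r ≠ 0) {a l : ℝ} (ha : 0 < a)
    (hl : 0 < l) (b : E3) (u : Flow) :
    mixedNorm r s (Ioi 0) (rsc a l b u)
      = ofReal (a * (l ^ 3)⁻¹ ^ (1 / s).toReal * (a * l)⁻¹ ^ (1 / r).toReal) *
        mixedNorm r s (Ioi 0) u := by
  have hα : 0 < a * l := mul_pos ha hl
  have hr' : 0 < r.toReal := toReal_pos hr0 hr
  let F : ℝ → ℝ≥0∞ := fun t => eLpNorm (u t) s volume ^ r.toReal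
  have e : ∀ t, eLpNorm (rsc a l b u t) s volume ^ r.toReal
      = ofReal (a * (l ^ 3)⁻¹ ^ (1 / s).toReal) ^ r.toReal * F (a * l * t) := fun t => by
    have e : rsc a l b u t = a • fun x => u (a * l * t) (l • x + b) := rfl
    rw [e, eLpNorm_const_smul, eLpNorm_affine hl b, ofReal_mul ha.le, ← mul_assoc,
      mul_rpow_of_nonneg _ _ hr'.le, Real.enorm_of_nonneg ha.le]
  have hemb : MeasurableEmbedding (fun t : ℝ => a * l * t) :=
    (mulLeft₀ _ hα.ne').measurableEmbedding
  simp only [mixedNorm, if_neg hr, e]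
  rw [lintegral_const_mul' _ _ (by simp [hr'.le]), ← hemb.lintegral_map F, map_mul_restrict_Ioi hα,
    lintegral_smul_measure, smul_eq_mul, mul_rpow_of_nonneg _ _ (by positivity),
    mul_rpow_of_nonneg _ _ (by positivity), ← rpow_mul,
    mul_one_div_cancel hr'.ne', rpow_one, ofReal_rpow_of_nonneg (by positivity)
    (by positivity), ← mul_assoc, ← ofReal_mul (by positivity)]
  simp [toReal_inv, F]

/-- Existence of a weak solution with datum `v` obeying prescribed bounds. -/
def Good (ν : ℝ) (r s : ℝ≥0∞) (I : Set ℝ) (M C : ℝ) (N : ℝ≥0∞) (v : E3 → E3) : Prop :=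
  ∃ u, Sol ν v u M C ∧ mixedNorm r s I u ≤ N

lemma Sol.congr_data {M C : ℝ} {u₁ : E3 → E3} (h : Sol ν u₀ u M C)
    (he : ∀ ψ, DfTest ψ → ∫ x, ∑ i, u₀ x i * ψ x i = ∫ x, ∑ i, u₁ x i * ψ x i) :
    Sol ν u₁ u M C :=
  ⟨h.bddU, h.divFree, h.gradBd, fun φ hφ => by rw [h.weak φ hφ, he _ (hφ.dfTest 0)]⟩

lemma Sol.translate {M C : ℝ} (h : Sol ν u₀ u M C) (b : E3) :
    Sol ν (fun x => u₀ (x + b)) (fun t x => u t (x + b)) M C := by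
  have := h.rescale one_pos one_pos b
  have e : rsc 1 1 b u = fun t x => u t (x + b) := by funext t x; simp [rsc]
  simpa [e] using this

lemma mixedNorm_translate (r s : ℝ≥0∞) (I : Set ℝ) (u : Flow) (b : E3) :
    mixedNorm r s I (fun t x => u t (x + b)) = mixedNorm r s I u := by
  have e : ∀ t, eLpNorm (fun x => u t (x + b)) s volume = eLpNorm (u t) s volume := fun t => by
    simpa using eLpNorm_affine one_pos b (u t) (s := s)
  simp only [mixedNorm, e]

lemma Sol.mono {M C M' C' : ℝ} (h : Sol ν u₀ u M C)
    (hM : M ≤ M') (hC : C ≤ C') : Sol ν u₀ u M' C' :=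
  ⟨⟨h.bddU.aesm, h.bddU.bdd.mono fun _ ht => ht.trans (ofReal_le_ofReal hM)⟩, h.divFree,
    fun f hf => (h.gradBd f hf).trans (mul_le_mul_of_nonneg_right hC toReal_nonneg), h.weak⟩

lemma mixedNorm_mono {I J : Set ℝ} (hr : r ≠ ∞) (h : I ⊆ J) (u : Flow) :
    mixedNorm r s I u ≤ mixedNorm r s J u := by
  simp only [mixedNorm, if_neg hr]
  gcongr

lemma IsDivFree.add {w : E3 → E3} (hv : IsDivFree v) (hw : IsDivFree w) (hvm : MemLp v 2 volume)
    (hwm : MemLp w 2 volume) : IsDivFree (fun x => v x + w x) := by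
  have h0 : IsDivFree (fun _ => (0:E3)) := fun f _ _ => by simp
  have h1 : IsDivFree (fun x => -w x) := by simpa using h0.sub hw MemLp.zero' hwm
  simpa using hv.sub h1 hvm hwm.neg

lemma IsDivFree.translate (hv : IsDivFree v) (b : E3) : IsDivFree (fun x => v (x + b)) := by
  intro f hf hc
  have hf' : Cc f := ⟨hf, hc⟩
  have h1 : Cc fun x => f (x + -b) := by simpa using hf'.comp_affine one_ne_zero (-b)
  have h2 : ∀ i x, pd (fun x => f (x + -b)) i x = pd f i (x + -b) := fun i x => by
    simpa using pd_comp_affine hf'.differentiable 1 (-b) i x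
  have h3 := hv _ h1.1 h1.2
  rw [← integral_add_right_eq_self _ b] at h3
  simpa [h2] using h3

lemma toReal_eLpNorm_two {X : Type*} [MeasurableSpace X] {μ : Measure X} {f : X → ℝ}
    (hf : MemLp f 2 μ) : (eLpNorm f 2 μ).toReal = √(∫ x, f x ^ 2 ∂μ) := by
  rw [MemLp.eLpNorm_eq_integral_rpow_norm (by norm_num) (by norm_num) hf,
    toReal_ofReal (by positivity), sqrt_eq_rpow]
  simp

lemma tendsto_translate_zero_scalar {e : E3} (he : ‖e‖ = 1) {w g : E3 → ℝ} (hw : MemLp w 2 volume)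
    (hg : Cc g) :
    Tendsto (fun k : ℕ => ∫ x, w (x + (k : ℝ) • e) * g x) atTop (nhds 0) := by
  obtain ⟨R, hR⟩ := hg.2.isCompact.isBounded.subset_closedBall (0 : E3)
  let S : ℕ → Set E3 := fun k => closedBall ((k:ℝ) • e) R
  have hS : ∀ k, MeasurableSet (S k) := fun k => Metric.isClosed_closedBall.measurableSet
  have h1 : ∀ k : ℕ, ∫ x, w (x + (k : ℝ) • e) * g x
      = ∫ x, (S k).indicator w x * g (x + -((k : ℝ) • e)) := fun k => by
    rw [← integral_add_right_eq_self (fun x => (S k).indicator w x * _) ((k:ℝ) • e)]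
    refine integral_congr_ae (.of_forall fun x => ?_)
    simp only [add_neg_cancel_right]
    by_cases hx : x ∈ closedBall (0:E3) R
    · rw [indicator_of_mem]
      simpa [S, dist_eq_norm] using hx
    · rw [image_eq_zero_of_notMem_tsupport fun h => hx (hR h)]; simp
  have hsq : ∀ k : ℕ, (eLpNorm ((S k).indicator w) 2 volume).toReal
      = √(∫ x, (S k).indicator (fun x => w x ^ 2) x) := fun k => by
    rw [toReal_eLpNorm_two (hw.indicator (hS k))]
    congr 2
    funext x
    by_cases hx : x ∈ S k <;> simp [hx]
  have h2 : ∀ k : ℕ, |∫ x, w (x + (k : ℝ) • e) * g x|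
      ≤ √(∫ x, (S k).indicator (fun x => w x ^ 2) x) * (eLpNorm g 2 volume).toReal := fun k => by
    rw [h1]
    have hg' : MemLp (fun x => g (x + -((k : ℝ) • e))) 2 volume := by
      have : Cc fun x => g (x + -((k : ℝ) • e)) := by
        simpa using hg.comp_affine one_ne_zero (-((k : ℝ) • e))
      exact this.memLp
    refine (abs_integral_mul_le (hw.indicator (hS k)) hg').trans_eq ?_
    rw [eLpNorm_shift hg.continuous.aestronglyMeasurable]
    congr 1
    exact hsq k
  have h3 : Tendsto (fun k => ∫ x, (S k).indicator (fun x => w x ^ 2) x) atTop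
      (nhds (∫ _ : E3, (0:ℝ))) := by
    refine tendsto_integral_of_dominated_convergence (fun x => w x ^ 2)
      (fun k => ((hw.1.pow 2).indicator (hS k))) hw.integrable_sq
      (fun k => .of_forall fun x => ?_) (.of_forall fun x => ?_)
    · by_cases hx : x ∈ S k <;> simp [hx, sq_nonneg]
    · refine tendsto_const_nhds.congr' ?_
      obtain ⟨n, hn⟩ := exists_nat_gt (R + ‖x‖)
      filter_upwards [eventually_ge_atTop n] with k hk
      rw [indicator_of_notMem]
      intro hx
      have h4 : ‖x - (k:ℝ) • e‖ ≤ R := by simpa [S, dist_eq_norm] using hx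
      have h5 : ‖(k:ℝ) • e‖ ≤ ‖x‖ + ‖x - (k:ℝ) • e‖ := by
        have := norm_sub_le x (x - (k:ℝ) • e)
        rwa [_root_.sub_sub_cancel] at this
      rw [norm_smul, he, mul_one, Real.norm_natCast] at h5
      have : (n:ℝ) ≤ k := by exact_mod_cast hk
      linarith
  refine squeeze_zero_norm h2 ?_
  have h4 := (h3.sqrt).mul_const (eLpNorm g 2 volume).toReal
  simpa using h4

lemma tendsto_translate_zero {e : E3} (he : ‖e‖ = 1) {w ψ : E3 → E3} (hw : MemLp w 2 volume)
    (hψ : ∀ i, Cc fun x => ψ x i) :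
    Tendsto (fun k : ℕ => ∫ x, ∑ i, w (x + (k : ℝ) • e) i * ψ x i) atTop (nhds 0) := by
  have h : ∀ k : ℕ, ∫ x, ∑ i, w (x + (k : ℝ) • e) i * ψ x i
      = ∑ i, ∫ x, w (x + (k : ℝ) • e) i * ψ x i := fun k => by
    refine integral_finsetSum _ fun i _ => MemLp.integrable_mul_fun ?_ (hψ i).memLp
    exact MemLp.coord (hw.comp_measurePreserving (measurePreserving_add_right volume _)) i
  simp only [h]
  have := tendsto_finsetSum Finset.univ fun i (_ : i ∈ Finset.univ) =>
    tendsto_translate_zero_scalar he (MemLp.coord hw i) (hψ i)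
  simpa using this

lemma Good.limit {M C : ℝ} {I : Set ℝ} (hr : r ≠ ∞) (hr0 : r ≠ 0)
    (hI : I ⊆ Ioi 0) (hM : 0 ≤ M) (hC : 0 ≤ C) {d : ℕ → E3 → E3}
    (h : ∀ k, Good ν r s I M C N (d k))
    (hd : ∀ ψ, DfTest ψ → Tendsto (fun k => ∫ x, ∑ i, d k x i * ψ x i) atTop
      (nhds (∫ x, ∑ i, v x i * ψ x i))) : Good ν r s I M C N v := by
  choose u hu hN using h
  obtain ⟨w, σ, -, hw, hwN, -⟩ := exists_limit_solution hr hr0 hI hu hM hC hd hN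
  exact ⟨w, hw, hwN⟩

lemma Good.congr {M C : ℝ} {I : Set ℝ} {w : E3 → E3}
    (h : Good ν r s I M C N v) (he : v =ᵐ[volume] w) : Good ν r s I M C N w := by
  obtain ⟨u, hu, hN⟩ := h
  refine ⟨u, hu.congr_data fun ψ _ => integral_congr_ae ?_, hN⟩
  filter_upwards [he] with x hx
  rw [hx]

lemma Good.translate {M C : ℝ} {I : Set ℝ}
    (h : Good ν r s I M C N v) (b : E3) : Good ν r s I M C N (fun x => v (x + b)) := by
  obtain ⟨u, hu, hN⟩ := h
  exact ⟨_, hu.translate b, by rwa [mixedNorm_translate]⟩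

lemma tendsto_pairing {v : ℕ → L2E} {w : L2E}
    (h : Tendsto v atTop (nhds w)) {ψ : E3 → E3} (hψ : MemLp ψ 2 volume) :
    Tendsto (fun k => ∫ x, ∑ i, v k x i * ψ x i) atTop (nhds (∫ x, ∑ i, w x i * ψ x i)) := by
  have e : ∀ v : L2E, ∫ x, ∑ i, v x i * ψ x i = inner ℝ v hψ.toLp := fun v => by
      rw [integral_sum_eq_inner (Lp.memLp v) hψ, Lp.toLp_coeFn]
  simp only [e]
  exact h.inner tendsto_const_nhds

lemma isClosed_L2σ : IsClosed L2σ := by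
  refine IsSeqClosed.isClosed fun v w hv h f hf hc => ?_
  have := tendsto_pairing h (memLp_grad3 ⟨hf, hc⟩)
  refine tendsto_nhds_unique this (tendsto_const_nhds.congr fun k => ?_)
  exact (hv k f hf hc).symm

lemma IsDivFree.congr {w : E3 → E3} (hv : IsDivFree v) (h : v =ᵐ[volume] w) : IsDivFree w := by
  intro f hf hc
  rw [← hv f hf hc]
  refine integral_congr_ae ?_
  filter_upwards [h] with x hx
  rw [hx]

/-- Uniform bounds on a ball from a non-meagre set of data. -/
theorem exists_ball_good (hr : r ≠ ∞) (hr0 : r ≠ 0) {S : Set L2σ}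
    (hS : ¬ IsMeagre S) {I : ℕ → Set ℝ} (hI : ∀ n, I n ⊆ Ioi 0)
    (h : ∀ v ∈ S, ∃ n : ℕ, Good ν r s (I n) n n n ((v : L2E) : E3 → E3)) :
    ∃ n : ℕ, ∃ ε : ℝ, 0 < ε ∧ ∀ v : E3 → E3, MemLp v 2 volume → IsDivFree v →
      eLpNorm v 2 volume ≤ ofReal ε → Good ν r s (I n) n n n v := by
  let F : ℕ → Set L2σ := fun n =>
    {v | Good ν r s (I n) n n n ((v : L2E) : E3 → E3)}
  have hF : ∀ n, IsClosed (F n) := fun n => IsSeqClosed.isClosed fun v w hv hvw =>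
    Good.limit hr hr0 (hI n) n.cast_nonneg n.cast_nonneg hv fun ψ hψ =>
      tendsto_pairing ((continuous_subtype_val.tendsto w).comp hvw) hψ.memLp
  obtain ⟨n, hn⟩ : ∃ n, (interior (F n)).Nonempty := by
    by_contra! hc
    refine hS ((isMeagre_iUnion fun n => ?_).mono (s := ⋃ n, F n) fun v hv => mem_iUnion.2 (h v hv))
    exact ((hF n).isNowhereDense_iff.2 (hc n)).isMeagre
  obtain ⟨w, hw⟩ := hn
  obtain ⟨ε, hε, hball⟩ := Metric.isOpen_iff.1 isOpen_interior w hw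
  refine ⟨n, ε / 2, by positivity, fun v hv hdiv hnorm => ?_⟩
  let b : ℕ → E3 := fun k => (k:ℝ) • e3 0
  have hvb : ∀ k, MemLp (fun x => v (x + -b k)) 2 volume := fun k =>
    hv.comp_measurePreserving (measurePreserving_add_right volume (-b k))
  let W : L2E := w
  have hWm : MemLp W 2 volume := Lp.memLp W
  have hd : ∀ k, MemLp (fun x => W x + v (x + -b k)) 2 volume := fun k => hWm.add (hvb k)
  have hdd : ∀ k, IsDivFree (fun x => W x + v (x + -b k)) := fun k =>
    IsDivFree.add w.2 (hdiv.translate _) hWm (hvb k)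
  have hg : ∀ k, Good ν r s (I n) n n n (fun x => W (x + b k) + v x) := fun k => by
    let D : L2σ := ⟨(hd k).toLp, (hdd k).congr (hd k).coeFn_toLp.symm⟩
    have hD : D ∈ F n := by
      refine interior_subset (hball ?_)
      rw [mem_ball, Subtype.dist_eq, dist_eq_norm]
      have e : (hd k).toLp - W = (hvb k).toLp := by
        have : (hd k).toLp = hWm.toLp + (hvb k).toLp := rfl
        rw [this, Lp.toLp_coeFn, add_sub_cancel_left]
      rw [e, Lp.norm_toLp, eLpNorm_shift hv.1]
      exact (toReal_le_of_le_ofReal (by positivity) hnorm).trans_lt (by linarith)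
    have := (Good.congr hD (hd k).coeFn_toLp).translate (b k)
    simpa using this
  refine Good.limit hr hr0 (hI n) n.cast_nonneg n.cast_nonneg hg fun ψ hψ => ?_
  have h1 := (tendsto_translate_zero (norm_e3 0) hWm hψ.1).add_const (∫ x, ∑ i, v x i * ψ x i)
  rw [zero_add] at h1
  refine h1.congr fun k => ?_
  have hWb : MemLp (fun x => W (x + (k:ℝ) • e3 0)) 2 volume :=
    hWm.comp_measurePreserving (measurePreserving_add_right volume _)
  rw [← integral_add (integrable_sum_mul hWb hψ.memLp) (integrable_sum_mul hv hψ.memLp)]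
  congr 1; funext x
  rw [← sum_add_distrib]
  exact sum_congr rfl fun i _ => by simp [b]; ring

lemma SptM.scl {f : ST → E9} (hf : SptM f) (b : E3) : SptM fun p => f (scl 1 1 b p) :=
  fun k => (hf k).scl one_pos one_ne_zero b

lemma SptM.comb {f g : ST → E9} (hf : SptM f) (hg : SptM g) (α β : ℝ) :
    SptM fun p => α • f p + β • g p := fun k => by
  simpa using ((hf k).const_mul α).add ((hg k).const_mul β)

lemma gp_translate {f : ST → E9} (hf : SptM f) (b : E3) :
    gp u (fun p => f (scl 1 1 (-b) p)) = gp (fun t x => u t (x + b)) f := by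
  let F : ST → ℝ := fun p => ∑ k : Fin 3 × Fin 3, u p.1 (p.2 + b) k.1 * dX k.2 (fun q => f q k) p
  have e := integral_scl one_pos one_pos (-b) F
  simp only [one_pow, inv_one, one_mul] at e
  change _ = ∫ p, F p ∂μST
  rw [← e]
  refine integral_congr_ae (.of_forall fun p => sum_congr rfl fun k _ => ?_)
  have h := dX_scl (α := 1) (l := 1) (hf.cc k).differentiable (-b) k.2 p
  simp only [h]
  simp [scl]

lemma BddU.gp_comb (hu : BddU u M) (hM : M < ∞)
    {f g : ST → E9} (hf : SptM f) (hg : SptM g) (α β : ℝ) :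
    gp u (fun p => α • f p + β • g p) = α * gp u f + β * gp u g := by
  unfold gp
  rw [← integral_const_mul, ← integral_const_mul, ← integral_add
    ((hu.integrable_gp hM hf).const_mul α) ((hu.integrable_gp hM hg).const_mul β)]
  refine integral_congr_ae (.of_forall fun p => ?_)
  simp only [mul_sum, ← sum_add_distrib]
  refine sum_congr rfl fun k _ => ?_
  have : dX k.2 (fun q => (α • f q + β • g q) k) p
      = α * dX k.2 (fun q => f q k) p + β * dX k.2 (fun q => g q k) p := by
    have h1 := (((hf.cc k).differentiable p).hasFDerivAt.const_mul α).add
      (((hg.cc k).differentiable p).hasFDerivAt.const_mul β)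
    have h2 : fderiv ℝ (fun q => (α • f q + β • g q) k) p = _ := h1.fderiv
    simpa [dX] using DFunLike.congr_fun h2 ((0:ℝ), e3 k.2)
  rw [this]; ring

lemma toReal_eLpNorm_comb {X F : Type*} [MeasurableSpace X] {μ : Measure X}
    [NormedAddCommGroup F] [NormedSpace ℝ F] {f g : X → F} (hf : MemLp f 2 μ) (hg : MemLp g 2 μ)
    (hd : ∀ x, f x = 0 ∨ g x = 0) (α β : ℝ) :
    (eLpNorm (fun x => α • f x + β • g x) 2 μ).toReal
      = √(α ^ 2 * (eLpNorm f 2 μ).toReal ^ 2 + β ^ 2 * (eLpNorm g 2 μ).toReal ^ 2) := by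
  have h1 : eLpNorm (fun x => α • f x + β • g x) 2 μ ^ 2
      = eLpNorm (α • f) 2 μ ^ 2 + eLpNorm (β • g) 2 μ ^ 2 := by
    rw [← lintegral_enorm_sq, ← lintegral_enorm_sq, ← lintegral_enorm_sq,
      ← lintegral_add_left' (((hf.1.const_smul α).enorm).pow_const 2)]
    refine lintegral_congr fun x => ?_
    rcases hd x with h | h <;> simp [h]
  have h2 := congrArg ENNReal.toReal h1
  rw [toReal_add (pow_ne_top (hf.const_smul α).2.ne) (pow_ne_top (hg.const_smul β).2.ne),
    eLpNorm_const_smul, eLpNorm_const_smul] at h2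
  simp only [toReal_pow, toReal_mul, toReal_enorm, mul_pow, norm_eq_abs, sq_abs] at h2
  rw [← h2, sqrt_sq toReal_nonneg]

lemma SptM.eventually_disjoint {f g : ST → E9} (hf : SptM f) (hg : SptM g) {e : E3}
    (he : ‖e‖ = 1) : ∀ᶠ k : ℕ in atTop, ∀ p, f p = 0 ∨ g (_root_.scl 1 1 ((k:ℝ) • e) p) = 0 := by
  have hb : ∀ {f : ST → E9}, SptM f → ∃ R, ∀ p, f p ≠ 0 → ‖p.2‖ ≤ R := fun {f} hf => by
    obtain ⟨R, hR⟩ := (hasCompactSupport_euclidean fun k => (hf.cc k).2).isCompact.isBounded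
      |>.subset_closedBall (0 : ST)
    refine ⟨R, fun p hp => ?_⟩
    have := hR (subset_tsupport f hp)
    rw [mem_closedBall_zero_iff] at this
    exact (norm_snd_le p).trans this
  obtain ⟨R, hR⟩ := hb hf
  obtain ⟨R', hR'⟩ := hb hg
  obtain ⟨n, hn⟩ := exists_nat_gt (R + R')
  filter_upwards [eventually_ge_atTop n] with k hk p
  by_contra! h
  have h1 := hR p h.1
  have h2 := hR' _ h.2
  simp only [_root_.scl, one_smul] at h2
  have h3 := norm_sub_le (p.2 + (k:ℝ) • e) p.2
  rw [add_sub_cancel_left, norm_smul, he, mul_one, Real.norm_natCast] at h3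
  have : (n:ℝ) ≤ k := by exact_mod_cast hk
  linarith

/-- If all data of size at most `η` are good, halving the size of the data
reduces the gradient bound by the factor `√2`. -/
lemma good_half {M C η : ℝ} {I : Set ℝ} (hr : r ≠ ∞) (hr0 : r ≠ 0)
    (hI : I ⊆ Ioi 0) (hM : 0 ≤ M) (hC : 0 ≤ C)
    (hQ : ∀ v, MemLp v 2 volume → IsDivFree v → eLpNorm v 2 volume ≤ ofReal η →
      Good ν r s I M C N v) (hv : MemLp v 2 volume) (hdv : IsDivFree v)
    (hη : eLpNorm v 2 volume ≤ ofReal (η / 2)) : Good ν r s I M (C / √2) N v := by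
  let e : ℕ → E3 := fun k => (k:ℝ) • e3 0
  have hsh : ∀ b, MemLp (fun x => v (x + b)) 2 volume := fun b =>
    hv.comp_measurePreserving (measurePreserving_add_right volume b)
  have hgood : ∀ k, Good ν r s I M C N fun x => v x + v (x + e k) := fun k => by
    refine hQ _ (hv.add (hsh _)) (hdv.add (hdv.translate _) hv (hsh _)) ?_
    refine (eLpNorm_add_le hv.1 (hsh _).1 (by norm_num)).trans ?_
    rw [eLpNorm_shift hv.1]
    refine (add_le_add hη hη).trans_eq ?_
    rw [← two_mul, show (2:ℝ≥0∞) = ofReal 2 by simp, ← ofReal_mul (by norm_num)]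
    congr 1; ring
  choose U hU hN using hgood
  have hlim : ∀ {c : E3} (_ : ‖c‖ = 1) {σ : ℕ → ℕ} (_ : StrictMono σ) {ψ}, DfTest ψ →
      Tendsto (fun k => ∫ x, ∑ i, (v x + v (x + (σ k : ℝ) • c)) i * ψ x i) atTop
      (nhds (∫ x, ∑ i, v x i * ψ x i)) := fun {c} hc {σ} hσ {ψ} hψ => by
    have h1 := ((tendsto_translate_zero hc hv hψ.1).const_add (∫ x, ∑ i, v x i * ψ x i)).comp
      hσ.tendsto_atTop
    rw [add_zero] at h1
    refine h1.congr fun k => ?_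
    rw [Function.comp_apply, ← integral_add (integrable_sum_mul hv hψ.memLp)
      (integrable_sum_mul (hsh _) hψ.memLp)]
    simp [add_mul, sum_add_distrib]
  obtain ⟨u₁, σ, hσ, h1, hN1, hs1⟩ := exists_limit_solution hr hr0 hI hU hM hC
    (fun ψ hψ => hlim (norm_e3 0) strictMono_id hψ) hN
  have hU' := fun k => (hU (σ k)).translate (-e (σ k))
  obtain ⟨u₂, τ, hτ, h2, hN2, hs2⟩ := exists_limit_solution (u₀ := v) hr hr0 hI hU' hM hC
    (fun ψ hψ => by
      have := hlim (c := -e3 0) (by rw [norm_neg, norm_e3]) hσ hψ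
      refine this.congr fun k => ?_
      simp [e, add_comm]) (fun k => (mixedNorm_translate r s I _ _).trans_le (hN _))
  by_cases hg1 : GradBd u₁ (C / √2)
  · exact ⟨u₁, ⟨h1.bddU, h1.divFree, hg1, h1.weak⟩, hN1⟩
  by_cases hg2 : GradBd u₂ (C / √2)
  · exact ⟨u₂, ⟨h2.bddU, h2.divFree, hg2, h2.weak⟩, hN2⟩
  exfalso
  unfold GradBd at hg1 hg2
  push Not at hg1 hg2
  obtain ⟨f, hf, hf1⟩ := hg1
  obtain ⟨g, hg, hg1⟩ := hg2
  have key : ∀ α β : ℝ, α * gp u₁ f + β * gp u₂ g ≤ C * √(α ^ 2 * (eLpNorm f 2 μST).toReal ^ 2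
      + β ^ 2 * (eLpNorm g 2 μST).toReal ^ 2) := fun α β => by
    have t1 := ((hs1.gradBd (fun k => (hU _).bddU) h1.bddU hf).comp hτ.tendsto_atTop).const_mul α
    have t2 := (hs2.gradBd (fun k => (hU' _).bddU) h2.bddU hg).const_mul β
    refine le_of_tendsto (t1.add t2) ?_
    have hev := (hσ.comp hτ).tendsto_atTop.eventually (hf.eventually_disjoint hg (norm_e3 0))
    filter_upwards [hev] with k hk
    have h3 := gp_translate (u := U (σ (τ k))) hg (-e (σ (τ k)))
    rw [neg_neg] at h3
    have h4 := (hU (σ (τ k))).gradBd _ (hf.comb (hg.scl (e (σ (τ k)))) α β)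
    rw [(hU (σ (τ k))).bddU.gp_comb ofReal_lt_top hf (hg.scl _), h3,
      toReal_eLpNorm_comb hf.memLp (hg.scl _).memLp (g := fun p => g (_root_.scl 1 1 (e (σ (τ k))) p)) hk,
      eLpNorm_scl one_pos one_pos (e (σ (τ k))) g] at h4
    simpa using h4
  set a := (eLpNorm f 2 μST).toReal
  set b := (eLpNorm g 2 μST).toReal
  have ha : 0 ≤ a := toReal_nonneg
  have hb : 0 ≤ b := toReal_nonneg
  rcases ha.eq_or_lt with ha0 | ha0
  · have := key 1 0
    simp [← ha0] at this hf1
    linarith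
  rcases hb.eq_or_lt with hb0 | hb0
  · have := key 0 1
    simp [← hb0] at this hg1
    linarith
  have h5 := key b a
  have h6 : b ^ 2 * a ^ 2 + a ^ 2 * b ^ 2 = 2 * (a * b) ^ 2 := by ring
  rw [h6, sqrt_mul (by norm_num), sqrt_sq (by positivity)] at h5
  have h7 : C / √2 = C * √2 / 2 := by grind
  rw [h7] at hf1 hg1
  nlinarith

lemma good_half_pow {M C η : ℝ} {I : Set ℝ} (hr : r ≠ ∞) (hr0 : r ≠ 0)
    (hI : I ⊆ Ioi 0) (hM : 0 ≤ M) (hC : 0 ≤ C)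
    (hQ : ∀ v, MemLp v 2 volume → IsDivFree v → eLpNorm v 2 volume ≤ ofReal η →
      Good ν r s I M C N v) (m : ℕ) : ∀ v, MemLp v 2 volume → IsDivFree v →
      eLpNorm v 2 volume ≤ ofReal (η / 2 ^ m) → Good ν r s I M (C / √2 ^ m) N v := by
  induction m with
  | zero => simpa using hQ
  | succ m ih =>
    intro v hv hd hη
    rw [pow_succ, ← div_div] at hη ⊢
    exact good_half hr hr0 hI hM (by positivity) ih hv hd hη

lemma Cc.tendsto_slice_sq (hg : Cc g) (t₀ : ℝ) :
    Tendsto (fun t => (eLpNorm (fun x => g (t, x) - g (t₀, x)) 2 volume).toReal) (nhds t₀)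
      (nhds 0) := by
  let K := Prod.snd '' tsupport g
  have hK : IsCompact K := IsCompact.image (show IsCompact (tsupport g) from hg.2) continuous_snd
  have h0 : ∀ t x, x ∉ K → g (t, x) = 0 := fun t x hx =>
    image_eq_zero_of_notMem_tsupport fun h => hx ⟨_, h, rfl⟩
  have h1 : ∀ t, (eLpNorm (fun x => g (t, x) - g (t₀, x)) 2 volume).toReal
      = √(∫ x in K, (g (t, x) - g (t₀, x)) ^ 2) := fun t => by
    rw [toReal_eLpNorm_two ((hg.slice t).sub (hg.slice t₀)).memLp,
      setIntegral_eq_integral_of_forall_compl_eq_zero fun x hx => by simp [h0 _ _ hx]]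
  have hc : Continuous fun t => ∫ x in K, (g (t, x) - g (t₀, x)) ^ 2 := by
    refine continuous_parametric_integral_of_continuous ?_ hK
    have := hg.continuous
    simp only [Function.uncurry_def]
    fun_prop
  simp only [h1]
  have := (hc.sqrt.tendsto t₀)
  simpa using this

/-- For almost every time, the time-integrated weak formulation holds for all test functions. -/
lemma Sol.ae_forall_pairT_eq {M C : ℝ} (h : Sol ν v u M C) (hM : 0 ≤ M) : ∀ᵐ t ∂μT, ∀ φ, IsTest φ →
      pairT u φ t = hT ν (∫ x, ∑ i, v x i * φ (0, x) i) φ u t := by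
  let Φ : ℕ × ℕ → ST → E3 := fun i => tens (cutT i.1) (dfSeq i.2)
  have hΦ : ∀ i, IsTest (Φ i) := fun i => isTest_tens (cutT_cc _) (dfSeq_dfTest _)
  let P : ℝ → Prop := fun t => (∀ i, pairT u (Φ i) t
    = hT ν (∫ x, ∑ m, v x m * Φ i (0, x) m) (Φ i) u t) ∧ MemLp (u t) 2 volume ∧
    eLpNorm (u t) 2 volume ≤ ofReal M ∧ IsDivFree (u t)
  have hP : ∀ᵐ t ∂μT, P t := by
    filter_upwards [ae_all_iff.2 fun i => h.pairT_eq (hΦ i), h.bddU.bdd,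
      h.bddU.slice_memLp ofReal_lt_top, h.divFree.slice h.bddU ofReal_lt_top] with t h1 h2 h3 h4
    exact ⟨h1, h3, h2, h4⟩
  filter_upwards [hP, ae_restrict_mem measurableSet_Ioi] with t₀ ht₀ hpos φ hφ
  have hA : ∀ᵐ t ∂μT, P t ∧ pairT u φ t
      = hT ν (∫ x, ∑ i, v x i * φ (0, x) i) φ u t := hP.and (h.pairT_eq hφ)
  let A := {t : ℝ | 0 < t ∧ P t ∧ pairT u φ t = hT ν (∫ x, ∑ i, v x i * φ (0, x) i) φ u t}
  have hcl : t₀ ∈ closure A := by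
    rw [mem_closure_iff]
    intro o ho ht
    have h1 : volume (o ∩ R₊) ≠ 0 := ((ho.inter isOpen_Ioi).measure_pos volume ⟨t₀, ht, hpos⟩).ne'
    by_contra hne
    refine h1 (measure_mono_null ?_ ((ae_restrict_iff' measurableSet_Ioi).1 hA))
    intro t htt hcon
    exact hne ⟨t, htt.1, htt.2, hcon htt.2⟩
  let l : Filter A := comap Subtype.val (nhds t₀)
  have hl : l.NeBot := mem_closure_iff_comap_neBot.1 hcl
  have hlt : Tendsto (Subtype.val : A → ℝ) l (nhds t₀) := tendsto_comap
  have hcont : ∀ {φ}, IsTest φ → ∀ c, Tendsto (fun t : A => hT ν c φ u t) l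
      (nhds (hT ν c φ u t₀)) := fun {φ} hφ c => by
    obtain ⟨L, hL0, hL⟩ := exists_nsK_bound hφ ν M hM
    refine tendsto_iff_dist_tendsto_zero.2 (squeeze_zero (fun _ => dist_nonneg)
      (fun t : A => hT_sub_le h.bddU ofReal_lt_top hφ hL0 (hL u h.bddU) c t₀ t) ?_)
    have := ((hlt.sub_const t₀).abs).const_mul L
    simpa using this
  have hInt : ∀ (t : A) {g : E3 → E3}, MemLp g 2 volume → ∫ x, ∑ i, (u t x - u t₀ x) i * g x i
      = (∫ x, ∑ i, u t x i * g x i) - ∫ x, ∑ i, u t₀ x i * g x i := fun t g hg => by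
    rw [← integral_sub (integrable_sum_mul t.2.2.1.2.1 hg) (integrable_sum_mul ht₀.2.1 hg)]
    congr 1; funext x
    rw [← sum_sub_distrib]
    exact sum_congr rfl fun i _ => by simp; ring
  have hg := (hφ.dfTest t₀).memLp
  have key := tendsto_weak_zero (l := l) (B := M + M) (a := fun t x => u t x - u t₀ x)
    (fun t => t.2.2.1.2.1.sub ht₀.2.1) (fun t => by
      refine (eLpNorm_sub_le t.2.2.1.2.1.1 ht₀.2.1.1 (by norm_num)).trans ?_
      rw [ofReal_add hM hM]
      exact add_le_add t.2.2.1.2.2.1 ht₀.2.2.1) (by linarith)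
    (fun t => t.2.2.1.2.2.2.sub ht₀.2.2.2 t.2.2.1.2.1 ht₀.2.1) (fun j => by
      simp only [hInt _ (dfSeq_dfTest j).memLp]
      obtain ⟨n, hn⟩ := exists_nat_gt |t₀|
      have h1 := (hcont (hΦ (n, j)) (∫ x, ∑ m, v x m * Φ (n, j) (0, x) m)).sub_const
        (hT ν (∫ x, ∑ m, v x m * Φ (n, j) (0, x) m) (Φ (n, j)) u t₀)
      rw [sub_self, ← ht₀.1 (n, j)] at h1
      refine h1.congr' ?_
      have h2 : ∀ᶠ t : A in l, |(t:ℝ)| < n := hlt.abs.eventually (gt_mem_nhds hn)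
      filter_upwards [h2] with t ht
      rw [← t.2.2.1.1 (n, j), pairT_tens ht.le, pairT_tens hn.le]) hg
  simp only [hInt _ hg] at key
  have h5 : ∀ i, Tendsto (fun t : A => ∫ x, u t x i * (φ (t, x) i - φ (t₀, x) i)) l (nhds 0) :=
    fun i => by
    have h6 := (((hφ.cc i).tendsto_slice_sq t₀).comp hlt).const_mul M
    rw [mul_zero] at h6
    refine squeeze_zero_norm (fun t => ?_) h6
    have hm := MemLp.coord t.2.2.1.2.1 i
    refine (abs_integral_mul_le hm (((hφ.cc i).slice t).sub ((hφ.cc i).slice t₀)).memLp).trans ?_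
    refine mul_le_mul_of_nonneg_right ?_ toReal_nonneg
    refine toReal_le_of_le_ofReal hM ((eLpNorm_mono_ae (.of_forall fun x => ?_)).trans
      t.2.2.1.2.2.1)
    exact norm_apply_le _ _
  have h7 := (tendsto_finsetSum Finset.univ fun i (_ : i ∈ Finset.univ) => h5 i).add key
  have h8 := (hcont hφ (∫ x, ∑ i, v x i * φ (0, x) i)).sub_const (pairT u φ t₀)
  refine (sub_eq_zero.1 (tendsto_nhds_unique h8 ((h7.congr fun t => ?_).trans_eq (by simp)))).symm
  rw [← t.2.2.2, ← integral_finsetSum]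
  · have hgt := (hφ.dfTest t).memLp
    rw [pairT, pairT, ← add_sub_assoc, ← integral_add]
    · congr 2; funext x
      rw [← sum_add_distrib]
      exact sum_congr rfl fun i _ => by ring
    · exact integrable_finsetSum _ fun i _ => MemLp.integrable_mul_fun
        (MemLp.coord t.2.2.1.2.1 i) (((hφ.cc i).slice t).sub ((hφ.cc i).slice t₀)).memLp
    · exact integrable_sum_mul t.2.2.1.2.1 hg
  · exact fun i _ => MemLp.integrable_mul_fun
      (MemLp.coord t.2.2.1.2.1 i) (((hφ.cc i).slice t).sub ((hφ.cc i).slice t₀)).memLp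

/-- Follow `u` up to time `t₀`, then restart with `w`. -/
def glue {α : Type*} (t₀ : ℝ) (u w : ℝ → α) (t : ℝ) : α := if t ≤ t₀ then u t else w (t - t₀)

variable {t₀ : ℝ}

lemma ae_glue {P Q : ℝ → Prop} (hP : ∀ᵐ t ∂μT, P t) (hQ : ∀ᵐ t ∂μT, Q t) :
    ∀ᵐ t ∂μT, (t ≤ t₀ → P t) ∧ (t₀ < t → Q (t - t₀)) := by
  rw [ae_restrict_iff' measurableSet_Ioi] at hQ
  have h := (measurePreserving_sub_right volume t₀).quasiMeasurePreserving.ae hQ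
  filter_upwards [hP, ae_restrict_of_ae h] with t h1 h2
  grind

lemma measurePreserving_sub_Ioi (t₀ : ℝ) : MeasurePreserving (fun t => t - t₀)
    (volume.restrict (Ioi t₀)) μT := by
  have := (measurePreserving_sub_right volume t₀).restrict_preimage (s := Ioi 0) measurableSet_Ioi
  simpa using this

lemma aesm_glue {α : Type*} [TopologicalSpace α] [TopologicalSpace.PseudoMetrizableSpace α]
    {u w : ℝ → E3 → α} (ht₀ : 0 < t₀)
    (hu : AEStronglyMeasurable (uncurry u) μST)
    (hw : AEStronglyMeasurable (uncurry w) μST) :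
    AEStronglyMeasurable (uncurry (glue t₀ u w)) μST := by
  have hs : MeasurableSet {p : ST | p.1 ≤ t₀} := measurableSet_le measurable_fst measurable_const
  have e : uncurry (glue t₀ u w) = {p : ST | p.1 ≤ t₀}.piecewise
      (uncurry u) (fun p => uncurry w (p.1 - t₀, p.2)) := by
    funext p
    by_cases hp : p.1 ≤ t₀ <;> simp [uncurry, glue, hp]
  rw [e]
  refine AEStronglyMeasurable.piecewise hs hu.restrict ?_
  have hr : μST.restrict {p : ST | p.1 ≤ t₀}ᶜ = (volume.restrict (Ioi t₀)).prod volume := by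
    have : {p : ST | p.1 ≤ t₀}ᶜ = Ioi t₀ ×ˢ univ := by ext p; simp
    rw [this, μST, ← prod_restrict, restrict_univ,
      restrict_restrict measurableSet_Ioi, inter_eq_left.2 (Ioi_subset_Ioi ht₀.le)]
  rw [hr]
  exact hw.comp_measurePreserving
    ((measurePreserving_sub_Ioi t₀).prod (MeasurePreserving.id volume))

lemma lintegral_glue {α : Type*} (ht₀ : 0 < t₀) (u w : ℝ → α) (f : α → ℝ≥0∞) :
    ∫⁻ t in R₊, f (glue t₀ u w t) = (∫⁻ t in Ioc 0 t₀, f (u t)) + ∫⁻ t in R₊, f (w t) := by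
  rw [← Ioc_union_Ioi_eq_Ioi ht₀.le, lintegral_union measurableSet_Ioi Ioc_disjoint_Ioi_same]
  congr 1
  · refine setLIntegral_congr_fun measurableSet_Ioc fun t ht => ?_
    simp [glue, ht.2]
  · have h := (measurePreserving_sub_Ioi t₀).lintegral_comp_emb
      (MeasurableEquiv.subRight t₀).measurableEmbedding (fun t => f (w t))
    rw [Ioc_union_Ioi_eq_Ioi ht₀.le, ← h]
    refine setLIntegral_congr_fun measurableSet_Ioi fun t ht => ?_
    simp [glue, not_le.2 (mem_Ioi.1 ht)]

lemma integral_sub_Ioi (t₀ : ℝ) (f : ℝ → ℝ) : ∫ t in Ioi t₀, f (t - t₀) = ∫ t in R₊, f t :=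
  (measurePreserving_sub_Ioi t₀).integral_comp (MeasurableEquiv.subRight t₀).measurableEmbedding f

lemma IsTest.time_shift (hφ : IsTest φ) (t₀ : ℝ) : IsTest fun p => φ (p + ((t₀, 0) : ST)) := by
  refine isTest_iff.2 ⟨fun i => ⟨(hφ.cc i).1.comp (contDiff_id.add contDiff_const),
    (hφ.cc i).2.comp_homeomorph (addRight ((t₀, 0) : ST))⟩, fun p => ?_⟩
  have : ∀ i, dX i (fun q => φ (q + ((t₀, 0) : ST)) i) p
      = dX i (fun q => φ q i) (p + ((t₀, 0) : ST)) := fun i => by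
    simp only [dX]; rw [fderiv_comp_add_right (f := fun q => φ q i)]
  simp only [this, (isTest_iff.1 hφ).2]

lemma nsI_time_shift (ν : ℝ) (φ : ST → E3) (u w : Flow) (ht : t₀ < t) (x : E3) :
    nsI ν (fun p => φ (p + ((t₀, 0) : ST))) w (t - t₀, x) = nsI ν φ (glue t₀ u w) (t, x) := by
  have hX : ∀ (f : ST → ℝ) j, dX j (fun q => f (q + ((t₀, 0) : ST)))
      = fun p => dX j f (p + ((t₀, 0) : ST)) := fun f j => by
    funext p; simp only [dX]; rw [fderiv_comp_add_right (f := f)]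
  have hT : ∀ (f : ST → ℝ), dT (fun q => f (q + ((t₀, 0) : ST)))
      = fun p => dT f (p + ((t₀, 0) : ST)) := fun f => by
    funext p; simp only [dT]; rw [fderiv_comp_add_right (f := f)]
  have e : ((t - t₀, x) + (t₀, 0) : ST) = (t, x) := by simp
  have hX' := fun i j => hX (fun q => φ q i) j
  have hXX := fun i j => hX (dX j fun q => φ q i) j
  have hT' := fun i => hT (fun q => φ q i)
  simp only [nsI, nsA, nsB, hX', hXX, hT', e]
  simp [glue, not_le.2 ht]

/-- At almost every time a solution may be restarted with any solution issuing from its slice. -/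
lemma Sol.glue {M C M' C' : ℝ} {w : Flow} (ht₀ : 0 < t₀)
    (h : Sol ν v u M C) (hC : 0 ≤ C) (hC' : 0 ≤ C')
    (ht : ∀ φ, IsTest φ → pairT u φ t₀ = hT ν (∫ x, ∑ i, v x i * φ (0, x) i) φ u t₀)
    (hw : Sol ν (u t₀) w M' C') :
    Sol ν v (glue t₀ u w) (max M M') (C + C') := by
  have hb : BddU (_root_.glue t₀ u w) (ofReal (max M M')) := by
    refine ⟨aesm_glue ht₀ h.bddU.aesm hw.bddU.aesm, ?_⟩
    filter_upwards [ae_glue h.bddU.bdd hw.bddU.bdd] with t h1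
    rcases le_or_gt t t₀ with htt | htt
    · simpa [_root_.glue, htt] using (h1.1 htt).trans (ofReal_le_ofReal (le_max_left M M'))
    · simpa [_root_.glue, not_le.2 htt] using
        (h1.2 htt).trans (ofReal_le_ofReal (le_max_right M M'))
  have hM' : ofReal (max M M') < ∞ := ofReal_lt_top
  refine ⟨hb, DivFreeST.of_slice hb hM' ?_, ?_, fun φ hφ => ?_⟩
  · filter_upwards [ae_glue (h.divFree.slice h.bddU ofReal_lt_top)
      (hw.divFree.slice hw.bddU ofReal_lt_top)] with t h1
    rcases le_or_gt t t₀ with htt | htt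
    · simpa [_root_.glue, htt] using h1.1 htt
    · simpa [_root_.glue, not_le.2 htt] using h1.2 htt
  · obtain ⟨G, hGm, hG, hGb⟩ := h.gradBd.exists_isDistGrad h.bddU ofReal_lt_top hC
    obtain ⟨G', hGm', hG', hGb'⟩ := hw.gradBd.exists_isDistGrad hw.bddU ofReal_lt_top hC'
    have hm := aesm_glue ht₀ hGm hGm'
    have hgb : ∫⁻ t in R₊, gradSq (_root_.glue t₀ G G') t ≤ ofReal (C + C') ^ 2 := by
      have e := lintegral_glue ht₀ G G' (fun g => ∫⁻ x : E3, ∑ i, ∑ j, ofReal ((g x i j) ^ 2))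
      unfold gradSq at hGb hGb' ⊢
      rw [e, ofReal_add hC hC', add_sq]
      calc _ ≤ ofReal C ^ 2 + ofReal C' ^ 2 :=
            add_le_add ((lintegral_mono_set Ioc_subset_Ioi_self).trans hGb) hGb'
        _ ≤ _ := by gcongr; exact le_self_add
    refine IsDistGrad.gradBd (by positivity) hb hM' (IsDistGrad.of_slice hb hM'
      (eLpNorm_toE9_le hm hgb).1 ?_) hm hgb
    filter_upwards [ae_glue (hG.slice h.bddU ofReal_lt_top (eLpNorm_toE9_le hGm hGb).1)
      (hG'.slice hw.bddU ofReal_lt_top (eLpNorm_toE9_le hGm' hGb').1)] with t h1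
    rcases le_or_gt t t₀ with htt | htt
    · simpa [_root_.glue, htt] using h1.1 htt
    · simpa [_root_.glue, not_le.2 htt] using h1.2 htt
  · have hi := hb.integrableOn_nsK hM' hφ ν
    rw [μST, integral_prod _ (hb.integrable_nsI hM' hφ ν)]
    change ∫ t in R₊, nsK ν φ (_root_.glue t₀ u w) t = _
    rw [← Ioc_union_Ioi_eq_Ioi ht₀.le, setIntegral_union Ioc_disjoint_Ioi_same measurableSet_Ioi
      (hi.mono_set Ioc_subset_Ioi_self) (hi.mono_set (Ioi_subset_Ioi ht₀.le))]
    have e1 : ∫ t in Ioc 0 t₀, nsK ν φ (_root_.glue t₀ u w) t = ∫ t in Ioc 0 t₀, nsK ν φ u t := by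
      refine setIntegral_congr_fun measurableSet_Ioc fun t ht => ?_
      simp [nsK, nsI, _root_.glue, ht.2]
    have hs := hφ.time_shift t₀
    have e2 : ∫ t in Ioi t₀, nsK ν φ (_root_.glue t₀ u w) t
        = ∫ t in R₊, nsK ν (fun p => φ (p + ((t₀, 0) : ST))) w t := by
      rw [← integral_sub_Ioi t₀]
      refine setIntegral_congr_fun measurableSet_Ioi fun t ht => ?_
      simp only [nsK, nsI_time_shift ν φ u w ht]
    have h3 := hw.weak _ hs
    rw [μST, integral_prod _ (hw.bddU.integrable_nsI ofReal_lt_top hs ν)] at h3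
    change ∫ t in R₊, nsK ν _ w t = _ at h3
    have h4 := ht φ hφ
    rw [e1, e2, h3]
    simp only [pairT, hT, Prod.mk_add_mk, zero_add, add_zero] at h4 ⊢
    rw [h4]; ring

lemma mixedNorm_glue_lt_top (hr : r ≠ ∞) (hr0 : r ≠ 0) {T : ℝ} (ht₀ : 0 < t₀)
    (hT : t₀ < T) {w : Flow} (hu : mixedNorm r s (Ioo 0 T) u < ∞)
    (hw : mixedNorm r s (Ioi 0) w < ∞) : mixedNorm r s (Ioi 0) (glue t₀ u w) < ∞ := by
  have hp : 0 < r.toReal := toReal_pos hr0 hr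
  have hip : 0 < 1 / r.toReal := by positivity
  simp only [mixedNorm, if_neg hr, rpow_lt_top_iff_of_pos hip] at hu hw ⊢
  rw [lintegral_glue ht₀ u w (fun v => eLpNorm v s volume ^ r.toReal)]
  exact add_lt_top.2 ⟨(lintegral_mono_set (t := Ioo 0 T) fun t ht => ⟨ht.1, ht.2.trans_lt hT⟩).trans_lt hu, hw⟩

/-- A solution with finite mixed norm on a short time interval and small gradient can be continued
to one with finite mixed norm for all times, granted global solvability for data with
small gradient. -/
lemma Sol.exists_global {M C δ T : ℝ} (hr : r ≠ ∞) (hr0 : r ≠ 0) (h : Sol ν v u M C) (hM : 0 ≤ M)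
    (hC : 0 ≤ C) (hδ0 : 0 ≤ δ)
    (hδ : C ^ 2 < δ ^ 2 * T) (hu : mixedNorm r s (Ioo 0 T) u < ∞)
    (hsd : ∀ (f : E3 → E3) (g : E3 → E9), MemLp f 2 volume → IsDivFree f →
      eLpNorm f 2 volume ≤ ofReal M → MemLp g 2 volume →
      eLpNorm g 2 volume ≤ ofReal δ →
      (∀ i j ψ, Cc ψ → ∫ x, f x i * pd ψ j x = -∫ x, g x (i, j) * ψ x) →
      ∃ w M' C', 0 ≤ C' ∧ Sol ν f w M' C' ∧ mixedNorm r s (Ioi 0) w < ∞) :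
    ∃ w M' C', 0 ≤ C' ∧ Sol ν v w M' C' ∧ mixedNorm r s (Ioi 0) w < ∞ := by
  obtain ⟨G, hGm, hG, hGb⟩ := h.gradBd.exists_isDistGrad h.bddU ofReal_lt_top hC
  have hG9 := eLpNorm_toE9_le hGm hGb
  have hsl : ∀ᵐ t ∂μT, AEStronglyMeasurable (fun x => toE9 G (t, x)) volume := by
    exact hG9.1.1.prodMk_left
  have hall := (hG.slice h.bddU ofReal_lt_top hG9.1).and <| hsl.and <|
    (h.ae_forall_pairT_eq hM).and <| h.bddU.bdd.and <| (h.bddU.slice_memLp ofReal_lt_top).and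
    (h.divFree.slice h.bddU ofReal_lt_top)
  have hall' := ae_restrict_of_ae_restrict_of_subset (t := R₊) (s := Ioo 0 T)
    Ioo_subset_Ioi_self hall
  have hex : ∃ᶠ t in ae (volume.restrict (Ioo 0 T)), gradSq G t ≤ ofReal δ ^ 2 := by
    by_contra! hne
    have h2 : ofReal δ ^ 2 * ofReal T ≤ ofReal C ^ 2 := by
      calc ofReal δ ^ 2 * ofReal T = ∫⁻ t in Ioo 0 T, ofReal δ ^ 2 := by simp
        _ ≤ ∫⁻ t in Ioo 0 T, gradSq G t := lintegral_mono_ae (hne.mono fun t ht => ht.le)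
        _ ≤ _ := (lintegral_mono_set Ioo_subset_Ioi_self).trans hGb
    rw [← ofReal_pow hδ0, ← ofReal_pow hC, ← ofReal_mul (by positivity),
      ofReal_le_ofReal_iff (by positivity)] at h2
    linarith
  obtain ⟨t₀, hg, ⟨h1, h2, h3, h4, h5, h6⟩, ht⟩ :=
    (hex.and_eventually (hall'.and (ae_restrict_mem measurableSet_Ioo))).exists
  have hgn : eLpNorm (fun x => toE9 G (t₀, x)) 2 volume ≤ ofReal δ := by
    refine (pow_le_pow_left_iff two_ne_zero).1 ?_
    rw [← lintegral_enorm_sq]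
    simp only [enorm_sq_E9]
    exact hg
  obtain ⟨w, M', C', hC', hw, hwn⟩ := hsd (u t₀) (fun x => toE9 G (t₀, x)) h5 h6 h4
    ⟨h2, hgn.trans_lt ofReal_lt_top⟩ hgn h1
  exact ⟨_, _, _, by positivity, h.glue ht.1 hC hC' h3 hw,
    mixedNorm_glue_lt_top hr hr0 ht.1 ht.2 hu hwn⟩

theorem lintegral_mul_sq_le {α : Type*} [MeasurableSpace α] {μ : Measure α} {f g : α → ℝ≥0∞}
    (hf : AEMeasurable f μ) (hg : AEMeasurable g μ) :
    (∫⁻ x, f x * g x ∂μ) ^ 2 ≤ (∫⁻ x, f x ^ 2 ∂μ) * ∫⁻ x, g x ^ 2 ∂μ := by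
  have h := lintegral_mul_le_Lp_mul_Lq μ (two_two) hf hg
  have h2 : ∀ y : ℝ≥0∞, (y ^ (1 / 2 : ℝ)) ^ 2 = y := fun y => by
    rw [← rpow_natCast, ← rpow_mul]; norm_num
  calc _ ≤ _ := pow_le_pow_left' h 2
    _ = _ := by
      rw [mul_pow, h2, h2]
      simp only [rpow_two]

theorem lintegral_weight_mul_sq_le {α : Type*} [MeasurableSpace α] {μ : Measure α}
    {w h : α → ℝ≥0∞} (hw : AEMeasurable w μ) (hh : AEMeasurable h μ) :
    (∫⁻ x, w x * h x ∂μ) ^ 2 ≤ (∫⁻ x, w x ∂μ) * ∫⁻ x, w x * h x ^ 2 ∂μ := by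
  have h2 : ∀ y : ℝ≥0∞, y ^ (1 / 2 : ℝ) * y ^ (1 / 2 : ℝ) = y := fun y => by
    rw [← rpow_add_of_nonneg _ _ (by norm_num) (by norm_num)]; norm_num
  have := lintegral_mul_sq_le (hw.pow_const (1 / 2 : ℝ)) ((hw.pow_const (1 / 2 : ℝ)).mul hh)
  convert this using 2
  · simp only [Pi.mul_apply, ← mul_assoc, h2]
  · simp only [sq, h2]
  · refine lintegral_congr fun x => ?_
    simp only [Pi.mul_apply]
    rw [mul_pow, sq (_ ^ _), h2]

theorem le_rpow_half_of_sq_le {x y : ℝ≥0∞} (h : x ^ 2 ≤ y) : x ≤ y ^ (1 / 2 : ℝ) := by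
  calc x = (x ^ 2) ^ (1 / 2 : ℝ) := by rw [← rpow_natCast, ← rpow_mul]; norm_num
    _ ≤ _ := rpow_le_rpow h (by norm_num)

theorem ofReal_rpow_mul (ht : 0 < t) (a b : ℝ) : ofReal t ^ a * ofReal t ^ b = ofReal t ^ (a + b) :=
  (rpow_add _ _ (by simpa using ht) ofReal_ne_top).symm

theorem lintegral_rpow_Ioo {b : ℝ} (hb : b < 1) (ht : 0 < t) : ∫⁻ τ in Ioo 0 t, ofReal τ ^ (-b) =
      ofReal (1 - b)⁻¹ * ofReal t ^ (1 - b) := by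
  have h1 : ∀ τ ∈ Ioo 0 t, ofReal τ ^ (-b) = ofReal (τ ^ (-b)) := fun τ hτ =>
    ofReal_rpow_of_pos hτ.1
  have hI : IntegrableOn (fun τ : ℝ => τ ^ (-b)) (Ioo 0 t) :=
    ((intervalIntegral.intervalIntegrable_rpow' (by linarith : -1 < -b)).1 :
      IntegrableOn _ (Ioc 0 t)).mono_set Ioo_subset_Ioc_self
  rw [setLIntegral_congr_fun measurableSet_Ioo h1, ← ofReal_integral_eq_lintegral_ofReal hI
    ((ae_restrict_mem measurableSet_Ioo).mono fun τ hτ => Real.rpow_nonneg hτ.1.le _),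
    ofReal_rpow_of_pos ht, ← ofReal_mul (by simp; linarith),
    ← integral_Ioc_eq_integral_Ioo, ← intervalIntegral.integral_of_le ht.le,
    integral_rpow (Or.inl (by linarith))]
  congr 1
  rw [show -b + 1 = 1 - b by ring, Real.zero_rpow (by linarith)]
  field_simp
  ring

theorem lintegral_Ioo_reflect (f : ℝ → ℝ≥0∞) (t : ℝ) :
    ∫⁻ τ in Ioo 0 t, f (t - τ) = ∫⁻ τ in Ioo 0 t, f τ := by
  rw [← lintegral_indicator measurableSet_Ioo, ← lintegral_indicator measurableSet_Ioo,
    ← lintegral_sub_left_eq_self _ t]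
  refine lintegral_congr fun τ => ?_
  by_cases h : τ ∈ Ioo 0 t
  · rw [indicator_of_mem h, indicator_of_mem (show t - τ ∈ Ioo 0 t from
      ⟨by linarith [h.2], by linarith [h.1]⟩), _root_.sub_sub_cancel]
  · rw [indicator_of_notMem h, indicator_of_notMem (show t - τ ∉ Ioo 0 t from
      fun h' => h ⟨by linarith [h'.2], by linarith [h'.1]⟩)]

theorem exists_beta_bound {a b : ℝ} (ha0 : 0 ≤ a) (ha : a < 1) (hb0 : 0 ≤ b) (hb : b < 1) :
    ∃ B : ℝ≥0∞, B ≠ ∞ ∧ ∀ t : ℝ, 0 < t → ∫⁻ τ in Ioo 0 t, ofReal (t - τ) ^ (-a) * ofReal τ ^ (-b) ≤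
        B * ofReal t ^ (1 - a - b) := by
  refine ⟨ofReal (1 / 2) ^ (-a) * ofReal (1 - b)⁻¹ +
    ofReal (1 / 2) ^ (-b) * ofReal (1 - a)⁻¹, ?_, fun t ht => ?_⟩
  · simp [mul_eq_top, rpow_eq_top_iff, ha0.not_gt, hb0.not_gt]
  have hpt : ∀ τ ∈ Ioo 0 t, ofReal (t - τ) ^ (-a) * ofReal τ ^ (-b) ≤
      ofReal (1 / 2 * t) ^ (-a) * ofReal τ ^ (-b) +
      ofReal (1 / 2 * t) ^ (-b) * ofReal (t - τ) ^ (-a) := by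
    intro τ hτ
    have mono : ∀ e x y : ℝ, 0 ≤ e → x ≤ y → ofReal y ^ (-e) ≤ ofReal x ^ (-e) :=
      fun e x y he hxy => by
        rw [rpow_neg, rpow_neg]
        exact ENNReal.inv_le_inv.2 (rpow_le_rpow (ofReal_le_ofReal hxy) he)
    rcases le_total τ (t / 2) with h | h
    · refine le_add_right (mul_le_mul_left ?_ _)
      exact mono a _ _ ha0 (by linarith)
    · refine le_add_left ?_
      rw [mul_comm]
      exact mul_le_mul_left (mono b _ _ hb0 (by linarith)) _
  refine (setLIntegral_mono' measurableSet_Ioo hpt).trans ?_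
  rw [lintegral_add_left (by fun_prop), lintegral_const_mul _ (by fun_prop),
    lintegral_const_mul _ (by fun_prop),
    lintegral_Ioo_reflect (fun τ => ofReal τ ^ (-a)), lintegral_rpow_Ioo hb ht,
    lintegral_rpow_Ioo ha ht, ofReal_mul (by norm_num),
    mul_rpow_of_ne_top ofReal_ne_top ofReal_ne_top,
    mul_rpow_of_ne_top ofReal_ne_top ofReal_ne_top, add_mul]
  refine le_of_eq ?_
  congr 1
  · rw [show 1 - a - b = -a + (1 - b) by ring, ← ofReal_rpow_mul ht]; ring
  · rw [show 1 - a - b = -b + (1 - a) by ring, ← ofReal_rpow_mul ht]; ring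

theorem exists_gauss_bound {q : ℝ} (hq : -3 < q) : ∃ C : ℝ≥0∞, C ≠ ∞ ∧ ∀ b : ℝ, 0 < b →
      ∫⁻ ξ : E3, ofReal (‖ξ‖ ^ q * exp (-b * ‖ξ‖ ^ 2)) = C * ofReal b ^ (-((q + 3) / 2)) := by
  refine ⟨ofReal (3 * ((volume (ball (0 : E3) 1)).toReal *
    (1 / 2 * Real.Gamma ((q + 3) / 2)))), ofReal_ne_top, fun b hb => ?_⟩
  have hdim : Module.finrank ℝ E3 = 3 := by simp
  have hfun : ∀ y ∈ Ioi (0 : ℝ), y ^ (Module.finrank ℝ E3 - 1) •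
      (y ^ q * exp (-b * y ^ 2)) = y ^ (q + 2) * exp (-b * y ^ (2 : ℝ)) := by
    intro y hy
    rw [hdim, smul_eq_mul, ← mul_assoc, Real.rpow_add hy, Real.rpow_two]
    norm_num
    ring
  have hInt : Integrable (fun ξ : E3 => ‖ξ‖ ^ q * exp (-b * ‖ξ‖ ^ 2)) := by
    refine (integrable_fun_norm_addHaar volume (f := fun y => y ^ q * exp (-b * y ^ 2))).2 ?_
    refine IntegrableOn.congr_fun ?_ (fun y hy => (hfun y hy).symm) measurableSet_Ioi
    exact integrableOn_rpow_mul_exp_neg_mul_rpow (by linarith) (by norm_num) hb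
  rw [← ofReal_integral_eq_lintegral_ofReal hInt (.of_forall fun ξ => by positivity),
    integral_fun_norm_addHaar volume (fun y => y ^ q * exp (-b * y ^ 2)),
    setIntegral_congr_fun measurableSet_Ioi hfun,
    integral_rpow_mul_exp_neg_mul_rpow (by norm_num) (by linarith) hb, hdim,
    ofReal_rpow_of_pos hb, ← ofReal_mul]
  · congr 1
    rw [show (q + 2 + 1) / 2 = (q + 3) / 2 by ring,
      show -(q + 2 + 1) / 2 = -((q + 3) / 2) by ring]
    simp [Measure.real]
    ring
  · have := Real.Gamma_pos_of_pos (show 0 < (q + 3) / 2 by linarith)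
    positivity

/-- The Fourier multiplier of the heat semigroup. -/
def hk (c s : ℝ) (ξ : E3) : ℝ := exp (-(c * s) * ‖ξ‖ ^ 2)

/-- The heat multiplier between the times `τ` and `t`, set to zero unless `0 < τ < t`. -/
def kr (c t τ : ℝ) (ξ : E3) : ℝ := (Ioo 0 t).indicator (fun τ => hk c (t - τ) ξ) τ

/-- Self-convolution in frequency. -/
def sconv (A : ST → ℝ≥0∞) (τ : ℝ) (ξ : E3) : ℝ≥0∞ := ∫⁻ η, A (τ, η) * A (τ, ξ - η)

/-- The scalar Duhamel term. -/
def nl (c : ℝ) (A : ST → ℝ≥0∞) (p : ST) : ℝ≥0∞ :=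
  ∫⁻ τ, ofReal (kr c p.1 τ p.2 * ‖p.2‖) * sconv A τ p.2

theorem nl_eq (c : ℝ) (A : ST → ℝ≥0∞) (t : ℝ) (ξ : E3) :
    nl c A (t, ξ) = ∫⁻ τ in Ioo 0 t, ofReal (hk c (t - τ) ξ * ‖ξ‖) * sconv A τ ξ := by
  rw [nl, ← lintegral_indicator measurableSet_Ioo]
  refine lintegral_congr fun τ => ?_
  by_cases h : τ ∈ Ioo 0 t <;> simp [kr, h]

theorem hk_pos (c s : ℝ) (ξ : E3) : 0 < hk c s ξ := Real.exp_pos _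

theorem hk_le_one {s : ℝ} (h : 0 ≤ c * s) (ξ : E3) : hk c s ξ ≤ 1 :=
  Real.exp_le_one_iff.2 (by nlinarith [sq_nonneg ‖ξ‖])

theorem kr_nonneg (c t τ : ℝ) (ξ : E3) : 0 ≤ kr c t τ ξ :=
  indicator_nonneg (fun _ _ => (hk_pos _ _ _).le) _

theorem measurable_kr (c : ℝ) : Measurable fun q : ST × ℝ => kr c q.1.1 q.2 q.1.2 := by
  have : (fun q : ST × ℝ => kr c q.1.1 q.2 q.1.2) =
      {q : ST × ℝ | 0 < q.2 ∧ q.2 < q.1.1}.indicator (fun q => hk c (q.1.1 - q.2) q.1.2) := by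
    ext q
    by_cases h : 0 < q.2 ∧ q.2 < q.1.1
    · rw [kr, indicator_of_mem (show q.2 ∈ Ioo 0 q.1.1 from h), indicator_of_mem]; exact h
    · rw [kr, indicator_of_notMem (show q.2 ∉ Ioo 0 q.1.1 from h), indicator_of_notMem]; exact h
  rw [this]
  refine Measurable.indicator (by unfold hk; fun_prop) ?_
  exact (measurableSet_lt measurable_const measurable_snd).inter
    (measurableSet_lt measurable_snd (by fun_prop))

theorem measurable_sconv (hA : Measurable A) : Measurable fun p : ST => sconv A p.1 p.2 := by
  unfold sconv
  fun_prop

theorem measurable_nl (c : ℝ) (hA : Measurable A) : Measurable (nl c A) := by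
  unfold nl
  refine lintegral_prod_right' (f := fun q : ST × ℝ =>
    ofReal (kr c q.1.1 q.2 q.1.2 * ‖q.1.2‖) * sconv A q.2 q.1.2) ?_
  exact ((measurable_kr c).mul (by fun_prop)).ennreal_ofReal.mul
    ((measurable_sconv hA).comp (by fun_prop : Measurable fun q : ST × ℝ => (q.2, q.1.2)))

theorem sconv_mono {A' : ST → ℝ≥0∞} (h : A ≤ A') (τ : ℝ) (ξ : E3) : sconv A τ ξ ≤ sconv A' τ ξ :=
  lintegral_mono fun _ => mul_le_mul' (h _) (h _)

theorem nl_mono (c : ℝ) {A' : ST → ℝ≥0∞} (h : A ≤ A') : nl c A ≤ nl c A' := fun p =>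
  lintegral_mono fun τ => mul_le_mul_right (sconv_mono h τ p.2) _

theorem lintegral_sconv (hA : Measurable A) (τ : ℝ) : ∫⁻ ξ, sconv A τ ξ = (∫⁻ ξ, A (τ, ξ)) ^ 2 := by
  unfold sconv
  rw [lintegral_lintegral_swap (by fun_prop)]
  have : ∀ η : E3, ∫⁻ ξ : E3, A (τ, η) * A (τ, ξ - η) = A (τ, η) * ∫⁻ ξ, A (τ, ξ) := fun η => by
    rw [lintegral_const_mul _ (by fun_prop), lintegral_sub_right_eq_self (fun ξ => A (τ, ξ)) η]
  simp_rw [this]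
  rw [lintegral_mul_const _ (by fun_prop), sq]

theorem lintegral_sconv_sq (hA : Measurable A) (τ : ℝ) :
    ∫⁻ ξ, sconv A τ ξ ^ 2 ≤ (∫⁻ ξ, A (τ, ξ)) ^ 2 * ∫⁻ ξ, A (τ, ξ) ^ 2 := by
  have h1 : ∀ ξ, sconv A τ ξ ^ 2 ≤ (∫⁻ ξ, A (τ, ξ)) * ∫⁻ η, A (τ, η) * A (τ, ξ - η) ^ 2 := fun ξ =>
    lintegral_weight_mul_sq_le (by fun_prop) (by fun_prop)
  refine (lintegral_mono h1).trans ?_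
  rw [lintegral_const_mul _ (lintegral_prod_right'
    (f := fun q : E3 × E3 => A (τ, q.2) * A (τ, q.1 - q.2) ^ 2) (by fun_prop)),
    lintegral_lintegral_swap (by fun_prop)]
  have : ∀ η : E3, ∫⁻ ξ : E3, A (τ, η) * A (τ, ξ - η) ^ 2 =
      A (τ, η) * ∫⁻ ξ, A (τ, ξ) ^ 2 := fun η => by
    rw [lintegral_const_mul _ (by fun_prop), lintegral_sub_right_eq_self (fun ξ => A (τ, ξ) ^ 2) η]
  simp_rw [this]
  rw [lintegral_mul_const _ (by fun_prop), sq, mul_assoc]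

theorem hk_mul_norm_le {s : ℝ} (hc : 0 < c) (hs : 0 < s) (ξ : E3) : ofReal (hk c s ξ * ‖ξ‖) ≤
      ofReal c ^ (-(1 / 2) : ℝ) * ofReal s ^ (-(1 / 2) : ℝ) := by
  rw [← mul_rpow_of_ne_top ofReal_ne_top ofReal_ne_top, ← ofReal_mul hc.le,
    ofReal_rpow_of_pos (by positivity)]
  refine ofReal_le_ofReal ?_
  have h0 : 0 < c * s := by positivity
  rw [Real.rpow_neg h0.le, ← sqrt_eq_rpow]
  set y := √(c * s) with hy
  have hy0 : 0 < y := Real.sqrt_pos.2 h0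
  have hy2 : y ^ 2 = c * s := sq_sqrt h0.le
  rw [hk, ← hy2, neg_mul, Real.exp_neg, inv_mul_le_iff₀ (Real.exp_pos _), ← div_eq_mul_inv,
    le_div_iff₀ hy0, ← mul_pow]
  nlinarith [Real.add_one_le_exp ((y * ‖ξ‖) ^ 2), sq_nonneg (y * ‖ξ‖ - 1)]

theorem lintegral_hk_mul_le {s : ℝ} (hc : 0 < c) (hs : 0 < s) (F : E3 → ℝ≥0∞) :
    ∫⁻ ξ, ofReal (hk c s ξ * ‖ξ‖) * F ξ ≤
      ofReal c ^ (-(1 / 2) : ℝ) * ofReal s ^ (-(1 / 2) : ℝ) * ∫⁻ ξ, F ξ := by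
  refine (lintegral_mono fun ξ => mul_le_mul_left (hk_mul_norm_le hc hs ξ) _).trans ?_
  rw [lintegral_const_mul']
  exact mul_ne_top (by simp [rpow_eq_top_iff, hc]) (by simp [rpow_eq_top_iff, hs])

theorem exists_lintegral_hk_pow (hc : 0 < c) {q : ℝ} (hq : -3 < 2 * q) :
    ∃ C : ℝ≥0∞, C ≠ ∞ ∧ ∀ s : ℝ, 0 < s → ∫⁻ ξ : E3, ofReal (hk c s ξ * ‖ξ‖ ^ q) ^ 2 =
        C * ofReal s ^ (-(q + 3 / 2)) := by
  obtain ⟨C, hC, h⟩ := exists_gauss_bound hq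
  refine ⟨C * ofReal (2 * c) ^ (-(q + 3 / 2)),
    mul_ne_top hC (rpow_ne_top_of_ne_zero (by simpa using hc) ofReal_ne_top),
    fun s hs => ?_⟩
  rw [mul_assoc, ← mul_rpow_of_ne_top ofReal_ne_top ofReal_ne_top,
    ← ofReal_mul (by positivity), show q + 3 / 2 = (2 * q + 3) / 2 by ring,
    ← h (2 * c * s) (by positivity)]
  refine lintegral_congr fun ξ => ?_
  rw [← ofReal_pow (by have := hk_pos c s ξ; positivity), mul_pow, hk, ← Real.exp_nat_mul,
    ← Real.rpow_natCast (‖ξ‖ ^ q), ← Real.rpow_mul (norm_nonneg _), mul_comm]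
  congr 2
  · congr 1; push_cast; ring
  · congr 1; push_cast; ring

/-- Scale-invariant bounds for a nonnegative function of time and frequency. -/
structure FBd (A : ST → ℝ≥0∞) (D N : ℝ≥0∞) : Prop where
  meas : Measurable A
  short : ∀ t : ℝ, 0 < t → ∫⁻ ξ, A (t, ξ) ≤ D * ofReal t ^ (-(1 / 4) : ℝ)
  long : ∀ t : ℝ, 0 < t → ∫⁻ ξ, A (t, ξ) ≤ N * ofReal t ^ (-(3 / 4) : ℝ)
  l2 : ∀ t : ℝ, 0 < t → ∫⁻ ξ, A (t, ξ) ^ 2 ≤ N ^ 2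

theorem FBd.mid (h : FBd A D N) (ht : 0 < t) :
    (∫⁻ ξ, A (t, ξ)) ^ 2 ≤ D * N * ofReal t ^ (-1 : ℝ) := by
  rw [sq]
  refine (mul_le_mul' (h.short t ht) (h.long t ht)).trans (le_of_eq ?_)
  rw [show (-1 : ℝ) = -(1 / 4) + -(3 / 4) by norm_num, ← ofReal_rpow_mul ht]
  ring

theorem FBd.mid' (h : FBd A D N) (ht : 0 < t) :
    ∫⁻ ξ, A (t, ξ) ≤ (D * N) ^ (1 / 2 : ℝ) * ofReal t ^ (-(1 / 2) : ℝ) := by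
  refine (le_rpow_half_of_sq_le (h.mid ht)).trans (le_of_eq ?_)
  rw [mul_rpow_of_nonneg _ _ (by norm_num), ← rpow_mul]
  norm_num

theorem lintegral_nl (hA : Measurable A) (t : ℝ) : ∫⁻ ξ, nl c A (t, ξ) = ∫⁻ τ in Ioo 0 t, ∫⁻ ξ : E3,
      ofReal (hk c (t - τ) ξ * ‖ξ‖) * sconv A τ ξ := by
  simp_rw [nl_eq]
  refine lintegral_lintegral_swap (Measurable.aemeasurable ?_)
  refine Measurable.mul (by unfold hk; fun_prop) ?_
  exact (measurable_sconv hA).comp measurable_swap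

theorem half_sq (x : ℝ≥0∞) : (x ^ (1 / 2 : ℝ)) ^ 2 = x := by
  rw [← rpow_natCast, ← rpow_mul]; norm_num

theorem exists_nl_bound (hc : 0 < c) : ∃ K : ℝ≥0∞, K ≠ ∞ ∧ ∀ A D N, FBd A D N → ∀ t : ℝ, 0 < t →
      ∫⁻ ξ, nl c A (t, ξ) ≤ K * (D * N) ^ (1 / 2 : ℝ) * D * ofReal t ^ (-(1 / 4) : ℝ) ∧
      ∫⁻ ξ, nl c A (t, ξ) ≤ K * (D * N) ^ (1 / 2 : ℝ) * N * ofReal t ^ (-(3 / 4) : ℝ) ∧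
      ∫⁻ ξ, nl c A (t, ξ) ^ 2 ≤ (K * (D * N) ^ (1 / 2 : ℝ) * N) ^ 2 := by
  obtain ⟨B1, hB1, hb1⟩ := exists_beta_bound (a := 1 / 2) (b := 3 / 4) (by norm_num)
    (by norm_num) (by norm_num) (by norm_num)
  obtain ⟨B2, hB2, hb2⟩ := exists_beta_bound (a := 7 / 8) (b := 7 / 8) (by norm_num)
    (by norm_num) (by norm_num) (by norm_num)
  obtain ⟨B3, hB3, hb3⟩ := exists_beta_bound (a := 1 / 2) (b := 1 / 2) (by norm_num)
    (by norm_num) (by norm_num) (by norm_num)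
  obtain ⟨C2, hC2, hg⟩ := exists_lintegral_hk_pow hc (q := 1) (by norm_num)
  set c1 : ℝ≥0∞ := ofReal c ^ (-(1 / 2) : ℝ) with hc1
  have hc1t : c1 ≠ ∞ := by simp [hc1, rpow_eq_top_iff, hc]
  set c2 : ℝ≥0∞ := (c1 * C2 ^ (1 / 2 : ℝ)) ^ (1 / 2 : ℝ) with hc2
  have hc2t : c2 ≠ ∞ := rpow_ne_top_of_nonneg (by norm_num)
    (mul_ne_top hc1t (rpow_ne_top_of_nonneg (by norm_num) hC2))
  refine ⟨c1 * B1 + c2 * B2 + c1 * B3, by simp [mul_eq_top, *], ?_⟩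
  intro A D N hA t ht
  set κ : ℝ≥0∞ := (D * N) ^ (1 / 2 : ℝ) with hκ
  set K := c1 * B1 + c2 * B2 + c1 * B3 with hK
  have hK1 : c1 * B1 ≤ K := le_self_add.trans le_self_add
  have hK2 : c2 * B2 ≤ K := (le_add_left le_rfl : c2 * B2 ≤ c1 * B1 + c2 * B2).trans le_self_add
  have hK3 : c1 * B3 ≤ K := le_add_left le_rfl
  set m : ℝ → ℝ≥0∞ := fun τ => ∫⁻ ξ, A (τ, ξ) with hm
  have hmeas := hA.meas
  have hmm : Measurable m := hmeas.lintegral_prod_right'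
  set q : ℝ → ℝ≥0∞ := fun s => ofReal s with hq
  set J : ℝ → ℝ≥0∞ := fun τ => ∫⁻ ξ : E3, ofReal (hk c (t - τ) ξ * ‖ξ‖) * sconv A τ ξ with hJ
  have hscm : ∀ τ, Measurable fun ξ => sconv A τ ξ := fun τ =>
    (measurable_sconv hmeas).comp measurable_prodMk_left
  have hJ1 : ∀ τ ∈ Ioo 0 t, J τ ≤ c1 * q (t - τ) ^ (-(1 / 2) : ℝ) * m τ ^ 2 := by
    intro τ hτ
    have := lintegral_hk_mul_le hc (sub_pos.2 hτ.2) (sconv A τ)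
    rwa [lintegral_sconv hmeas] at this
  have hJ2 : ∀ τ ∈ Ioo 0 t, J τ ^ 2 ≤ C2 * q (t - τ) ^ (-(5 / 2) : ℝ) * (m τ ^ 2 * N ^ 2) := by
    intro τ hτ
    refine (lintegral_mul_sq_le (by unfold hk; fun_prop) (hscm τ).aemeasurable).trans ?_
    refine mul_le_mul' ?_ ((lintegral_sconv_sq hmeas τ).trans (mul_le_mul_right (hA.l2 τ hτ.1) _))
    have := hg (t - τ) (sub_pos.2 hτ.2)
    simp only [Real.rpow_one] at this
    rw [this]
    norm_num [hq]
  have hJ2' : ∀ τ ∈ Ioo 0 t, J τ ≤ C2 ^ (1 / 2 : ℝ) * q (t - τ) ^ (-(5 / 4) : ℝ) * (m τ * N) := by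
    intro τ hτ
    refine (le_rpow_half_of_sq_le (hJ2 τ hτ)).trans (le_of_eq ?_)
    rw [← mul_pow, mul_rpow_of_nonneg _ _ (by norm_num),
      mul_rpow_of_nonneg _ _ (by norm_num), ← rpow_mul, ← rpow_natCast,
      ← rpow_mul (m τ * N)]
    norm_num
  refine ⟨?_, ?_, ?_⟩
  · rw [lintegral_nl hmeas]
    calc _ ≤ ∫⁻ τ in Ioo 0 t, (c1 * κ * D) *
          (q (t - τ) ^ (-(1 / 2) : ℝ) * q τ ^ (-(3 / 4) : ℝ)) := by
          refine setLIntegral_mono' measurableSet_Ioo fun τ hτ => (hJ1 τ hτ).trans ?_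
          rw [sq]
          refine (mul_le_mul_right (mul_le_mul' (hA.mid' hτ.1) (hA.short τ hτ.1)) _).trans
            (le_of_eq ?_)
          rw [show (-(3 / 4) : ℝ) = -(1 / 2) + -(1 / 4) by norm_num, ← ofReal_rpow_mul hτ.1]
          ring
      _ = (c1 * κ * D) * ∫⁻ τ in Ioo 0 t, (q (t - τ) ^ (-(1 / 2) : ℝ) * q τ ^ (-(3 / 4) : ℝ)) :=
          lintegral_const_mul _ (by fun_prop)
      _ ≤ (c1 * κ * D) * (B1 * q t ^ (1 - 1 / 2 - 3 / 4 : ℝ)) := mul_le_mul_right (hb1 t ht) _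
      _ = (c1 * B1) * κ * D * q t ^ (-(1 / 4) : ℝ) := by
          rw [show (1 - 1 / 2 - 3 / 4 : ℝ) = -(1 / 4) by norm_num]; ring
      _ ≤ _ := by gcongr
  · rw [lintegral_nl hmeas]
    calc _ ≤ ∫⁻ τ in Ioo 0 t, (c2 * κ * N) *
          (q (t - τ) ^ (-(7 / 8) : ℝ) * q τ ^ (-(7 / 8) : ℝ)) := by
          refine setLIntegral_mono' measurableSet_Ioo fun τ hτ => ?_
          have hs : 0 < t - τ := sub_pos.2 hτ.2
          have : J τ ^ 2 ≤ (c1 * C2 ^ (1 / 2 : ℝ)) * (D * N) * N ^ 2 *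
              (q (t - τ) ^ (-(7 / 4) : ℝ) * q τ ^ (-(7 / 4) : ℝ)) := by
            rw [sq]
            refine (mul_le_mul' (hJ1 τ hτ) (hJ2' τ hτ)).trans ?_
            calc _ = (c1 * C2 ^ (1 / 2 : ℝ)) * (q (t - τ) ^ (-(1 / 2) : ℝ) *
                  q (t - τ) ^ (-(5 / 4) : ℝ)) * (m τ ^ 2) * m τ * N := by ring
              _ ≤ (c1 * C2 ^ (1 / 2 : ℝ)) * (q (t - τ) ^ (-(1 / 2) : ℝ) *
                  q (t - τ) ^ (-(5 / 4) : ℝ)) * (D * N * q τ ^ (-1 : ℝ)) *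
                  (N * q τ ^ (-(3 / 4) : ℝ)) * N := by
                  gcongr
                  · exact hA.mid hτ.1
                  · exact hA.long τ hτ.1
              _ = _ := by
                  rw [show (-(7 / 4) : ℝ) = -(1 / 2) + -(5 / 4) by norm_num,
                    ← ofReal_rpow_mul hs, show (-(1 / 2) + -(5 / 4) : ℝ) = -1 + -(3 / 4) by
                    norm_num, ← ofReal_rpow_mul hτ.1]
                  ring
          refine (le_rpow_half_of_sq_le this).trans (le_of_eq ?_)
          rw [mul_rpow_of_nonneg _ _ (by norm_num), mul_rpow_of_nonneg _ _ (by norm_num),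
            mul_rpow_of_nonneg _ _ (by norm_num),
            mul_rpow_of_nonneg (q (t - τ) ^ _) _ (by norm_num), ← hc2, ← hκ,
            ← rpow_natCast, ← rpow_mul, ← rpow_mul,
            ← rpow_mul]
          norm_num
      _ = (c2 * κ * N) * ∫⁻ τ in Ioo 0 t, (q (t - τ) ^ (-(7 / 8) : ℝ) * q τ ^ (-(7 / 8) : ℝ)) :=
          lintegral_const_mul _ (by fun_prop)
      _ ≤ (c2 * κ * N) * (B2 * q t ^ (1 - 7 / 8 - 7 / 8 : ℝ)) := mul_le_mul_right (hb2 t ht) _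
      _ = (c2 * B2) * κ * N * q t ^ (-(3 / 4) : ℝ) := by
          rw [show (1 - 7 / 8 - 7 / 8 : ℝ) = -(3 / 4) by norm_num]; ring
      _ ≤ _ := by gcongr
  · set w : ℝ → ℝ≥0∞ := fun τ => q (t - τ) ^ (-(1 / 2) : ℝ) * q τ ^ (-(1 / 2) : ℝ) with hw
    have hwm : Measurable w := by fun_prop
    have hB : ∫⁻ τ in Ioo 0 t, w τ ≤ B3 := by
      have := hb3 t ht
      rwa [show (1 - 1 / 2 - 1 / 2 : ℝ) = 0 by norm_num, rpow_zero, mul_one] at this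
    have hpt : ∀ ξ, nl c A (t, ξ) ^ 2 ≤ (c1 ^ 2 * B3) * ∫⁻ τ in Ioo 0 t,
        w τ * (q τ ^ (1 / 2 : ℝ) * sconv A τ ξ) ^ 2 := by
      intro ξ
      have hm1 : Measurable fun τ => sconv A τ ξ :=
        (measurable_sconv hmeas).comp measurable_prodMk_right
      have : nl c A (t, ξ) ≤ c1 * ∫⁻ τ in Ioo 0 t, w τ * (q τ ^ (1 / 2 : ℝ) * sconv A τ ξ) := by
        rw [nl_eq, ← lintegral_const_mul _ (by fun_prop)]
        refine setLIntegral_mono' measurableSet_Ioo fun τ hτ => ?_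
        refine (mul_le_mul_left (hk_mul_norm_le hc (sub_pos.2 hτ.2) ξ) _).trans (le_of_eq ?_)
        have e : q τ ^ (-(1 / 2) : ℝ) * q τ ^ (1 / 2 : ℝ) = 1 := by
          rw [ofReal_rpow_mul hτ.1]; norm_num
        calc _ = c1 * (q (t - τ) ^ (-(1 / 2) : ℝ) * 1 * sconv A τ ξ) := by rw [mul_one, mul_assoc]
          _ = _ := by rw [← e]; ring
      refine (pow_le_pow_left' this 2).trans ?_
      rw [mul_pow, mul_assoc]
      refine mul_le_mul_right ((lintegral_weight_mul_sq_le hwm.aemeasurable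
        (by fun_prop)).trans (mul_le_mul_left hB _)) _
    refine (lintegral_mono hpt).trans ?_
    have hm2 : Measurable fun p : E3 × ℝ => w p.2 * (q p.2 ^ (1 / 2 : ℝ) * sconv A p.2 p.1) ^ 2 := by
      have := (measurable_sconv hmeas).comp (measurable_swap (α := E3) (β := ℝ))
      fun_prop
    rw [lintegral_const_mul _ hm2.lintegral_prod_right', lintegral_lintegral_swap hm2.aemeasurable]
    calc _ ≤ (c1 ^ 2 * B3) * ∫⁻ τ in Ioo 0 t, w τ * (κ ^ 2 * N ^ 2) := by
          refine mul_le_mul_right (setLIntegral_mono' measurableSet_Ioo fun τ hτ => ?_) _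
          change ∫⁻ ξ, w τ * (q τ ^ (1 / 2 : ℝ) * sconv A τ ξ) ^ 2 ≤ _
          rw [lintegral_const_mul _ (by have := hscm τ; fun_prop)]
          refine mul_le_mul_right ?_ _
          simp_rw [mul_pow]
          rw [lintegral_const_mul _ (by have := hscm τ; fun_prop)]
          calc _ ≤ (q τ ^ (1 / 2 : ℝ)) ^ 2 * ((D * N * q τ ^ (-1 : ℝ)) * N ^ 2) := by
                refine mul_le_mul_right ((lintegral_sconv_sq hmeas τ).trans
                  (mul_le_mul' (hA.mid hτ.1) (hA.l2 τ hτ.1))) _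
            _ = (q τ ^ (1 : ℝ) * q τ ^ (-1 : ℝ)) * (D * N * N ^ 2) := by
                rw [half_sq, rpow_one]; ring
            _ = _ := by rw [ofReal_rpow_mul hτ.1, hκ, half_sq]; norm_num
      _ ≤ (c1 ^ 2 * B3) * (B3 * (κ ^ 2 * N ^ 2)) := by
          rw [lintegral_mul_const _ hwm]
          gcongr
      _ = (c1 * B3 * κ * N) ^ 2 := by ring
      _ ≤ _ := by gcongr

theorem lintegral_hk_time_le (hc : 0 < c) (ξ : E3) :
    ∫⁻ s in R₊, ofReal (hk c s ξ * ‖ξ‖ ^ 2) ≤ ofReal c⁻¹ := by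
  by_cases hξ : ξ = 0
  · simp [hξ]
  have hpos : 0 < ‖ξ‖ ^ 2 := by positivity
  have hneg : -(c * ‖ξ‖ ^ 2) < 0 := by nlinarith [mul_pos hc hpos]
  have he : ∀ s : ℝ, hk c s ξ * ‖ξ‖ ^ 2 = exp (-(c * ‖ξ‖ ^ 2) * s) * ‖ξ‖ ^ 2 := fun s => by
    rw [hk]; congr 2; ring
  simp_rw [he]
  rw [← ofReal_integral_eq_lintegral_ofReal
    ((integrableOn_exp_mul_Ioi hneg 0).mul_const _) (.of_forall fun s => by positivity),
    integral_mul_const, integral_exp_mul_Ioi hneg]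
  refine ofReal_le_ofReal (le_of_eq ?_)
  simp
  field_simp

theorem exists_lin_bound (hc : 0 < c) : ∃ K : ℝ≥0∞, K ≠ ∞ ∧ ∀ B : E3 → ℝ≥0∞,
    Measurable B → ∀ t : ℝ, 0 < t → ∫⁻ ξ, ofReal (hk c t ξ) * B ξ ≤
        K * (∫⁻ ξ, (‖ξ‖ₑ * B ξ) ^ 2) ^ (1 / 2 : ℝ) * ofReal t ^ (-(1 / 4) : ℝ) ∧
      ∫⁻ ξ, ofReal (hk c t ξ) * B ξ ≤
        K * (∫⁻ ξ, B ξ ^ 2) ^ (1 / 2 : ℝ) * ofReal t ^ (-(3 / 4) : ℝ) ∧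
      ∫⁻ ξ, (ofReal (hk c t ξ) * B ξ) ^ 2 ≤ ∫⁻ ξ, B ξ ^ 2 := by
  obtain ⟨C0, hC0, h0⟩ := exists_lintegral_hk_pow hc (q := 0) (by norm_num)
  obtain ⟨C1, hC1, h1⟩ := exists_lintegral_hk_pow hc (q := -1) (by norm_num)
  have ht0 := rpow_ne_top_of_nonneg (by norm_num : (0 : ℝ) ≤ 1 / 2) hC0
  have ht1 := rpow_ne_top_of_nonneg (by norm_num : (0 : ℝ) ≤ 1 / 2) hC1
  refine ⟨C0 ^ (1 / 2 : ℝ) + C1 ^ (1 / 2 : ℝ), add_ne_top.2 ⟨ht0, ht1⟩,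
    fun B hB t ht => ⟨?_, ?_, ?_⟩⟩
  · have hae : ∀ᵐ ξ : E3, ofReal (hk c t ξ) * B ξ =
        ofReal (hk c t ξ * ‖ξ‖ ^ (-1 : ℝ)) * (‖ξ‖ₑ * B ξ) := by
      have : ∀ᵐ ξ : E3, ξ ≠ 0 := by simp [ae_iff, measure_singleton]
      filter_upwards [this] with ξ hξ
      rw [← mul_assoc, ← ofReal_norm, ← ofReal_mul (by
        have := hk_pos c t ξ; positivity), Real.rpow_neg_one]
      congr 2
      field_simp
    rw [lintegral_congr_ae hae]
    refine (le_rpow_half_of_sq_le (lintegral_mul_sq_le (by unfold hk; fun_prop)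
      (by fun_prop))).trans ?_
    rw [h1 t ht, mul_rpow_of_nonneg _ _ (by norm_num),
      mul_rpow_of_nonneg _ _ (by norm_num), ← rpow_mul, mul_right_comm]
    norm_num
    gcongr
    simp
  · refine (le_rpow_half_of_sq_le (lintegral_mul_sq_le (by unfold hk; fun_prop)
      (by fun_prop))).trans ?_
    have := h0 t ht
    simp only [Real.rpow_zero, mul_one] at this
    rw [this, mul_rpow_of_nonneg _ _ (by norm_num),
      mul_rpow_of_nonneg _ _ (by norm_num), ← rpow_mul, mul_right_comm]
    norm_num
    gcongr
    simp
  · refine lintegral_mono fun ξ => pow_le_pow_left' ?_ 2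
    calc _ ≤ 1 * B ξ := by
          gcongr
          exact ofReal_le_one.2 (hk_le_one (by positivity) ξ)
      _ = _ := one_mul _

/-- The linear part of the majorant. -/
def lin (c : ℝ) (B : E3 → ℝ≥0∞) (p : ST) : ℝ≥0∞ := ofReal (hk c p.1 p.2) * B p.2

/-- The Picard iterates of the scalar majorant. -/
def maj (c : ℝ) (K : ℝ≥0∞) (B : E3 → ℝ≥0∞) : ℕ → ST → ℝ≥0∞
  | 0 => 0
  | n + 1 => fun p => lin c B p + K * nl c (maj c K B n) p

/-- The supremum of the scalar Picard iterates. -/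
def majSup (c : ℝ) (K : ℝ≥0∞) (B : E3 → ℝ≥0∞) (p : ST) : ℝ≥0∞ := ⨆ n, maj c K B n p

theorem measurable_lin (c : ℝ) {B : E3 → ℝ≥0∞} (hB : Measurable B) : Measurable (lin c B) := by
  unfold lin hk; fun_prop

theorem measurable_maj (c : ℝ) (K : ℝ≥0∞) {B : E3 → ℝ≥0∞} (hB : Measurable B) (n : ℕ) :
    Measurable (maj c K B n) := by
  induction n with
  | zero => exact measurable_const
  | succ n ih => exact (measurable_lin c hB).add ((measurable_nl c ih).const_mul K)

theorem maj_mono (c : ℝ) (K : ℝ≥0∞) (B : E3 → ℝ≥0∞) : Monotone (maj c K B) := by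
  refine monotone_nat_of_le_succ fun n => ?_
  induction n with
  | zero => exact fun p => zero_le
  | succ n ih => exact fun p => add_le_add_right (mul_le_mul_right (nl_mono c ih p) K) _

theorem maj_le_majSup (c : ℝ) (K : ℝ≥0∞) (B : E3 → ℝ≥0∞) (n : ℕ) :
    maj c K B n ≤ majSup c K B := fun p => le_iSup (fun n => maj c K B n p) n

theorem majSup_le (c : ℝ) (K : ℝ≥0∞) (B : E3 → ℝ≥0∞) (p : ST) :
    majSup c K B p ≤ lin c B p + K * nl c (majSup c K B) p := by
  refine iSup_le fun n => ?_
  cases n with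
  | zero => exact zero_le
  | succ n => exact add_le_add_right (mul_le_mul_right (nl_mono c (maj_le_majSup c K B n) p) K) _

theorem exists_fbd_majSup (hc : 0 < c) {K : ℝ≥0∞} (hK : K ≠ ∞) :
    ∃ K₀ κ : ℝ≥0∞, K₀ ≠ ∞ ∧ 0 < κ ∧ ∀ (B : E3 → ℝ≥0∞) (δ N : ℝ≥0∞), Measurable B →
      ∫⁻ ξ, (‖ξ‖ₑ * B ξ) ^ 2 ≤ δ ^ 2 → ∫⁻ ξ, B ξ ^ 2 ≤ N ^ 2 → δ * N ≤ κ →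
      FBd (majSup c K B) (K₀ * δ) (K₀ * N) := by
  obtain ⟨K1, hK1, hnl⟩ := exists_nl_bound hc
  obtain ⟨K2, hK2, hlin⟩ := exists_lin_bound hc
  set L : ℝ≥0∞ := 2 * (K2 + 1) with hL
  have hLt : L ≠ ∞ := by simp [hL, mul_eq_top, hK2]
  have hden : K * K1 * L ≠ ∞ := mul_ne_top (mul_ne_top hK hK1) hLt
  refine ⟨L, ((2 * (K * K1 * L + 1))⁻¹) ^ 2, hLt, ?_, fun B δ N hB hδ hN hκ => ?_⟩
  · refine ENNReal.pow_pos (ENNReal.inv_pos.2 ?_) 2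
    exact mul_ne_top (by norm_num) (add_ne_top.2 ⟨hden, one_ne_top⟩)
  have hsm : K * K1 * (L * δ * (L * N)) ^ (1 / 2 : ℝ) ≤ 2⁻¹ := by
    have e : (L * δ * (L * N)) ^ (1 / 2 : ℝ) ≤ L * (2 * (K * K1 * L + 1))⁻¹ := by
      calc _ ≤ ((L * (2 * (K * K1 * L + 1))⁻¹) ^ 2) ^ (1 / 2 : ℝ) := by
            refine rpow_le_rpow ?_ (by norm_num)
            calc _ = L ^ 2 * (δ * N) := by ring
              _ ≤ L ^ 2 * ((2 * (K * K1 * L + 1))⁻¹) ^ 2 := mul_le_mul_right hκ _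
              _ = _ := by ring
        _ = _ := by rw [← rpow_natCast, ← rpow_mul]; norm_num
    refine (mul_le_mul_right e _).trans ?_
    rw [ENNReal.mul_inv (by simp) (by simp)]
    calc _ = (K * K1 * L) * (K * K1 * L + 1)⁻¹ * 2⁻¹ := by ring
      _ ≤ 1 * 2⁻¹ := by
          gcongr
          exact div_le_of_le_mul (by rw [one_mul]; exact le_self_add)
      _ = _ := one_mul _
  have hδ' : (∫⁻ ξ, (‖ξ‖ₑ * B ξ) ^ 2) ^ (1 / 2 : ℝ) ≤ δ := by
    refine (rpow_le_rpow hδ (by norm_num)).trans (le_of_eq ?_)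
    rw [← rpow_natCast, ← rpow_mul]; norm_num
  have hN' : (∫⁻ ξ, B ξ ^ 2) ^ (1 / 2 : ℝ) ≤ N := by
    refine (rpow_le_rpow hN (by norm_num)).trans (le_of_eq ?_)
    rw [← rpow_natCast, ← rpow_mul]; norm_num
  have hhalf : ∀ x : ℝ≥0∞, K2 * x + 2⁻¹ * (L * x) ≤ L * x := fun x => by
    have : 2⁻¹ * (L * x) = (K2 + 1) * x := by
      rw [hL, mul_assoc, ← mul_assoc, ENNReal.inv_mul_cancel (by norm_num) (by norm_num), one_mul]
    rw [this, hL]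
    calc K2 * x + (K2 + 1) * x ≤ (K2 + 1) * x + (K2 + 1) * x := by gcongr; exact le_self_add
      _ = _ := by ring
  have hn : ∀ n, FBd (maj c K B n) (L * δ) (L * N) := by
    intro n
    induction n with
    | zero => exact ⟨measurable_const, fun t _ => by simp [maj], fun t _ => by simp [maj],
        fun t _ => by simp [maj]⟩
    | succ n ih =>
      have hm := measurable_nl c ih.meas
      have hmt : ∀ t : ℝ, Measurable fun ξ => nl c (maj c K B n) (t, ξ) := by fun_prop
      have hlt : ∀ t : ℝ, Measurable fun ξ => lin c B (t, ξ) := fun t =>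
        (measurable_lin c hB).comp measurable_prodMk_left
      refine ⟨measurable_maj c K hB _, fun t ht => ?_, fun t ht => ?_, fun t ht => ?_⟩
      all_goals
        obtain ⟨a1, a2, a3⟩ := hnl _ _ _ ih t ht
        obtain ⟨b1, b2, b3⟩ := hlin B hB t ht
        simp only [maj]
      · rw [lintegral_add_left (hlt t), lintegral_const_mul _ (hmt t)]
        calc _ ≤ K2 * δ * ofReal t ^ (-(1 / 4) : ℝ) + K * (K1 *
              (L * δ * (L * N)) ^ (1 / 2 : ℝ) * (L * δ) * ofReal t ^ (-(1 / 4) : ℝ)) :=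
              add_le_add (b1.trans (by gcongr)) (mul_le_mul_right a1 K)
          _ = (K2 * δ + (K * K1 * (L * δ * (L * N)) ^ (1 / 2 : ℝ)) * (L * δ)) *
              ofReal t ^ (-(1 / 4) : ℝ) := by ring
          _ ≤ (K2 * δ + 2⁻¹ * (L * δ)) * ofReal t ^ (-(1 / 4) : ℝ) := by gcongr
          _ ≤ _ := mul_le_mul_left (hhalf δ) _
      · rw [lintegral_add_left (hlt t), lintegral_const_mul _ (hmt t)]
        calc _ ≤ K2 * N * ofReal t ^ (-(3 / 4) : ℝ) + K * (K1 *
              (L * δ * (L * N)) ^ (1 / 2 : ℝ) * (L * N) * ofReal t ^ (-(3 / 4) : ℝ)) :=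
              add_le_add (b2.trans (by gcongr)) (mul_le_mul_right a2 K)
          _ = (K2 * N + (K * K1 * (L * δ * (L * N)) ^ (1 / 2 : ℝ)) * (L * N)) *
              ofReal t ^ (-(3 / 4) : ℝ) := by ring
          _ ≤ (K2 * N + 2⁻¹ * (L * N)) * ofReal t ^ (-(3 / 4) : ℝ) := by gcongr
          _ ≤ _ := mul_le_mul_left (hhalf N) _
      · have hsq : ∀ x y : ℝ≥0∞, (x + y) ^ 2 ≤ 2 * x ^ 2 + 2 * y ^ 2 := fun x y => by
          have := rpow_add_le_mul_rpow_add_rpow x y (one_le_two : (1 : ℝ) ≤ 2)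
          norm_num at this
          rwa [← mul_add]
        refine (lintegral_mono fun ξ => hsq _ _).trans ?_
        rw [lintegral_add_left (by have := hlt t; fun_prop),
          lintegral_const_mul _ (by have := hlt t; fun_prop),
          lintegral_const_mul _ (by have := hmt t; fun_prop)]
        simp_rw [mul_pow K]
        rw [lintegral_const_mul _ (by have := hmt t; fun_prop)]
        calc _ ≤ 2 * (2⁻¹ * (L * N)) ^ 2 + 2 * (K ^ 2 *
              (K1 * (L * δ * (L * N)) ^ (1 / 2 : ℝ) * (L * N)) ^ 2) := by
              refine add_le_add (mul_le_mul_right ((b3.trans hN).trans ?_) _) (by gcongr)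
              refine pow_le_pow_left' ?_ 2
              rw [hL, ← mul_assoc, ← mul_assoc, ENNReal.inv_mul_cancel (by norm_num) (by norm_num),
                one_mul, add_mul, one_mul]
              simp
          _ = 2 * (2⁻¹ * (L * N)) ^ 2 + 2 *
              ((K * K1 * (L * δ * (L * N)) ^ (1 / 2 : ℝ)) * (L * N)) ^ 2 := by ring
          _ ≤ 2 * (2⁻¹ * (L * N)) ^ 2 + 2 * (2⁻¹ * (L * N)) ^ 2 := by gcongr
          _ = (2 * 2⁻¹) * (2 * 2⁻¹) * (L * N) ^ 2 := by ring
          _ = _ := by rw [ENNReal.mul_inv_cancel (by norm_num) (by norm_num)]; ring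
  have hmono : ∀ t : ℝ, Monotone fun n ξ => maj c K B n (t, ξ) := fun t m n hmn ξ =>
    maj_mono c K B hmn (t, ξ)
  have hmn : ∀ (t : ℝ) n, Measurable fun ξ => maj c K B n (t, ξ) := fun t n =>
    (hn n).meas.comp measurable_prodMk_left
  refine ⟨Measurable.iSup fun n => (hn n).meas, fun t ht => ?_, fun t ht => ?_, fun t ht => ?_⟩
  all_goals simp only [majSup]
  · rw [lintegral_iSup (hmn t) (hmono t)]
    exact iSup_le fun n => (hn n).short t ht
  · rw [lintegral_iSup (hmn t) (hmono t)]
    exact iSup_le fun n => (hn n).long t ht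
  · simp_rw [iSup_pow]
    rw [lintegral_iSup (fun n => (hmn t n).pow_const 2)
      fun m n hmn ξ => pow_le_pow_left' (hmono t hmn ξ) 2]
    exact iSup_le fun n => (hn n).l2 t ht

theorem FBd.lintegral_rpow_lt_top (h : FBd A D N)
    (hD : D ≠ ∞) (hN : N ≠ ∞) {p : ℝ} (hp : 4 / 3 < p) (hp' : p < 4) :
    ∫⁻ t in R₊, (∫⁻ ξ, A (t, ξ)) ^ p < ∞ := by
  have hp0 : 0 ≤ p := by linarith
  rw [← Ioc_union_Ioi_eq_Ioi (zero_le_one (α := ℝ))]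
  refine (lintegral_union_le _ _ _).trans_lt (add_lt_top.2 ⟨?_, ?_⟩)
  · rw [setLIntegral_congr Ioo_ae_eq_Ioc.symm]
    calc _ ≤ ∫⁻ t in Ioo (0 : ℝ) 1, D ^ p * ofReal t ^ (-(p / 4)) := by
          refine setLIntegral_mono' measurableSet_Ioo fun t ht => ?_
          refine (rpow_le_rpow (h.short t ht.1) hp0).trans (le_of_eq ?_)
          rw [mul_rpow_of_nonneg _ _ hp0, ← rpow_mul]
          congr 2; ring
      _ < ∞ := by
          rw [lintegral_const_mul _ (by fun_prop), lintegral_rpow_Ioo (by linarith) one_pos]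
          simpa using mul_lt_top (rpow_lt_top_of_nonneg hp0 hD) ofReal_lt_top
  · calc _ ≤ ∫⁻ t in Ioi (1 : ℝ), N ^ p * ofReal (t ^ (-(3 / 4 * p))) := by
          refine setLIntegral_mono' measurableSet_Ioi fun t ht => ?_
          have ht0 : 0 < t := by grind
          refine (rpow_le_rpow (h.long t ht0) hp0).trans (le_of_eq ?_)
          rw [mul_rpow_of_nonneg _ _ hp0, ← rpow_mul, ← ofReal_rpow_of_pos ht0]
          congr 2; ring
      _ < ∞ := by
          rw [lintegral_const_mul _ (by fun_prop)]
          refine mul_lt_top (rpow_lt_top_of_nonneg hp0 hN) ?_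
          exact (integrableOn_Ioi_rpow_of_lt (by linarith) one_pos).lintegral_lt_top

theorem lintegral_kr_left (hc : 0 < c) (t : ℝ) (ξ : E3) :
    ∫⁻ τ, ofReal (kr c t τ ξ * ‖ξ‖ ^ 2) ≤ ofReal c⁻¹ := by
  have : ∫⁻ τ, ofReal (kr c t τ ξ * ‖ξ‖ ^ 2) =
      ∫⁻ τ in Ioo 0 t, ofReal (hk c (t - τ) ξ * ‖ξ‖ ^ 2) := by
    rw [← lintegral_indicator measurableSet_Ioo]
    refine lintegral_congr fun τ => ?_
    by_cases h : τ ∈ Ioo 0 t <;> simp [kr, h]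
  rw [this, lintegral_Ioo_reflect (fun s => ofReal (hk c s ξ * ‖ξ‖ ^ 2)) t]
  exact (lintegral_mono_set Ioo_subset_Ioi_self).trans (lintegral_hk_time_le hc ξ)

theorem lintegral_kr_right (hc : 0 < c) (τ : ℝ) (ξ : E3) :
    ∫⁻ t, ofReal (kr c t τ ξ * ‖ξ‖ ^ 2) ≤ ofReal c⁻¹ := by
  refine le_trans ?_ (lintegral_hk_time_le hc ξ)
  rw [← lintegral_indicator measurableSet_Ioi, ← lintegral_sub_right_eq_self
      ((Ioi 0).indicator fun s => ofReal (hk c s ξ * ‖ξ‖ ^ 2)) τ]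
  refine lintegral_mono fun t => ?_
  by_cases h : τ ∈ Ioo 0 t
  · rw [indicator_of_mem (show t - τ ∈ Ioi (0 : ℝ) from sub_pos.2 h.2), kr, indicator_of_mem h]
  · simp [kr, h]

theorem lintegral_grad_lin_lt_top (hc : 0 < c) {B : E3 → ℝ≥0∞} (hB : Measurable B)
    (hBN : ∫⁻ ξ, B ξ ^ 2 ≠ ∞) :
    ∫⁻ t in R₊, ∫⁻ ξ, (‖ξ‖ₑ * lin c B (t, ξ)) ^ 2 < ∞ := by
  have hlm := measurable_lin c hB
  have hm1 : Measurable fun p : ST => (‖p.2‖ₑ * lin c B p) ^ 2 := by fun_prop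
  rw [lintegral_lintegral_swap hm1.aemeasurable]
  have : ∀ ξ : E3, ∫⁻ t in R₊, (‖ξ‖ₑ * lin c B (t, ξ)) ^ 2 ≤ B ξ ^ 2 * ofReal c⁻¹ := fun ξ => by
    calc _ ≤ ∫⁻ t in R₊, B ξ ^ 2 * ofReal (hk c t ξ * ‖ξ‖ ^ 2) := by
          refine setLIntegral_mono' measurableSet_Ioi fun t ht => ?_
          have h1 : ofReal (hk c t ξ) ≤ 1 := ofReal_le_one.2 (hk_le_one (mul_pos hc ht).le ξ)
          rw [lin, ofReal_mul (hk_pos _ _ _).le, ofReal_pow (norm_nonneg _), ofReal_norm]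
          calc _ = B ξ ^ 2 * (ofReal (hk c t ξ) * ‖ξ‖ₑ ^ 2) *
                ofReal (hk c t ξ) := by ring
            _ ≤ B ξ ^ 2 * (ofReal (hk c t ξ) * ‖ξ‖ₑ ^ 2) * 1 := by gcongr
            _ = _ := mul_one _
      _ = B ξ ^ 2 * ∫⁻ t in R₊, ofReal (hk c t ξ * ‖ξ‖ ^ 2) :=
          lintegral_const_mul _ (by unfold hk; fun_prop)
      _ ≤ _ := mul_le_mul_right (lintegral_hk_time_le hc ξ) _
  refine (lintegral_mono this).trans_lt ?_
  rw [lintegral_mul_const _ (by fun_prop)]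
  exact mul_lt_top hBN.lt_top ofReal_lt_top

theorem FBd.lintegral_grad_nl_lt_top (hc : 0 < c) (h : FBd A D N) (hD : D ≠ ∞) (hN : N ≠ ∞) :
    ∫⁻ t in R₊, ∫⁻ ξ, (‖ξ‖ₑ * nl c A (t, ξ)) ^ 2 < ∞ := by
  have hnm := measurable_nl c h.meas
  have hsm := measurable_sconv h.meas
  have hm2 : Measurable fun p : ST => (‖p.2‖ₑ * nl c A p) ^ 2 := by fun_prop
  have hkm := measurable_kr c
  rw [lintegral_lintegral_swap hm2.aemeasurable]
  have hkt : ∀ ξ : E3, Measurable fun q : ℝ × ℝ => kr c q.1 q.2 ξ := fun ξ =>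
    hkm.comp (by fun_prop : Measurable fun q : ℝ × ℝ => ((q.1, ξ), q.2))
  have hst : ∀ ξ : E3, Measurable fun τ => sconv A τ ξ := by fun_prop
  have h1 : ∀ (ξ : E3) (t : ℝ), (‖ξ‖ₑ * nl c A (t, ξ)) ^ 2 ≤ ofReal c⁻¹ *
      ∫⁻ τ in R₊, ofReal (kr c t τ ξ * ‖ξ‖ ^ 2) * sconv A τ ξ ^ 2 := by
    intro ξ t
    have e : ‖ξ‖ₑ * nl c A (t, ξ) = ∫⁻ τ in R₊, ofReal (kr c t τ ξ * ‖ξ‖ ^ 2) * sconv A τ ξ := by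
      rw [nl, ← lintegral_const_mul _ (by fun_prop), ← lintegral_indicator measurableSet_Ioi]
      refine lintegral_congr fun τ => ?_
      by_cases hτ : τ ∈ Ioi (0 : ℝ)
      · rw [indicator_of_mem hτ, ← ofReal_norm, ← mul_assoc, ← ofReal_mul (norm_nonneg _)]
        congr 2; ring
      · have : kr c t τ ξ = 0 := indicator_of_notMem (fun h' => hτ h'.1) _
        rw [indicator_of_notMem hτ]
        simp [this]
    rw [e]
    refine (lintegral_weight_mul_sq_le (by fun_prop) (by fun_prop)).trans ?_
    exact mul_le_mul_left ((setLIntegral_le_lintegral _ _).trans (lintegral_kr_left hc t ξ)) _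
  have h2 : ∀ ξ : E3, ∫⁻ t in R₊, (‖ξ‖ₑ * nl c A (t, ξ)) ^ 2 ≤
      ofReal c⁻¹ * (ofReal c⁻¹ * ∫⁻ τ in R₊, sconv A τ ξ ^ 2) := by
    intro ξ
    have hm : Measurable fun q : ℝ × ℝ =>
        ofReal (kr c q.1 q.2 ξ * ‖ξ‖ ^ 2) * sconv A q.2 ξ ^ 2 := by fun_prop
    refine (lintegral_mono (h1 ξ)).trans ?_
    rw [lintegral_const_mul _ (lintegral_prod_right' hm), lintegral_lintegral_swap hm.aemeasurable]
    refine mul_le_mul_right ?_ _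
    rw [← lintegral_const_mul _ (by fun_prop)]
    refine lintegral_mono fun τ => ?_
    change ∫⁻ t in R₊, ofReal (kr c t τ ξ * ‖ξ‖ ^ 2) * sconv A τ ξ ^ 2 ≤ _
    rw [lintegral_mul_const _ (by fun_prop)]
    exact mul_le_mul_left ((setLIntegral_le_lintegral _ _).trans (lintegral_kr_right hc τ ξ)) _
  refine (lintegral_mono h2).trans_lt ?_
  have hsm2 : Measurable fun q : E3 × ℝ => sconv A q.2 q.1 ^ 2 :=
    (hsm.comp (measurable_swap (α := E3) (β := ℝ))).pow_const 2
  rw [lintegral_const_mul' _ _ ofReal_ne_top, lintegral_const_mul' _ _ ofReal_ne_top,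
    lintegral_lintegral_swap hsm2.aemeasurable]
  refine mul_lt_top ofReal_lt_top (mul_lt_top ofReal_lt_top ?_)
  have hp := h.lintegral_rpow_lt_top hD hN (p := 2) (by norm_num) (by norm_num)
  simp only [rpow_two] at hp
  calc _ ≤ ∫⁻ τ in R₊, (∫⁻ ξ, A (τ, ξ)) ^ 2 * N ^ 2 := by
        refine setLIntegral_mono' measurableSet_Ioi fun τ hτ => ?_
        exact (lintegral_sconv_sq h.meas τ).trans (mul_le_mul_right (h.l2 τ hτ) _)
    _ = (∫⁻ τ in R₊, (∫⁻ ξ, A (τ, ξ)) ^ 2) * N ^ 2 := lintegral_mul_const' _ _ (pow_ne_top hN)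
    _ < ∞ := mul_lt_top hp (pow_lt_top hN.lt_top)

theorem lintegral_comb_lt_top {F G : ST → ℝ≥0∞} (hF : Measurable F)
    {x y : ℝ≥0∞} (hx : x ≠ ∞) (hy : y ≠ ∞) (h1 : ∫⁻ t in R₊, ∫⁻ ξ, F (t, ξ) < ∞)
    (h2 : ∫⁻ t in R₊, ∫⁻ ξ, G (t, ξ) < ∞) :
    ∫⁻ t in R₊, ∫⁻ ξ, (x * F (t, ξ) + y * G (t, ξ)) < ∞ := by
  have e : ∀ t : ℝ, ∫⁻ ξ, (x * F (t, ξ) + y * G (t, ξ)) =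
      x * (∫⁻ ξ, F (t, ξ)) + y * ∫⁻ ξ, G (t, ξ) := fun t => by
    have a1 : Measurable fun ξ => F (t, ξ) := by fun_prop
    rw [lintegral_add_left (a1.const_mul x), lintegral_const_mul' _ _ hx,
      lintegral_const_mul' _ _ hy]
  have b1 : Measurable fun t => ∫⁻ ξ, F (t, ξ) := by fun_prop
  rw [lintegral_congr e, lintegral_add_left (b1.const_mul x), lintegral_const_mul' _ _ hx,
    lintegral_const_mul' _ _ hy]
  exact add_lt_top.2 ⟨mul_lt_top hx.lt_top h1, mul_lt_top hy.lt_top h2⟩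

theorem FBd.lintegral_grad_lt_top (hc : 0 < c) {K : ℝ≥0∞}
    (h : FBd A D N) (hD : D ≠ ∞) (hN : N ≠ ∞) (hK : K ≠ ∞) {B : E3 → ℝ≥0∞} (hB : Measurable B)
    (hBN : ∫⁻ ξ, B ξ ^ 2 ≠ ∞) (hle : ∀ p, A p ≤ lin c B p + K * nl c A p) :
    ∫⁻ t in R₊, ∫⁻ ξ, (‖ξ‖ₑ * A (t, ξ)) ^ 2 < ∞ := by
  have hlm := measurable_lin c hB
  have hsq : ∀ x y : ℝ≥0∞, (x + y) ^ 2 ≤ 2 * x ^ 2 + 2 * y ^ 2 := fun x y => by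
    have := rpow_add_le_mul_rpow_add_rpow x y (one_le_two : (1 : ℝ) ≤ 2)
    norm_num at this
    rwa [← mul_add]
  have hpt : ∀ p : ST, (‖p.2‖ₑ * A p) ^ 2 ≤
      2 * (‖p.2‖ₑ * lin c B p) ^ 2 + 2 * K ^ 2 * (‖p.2‖ₑ * nl c A p) ^ 2 := fun p => by
    calc _ ≤ (‖p.2‖ₑ * lin c B p + ‖p.2‖ₑ * (K * nl c A p)) ^ 2 := by
          rw [← mul_add]
          exact pow_le_pow_left' (mul_le_mul_right (hle p) _) 2
      _ ≤ _ := hsq _ _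
      _ = _ := by ring
  have hm1 : Measurable fun p : ST => (‖p.2‖ₑ * lin c B p) ^ 2 := by fun_prop
  have hl := lintegral_grad_lin_lt_top hc hB hBN
  have hnn := h.lintegral_grad_nl_lt_top hc hD hN
  refine (lintegral_mono fun t => lintegral_mono fun ξ => hpt (t, ξ)).trans_lt ?_
  exact lintegral_comb_lt_top (G := fun p => (‖p.2‖ₑ * nl c A p) ^ 2) hm1 ofNat_ne_top
    (mul_ne_top ofNat_ne_top (pow_ne_top hK)) hl hnn

theorem enorm_integral_sub_add_le {α E : Type*} [MeasurableSpace α] {μ : Measure α}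
    [NormedAddCommGroup E] [NormedSpace ℝ E] {f f' : α → E} {F F' : α → ℝ≥0∞}
    (hf : AEStronglyMeasurable f μ) (hf' : AEStronglyMeasurable f' μ)
    (h0 : ∀ x, ‖f x‖ₑ ≤ F x) (h0' : ∀ x, ‖f' x‖ₑ ≤ F' x) (h : ∀ x, ‖f' x - f x‖ₑ + F x ≤ F' x) :
    ‖(∫ x, f' x ∂μ) - ∫ x, f x ∂μ‖ₑ + ∫⁻ x, F x ∂μ ≤ ∫⁻ x, F' x ∂μ := by
  by_cases hF : ∫⁻ x, F' x ∂μ = ∞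
  · simp [hF]
  have i' : Integrable f' μ := ⟨hf', (lintegral_mono h0').trans_lt (lt_top_iff_ne_top.2 hF)⟩
  have i : Integrable f μ := ⟨hf, (lintegral_mono fun x =>
    (h0 x).trans (le_add_self.trans (h x))).trans_lt (lt_top_iff_ne_top.2 hF)⟩
  rw [← integral_sub i' i]
  calc _ ≤ ∫⁻ x, ‖f' x - f x‖ₑ ∂μ + ∫⁻ x, F x ∂μ := by
        gcongr; exact enorm_integral_le_lintegral_enorm _
    _ = ∫⁻ x, (‖f' x - f x‖ₑ + F x) ∂μ := (lintegral_add_left' (hf'.sub hf).enorm _).symm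
    _ ≤ _ := lintegral_mono h

/-- Tensor product of two complex vectors. -/
def tp (v w : C3) : Fin 3 → C3 := fun i j => v i * w j

theorem enorm_tp_le (v w : C3) : ‖tp v w‖ₑ ≤ ‖v‖ₑ * ‖w‖ₑ := by
  rw [← ofReal_norm, ← ofReal_norm, ← ofReal_norm, ← ofReal_mul (norm_nonneg _)]
  refine ofReal_le_ofReal ?_
  refine (pi_norm_le_iff_of_nonneg (by positivity)).2 fun i =>
    (pi_norm_le_iff_of_nonneg (by positivity)).2 fun j => ?_
  rw [tp, norm_mul]
  exact mul_le_mul (norm_le_pi_norm v i) (norm_le_pi_norm w j) (norm_nonneg _) (norm_nonneg _)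

theorem tp_sub_tp (v w v' w' : C3) : tp v' w' - tp v w = tp (v' - v) w' + tp v (w' - w) := by
  ext i j
  simp only [tp, Pi.sub_apply, Pi.add_apply]
  ring

theorem continuous_tp : Continuous fun q : C3 × C3 => tp q.1 q.2 := by
  unfold tp
  fun_prop

theorem tp_dom {v w v' w' : C3} {x y x' y' : ℝ≥0∞} (hv : ‖v‖ₑ ≤ x) (hw' : ‖w'‖ₑ ≤ y')
    (hx : ‖v' - v‖ₑ + x ≤ x') (hy : ‖w' - w‖ₑ + y ≤ y') :
    ‖tp v' w' - tp v w‖ₑ + x * y ≤ x' * y' := by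
  calc _ ≤ ‖v' - v‖ₑ * y' + x * ‖w' - w‖ₑ + x * y := by
        rw [tp_sub_tp]
        gcongr
        refine (enorm_add_le _ _).trans (add_le_add ((enorm_tp_le _ _).trans ?_)
          ((enorm_tp_le _ _).trans ?_)) <;> gcongr
    _ = ‖v' - v‖ₑ * y' + x * (‖w' - w‖ₑ + y) := by ring
    _ ≤ ‖v' - v‖ₑ * y' + x * y' := by gcongr
    _ = (‖v' - v‖ₑ + x) * y' := by ring
    _ ≤ _ := by gcongr

/-- Entries of the Leray projector. -/
def leray (ξ : E3) (k i : Fin 3) : ℝ := (if k = i then 1 else 0) - ξ k * ξ i / ‖ξ‖ ^ 2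

theorem abs_leray_le (ξ : E3) (k i : Fin 3) : |leray ξ k i| ≤ 2 := by
  have h : |ξ k * ξ i / ‖ξ‖ ^ 2| ≤ 1 := by
    rw [abs_div, abs_mul, abs_of_nonneg (sq_nonneg ‖ξ‖)]
    refine div_le_one_of_le₀ ?_ (sq_nonneg _)
    rw [sq]
    exact mul_le_mul (abs_coord_le ξ k) (abs_coord_le ξ i) (abs_nonneg _) (norm_nonneg _)
  have h' : |(if k = i then 1 else 0 : ℝ)| ≤ 1 := by split_ifs <;> simp
  exact (abs_sub _ _).trans (by linarith)

theorem sum_mul_leray (ξ : E3) (i : Fin 3) : ∑ k, ξ k * leray ξ k i = 0 := by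
  have hn : ‖ξ‖ ^ 2 = ∑ k, ξ k * ξ k := by rw [← inner_eq_sum, real_inner_self_eq_norm_sq]
  by_cases h : ξ = 0
  · simp [h]
  have h0 : ‖ξ‖ ^ 2 ≠ 0 := by simpa using h
  have : ∑ k, ξ k * leray ξ k i = ξ i - (∑ k, ξ k * ξ k) * ξ i / ‖ξ‖ ^ 2 := by
    simp only [leray, mul_sub, sum_sub_distrib, mul_ite, mul_one, mul_zero,
      Finset.sum_ite_eq', Finset.mem_univ, if_true, sum_mul, Finset.sum_div]
    congr 1
    exact sum_congr rfl fun k _ => by ring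
  rw [this, ← hn]
  field_simp
  ring

theorem measurable_leray (k i : Fin 3) : Measurable fun ξ => leray ξ k i := by
  unfold leray
  fun_prop

/-- Symbol of the projected divergence. -/
def sy (ξ : E3) (T : Fin 3 → C3) : C3 :=
  fun k => ∑ i, ∑ j, leray ξ k i * (2 * π * Complex.I * ξ j) * T i j

theorem sy_sub (ξ : E3) (T T' : Fin 3 → C3) : sy ξ T' - sy ξ T = sy ξ (T' - T) := by
  ext k
  simp only [sy, Pi.sub_apply, mul_sub, sum_sub_distrib]

theorem sum_mul_sy (ξ : E3) (T : Fin 3 → C3) : ∑ k, (ξ k : ℂ) * sy ξ T k = 0 := by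
  simp only [sy, mul_sum]
  rw [sum_comm]
  refine sum_eq_zero fun i _ => ?_
  rw [sum_comm]
  refine sum_eq_zero fun j _ => ?_
  have := congrArg (fun x : ℝ => (x : ℂ) * (2 * π * Complex.I * ξ j * T i j)) (sum_mul_leray ξ i)
  simp only [ofReal_sum, Complex.ofReal_mul, Complex.ofReal_zero, zero_mul, sum_mul] at this
  rw [← this]
  exact sum_congr rfl fun k _ => by ring

theorem continuous_sy (ξ : E3) : Continuous (sy ξ) := by
  unfold sy
  fun_prop

theorem measurable_sy : Measurable fun q : E3 × (Fin 3 → C3) => sy q.1 q.2 := by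
  have := measurable_leray
  unfold sy
  refine measurable_pi_lambda _ fun k => ?_
  refine measurable_sum _ fun i _ => measurable_sum _ fun j _ => ?_
  have h : Measurable fun q : E3 × (Fin 3 → C3) => (leray q.1 k i : ℂ) :=
    Complex.measurable_ofReal.comp ((this k i).comp measurable_fst)
  have h' : Measurable fun q : E3 × (Fin 3 → C3) => (q.1 j : ℂ) :=
    Complex.measurable_ofReal.comp (by fun_prop)
  have h'' : Measurable fun q : E3 × (Fin 3 → C3) => q.2 i j := by fun_prop
  exact (h.mul (h'.const_mul _)).mul h''

/-- Norm bound of the symbol of the projected divergence. -/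
def ksy : ℝ≥0∞ := ofReal (36 * π)

theorem ksy_ne_top : ksy ≠ ∞ := ofReal_ne_top

theorem ksy_ne_zero : ksy ≠ 0 := (ofReal_pos.2 (by positivity)).ne'

theorem enorm_sy_le (ξ : E3) (T : Fin 3 → C3) : ‖sy ξ T‖ₑ ≤ ksy * (‖ξ‖ₑ * ‖T‖ₑ) := by
  rw [ksy, ← ofReal_norm, ← ofReal_norm, ← ofReal_norm, ← ofReal_mul (norm_nonneg _),
    ← ofReal_mul (by positivity)]
  refine ofReal_le_ofReal ?_
  refine (pi_norm_le_iff_of_nonneg (by positivity)).2 fun k => ?_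
  calc ‖sy ξ T k‖ ≤ ∑ _i : Fin 3, ∑ _j : Fin 3, 2 * (2 * π * ‖ξ‖) * ‖T‖ := by
        refine (norm_sum_le _ _).trans (sum_le_sum fun i _ =>
          (norm_sum_le _ _).trans (sum_le_sum fun j _ => ?_))
        have h1 : ‖(leray ξ k i : ℂ)‖ ≤ 2 := by simpa using abs_leray_le ξ k i
        have h2 : ‖(ξ j : ℂ)‖ ≤ ‖ξ‖ := by simpa using abs_coord_le ξ j
        have h3 : ‖T i j‖ ≤ ‖T‖ := (norm_le_pi_norm (T i) j).trans (norm_le_pi_norm T i)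
        have h4 : ‖(2 * π * Complex.I : ℂ)‖ = 2 * π := by simp [abs_of_pos pi_pos]
        rw [norm_mul, norm_mul, norm_mul, h4]
        gcongr
    _ = _ := by simp; ring

/-- Self-convolution of a vector field in frequency. -/
def cv (a : ST → C3) (τ : ℝ) (ξ : E3) : Fin 3 → C3 :=
  ∫ η, tp (a (τ, η)) (a (τ, ξ - η))

/-- The projected nonlinearity in frequency. -/
def nf (a : ST → C3) (τ : ℝ) (ξ : E3) : C3 := sy ξ (cv a τ ξ)

/-- The right-hand side of Duhamel's formula in frequency. -/
def duh (c : ℝ) (b : E3 → C3) (a : ST → C3) (p : ST) : C3 :=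
  hk c p.1 p.2 • b p.2 + ∫ τ, kr c p.1 τ p.2 • nf a τ p.2

/-- Picard iterates. -/
def picard (c : ℝ) (b : E3 → C3) : ℕ → ST → C3
  | 0 => 0
  | n + 1 => duh c b (picard c b n)

theorem measurable_tp {α : Type*} [MeasurableSpace α] {f g : α → C3} (hf : Measurable f)
    (hg : Measurable g) : Measurable fun x => tp (f x) (g x) :=
  continuous_tp.measurable.comp (hf.prodMk hg)

theorem measurable_cv (ha : Measurable a) : Measurable fun p : ST => cv a p.1 p.2 := by
  have : Measurable fun q : ST × E3 => tp (a (q.1.1, q.2)) (a (q.1.1, q.1.2 - q.2)) :=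
    measurable_tp (by fun_prop) (by fun_prop)
  exact (this.stronglyMeasurable.integral_prod_right').measurable

theorem measurable_nf (ha : Measurable a) : Measurable fun p : ST => nf a p.1 p.2 := by
  have h : Measurable fun p : ST => (p.2, cv a p.1 p.2) := measurable_snd.prodMk (measurable_cv ha)
  have := measurable_sy.comp h
  exact this

theorem measurable_kr_smul_nf (c : ℝ) (ha : Measurable a) :
    Measurable fun q : ST × ℝ => kr c q.1.1 q.2 q.1.2 • nf a q.2 q.1.2 := by
  have h' := (measurable_nf ha).comp (f := fun q : ST × ℝ => (q.2, q.1.2)) (by fun_prop)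
  have := (measurable_kr c).smul h'
  exact this

theorem measurable_duh (c : ℝ) (hb : Measurable b) (ha : Measurable a) : Measurable
    (duh c b a) := by
  have h1 : Measurable fun p : ST => hk c p.1 p.2 := by unfold hk; fun_prop
  exact (h1.smul (hb.comp measurable_snd)).add
    ((measurable_kr_smul_nf c ha).stronglyMeasurable.integral_prod_right').measurable

theorem measurable_picard (c : ℝ) (hb : Measurable b) : ∀ n, Measurable (picard c b n)
  | 0 => measurable_const
  | n + 1 => measurable_duh c hb (measurable_picard c hb n)

theorem enorm_cv_le (h : ∀ p, ‖a p‖ₑ ≤ A p) (τ : ℝ) (ξ : E3) : ‖cv a τ ξ‖ₑ ≤ sconv A τ ξ :=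
  (enorm_integral_le_lintegral_enorm _).trans (lintegral_mono fun _ =>
    (enorm_tp_le _ _).trans (mul_le_mul' (h _) (h _)))

theorem enorm_kr_smul_le {τ : ℝ} {ξ : E3} {T : Fin 3 → C3} {x : ℝ≥0∞} (h : ‖T‖ₑ ≤ x) :
    ‖kr c t τ ξ • sy ξ T‖ₑ ≤ ksy * (ofReal (kr c t τ ξ * ‖ξ‖) * x) := by
  rw [enorm_smul, Real.enorm_of_nonneg (kr_nonneg _ _ _ _), ofReal_mul (kr_nonneg _ _ _ _),
    ofReal_norm]
  calc _ ≤ ofReal (kr c t τ ξ) * (ksy * (‖ξ‖ₑ * ‖T‖ₑ)) := by gcongr; exact enorm_sy_le ξ T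
    _ ≤ ofReal (kr c t τ ξ) * (ksy * (‖ξ‖ₑ * x)) := by gcongr
    _ = _ := by ring

theorem lintegral_ksy_mul (c : ℝ) (A : ST → ℝ≥0∞) (p : ST) :
    ∫⁻ τ, ksy * (ofReal (kr c p.1 τ p.2 * ‖p.2‖) * sconv A τ p.2) = ksy * nl c A p :=
  lintegral_const_mul' _ _ ksy_ne_top

theorem duh_dom {a' : ST → C3}
    {A' : ST → ℝ≥0∞} (ha : Measurable a) (ha' : Measurable a') (h0 : ∀ p, ‖a p‖ₑ ≤ A p)
    (h0' : ∀ p, ‖a' p‖ₑ ≤ A' p) (h : ∀ p, ‖a' p - a p‖ₑ + A p ≤ A' p) (p : ST) :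
    ‖duh c b a' p - duh c b a p‖ₑ + ksy * nl c A p ≤ ksy * nl c A' p := by
  have hm : ∀ {a : ST → C3}, Measurable a → ∀ (τ : ℝ) (ξ : E3),
      AEStronglyMeasurable (fun η => tp (a (τ, η)) (a (τ, ξ - η))) volume := fun ha τ ξ =>
    (measurable_tp (by fun_prop) (by fun_prop)).aestronglyMeasurable
  have hcv : ∀ (τ : ℝ) (ξ : E3), ‖cv a' τ ξ - cv a τ ξ‖ₑ + sconv A τ ξ ≤ sconv A' τ ξ :=
    fun τ ξ => enorm_integral_sub_add_le (hm ha τ ξ) (hm ha' τ ξ)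
      (fun η => (enorm_tp_le _ _).trans (mul_le_mul' (h0 _) (h0 _)))
      (fun η => (enorm_tp_le _ _).trans (mul_le_mul' (h0' _) (h0' _)))
      (fun η => tp_dom (h0 _) (h0' _) (h _) (h _))
  have hn : ∀ {a : ST → C3}, Measurable a →
      AEStronglyMeasurable (fun τ => kr c p.1 τ p.2 • nf a τ p.2) volume := fun ha =>
    ((measurable_kr_smul_nf c ha).comp (measurable_prodMk_left (x := p))).aestronglyMeasurable
  rw [← lintegral_ksy_mul, ← lintegral_ksy_mul, duh, duh, add_sub_add_left_eq_sub]
  refine enorm_integral_sub_add_le (hn ha) (hn ha') (fun τ => enorm_kr_smul_le (enorm_cv_le h0 _ _))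
    (fun τ => enorm_kr_smul_le (enorm_cv_le h0' _ _)) fun τ => ?_
  rw [nf, nf, ← smul_sub, sy_sub]
  refine (add_le_add_left (enorm_kr_smul_le le_rfl) _).trans ?_
  rw [← mul_add, ← mul_add]
  gcongr
  exact hcv τ p.2

theorem picard_dom (c : ℝ) (hb : Measurable b) (n : ℕ) :
    (∀ p, ‖picard c b n p‖ₑ ≤ maj c ksy (fun ξ => ‖b ξ‖ₑ) n p) ∧
    ∀ p, ‖picard c b (n + 1) p - picard c b n p‖ₑ + maj c ksy (fun ξ => ‖b ξ‖ₑ) n p ≤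
      maj c ksy (fun ξ => ‖b ξ‖ₑ) (n + 1) p := by
  have hl : ∀ p : ST, ‖hk c p.1 p.2 • b p.2‖ₑ = lin c (fun ξ => ‖b ξ‖ₑ) p := fun p => by
    rw [lin, enorm_smul, Real.enorm_of_nonneg (hk_pos _ _ _).le]
  induction n with
  | zero =>
    refine ⟨fun p => by simp [picard, maj], fun p => ?_⟩
    have h1 : picard c b 1 p = hk c p.1 p.2 • b p.2 := by
      have : ∀ τ : ℝ, nf (picard c b 0) τ p.2 = 0 := fun τ => by
        ext k
        simp [nf, sy, cv, tp, picard]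
      simp only [picard, duh] at this ⊢
      simp [this]
    have h2 : picard c b 0 p = 0 := rfl
    rw [zero_add, h1, h2, sub_zero, hl, maj, maj]
    simp
  | succ n ih =>
    have h : ∀ p, ‖picard c b (n + 1) p‖ₑ ≤ maj c ksy (fun ξ => ‖b ξ‖ₑ) (n + 1) p := fun p => by
      refine le_trans ?_ (ih.2 p)
      calc _ = ‖picard c b (n + 1) p - picard c b n p + picard c b n p‖ₑ := by rw [sub_add_cancel]
        _ ≤ _ := (enorm_add_le _ _).trans (add_le_add_right (ih.1 p) _)
    refine ⟨h, fun p => ?_⟩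
    have := duh_dom (c := c) (b := b) (measurable_picard c hb n) (measurable_picard c hb (n + 1))
      ih.1 h ih.2 p
    calc _ = lin c (fun ξ => ‖b ξ‖ₑ) p + (‖duh c b (picard c b (n + 1)) p -
          duh c b (picard c b n) p‖ₑ + ksy * nl c (maj c ksy (fun ξ => ‖b ξ‖ₑ) n) p) := by
          rw [maj, picard, picard]; ring
      _ ≤ _ := add_le_add_right this _

theorem exists_tendsto_picard (c : ℝ) (hb : Measurable b) {p : ST}
    (h : majSup c ksy (fun ξ => ‖b ξ‖ₑ) p ≠ ∞) :
    ∃ l, Tendsto (fun n => picard c b n p) atTop (nhds l) := by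
  have hs : ∀ m, ∑ n ∈ Finset.range m, edist (picard c b n p) (picard c b (n + 1) p) ≤
      maj c ksy (fun ξ => ‖b ξ‖ₑ) m p := fun m => by
    induction m with
    | zero => simp
    | succ m ih =>
      rw [Finset.sum_range_succ, add_comm, edist_comm, edist_eq_enorm_sub]
      exact (add_le_add_right ih _).trans ((picard_dom c hb m).2 p)
  refine cauchySeq_tendsto_of_complete (cauchySeq_of_edist_le_of_tsum_ne_top _ (fun _ => le_rfl)
    (ne_top_of_le_ne_top h ?_))
  rw [ENNReal.tsum_eq_iSup_nat]
  exact iSup_le fun m => (hs m).trans (le_iSup (fun n => maj c ksy (fun ξ => ‖b ξ‖ₑ) n p) m)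

theorem tendsto_integral_of_enorm_le {α E : Type*} [MeasurableSpace α] {μ : Measure α}
    [NormedAddCommGroup E] [NormedSpace ℝ E] {F : ℕ → α → E} {f : α → E} {G : α → ℝ≥0∞}
    (hF : ∀ n, AEStronglyMeasurable (F n) μ) (hG : AEMeasurable G μ) (hGi : ∫⁻ x, G x ∂μ ≠ ∞)
    (hFG : ∀ n x, ‖F n x‖ₑ ≤ G x)
    (hl : ∀ᵐ x ∂μ, Tendsto (fun n => F n x) atTop (nhds (f x))) :
    Tendsto (fun n => ∫ x, F n x ∂μ) atTop (nhds (∫ x, f x ∂μ)) := by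
  refine tendsto_integral_of_dominated_convergence (fun x => (G x).toReal) hF
    (integrable_toReal_of_lintegral_ne_top hG hGi) (fun n => ?_) hl
  filter_upwards [ae_lt_top' hG hGi] with x hx
  exact toReal_mono hx.ne (hFG n x)

theorem integral_star {α E : Type*} [MeasurableSpace α] {μ : Measure α} [NormedAddCommGroup E]
    [NormedSpace ℝ E] [StarAddMonoid E] [StarModule ℝ E] [ContinuousStar E] (f : α → E) :
    ∫ x, star (f x) ∂μ = star (∫ x, f x ∂μ) :=
  (starL' ℝ : E ≃L[ℝ] E).integral_comp_comm f

theorem tp_star (v w : C3) : tp (star v) (star w) = star (tp v w) := by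
  ext i j
  simp [tp]

theorem sy_neg_star (ξ : E3) (T : Fin 3 → C3) : sy (-ξ) (star T) = star (sy ξ T) := by
  ext k
  simp [sy, leray]

theorem cv_neg (h : ∀ t ξ, a (t, -ξ) = star (a (t, ξ))) (τ : ℝ) (ξ : E3) :
    cv a τ (-ξ) = star (cv a τ ξ) := by
  rw [cv, cv, ← integral_star, ← integral_neg_eq_self]
  refine integral_congr_ae (.of_forall fun η => ?_)
  change tp (a (τ, -η)) (a (τ, -ξ - -η)) = _
  rw [h, ← neg_sub', h, tp_star]

theorem duh_neg (hb : ∀ ξ, b (-ξ) = star (b ξ)) (h : ∀ t ξ, a (t, -ξ) = star (a (t, ξ))) (t : ℝ)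
    (ξ : E3) :
    duh c b a (t, -ξ) = star (duh c b a (t, ξ)) := by
  simp only [duh, nf, cv_neg h, sy_neg_star, star_add, ← integral_star, star_smul, hb, hk, kr,
    norm_neg, star_trivial]

theorem picard_neg (hb : ∀ ξ, b (-ξ) = star (b ξ)) :
    ∀ n t ξ, picard c b n (t, -ξ) = star (picard c b n (t, ξ))
  | 0, _, _ => by simp [picard]
  | n + 1, t, ξ => duh_neg hb (picard_neg hb n) t ξ

/-- The linear form `v ↦ ξ · v`. -/
def dotL (ξ : E3) : C3 →L[ℝ] ℂ :=
  ∑ k, ξ k • (ContinuousLinearMap.proj k : C3 →L[ℝ] ℂ)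

theorem dotL_apply (ξ : E3) (v : C3) : dotL ξ v = ∑ k, (ξ k : ℂ) * v k := by simp [dotL]

theorem dotL_duh (hb : ∀ ξ, dotL ξ (b ξ) = 0)
    (a : ST → C3) (p : ST) : dotL p.2 (duh c b a p) = 0 := by
  rw [duh, map_add, map_smul, hb, smul_zero, zero_add]
  by_cases hi : Integrable fun τ => kr c p.1 τ p.2 • nf a τ p.2
  · rw [← ContinuousLinearMap.integral_comp_comm _ hi]
    simp [map_smul, nf, dotL_apply, sum_mul_sy]
  · rw [integral_undef hi, map_zero]

open Classical in
/-- The limit of the Picard iterates. -/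
def pic (c : ℝ) (b : E3 → C3) (p : ST) : C3 :=
  if ∃ l, Tendsto (fun n => picard c b n p) atTop (nhds l) then
    limUnder atTop fun n => picard c b n p else 0

theorem tendsto_pic {p : ST} {l : C3}
    (h : Tendsto (fun n => picard c b n p) atTop (nhds l)) : pic c b p = l := by
  rw [pic, if_pos ⟨l, h⟩, h.limUnder_eq]

theorem tendsto_picard_pic (c : ℝ) (hb : Measurable b) {p : ST}
    (h : majSup c ksy (fun ξ => ‖b ξ‖ₑ) p ≠ ∞) :
    Tendsto (fun n => picard c b n p) atTop (nhds (pic c b p)) := by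
  obtain ⟨l, hl⟩ := exists_tendsto_picard c hb h
  rwa [tendsto_pic hl]

theorem enorm_picard_le (c : ℝ) (hb : Measurable b) (n : ℕ) (p : ST) :
    ‖picard c b n p‖ₑ ≤ majSup c ksy (fun ξ => ‖b ξ‖ₑ) p :=
  ((picard_dom c hb n).1 p).trans (le_iSup (fun n => maj c ksy (fun ξ => ‖b ξ‖ₑ) n p) n)

/-- A solution of the Navier–Stokes equations in frequency, with its majorant. -/
structure FSol (c : ℝ) (b : E3 → C3) (a : ST → C3) (A : ST → ℝ≥0∞) (D N : ℝ≥0∞) : Prop where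
  meas : Measurable a
  le : ∀ p, ‖a p‖ₑ ≤ A p
  fbd : FBd A D N
  hD : D ≠ ∞
  hN : N ≠ ∞
  grad : ∫⁻ t in R₊, ∫⁻ ξ, (‖ξ‖ₑ * A (t, ξ)) ^ 2 < ∞
  symm : ∀ t ξ, a (t, -ξ) = star (a (t, ξ))
  div : ∀ p, dotL p.2 (a p) = 0
  eq : ∀ t, 0 < t → ∀ᵐ ξ, a (t, ξ) = duh c b a (t, ξ)

theorem measurable_pic (c : ℝ) (hb : Measurable b) : Measurable (pic c b) := by
  have hm := measurable_picard c hb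
  refine Measurable.ite (measurableSet_exists_tendsto hm) ?_ measurable_const
  exact (StronglyMeasurable.limUnder fun n => (hm n).stronglyMeasurable).measurable

theorem pic_cases (p : ST) :
    Tendsto (fun n => picard c b n p) atTop (nhds (pic c b p)) ∨ pic c b p = 0 := by
  by_cases h : ∃ l, Tendsto (fun n => picard c b n p) atTop (nhds l)
  · obtain ⟨l, hl⟩ := h
    exact Or.inl (by rwa [tendsto_pic hl])
  · exact Or.inr (if_neg h)

theorem enorm_pic_le (c : ℝ) (hb : Measurable b) (p : ST) :
    ‖pic c b p‖ₑ ≤ majSup c ksy (fun ξ => ‖b ξ‖ₑ) p := by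
  rcases pic_cases (c := c) (b := b) p with h | h
  · exact le_of_tendsto h.enorm (.of_forall fun n => enorm_picard_le c hb n p)
  · simp [h]

theorem pic_neg (hb : ∀ ξ, b (-ξ) = star (b ξ)) (t : ℝ) (ξ : E3) :
    pic c b (t, -ξ) = star (pic c b (t, ξ)) := by
  by_cases h : ∃ l, Tendsto (fun n => picard c b n (t, ξ)) atTop (nhds l)
  · obtain ⟨l, hl⟩ := h
    rw [tendsto_pic hl]
    refine tendsto_pic ?_
    simp only [picard_neg hb]
    exact hl.star
  · have h' : ¬ ∃ l, Tendsto (fun n => picard c b n (t, -ξ)) atTop (nhds l) := fun ⟨l, hl⟩ =>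
      h ⟨star l, by simpa only [picard_neg hb, star_star] using hl.star⟩
    rw [pic, pic, if_neg h, if_neg h', star_zero]

theorem dotL_pic (hb : ∀ ξ, dotL ξ (b ξ) = 0) (p : ST) : dotL p.2 (pic c b p) = 0 := by
  have h0 : ∀ n, dotL p.2 (picard c b n p) = 0
    | 0 => by simp [picard]
    | n + 1 => dotL_duh hb _ p
  rcases pic_cases (c := c) (b := b) p with h | h
  · refine tendsto_nhds_unique ((dotL p.2).continuous.tendsto _ |>.comp h) ?_
    simp only [comp_def, h0]
    simp
  · grind

theorem FBd.lintegral_ne_top (h : FBd A D N) (hD : D ≠ ∞) (ht : 0 < t) : ∫⁻ ξ, A (t, ξ) ≠ ∞ :=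
  ne_top_of_le_ne_top (mul_ne_top hD
    (rpow_ne_top_of_ne_zero (by simpa using ht) ofReal_ne_top)) (h.short t ht)

theorem tendsto_cv_picard (hb : Measurable b)
    (h : FBd (majSup c ksy fun ξ => ‖b ξ‖ₑ) D N) (hD : D ≠ ∞) {τ : ℝ} (hτ : 0 < τ) {ξ : E3}
    (hs : sconv (majSup c ksy fun ξ => ‖b ξ‖ₑ) τ ξ ≠ ∞) :
    Tendsto (fun n => cv (picard c b n) τ ξ) atTop (nhds (cv (pic c b) τ ξ)) := by
  have hm := measurable_picard c hb
  have hS := h.meas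
  set S := majSup c ksy fun ξ => ‖b ξ‖ₑ with hSd
  have hf : ∀ᵐ η : E3, S (τ, η) < ∞ :=
    ae_lt_top (hS.comp measurable_prodMk_left) (h.lintegral_ne_top hD hτ)
  have hf' : ∀ᵐ η : E3, S (τ, ξ - η) < ∞ :=
    (Measure.measurePreserving_sub_left (volume : Measure E3) ξ).quasiMeasurePreserving.ae hf
  refine tendsto_integral_of_enorm_le (G := fun η => S (τ, η) * S (τ, ξ - η))
    (fun n => (measurable_tp ((hm n).comp (by fun_prop))
      ((hm n).comp (by fun_prop))).aestronglyMeasurable) (by fun_prop) hs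
    (fun n η => (enorm_tp_le _ _).trans
      (mul_le_mul' (enorm_picard_le c hb n _) (enorm_picard_le c hb n _))) ?_
  filter_upwards [hf, hf'] with η h1 h2
  exact (continuous_tp.tendsto _).comp
    ((tendsto_picard_pic c hb h1.ne).prodMk_nhds (tendsto_picard_pic c hb h2.ne))

theorem pic_eq_duh (hc : 0 < c) (hb : Measurable b)
    (h : FBd (majSup c ksy fun ξ => ‖b ξ‖ₑ) D N) (hD : D ≠ ∞) (hN : N ≠ ∞) (ht : 0 < t) :
    ∀ᵐ ξ, pic c b (t, ξ) = duh c b (pic c b) (t, ξ) := by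
  have hm := measurable_picard c hb
  have hS := h.meas
  set S := majSup c ksy fun ξ => ‖b ξ‖ₑ with hSd
  have hf : ∀ᵐ ξ : E3, S (t, ξ) < ∞ :=
    ae_lt_top (hS.comp measurable_prodMk_left) (h.lintegral_ne_top hD ht)
  have hnl : ∀ᵐ ξ : E3, nl c S (t, ξ) < ∞ := by
    obtain ⟨K, hK, hb⟩ := exists_nl_bound hc
    refine ae_lt_top ((measurable_nl c hS).comp measurable_prodMk_left) ?_
    refine ne_top_of_le_ne_top ?_ (hb _ _ _ h t ht).1
    exact mul_ne_top (mul_ne_top (mul_ne_top hK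
      (rpow_ne_top_of_nonneg (by norm_num) (mul_ne_top hD hN))) hD)
      (rpow_ne_top_of_ne_zero (by simpa using ht) ofReal_ne_top)
  have h0 : ∀ᵐ ξ : E3, ξ ≠ 0 := by simp [ae_iff]
  filter_upwards [hf, hnl, h0] with ξ h1 h2 h3
  refine tendsto_nhds_unique ((tendsto_add_atTop_iff_nat 1).2 (tendsto_picard_pic c hb h1.ne)) ?_
  refine tendsto_const_nhds.add ?_
  have hkm : Measurable fun τ => kr c t τ ξ := (measurable_kr c).comp (measurable_prodMk_left (x := (t, ξ)))
  have hsm : Measurable fun τ => sconv S τ ξ := (measurable_sconv hS).comp measurable_prodMk_right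
  have hGm : Measurable fun τ => ksy * (ofReal (kr c t τ ξ * ‖ξ‖) * sconv S τ ξ) := by fun_prop
  have hGi : ∫⁻ τ, ksy * (ofReal (kr c t τ ξ * ‖ξ‖) * sconv S τ ξ) ≠ ∞ := by
    rw [lintegral_ksy_mul c S (t, ξ)]
    exact mul_ne_top ksy_ne_top h2.ne
  refine tendsto_integral_of_enorm_le (fun n => ?_) hGm.aemeasurable hGi
    (fun n τ => enorm_kr_smul_le (enorm_cv_le (enorm_picard_le c hb n) τ ξ)) ?_
  · exact ((measurable_kr_smul_nf c (hm n)).comp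
      (measurable_prodMk_left (x := (t, ξ)))).aestronglyMeasurable
  filter_upwards [ae_lt_top hGm hGi] with τ hτ
  by_cases hτt : τ ∈ Ioo 0 t
  · refine Tendsto.const_smul ((continuous_sy ξ).tendsto _ |>.comp
      (tendsto_cv_picard hb h hD hτt.1 fun hs => ?_)) _
    have hk : 0 < kr c t τ ξ * ‖ξ‖ := by
      rw [kr, indicator_of_mem hτt]
      exact mul_pos (hk_pos _ _ _) (norm_pos_iff.2 h3)
    rw [hs, mul_top (ofReal_pos.2 hk).ne', mul_top ksy_ne_zero] at hτ
    grind
  · have : kr c t τ ξ = 0 := indicator_of_notMem hτt _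
    simp [this]

theorem exists_fSol (hc : 0 < c) : ∃ κ : ℝ≥0∞, 0 < κ ∧
    ∀ (b : E3 → C3) (δ N : ℝ≥0∞), Measurable b → δ ≠ ∞ → N ≠ ∞ →
      ∫⁻ ξ, (‖ξ‖ₑ * ‖b ξ‖ₑ) ^ 2 ≤ δ ^ 2 → ∫⁻ ξ, ‖b ξ‖ₑ ^ 2 ≤ N ^ 2 → δ * N ≤ κ →
      (∀ ξ, b (-ξ) = star (b ξ)) → (∀ ξ, dotL ξ (b ξ) = 0) →
      ∃ a A D N', FSol c b a A D N' := by
  obtain ⟨K₀, κ, hK₀, hκ, H⟩ := exists_fbd_majSup hc ksy_ne_top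
  refine ⟨κ, hκ, fun b δ N hb hδ hN h1 h2 h3 hs hd => ?_⟩
  have hB : Measurable fun ξ => ‖b ξ‖ₑ := hb.enorm
  have h := H _ δ N hB h1 h2 h3
  have hD := mul_ne_top hK₀ hδ
  have hN' := mul_ne_top hK₀ hN
  exact ⟨pic c b, _, _, _, measurable_pic c hb, enorm_pic_le c hb, h, hD, hN',
    h.lintegral_grad_lt_top hc hD hN' ksy_ne_top hB
      (ne_top_of_le_ne_top (pow_ne_top hN) h2) (majSup_le c ksy _),
    pic_neg hs, dotL_pic hd, fun t ht => pic_eq_duh hc hb h hD hN' ht⟩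

/-- A test function as a complex-valued Schwartz function. -/
def Cc.schw {ψ : E3 → ℝ} (h : Cc ψ) : 𝓢(E3, ℂ) :=
  (h.2.comp_left (g := fun y : ℝ => (y : ℂ)) (by simp)).toSchwartzMap (ofRealCLM.contDiff.comp h.1)

theorem Cc.schw_apply (h : Cc ψ) (x : E3) : h.schw x = ψ x := rfl

/-- The Fourier transform of a real function. -/
def ft (ψ : E3 → ℝ) : E3 → ℂ := 𝓕 fun x => (ψ x : ℂ)

theorem Cc.fourier_schw (h : Cc ψ) (ξ : E3) : (𝓕 h.schw) ξ = ft ψ ξ := by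
  rw [SchwartzMap.fourier_coe]; rfl

theorem ft_pd (h : Cc ψ) (j : Fin 3) (ξ : E3) :
    ft (pd ψ j) ξ = 2 * π * Complex.I * ξ j * ft ψ ξ := by
  have e : (h.pd j).schw = ∂_{single j (1:ℝ)} h.schw := by
    ext x
    rw [SchwartzMap.lineDerivOp_apply_eq_fderiv, Cc.schw_apply]
    have : HasFDerivAt h.schw (ofRealCLM ∘L fderiv ℝ ψ x) x :=
      ofRealCLM.hasFDerivAt.comp x (h.differentiable x).hasFDerivAt
    rw [this.fderiv]; rfl
  rw [← (h.pd j).fourier_schw, e, SchwartzMap.fourier_lineDerivOp_eq, ← h.fourier_schw,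
    smul_apply, smulLeftCLM_apply_apply (by fun_prop)]
  simp [mul_assoc, inner_single_right]

theorem enorm_fourier_le (f : E3 → ℂ) (ξ : E3) : ‖𝓕 f ξ‖ₑ ≤ ∫⁻ x, ‖f x‖ₑ := by
  rw [Real.fourier_eq]
  refine (enorm_integral_le_lintegral_enorm _).trans (lintegral_mono fun x => ?_)
  rw [← ofReal_norm, ← ofReal_norm, Circle.norm_smul]

theorem continuous_fourier {f : E3 → ℂ} (hf : Integrable f) : Continuous (𝓕 f) :=
  VectorFourier.fourierIntegral_continuous Real.continuous_fourierChar
    (by simpa using continuous_inner) hf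

theorem integral_fourier_mul {f g : E3 → ℂ} (hf : Integrable f) (hg : Integrable g) :
    ∫ x, 𝓕 f x * g x = ∫ ξ, f ξ * 𝓕 g ξ := by
  have := VectorFourier.integral_fourierIntegral_smul_eq_flip (L := innerₗ E3)
    Real.continuous_fourierChar continuous_inner hf hg
  rw [flip_innerₗ] at this
  exact this

theorem Cc.integrable_ofReal (h : Cc ψ) : Integrable fun x => (ψ x : ℂ) :=
  h.schw.integrable

theorem integral_fourier_ofReal {f : E3 → ℂ} (hf : Integrable f) (h : Cc ψ) :
    ∫ x, 𝓕 f x * (ψ x : ℂ) = ∫ ξ, f ξ * ft ψ ξ :=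
  integral_fourier_mul hf h.integrable_ofReal

theorem fourier_mul_eq {f g : E3 → ℂ} (hf : Integrable f) (hg : Integrable g) (x : E3) :
    𝓕 f x * 𝓕 g x = 𝓕 (fun ξ => ∫ η, f η * g (ξ - η)) x :=
  (Real.fourier_mul_convolution_eq hf hg x).symm

theorem integrable_conv {f g : E3 → ℂ} (hf : Integrable f) (hg : Integrable g) :
    Integrable (fun ξ => ∫ η, f η * g (ξ - η)) :=
  hf.integrable_convolution (ContinuousLinearMap.mul ℝ ℂ) hg

theorem integral_mul_fourier (f : Lp ℂ 2 (volume : Measure E3)) (k : 𝓢(E3, ℂ)) :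
    ∫ x, k x * (𝓕 f) x = ∫ x, (𝓕 k) x * f x := by
  have h := congrArg (fun T : 𝓢'(E3, ℂ) => T k) (Lp.fourier_toTemperedDistribution_eq f)
  simp only [TemperedDistribution.fourier_apply, Lp.toTemperedDistribution_apply, smul_eq_mul] at h
  exact h.symm

theorem ae_eq_of_integral_mul_cc {f g : E3 → ℂ} (hf : LocallyIntegrable f)
    (hg : LocallyIntegrable g)
    (h : ∀ ψ, Cc ψ → ∫ x, f x * (ψ x : ℂ) = ∫ x, g x * (ψ x : ℂ)) : f =ᵐ[volume] g := by
  refine ae_eq_of_integral_contDiff_smul_eq hf hg fun ψ h1 h2 => ?_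
  have := h ψ ⟨h1, h2⟩
  simpa only [real_smul, mul_comm] using this

/-- Plancherel for integrable square-integrable functions. -/
theorem fourier_memLp {f : E3 → ℂ} (h1 : Integrable f) (h2 : MemLp f 2 volume) :
    MemLp (𝓕 f) 2 volume ∧ eLpNorm (𝓕 f) 2 volume = eLpNorm f 2 volume := by
  have e : (𝓕 (h2.toLp f) : Lp ℂ 2 (volume : Measure E3)) =ᵐ[volume] 𝓕 f := by
    refine ae_eq_of_integral_mul_cc ((Lp.memLp _).locallyIntegrable (by norm_num))
      (continuous_fourier h1).locallyIntegrable fun ψ hψ => ?_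
    rw [integral_fourier_ofReal h1 hψ]
    have := integral_mul_fourier (h2.toLp f) hψ.schw
    simp only [Cc.schw_apply, hψ.fourier_schw] at this
    simp only [mul_comm _ (_ : ℂ)] at this ⊢
    rw [this]
    exact integral_congr_ae (h2.coeFn_toLp.mono fun x hx => by beta_reduce; rw [hx, mul_comm])
  refine ⟨(Lp.memLp _).ae_eq e, ?_⟩
  rw [← eLpNorm_congr_ae e, ← eLpNorm_congr_ae h2.coeFn_toLp]
  have := Lp.norm_fourier_eq (h2.toLp f)
  rw [Lp.norm_def, Lp.norm_def] at this
  exact (toReal_eq_toReal_iff' (Lp.eLpNorm_ne_top _) (Lp.eLpNorm_ne_top _)).1 this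

theorem enorm_le_sum_coord (v : E3) : ‖v‖ₑ ≤ ∑ i, ‖v i‖ₑ := by
  refine (pow_le_pow_left_iff two_ne_zero).1 ?_
  rw [enorm_euclidean_le, Fin.sum_univ_three, Fin.sum_univ_three]
  calc _ ≤ ‖v 0‖ₑ ^ 2 + ‖v 1‖ₑ ^ 2 + ‖v 2‖ₑ ^ 2 +
        2 * (‖v 0‖ₑ * ‖v 1‖ₑ + ‖v 0‖ₑ * ‖v 2‖ₑ + ‖v 1‖ₑ * ‖v 2‖ₑ) := le_self_add
    _ = _ := by ring

theorem Cc.integrable_mul_ft {f : E3 → ℂ} (hf : Integrable f) (h : Cc ψ) :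
    Integrable fun ξ => f ξ * ft ψ ξ :=
  hf.mul_bdd (c := ∫ x, ‖(ψ x : ℂ)‖) (continuous_fourier h.integrable_ofReal).aestronglyMeasurable
    (.of_forall fun ξ => VectorFourier.norm_fourierIntegral_le_integral_norm _ _ _ _ ξ)

/-- The velocity field with Fourier coefficients `a`. -/
def vel (a : ST → C3) (t : ℝ) (x : E3) : E3 :=
  toLp 2 fun i => (𝓕 (fun ξ => a (t, ξ) i) x).re

theorem measurable_vel (ha : Measurable a) : Measurable (uncurry (vel a)) := by
  refine (WithLp.measurable_toLp 2 (Fin 3 → ℝ)).comp (measurable_pi_iff.2 fun i => ?_)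
  refine Complex.measurable_re.comp ?_
  have h1 : Continuous fun q : ST × E3 =>
      (fourierChar (-inner ℝ q.2 q.1.2) : ℂ) := by
    have := Real.continuous_fourierChar
    fun_prop
  have h : Measurable fun q : ST × E3 =>
      (fourierChar (-inner ℝ q.2 q.1.2) : ℂ) * a (q.1.1, q.2) i :=
    h1.measurable.mul ((measurable_pi_apply i).comp (ha.comp (by fun_prop)))
  exact h.stronglyMeasurable.integral_prod_right'.measurable

namespace FSol

theorem measurable_coord (h : FSol c b a A D N) (i : Fin 3) : Measurable fun p => a p i :=
  (measurable_pi_apply i).comp h.meas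

theorem enorm_coord_le (h : FSol c b a A D N) (p : ST) (i : Fin 3) : ‖a p i‖ₑ ≤ A p := by
  refine le_trans ?_ (h.le p)
  rw [← ofReal_norm, ← ofReal_norm]
  exact ofReal_le_ofReal (norm_le_pi_norm _ i)

theorem integrable (h : FSol c b a A D N) (ht : 0 < t) (i : Fin 3) :
    Integrable fun ξ => a (t, ξ) i :=
  ⟨((h.measurable_coord i).comp measurable_prodMk_left).aestronglyMeasurable,
    (lintegral_mono fun ξ => h.enorm_coord_le (t, ξ) i).trans_lt
      (h.fbd.lintegral_ne_top h.hD ht).lt_top⟩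

theorem eLpNorm_le (h : FSol c b a A D N) (ht : 0 < t) (i : Fin 3) :
    eLpNorm (fun ξ => a (t, ξ) i) 2 volume ≤ N := by
  have : (eLpNorm (fun ξ => a (t, ξ) i) 2 volume) ^ 2 ≤ N ^ 2 := by
    rw [← lintegral_enorm_sq]
    exact (lintegral_mono fun ξ => pow_le_pow_left' (h.enorm_coord_le (t, ξ) i) 2).trans
      (h.fbd.l2 t ht)
  exact (pow_le_pow_left_iff two_ne_zero).1 this

theorem memLp (h : FSol c b a A D N) (ht : 0 < t) (i : Fin 3) :
    MemLp (fun ξ => a (t, ξ) i) 2 volume :=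
  ⟨(h.integrable ht i).1, (h.eLpNorm_le ht i).trans_lt h.hN.lt_top⟩

theorem ofReal_vel (h : FSol c b a A D N) (t : ℝ) (x : E3) (i : Fin 3) :
    ((vel a t x i : ℝ) : ℂ) = 𝓕 (fun ξ => a (t, ξ) i) x := by
  refine Complex.conj_eq_iff_re.1 ?_
  rw [Real.fourier_eq, starRingEnd_apply, ← integral_star, ← integral_neg_eq_self]
  refine integral_congr_ae (.of_forall fun ξ => ?_)
  simp only [inner_neg_left, neg_neg, h.symm, Circle.smul_def, Pi.star_apply, smul_eq_mul,
    star_mul', star_star]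
  congr 1
  rw [AddChar.map_neg_eq_inv, Circle.coe_inv_eq_conj]
  rfl

theorem ofReal_pairing (h : FSol c b a A D N) (ht : 0 < t) (i : Fin 3)
    (hψ : Cc ψ) : ((∫ x, vel a t x i * ψ x : ℝ) : ℂ) = ∫ ξ, a (t, ξ) i * ft ψ ξ := by
  rw [← integral_fourier_ofReal (h.integrable ht i) hψ, ← integral_complex_ofReal]
  simp only [Complex.ofReal_mul, h.ofReal_vel]

theorem enorm_vel_le (h : FSol c b a A D N) (t : ℝ) (x : E3) :
    ‖vel a t x‖ₑ ≤ 3 * ∫⁻ ξ, A (t, ξ) := by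
  have hc : ∀ i, ‖vel a t x i‖ₑ ≤ ∫⁻ ξ, A (t, ξ) := fun i => by
    refine le_trans ?_ ((enorm_fourier_le (fun ξ => a (t, ξ) i) x).trans
      (lintegral_mono fun ξ => h.enorm_coord_le (t, ξ) i))
    rw [← h.ofReal_vel, ← ofReal_norm, ← ofReal_norm, norm_real]
  exact (enorm_le_sum_coord _).trans ((sum_le_sum fun i _ => hc i).trans (by simp))

theorem eLpNorm_vel_le (h : FSol c b a A D N) (ht : 0 < t) :
    eLpNorm (vel a t) 2 volume ≤ 3 * N := by
  have hc : ∀ i, eLpNorm (fun x => vel a t x i) 2 volume ≤ N := fun i => by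
    refine le_trans (le_of_eq ?_) (h.eLpNorm_le ht i)
    rw [← (fourier_memLp (h.integrable ht i) (h.memLp ht i)).2]
    refine eLpNorm_congr_enorm_ae (.of_forall fun x => ?_)
    rw [← h.ofReal_vel, ← ofReal_norm, ← ofReal_norm, norm_real]
  have hm : ∀ i, Measurable fun x => ‖vel a t x i‖ₑ := fun i =>
    ((EuclideanSpace.proj (𝕜 := ℝ) i).measurable.comp
      ((measurable_vel h.meas).comp measurable_prodMk_left)).enorm
  refine (pow_le_pow_left_iff two_ne_zero).1 ?_
  rw [← lintegral_enorm_sq]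
  calc ∫⁻ x, ‖vel a t x‖ₑ ^ 2 ≤ ∫⁻ x, ∑ i, ‖vel a t x i‖ₑ ^ 2 :=
        lintegral_mono fun x => (enorm_euclidean_le _).le
    _ = ∑ i, eLpNorm (fun x => vel a t x i) 2 volume ^ 2 := by
        rw [lintegral_finsetSum _ fun i _ => (hm i).pow_const 2]
        exact sum_congr rfl fun i _ => lintegral_enorm_sq _ _
    _ ≤ ∑ _i : Fin 3, N ^ 2 := sum_le_sum fun i _ => pow_le_pow_left' (hc i) 2
    _ = 3 * N ^ 2 := by simp
    _ ≤ 9 * N ^ 2 := by gcongr; norm_num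
    _ = (3 * N) ^ 2 := by ring

theorem bddU (h : FSol c b a A D N) : BddU (vel a) (3 * N) :=
  ⟨(measurable_vel h.meas).aestronglyMeasurable,
    (ae_restrict_mem measurableSet_Ioi).mono fun _ ht => h.eLpNorm_vel_le ht⟩

theorem divFreeST (h : FSol c b a A D N) : DivFreeST (vel a) := by
  refine DivFreeST.of_slice h.bddU (mul_lt_top (by simp) h.hN.lt_top) ?_
  filter_upwards [ae_restrict_mem measurableSet_Ioi] with t ht
  intro ψ h1 h2
  have hψ : Cc ψ := ⟨h1, h2⟩
  have hv : ∀ i, MemLp (fun x => vel a t x i) 2 volume := fun i => MemLp.coord (ι := Fin 3)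
    ⟨((measurable_vel h.meas).comp measurable_prodMk_left).aestronglyMeasurable,
      (h.eLpNorm_vel_le ht).trans_lt (mul_lt_top (by simp) h.hN.lt_top)⟩ i
  have hv' : ∀ i, Integrable fun x => vel a t x i * pd ψ i x := fun i =>
    (hv i).integrable_mul ((hψ.pd i).memLp (p := 2))
  rw [integral_finsetSum _ fun i _ => hv' i, ← Complex.ofReal_inj, ofReal_sum]
  simp only [h.ofReal_pairing ht _ (hψ.pd _)]
  have hi := fun i => (hψ.pd i).integrable_mul_ft (h.integrable ht i)
  rw [← integral_finsetSum _ fun i _ => hi i, Complex.ofReal_zero, ← integral_zero E3 ℂ]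
  congr 1; funext ξ
  have := h.div (t, ξ)
  rw [dotL_apply] at this
  simp only [ft_pd hψ]
  calc _ = (2 * π * Complex.I * ft ψ ξ) * ∑ k, (ξ k : ℂ) * a (t, ξ) k := by
        rw [mul_sum]; exact sum_congr rfl fun i _ => by ring
    _ = 0 := by rw [this, mul_zero]

end FSol

theorem Cc.fourier_memLp (h : Cc ψ) : ∫⁻ ξ, ‖ft ψ ξ‖ₑ ^ 2 = ∫⁻ x, ‖ψ x‖ₑ ^ 2 := by
  rw [lintegral_enorm_sq, ft,
    (_root_.fourier_memLp h.integrable_ofReal (SchwartzMap.memLp h.schw 2 volume)).2,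
    ← lintegral_enorm_sq]
  simp only [← ofReal_norm, norm_real]

theorem rpow_half_sq (y : ℝ≥0∞) : (y ^ (1 / 2 : ℝ)) ^ 2 = y := by
  rw [← rpow_natCast, ← rpow_mul]; norm_num

theorem enorm_coord_ofReal_le (ξ : E3) (j : Fin 3) : ‖((ξ j : ℝ) : ℂ)‖ₑ ≤ ‖ξ‖ₑ := by
  rw [← ofReal_norm, ← ofReal_norm, norm_real]
  exact ofReal_le_ofReal (abs_coord_le ξ j)

namespace FSol

theorem enorm_grad_slice_le (h : FSol c b a A D N) (ht : 0 < t) (i j : Fin 3) (hψ : Cc ψ) :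
    ‖∫ x, vel a t x i * pd ψ j x‖ₑ ^ 2 ≤
      ‖(2 * π * Complex.I : ℂ)‖ₑ ^ 2 * ((∫⁻ ξ, (‖ξ‖ₑ * A (t, ξ)) ^ 2) * ∫⁻ x, ‖ψ x‖ₑ ^ 2) := by
  have e : ‖∫ x, vel a t x i * pd ψ j x‖ₑ = ‖∫ ξ, a (t, ξ) i * ft (pd ψ j) ξ‖ₑ := by
    rw [← h.ofReal_pairing ht i (hψ.pd j), ← ofReal_norm, ← ofReal_norm, norm_real]
  rw [e, ← hψ.fourier_memLp]
  have hA : AEMeasurable (fun ξ => ‖ξ‖ₑ * A (t, ξ)) (volume : Measure E3) :=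
    (measurable_enorm.mul (h.fbd.meas.comp measurable_prodMk_left)).aemeasurable
  have hF : AEMeasurable (fun ξ => ‖ft ψ ξ‖ₑ) (volume : Measure E3) :=
    (continuous_fourier hψ.integrable_ofReal).measurable.enorm.aemeasurable
  calc _ ≤ (∫⁻ ξ, ‖(2 * π * Complex.I : ℂ)‖ₑ *
        ((‖ξ‖ₑ * A (t, ξ)) * ‖ft ψ ξ‖ₑ)) ^ 2 := by
        gcongr
        refine (enorm_integral_le_lintegral_enorm _).trans (lintegral_mono fun ξ => ?_)
        rw [ft_pd hψ, enorm_mul, enorm_mul, enorm_mul]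
        calc _ ≤ A (t, ξ) * (‖(2 * π * Complex.I : ℂ)‖ₑ * ‖ξ‖ₑ * ‖ft ψ ξ‖ₑ) := by
              gcongr
              · exact h.enorm_coord_le _ i
              · exact enorm_coord_ofReal_le ξ j
          _ = _ := by ring
    _ = ‖(2 * π * Complex.I : ℂ)‖ₑ ^ 2 * (∫⁻ ξ, (‖ξ‖ₑ * A (t, ξ)) * ‖ft ψ ξ‖ₑ) ^ 2 := by
        rw [lintegral_const_mul' _ _ enorm_ne_top, mul_pow]
    _ ≤ _ := by
        gcongr
        exact lintegral_mul_sq_le hA hF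

theorem enorm_grad_le (h : FSol c b a A D N) (i j : Fin 3) {ψ : ST → ℝ} (hψ : Cc ψ) :
    ‖∫ p, vel a p.1 p.2 i * dX j ψ p ∂μST‖ₑ ^ 2 ≤ (‖(2 * π * Complex.I : ℂ)‖ₑ ^ 2 *
        ∫⁻ t in R₊, ∫⁻ ξ, (‖ξ‖ₑ * A (t, ξ)) ^ 2) * eLpNorm ψ 2 μST ^ 2 := by
  have hi := h.bddU.integrable_lin (mul_lt_top (by simp) h.hN.lt_top) (hψ.dX j) i
  have hm1 : Measurable fun t => ∫⁻ ξ, (‖ξ‖ₑ * A (t, ξ)) ^ 2 :=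
    lintegral_prod_right' (f := fun p : ST => (‖p.2‖ₑ * A p) ^ 2)
      (((measurable_enorm.comp measurable_snd).mul h.fbd.meas).pow_const 2)
  have hm2 : Measurable fun t => ∫⁻ x, ‖ψ (t, x)‖ₑ ^ 2 :=
    lintegral_prod_right' (f := fun p : ST => ‖ψ p‖ₑ ^ 2)
      (hψ.continuous.measurable.enorm.pow_const 2)
  set κ := ‖(2 * π * Complex.I : ℂ)‖ₑ
  calc _ ≤ (∫⁻ t in R₊, (κ * (∫⁻ ξ, (‖ξ‖ₑ * A (t, ξ)) ^ 2) ^ (1 / 2 : ℝ)) *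
        (∫⁻ x, ‖ψ (t, x)‖ₑ ^ 2) ^ (1 / 2 : ℝ)) ^ 2 := by
        gcongr
        rw [μST, integral_prod _ (by rw [← μST]; exact hi)]
        refine (enorm_integral_le_lintegral_enorm _).trans ?_
        refine lintegral_mono_ae ((ae_restrict_mem measurableSet_Ioi).mono fun t ht => ?_)
        have := h.enorm_grad_slice_le ht i j (hψ.slice t)
        simp only [pd_slice_eq_dX hψ.differentiable] at this
        refine (pow_le_pow_left_iff two_ne_zero).1 (this.trans (le_of_eq ?_))
        rw [mul_pow, mul_pow, rpow_half_sq, rpow_half_sq, mul_assoc (κ ^ 2)]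
    _ ≤ _ := by
        refine (lintegral_mul_sq_le ((hm1.pow_const _).const_mul _).aemeasurable
          (hm2.pow_const _).aemeasurable).trans (le_of_eq ?_)
        simp only [mul_pow κ, rpow_half_sq]
        rw [lintegral_const_mul _ hm1, ← lintegral_enorm_sq, μST, lintegral_prod _
          (hψ.continuous.measurable.enorm.pow_const 2).aemeasurable]

theorem exists_gradBd (h : FSol c b a A D N) : ∃ C, 0 ≤ C ∧ GradBd (vel a) C := by
  set Q := ‖(2 * π * Complex.I : ℂ)‖ₑ ^ 2 * ∫⁻ t in R₊, ∫⁻ ξ, (‖ξ‖ₑ * A (t, ξ)) ^ 2 with hQ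
  have hQt : Q ≠ ∞ := mul_ne_top (pow_ne_top enorm_ne_top) h.grad.ne
  refine ⟨9 * √Q.toReal, by positivity, fun f hf => ?_⟩
  have hi := fun k : Fin 3 × Fin 3 =>
    h.bddU.integrable_lin (mul_lt_top (by simp) h.hN.lt_top) ((hf.cc k).dX k.2) k.1
  rw [gp, integral_finsetSum _ fun k _ => hi k]
  have hk : ∀ k : Fin 3 × Fin 3, ∫ p, vel a p.1 p.2 k.1 * dX k.2 (fun q => f q k) p ∂μST
      ≤ √Q.toReal * (eLpNorm f 2 μST).toReal := fun k => by
    have h1 := (h.enorm_grad_le k.1 k.2 (hf.cc k)).trans (mul_le_mul' hQ.ge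
      (pow_le_pow_left' (eLpNorm_mono fun p => norm_apply_le (f p) k) 2))
    have h2 := toReal_mono (mul_ne_top hQt (pow_ne_top hf.memLp.2.ne)) h1
    rw [toReal_mul, toReal_pow, toReal_pow, toReal_enorm] at h2
    refine (Real.le_norm_self _).trans (abs_le_of_sq_le_sq' (h2.trans (le_of_eq ?_))
      (by positivity)).2
    rw [mul_pow, sq_sqrt toReal_nonneg]
  refine (sum_le_sum fun k _ => hk k).trans (le_of_eq ?_)
  simp [mul_assoc]

end FSol

/-- Interpolation of `L^s` between `L²` and `L^∞`. -/
theorem eLpNorm_le_interp {f : E3 → E3} {B K : ℝ≥0∞} (hs : 2 ≤ s) (hB' : B ≠ ∞)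
    (hB : ∀ x, ‖f x‖ₑ ≤ B)
    (hK : eLpNorm f 2 volume ≤ K) :
    eLpNorm f s volume ≤ K ^ (2 / s).toReal * B ^ (1 - (2 / s).toReal) := by
  rcases eq_or_ne s ∞ with rfl | hs'
  · simp only [div_top, toReal_zero, rpow_zero, one_mul, sub_zero, rpow_one]
    rw [eLpNorm_exponent_top]
    exact eLpNormEssSup_le_of_ae_enorm_bound (.of_forall hB)
  have hσ : 2 ≤ s.toReal := by simpa using toReal_mono hs' hs
  have hs0 : s ≠ 0 := fun h => by simp [h] at hs
  rw [eLpNorm_eq_lintegral_rpow_enorm_toReal hs0 hs']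
  set σ := s.toReal
  have h1 : ∫⁻ x, ‖f x‖ₑ ^ σ ≤ K ^ 2 * B ^ (σ - 2) := by
    calc ∫⁻ x, ‖f x‖ₑ ^ σ ≤ ∫⁻ x, ‖f x‖ₑ ^ 2 * B ^ (σ - 2) := by
          refine lintegral_mono fun x => ?_
          have e : σ = (2 : ℕ) + (σ - 2) := by push_cast; ring
          calc ‖f x‖ₑ ^ σ = ‖f x‖ₑ ^ 2 * ‖f x‖ₑ ^ (σ - 2) := by
                conv_lhs => rw [e]
                rw [rpow_add_of_nonneg _ _ (by positivity) (by linarith), rpow_natCast]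
            _ ≤ _ := by gcongr; exact hB x
      _ ≤ (∫⁻ x, ‖f x‖ₑ ^ 2) * B ^ (σ - 2) := by
          rw [lintegral_mul_const' _ _ (rpow_ne_top_of_nonneg (by linarith) hB')]
      _ ≤ _ := by
          rw [lintegral_enorm_sq]
          gcongr
  refine (rpow_le_rpow h1 (by positivity)).trans (le_of_eq ?_)
  have e : (2 / s).toReal = 2 / σ := by simp [toReal_div, σ]
  have h0 : σ ≠ 0 := by positivity
  rw [mul_rpow_of_nonneg _ _ (by positivity), ← rpow_natCast, ← rpow_mul, ← rpow_mul, e]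
  congr 2
  · push_cast; ring
  · field_simp

theorem FSol.mixedNorm_lt_top (h : FSol c b a A D N) (hr : r ≠ ∞)
    (hs : 2 ≤ s) (hp : 4 / 3 < r.toReal * (1 - (2 / s).toReal))
    (hp' : r.toReal * (1 - (2 / s).toReal) < 4) : mixedNorm r s (Ioi 0) (vel a) < ∞ := by
  have hθ : (2 / s).toReal ≤ 1 := by
    have := toReal_mono one_ne_top (show 2 / s ≤ 1 from div_le_of_le_mul (by simpa using hs))
    rwa [toReal_one] at this
  rw [mixedNorm, if_neg hr]
  refine rpow_lt_top_of_nonneg (by positivity) (ne_of_lt ?_)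
  set θ := (2 / s).toReal
  have hN : (3 * N) ^ θ ≠ ∞ := rpow_ne_top_of_nonneg toReal_nonneg (mul_ne_top (by simp) h.hN)
  have h3 : (3 : ℝ≥0∞) ^ (1 - θ) ≠ ∞ := rpow_ne_top_of_nonneg (by linarith) (by simp)
  calc ∫⁻ t in Ioi 0, eLpNorm (vel a t) s volume ^ r.toReal
      ≤ ∫⁻ t in R₊, ((3 * N) ^ θ * 3 ^ (1 - θ)) ^ r.toReal *
          (∫⁻ ξ, A (t, ξ)) ^ (r.toReal * (1 - θ)) := by
        refine lintegral_mono_ae ((ae_restrict_mem measurableSet_Ioi).mono fun t ht => ?_)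
        have hi : eLpNorm (vel a t) s volume ≤ (3 * N) ^ θ * (3 * ∫⁻ ξ, A (t, ξ)) ^ (1 - θ) :=
          eLpNorm_le_interp hs (mul_ne_top (by simp) (h.fbd.lintegral_ne_top h.hD ht))
            (h.enorm_vel_le t) (h.eLpNorm_vel_le ht)
        refine (rpow_le_rpow hi toReal_nonneg).trans (le_of_eq ?_)
        rw [mul_rpow_of_nonneg 3 (∫⁻ ξ, A (t, ξ)) (by linarith), ← mul_assoc,
          mul_rpow_of_nonneg _ _ toReal_nonneg, ← rpow_mul, mul_comm (1 - θ)]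
    _ < ∞ := by
        rw [lintegral_const_mul' _ _ (rpow_ne_top_of_nonneg toReal_nonneg (mul_ne_top hN h3))]
        exact mul_lt_top (rpow_lt_top_of_nonneg toReal_nonneg (mul_ne_top hN h3))
          (h.fbd.lintegral_rpow_lt_top h.hD h.hN hp hp')

theorem HasCompactSupport.exists_forall_ge {Φ : ℝ → ℂ} (h : HasCompactSupport Φ) :
    ∃ R, ∀ t, R ≤ t → Φ t = 0 := by
  obtain ⟨R, hR⟩ := h.isCompact.bddAbove
  exact ⟨R + 1, fun t ht => image_eq_zero_of_notMem_tsupport fun hm => by linarith [hR hm]⟩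

theorem integral_exp_mul_deriv {Φ Φ' : ℝ → ℂ} (hd : ∀ t, HasDerivAt Φ (Φ' t) t)
    (hc : Continuous Φ') (hK : HasCompactSupport Φ) (l τ : ℝ) :
    ∫ t in Ioi τ, (exp (-(l * (t - τ))) : ℂ) * (Φ' t - l * Φ t) = -Φ τ := by
  have hΦ : Continuous Φ := continuous_iff_continuousAt.2 fun t => (hd t).continuousAt
  have hK' : HasCompactSupport Φ' := by
    have : deriv Φ = Φ' := funext fun t => (hd t).deriv
    exact this ▸ hK.deriv
  have h : ∀ t, HasDerivAt (fun t => (exp (-(l * (t - τ))) : ℂ) * Φ t)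
      ((exp (-(l * (t - τ))) : ℂ) * (Φ' t - l * Φ t)) t := fun t => by
    have h1 : HasDerivAt (fun t : ℝ => exp (-(l * (t - τ)))) (exp (-(l * (t - τ))) * -(l * 1)) t :=
      ((((hasDerivAt_id t).sub_const τ).const_mul l).neg).exp
    refine (h1.ofReal_comp.mul (hd t)).congr_deriv ?_
    push_cast; ring
  rw [integral_Ioi_of_hasDerivAt_of_tendsto' (fun t _ => h t) (m := 0)]
  · simp
  · refine Continuous.integrable_of_hasCompactSupport (by fun_prop) ?_ |>.integrableOn
    exact HasCompactSupport.mul_left (hK'.sub (hK.mul_left))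
  · have := (hK.mul_left (f := fun t => (exp (-(l * (t - τ))) : ℂ)))
    obtain ⟨R, hR⟩ := this.exists_forall_ge
    exact tendsto_const_nhds.congr' (eventually_atTop.2 ⟨R, fun t ht => (hR t ht).symm⟩)

/-- Pairing Duhamel's formula for the scalar equation `z' = - l z + y` with a test function. -/
theorem duhamel_pairing {l : ℝ} (hl : 0 ≤ l) {Φ Φ' : ℝ → ℂ} (hd : ∀ t, HasDerivAt Φ (Φ' t) t)
    (hc : Continuous Φ') (hK : HasCompactSupport Φ) {y : ℝ → ℂ}
    (hy : ∀ R, IntegrableOn y (Ioo 0 R)) (β : ℂ) :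
    ∫ t in R₊, ((exp (-(l * t)) : ℂ) * β + ∫ τ, (((Ioo 0 t).indicator
      (fun τ => exp (-(l * (t - τ)))) τ : ℝ) : ℂ) * y τ) * (Φ' t - l * Φ t) =
      -(β * Φ 0) - ∫ t in Ioi 0, y t * Φ t := by
  have hΦ : Continuous Φ := continuous_iff_continuousAt.2 fun t => (hd t).continuousAt
  have hK' : HasCompactSupport Φ' := by
    have : deriv Φ = Φ' := funext fun t => (hd t).deriv
    exact this ▸ hK.deriv
  set Θ : ℝ → ℂ := fun t => Φ' t - l * Φ t with hΘ
  have hΘc : Continuous Θ := by fun_prop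
  have hΘK : HasCompactSupport Θ := hK'.sub hK.mul_left
  obtain ⟨R, hR⟩ : ∃ R, ∀ t, R ≤ t → Θ t = 0 := hΘK.exists_forall_ge
  set F : ℝ × ℝ → ℂ := fun q => ((((Ioo 0 q.1).indicator
      (fun τ => exp (-(l * (q.1 - τ)))) q.2 : ℝ) : ℂ) * y q.2) * Θ q.1 with hF
  set y₁ : ℝ → ℂ := (Ioo 0 R).indicator y with hy₁
  have hyi : Integrable y₁ := (hy R).integrable_indicator measurableSet_Ioo
  have hΘi : Integrable Θ := hΘc.integrable_of_hasCompactSupport hΘK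
  have hFe : F = fun q => ((({q : ℝ × ℝ | 0 < q.2 ∧ q.2 < q.1}.indicator
      (fun q => exp (-(l * (q.1 - q.2)))) q : ℝ) : ℂ) * y₁ q.2) * Θ q.1 := by
    funext q
    by_cases h : R ≤ q.1
    · simp [hF, hR _ h]
    · by_cases hq : q.2 ∈ Ioo 0 q.1
      · have h1 : q ∈ {q : ℝ × ℝ | 0 < q.2 ∧ q.2 < q.1} := hq
        have h2 : q.2 ∈ Ioo 0 R := ⟨hq.1, hq.2.trans (not_le.1 h)⟩
        simp only [hF, hy₁, indicator_of_mem hq, indicator_of_mem h1, indicator_of_mem h2]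
      · have h1 : q ∉ {q : ℝ × ℝ | 0 < q.2 ∧ q.2 < q.1} := hq
        simp only [hF, indicator_of_notMem hq, indicator_of_notMem h1]
        simp
  have hFi : Integrable F ((μT).prod volume) := by
    refine (hΘi.integrableOn.mul_prod hyi).mono ?_ (.of_forall fun q => ?_)
    · rw [hFe]
      refine AEStronglyMeasurable.mul (AEStronglyMeasurable.mul ?_ ?_) ?_
      · refine (Complex.measurable_ofReal.comp (Measurable.indicator (by fun_prop)
          ?_)).aestronglyMeasurable
        exact (measurableSet_lt measurable_const measurable_snd).inter
          (measurableSet_lt measurable_snd measurable_fst)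
      · exact hyi.aestronglyMeasurable.comp_snd
      · exact hΘc.aestronglyMeasurable.comp_fst
    · rw [hFe]
      simp only [norm_mul, norm_real]
      rw [mul_comm ‖Θ q.1‖]
      gcongr
      refine mul_le_of_le_one_left (norm_nonneg _) ?_
      by_cases h1 : q ∈ {q : ℝ × ℝ | 0 < q.2 ∧ q.2 < q.1}
      · rw [indicator_of_mem h1, norm_eq_abs, Real.abs_exp]
        exact Real.exp_le_one_iff.2 (by nlinarith [h1.2])
      · rw [indicator_of_notMem h1]; simp
  have h1 : ∫ t in R₊, (exp (-(l * t)) : ℂ) * β * Θ t = -(β * Φ 0) := by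
    have := integral_exp_mul_deriv hd hc hK l 0
    simp only [sub_zero] at this
    rw [← mul_neg, ← this, ← integral_const_mul]
    exact integral_congr_ae (.of_forall fun t => by simp only [hΘ]; ring)
  have h2 : ∫ t in R₊, ∫ τ, F (t, τ) = -∫ t in Ioi 0, y t * Φ t := by
    rw [integral_integral_swap hFi, ← integral_neg, ← integral_indicator measurableSet_Ioi]
    refine integral_congr_ae (.of_forall fun τ => ?_)
    by_cases hτ : 0 < τ
    · beta_reduce
      rw [indicator_of_mem (show τ ∈ Ioi 0 from hτ), ← mul_neg,
        ← integral_exp_mul_deriv hd hc hK l τ, ← integral_const_mul,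
        ← integral_indicator measurableSet_Ioi, ← integral_indicator measurableSet_Ioi]
      refine integral_congr_ae (.of_forall fun t => ?_)
      by_cases ht : τ < t
      · simp only [indicator_of_mem (show t ∈ Ioi τ from ht),
          indicator_of_mem (show t ∈ Ioi 0 from hτ.trans ht), hF,
          indicator_of_mem (show τ ∈ Ioo 0 t from ⟨hτ, ht⟩)]
        ring
      · have h0 : F (t, τ) = 0 := by
          simp only [hF, indicator_of_notMem (show τ ∉ Ioo 0 t from fun h => ht h.2)]
          simp
        rw [indicator_of_notMem (show t ∉ Ioi τ from ht), indicator_apply_eq_zero]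
        exact fun _ => h0
    · beta_reduce
      rw [indicator_of_notMem (show τ ∉ Ioi 0 from hτ)]
      simp only [hF, indicator_of_notMem (fun h : τ ∈ Ioo 0 _ => hτ h.1)]
      simp
  have h3 : ∀ t, ((exp (-(l * t)) : ℂ) * β + ∫ τ, (((Ioo 0 t).indicator
      (fun τ => exp (-(l * (t - τ)))) τ : ℝ) : ℂ) * y τ) * (Φ' t - l * Φ t) =
      (exp (-(l * t)) : ℂ) * β * Θ t + ∫ τ, F (t, τ) := fun t => by
    rw [add_mul, ← integral_mul_const]
  simp only [h3]
  rw [integral_add _ hFi.integral_prod_left, h1, h2, sub_eq_add_neg]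
  exact (Continuous.integrable_of_hasCompactSupport (by fun_prop) hΘK.mul_left).integrableOn

section slices
variable {g : ST → ℝ}

theorem ft_eq (ψ : E3 → ℝ) (ξ : E3) :
    ft ψ ξ = ∫ x, (fourierChar (-inner ℝ x ξ) : ℂ) * (ψ x : ℂ) := by
  rw [ft, Real.fourier_eq]; rfl

/-- The spatial Fourier transform of a space-time function. -/
def fts (g : ST → ℝ) (t : ℝ) (ξ : E3) : ℂ := ft (fun x => g (t, x)) ξ

theorem Cc.exists_indicator_bound (hg : Cc g) : ∃ (K : Set E3) (B : ℝ), IsCompact K ∧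
    ∀ t x, ‖g (t, x)‖ ≤ K.indicator (fun _ => B) x := by
  obtain ⟨B, -, hB⟩ := hg.bounded
  refine ⟨Prod.snd '' tsupport g, B, hg.2.isCompact.image continuous_snd, fun t x => ?_⟩
  by_cases hx : x ∈ Prod.snd '' tsupport g
  · rw [indicator_of_mem hx]; exact hB _
  · rw [indicator_of_notMem hx, image_eq_zero_of_notMem_tsupport fun h => hx ⟨_, h, rfl⟩]
    simp

theorem fts_eq_zero (ht : t ∉ Prod.fst '' tsupport g) (ξ : E3) : fts g t ξ = 0 := by
  have : (fun x => ((g (t, x) : ℝ) : ℂ)) = fun _ => 0 := funext fun x => by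
    rw [image_eq_zero_of_notMem_tsupport fun h => ht ⟨_, h, rfl⟩, Complex.ofReal_zero]
  rw [fts, ft_eq]
  simp only [congrFun this, mul_zero, integral_zero]

theorem Cc.hasCompactSupport_fts (hg : Cc g) (ξ : E3) : HasCompactSupport fun t => fts g t ξ :=
  HasCompactSupport.intro (hg.2.isCompact.image continuous_fst) fun _ ht => fts_eq_zero ht ξ

theorem Cc.exists_fts_bound (hg : Cc g) : ∃ (B : ℝ≥0∞) (R : ℝ), B ≠ ∞ ∧ 0 < R ∧
    ∀ t ξ, ‖fts g t ξ‖ₑ ≤ (Iio R).indicator (fun _ => B) t := by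
  obtain ⟨K, B, hK, hB⟩ := hg.exists_indicator_bound
  obtain ⟨R, hR⟩ := (hg.2.isCompact.image continuous_fst).bddAbove
  refine ⟨ofReal B * volume K, max R 0 + 1,
    mul_ne_top ofReal_ne_top hK.measure_lt_top.ne, by positivity, fun t ξ => ?_⟩
  by_cases ht : t < max R 0 + 1
  · rw [indicator_of_mem (show t ∈ Iio _ from ht)]
    refine (enorm_fourier_le _ ξ).trans ?_
    calc ∫⁻ x, ‖((g (t, x) : ℝ) : ℂ)‖ₑ ≤ ∫⁻ x, K.indicator (fun _ => ofReal B) x := by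
          refine lintegral_mono fun x => ?_
          rw [← ofReal_norm, norm_real]
          refine (ofReal_le_ofReal (hB t x)).trans (le_of_eq ?_)
          by_cases hx : x ∈ K
          · simp only [indicator_of_mem hx]
          · simp only [indicator_of_notMem hx, ofReal_zero]
      _ = _ := by rw [lintegral_indicator_const hK.measurableSet]
  · rw [indicator_of_notMem (show t ∉ Iio _ from ht), fts_eq_zero fun h => ht ?_]
    · simp
    · linarith [hR h, le_max_left R 0]

theorem measurable_fts (hg : Continuous g) : Measurable fun p : ST => fts g p.1 p.2 := by
  have h : Continuous fun q : ST × E3 =>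
      (fourierChar (-inner ℝ q.2 q.1.2) : ℂ) * (g (q.1.1, q.2) : ℂ) := by fun_prop
  exact h.measurable.stronglyMeasurable.integral_prod_right'.measurable

theorem Cc.hasDerivAt_fts (hg : Cc g) (t : ℝ) (ξ : E3) :
    HasDerivAt (fun t => fts g t ξ) (fts (_root_.dT g) t ξ) t := by
  obtain ⟨K, B, hK, hB⟩ := hg.dT.exists_indicator_bound
  have hn : ∀ x, ‖(fourierChar (-inner ℝ x ξ) : ℂ)‖ = 1 := fun x => Circle.norm_coe _
  have hc : Continuous fun x => (fourierChar (-inner ℝ x ξ) : ℂ) := by fun_prop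
  have hgc := hg.continuous
  have hgc' := hg.dT.continuous
  refine (hasDerivAt_integral_of_dominated_loc_of_deriv_le
    (F := fun t x => (fourierChar (-inner ℝ x ξ) : ℂ) * ((g (t, x) : ℝ) : ℂ))
    (F' := fun t x => (fourierChar (-inner ℝ x ξ) : ℂ) * ((_root_.dT g (t, x) : ℝ) : ℂ))
    (bound := K.indicator fun _ => B) (s := univ) univ_mem
    (.of_forall fun t => ?_) ?_ ?_ ?_ ?_ ?_).2
  · fun_prop
  · exact (hg.slice t).integrable_ofReal.bdd_mul (c := 1) hc.aestronglyMeasurable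
      (.of_forall fun x => (hn x).le)
  · fun_prop
  · refine of_forall fun x t _ => ?_
    rw [norm_mul, hn, one_mul, norm_real]
    exact hB t x
  · exact (integrable_indicator_iff hK.measurableSet).2 (integrableOn_const hK.measure_lt_top.ne)
  · refine of_forall fun x t _ => ?_
    have h1 : HasDerivAt (fun t => g (t, x)) (_root_.dT g (t, x)) t := by
      rw [← deriv_slice_eq_dT hg.differentiable]
      exact (hg.differentiable.comp (by fun_prop : Differentiable ℝ fun t : ℝ => (t, x)) t
        ).hasDerivAt
    exact h1.ofReal_comp.const_mul _

theorem Cc.continuous_fts (hg : Cc g) (ξ : E3) : Continuous fun t => fts g t ξ :=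
  continuous_iff_continuousAt.2 fun t => (hg.hasDerivAt_fts t ξ).continuousAt

theorem Cc.fts_dX (hg : Cc g) (j : Fin 3) (t : ℝ) (ξ : E3) :
    fts (_root_.dX j g) t ξ = 2 * π * Complex.I * ξ j * fts g t ξ := by
  rw [fts, fts, ← ft_pd (hg.slice t)]
  congr 1
  exact funext fun x => (pd_slice_eq_dX hg.differentiable j t x).symm

theorem ft_sum {ι : Type*} (s : Finset ι) {f : ι → E3 → ℝ} (hf : ∀ i ∈ s, Cc (f i)) (ξ : E3) :
    ft (fun x => ∑ i ∈ s, f i x) ξ = ∑ i ∈ s, ft (f i) ξ := by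
  have hb : ∀ i ∈ s, Integrable fun x => (fourierChar (-inner ℝ x ξ) : ℂ) * (f i x : ℂ) :=
    fun i hi => (hf i hi).integrable_ofReal.bdd_mul (c := 1) (by
      exact (show Continuous _ by fun_prop).aestronglyMeasurable)
      (.of_forall fun x => (Circle.norm_coe _).le)
  simp only [ft_eq, ofReal_sum, mul_sum]
  rw [integral_finsetSum _ hb]

theorem ft_const_mul (c : ℝ) (ψ : E3 → ℝ) (ξ : E3) : ft (fun x => c * ψ x) ξ = c * ft ψ ξ := by
  simp only [ft_eq, ← integral_const_mul, Complex.ofReal_mul]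
  grind

theorem ft_add {f g : E3 → ℝ} (hf : Cc f) (hg : Cc g) (ξ : E3) :
    ft (fun x => f x + g x) ξ = ft f ξ + ft g ξ := by
  have := ft_sum (Finset.univ : Finset (Fin 2)) (f := ![f, g])
    (by intro i _; fin_cases i <;> assumption) ξ
  simpa [Fin.sum_univ_two] using this

end slices

theorem IsTest.fts_nsA (hφ : IsTest φ) (ν : ℝ) (i : Fin 3) (t : ℝ) (ξ : E3) :
    fts (nsA ν φ i) t ξ = fts (dT fun q => φ q i) t ξ -
      ((4 * π ^ 2 * ν * ‖ξ‖ ^ 2 : ℝ) : ℂ) * fts (fun q => φ q i) t ξ := by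
  have h := (isTest_iff.1 hφ).1 i
  have h1 : fts (nsA ν φ i) t ξ = fts (dT fun q => φ q i) t ξ +
      ν * ∑ j, fts (dX j (dX j fun q => φ q i)) t ξ := by
    have hs : Cc fun x => ∑ j, dX j (dX j fun q => φ q i) (t, x) :=
      Cc.sum _ fun j _ => ((h.dX j).dX j).slice t
    simp only [fts, nsA]
    rw [ft_add (h.dT.slice t) (hs.const_mul ν), ft_const_mul,
      ft_sum _ fun j _ => ((h.dX j).dX j).slice t]
  rw [h1, EuclideanSpace.real_norm_sq_eq]
  simp only [fun j => (h.dX j).fts_dX j, h.fts_dX, Fin.sum_univ_three]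
  push_cast
  linear_combination (4 * π ^ 2 * ν * (ξ 0 ^ 2 + ξ 1 ^ 2 + ξ 2 ^ 2) *
    fts (fun q => φ q i) t ξ : ℂ) * Complex.I_sq

theorem IsTest.sum_mul_fts (hφ : IsTest φ) (t : ℝ) (ξ : E3) :
    ∑ i, (ξ i : ℂ) * fts (fun q => φ q i) t ξ = 0 := by
  obtain ⟨h, hd⟩ := isTest_iff.1 hφ
  have h1 : ∑ i, fts (dX i fun q => φ q i) t ξ = 0 := by
    simp only [fts]
    rw [← ft_sum _ fun i _ => ((h i).dX i).slice t]
    simp only [hd, ft_eq, Complex.ofReal_zero, mul_zero, integral_zero]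
  simp only [fun i => (h i).fts_dX i, mul_assoc, ← mul_sum] at h1
  have hπ : (π : ℂ) ≠ 0 := by simp
  simpa [hπ] using h1

/-- Against divergence-free test functions the Leray projection disappears. -/
theorem sum_sy_mul {ξ : E3} {Φ : C3} (h : ∑ i, (ξ i : ℂ) * Φ i = 0) (T : Fin 3 → C3) :
    ∑ k, sy ξ T k * Φ k = ∑ i, ∑ j, T i j * (2 * π * Complex.I * ξ j * Φ i) := by
  have hl : ∀ i, ∑ k, (leray ξ k i : ℂ) * Φ k = Φ i := fun i => by
    have e : ∀ k, (leray ξ k i : ℂ) * Φ k =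
        (if k = i then Φ k else 0) - (ξ i / (‖ξ‖ : ℂ) ^ 2) * (ξ k * Φ k) := fun k => by
      unfold leray
      split_ifs <;> push_cast <;> ring
    simp only [e, sum_sub_distrib, ← mul_sum, h]
    simp
  calc ∑ k, sy ξ T k * Φ k = ∑ k, ∑ i, ∑ j,
        (2 * π * Complex.I * ξ j) * T i j * ((leray ξ k i : ℂ) * Φ k) := by
        refine sum_congr rfl fun k _ => ?_
        simp only [sy, sum_mul]
        exact sum_congr rfl fun i _ => sum_congr rfl fun j _ => by ring
    _ = ∑ i, ∑ j, (2 * π * Complex.I * ξ j) * T i j * ∑ k, (leray ξ k i : ℂ) * Φ k := by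
        rw [sum_comm]
        refine sum_congr rfl fun i _ => ?_
        rw [sum_comm]
        simp only [mul_sum]
    _ = _ := by
        simp only [hl]
        exact sum_congr rfl fun i _ => sum_congr rfl fun j _ => by ring

theorem integrable_mul_fts {f : ST → ℂ} (hf : Measurable f)
    (hb : ∀ R : ℝ, 0 < R → ∫⁻ t in Ioo 0 R, ∫⁻ ξ, ‖f (t, ξ)‖ₑ < ∞) (hg : Cc g) :
    Integrable (fun p => f p * fts g p.1 p.2) μST := by
  obtain ⟨B, R, hB, hR, hle⟩ := hg.exists_fts_bound
  have hm : Measurable fun p : ST => f p * fts g p.1 p.2 := hf.mul (measurable_fts hg.continuous)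
  refine ⟨hm.aestronglyMeasurable, ?_⟩
  rw [HasFiniteIntegral, μST, lintegral_prod _ hm.enorm.aemeasurable]
  calc ∫⁻ t in R₊, ∫⁻ ξ, ‖f (t, ξ) * fts g t ξ‖ₑ
      ≤ ∫⁻ t in R₊, (Iio R).indicator (fun t => B * ∫⁻ ξ, ‖f (t, ξ)‖ₑ) t := by
        refine lintegral_mono fun t => ?_
        beta_reduce
        calc ∫⁻ ξ, ‖f (t, ξ) * fts g t ξ‖ₑ
            ≤ ∫⁻ ξ, (Iio R).indicator (fun _ => B) t * ‖f (t, ξ)‖ₑ := by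
              refine lintegral_mono fun ξ => ?_
              rw [enorm_mul, mul_comm]
              gcongr
              exact hle t ξ
          _ = _ := by
              by_cases ht : t ∈ Iio R
              · simp only [indicator_of_mem ht]
                rw [lintegral_const_mul' _ _ hB]
              · simp only [indicator_of_notMem ht, zero_mul, lintegral_zero]
    _ = ∫⁻ t in Ioo 0 R, B * ∫⁻ ξ, ‖f (t, ξ)‖ₑ := by
        rw [lintegral_indicator measurableSet_Iio, restrict_restrict measurableSet_Iio,
          inter_comm, Ioi_inter_Iio]
    _ < ∞ := by
        rw [lintegral_const_mul' _ _ hB]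
        exact mul_lt_top hB.lt_top (hb R hR)

theorem integrableOn_mul_of_compact {y Φ : ℝ → ℂ} (hy : ∀ R, IntegrableOn y (Ioo 0 R))
    (hΦ : Continuous Φ) (hK : HasCompactSupport Φ) :
    IntegrableOn (fun t => y t * Φ t) (Ioi 0) := by
  obtain ⟨R, hR⟩ := hK.exists_forall_ge
  obtain ⟨B, hB⟩ := hΦ.bounded_above_of_compact_support hK
  refine (integrable_indicator_iff measurableSet_Ioo).2 ?_ |>.integrableOn.congr_fun
    (f := (Ioo 0 R).indicator fun t => y t * Φ t) (fun t ht => ?_) measurableSet_Ioi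
  · exact (hy R).mul_bdd hΦ.aestronglyMeasurable (.of_forall hB)
  · by_cases h : t < R
    · rw [indicator_of_mem (show t ∈ Ioo 0 R from ⟨ht, h⟩)]
    · rw [indicator_of_notMem (fun h' : t ∈ Ioo 0 R => h h'.2)]
      simp [hR t (not_lt.1 h)]

namespace FSol

theorem lintegral_Ioo_lt_top (h : FSol c b a A D N) (i : Fin 3) {R : ℝ} (hR : 0 < R) :
    ∫⁻ t in Ioo 0 R, ∫⁻ ξ, ‖a (t, ξ) i‖ₑ < ∞ := by
  calc ∫⁻ t in Ioo 0 R, ∫⁻ ξ, ‖a (t, ξ) i‖ₑ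
      ≤ ∫⁻ t in Ioo 0 R, D * ofReal t ^ (-(1 / 4) : ℝ) :=
        lintegral_mono_ae ((ae_restrict_mem measurableSet_Ioo).mono fun t ht =>
          (lintegral_mono fun ξ => h.enorm_coord_le (t, ξ) i).trans (h.fbd.short t ht.1))
    _ < ∞ := by
        rw [lintegral_const_mul' _ _ h.hD, lintegral_rpow_Ioo (by norm_num) hR]
        exact mul_lt_top h.hD.lt_top (mul_lt_top ofReal_lt_top
          (rpow_lt_top_of_nonneg (by norm_num) ofReal_ne_top))

theorem lintegral_sconv_Ioo_lt_top (h : FSol c b a A D N) {R : ℝ} (hR : 0 < R) :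
    ∫⁻ t in Ioo 0 R, ∫⁻ ξ, sconv A t ξ < ∞ := by
  calc ∫⁻ t in Ioo 0 R, ∫⁻ ξ, sconv A t ξ
      ≤ ∫⁻ t in Ioo 0 R, D ^ 2 * ofReal t ^ (-(1 / 2) : ℝ) := by
        refine lintegral_mono_ae ((ae_restrict_mem measurableSet_Ioo).mono fun t ht => ?_)
        rw [lintegral_sconv h.fbd.meas]
        refine (pow_le_pow_left' (h.fbd.short t ht.1) 2).trans (le_of_eq ?_)
        rw [mul_pow, ← rpow_natCast (ofReal t ^ (-(1 / 4) : ℝ)), ← rpow_mul]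
        norm_num
    _ < ∞ := by
        have hD : D ^ 2 ≠ ∞ := pow_ne_top h.hD
        rw [lintegral_const_mul' _ _ hD, lintegral_rpow_Ioo (by norm_num) hR]
        exact mul_lt_top hD.lt_top (mul_lt_top ofReal_lt_top
          (rpow_lt_top_of_nonneg (by norm_num) ofReal_ne_top))

theorem enorm_cv_coord_le (h : FSol c b a A D N) (t : ℝ) (ξ : E3) (i j : Fin 3) :
    ‖cv a t ξ i j‖ₑ ≤ sconv A t ξ := by
  refine le_trans ?_ (enorm_cv_le h.le t ξ)
  rw [← ofReal_norm, ← ofReal_norm]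
  exact ofReal_le_ofReal ((norm_le_pi_norm _ j).trans (norm_le_pi_norm (cv a t ξ) i))

theorem integrable_lin (h : FSol c b a A D N) (i : Fin 3) (hg : Cc g) :
    Integrable (fun p : ST => a p i * fts g p.1 p.2) μST :=
  integrable_mul_fts (h.measurable_coord i) (fun _ hR => h.lintegral_Ioo_lt_top i hR) hg

theorem integrable_quad (h : FSol c b a A D N) (i j : Fin 3) (hg : Cc g) :
    Integrable (fun p : ST => cv a p.1 p.2 i j * fts g p.1 p.2) μST :=
  integrable_mul_fts ((measurable_pi_apply j).comp ((measurable_pi_apply i).comp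
    (measurable_cv h.meas))) (fun _ hR => (lintegral_mono fun t => lintegral_mono fun ξ =>
      h.enorm_cv_coord_le t ξ i j).trans_lt (h.lintegral_sconv_Ioo_lt_top hR)) hg

/-- Almost every frequency sees an integrable nonlinearity. -/
theorem ae_integrableOn_nf (h : FSol c b a A D N) :
    ∀ᵐ ξ, ∀ k R, IntegrableOn (fun t => nf a t ξ k) (Ioo 0 R) := by
  have hs : Measurable fun q : E3 × ℝ => sconv A q.2 q.1 := by
    have := (measurable_sconv h.fbd.meas).comp (measurable_swap (α := E3) (β := ℝ))
    exact this
  have h1 : ∀ᵐ ξ : E3, ∀ n : ℕ, ∫⁻ t in Ioo (0 : ℝ) (n + 1), sconv A t ξ < ∞ := by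
    refine ae_all_iff.2 fun n => ae_lt_top
      (lintegral_prod_right' (f := fun q : E3 × ℝ => sconv A q.2 q.1) hs) ?_
    rw [lintegral_lintegral_swap (f := fun (ξ : E3) (t : ℝ) => sconv A t ξ) hs.aemeasurable]
    exact (h.lintegral_sconv_Ioo_lt_top (by positivity)).ne
  filter_upwards [h1] with ξ hξ k R
  obtain ⟨n, hn⟩ := exists_nat_ge R
  have hm : Measurable fun t => nf a t ξ k := by
    have h2 : Measurable fun t : ℝ => nf a t ξ := by
      have := (measurable_nf h.meas).comp (measurable_prodMk_right (y := ξ))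
      exact this
    exact measurable_pi_iff.1 h2 k
  refine IntegrableOn.mono_set (t := Ioo 0 ((n : ℝ) + 1)) ⟨hm.aestronglyMeasurable, ?_⟩
    (Ioo_subset_Ioo le_rfl (by linarith))
  calc ∫⁻ t in Ioo (0 : ℝ) (n + 1), ‖nf a t ξ k‖ₑ
      ≤ ∫⁻ t in Ioo (0 : ℝ) (n + 1), ksy * ‖ξ‖ₑ * sconv A t ξ := by
        refine lintegral_mono fun t => ?_
        calc ‖nf a t ξ k‖ₑ ≤ ‖nf a t ξ‖ₑ := by
              rw [← ofReal_norm, ← ofReal_norm]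
              exact ofReal_le_ofReal (norm_le_pi_norm _ k)
          _ ≤ ksy * (‖ξ‖ₑ * ‖cv a t ξ‖ₑ) := enorm_sy_le _ _
          _ ≤ _ := by rw [mul_assoc]; gcongr; exact enorm_cv_le h.le t ξ
    _ < ∞ := by
        have : ksy * ‖ξ‖ₑ ≠ ∞ := mul_ne_top ksy_ne_top enorm_ne_top
        rw [lintegral_const_mul' _ _ this]
        exact mul_lt_top this.lt_top (hξ n)

end FSol

theorem integral_sum_add_sum {f f' : Fin 3 → E3 → ℂ} {g g' : Fin 3 → Fin 3 → E3 → ℂ}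
    (hf : ∀ i, Integrable (f i)) (hf' : ∀ i, Integrable (f' i)) (hg : ∀ i j, Integrable (g i j))
    (hg' : ∀ i j, Integrable (g' i j)) (h1 : ∀ i, ∫ x, f i x = ∫ x, f' i x)
    (h2 : ∀ i j, ∫ x, g i j x = ∫ x, g' i j x) :
    ∫ x, ((∑ i, f i x) + ∑ i, ∑ j, g i j x) = ∫ x, ((∑ i, f' i x) + ∑ i, ∑ j, g' i j x) := by
  have hs : ∀ {g : Fin 3 → Fin 3 → E3 → ℂ}, (∀ i j, Integrable (g i j)) →
      ∀ i, Integrable fun x => ∑ j, g i j x := by fun_prop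
  rw [integral_add (integrable_finsetSum _ fun i _ => hf i)
      (integrable_finsetSum _ fun i _ => hs hg i),
    integral_add (integrable_finsetSum _ fun i _ => hf' i)
      (integrable_finsetSum _ fun i _ => hs hg' i),
    integral_finsetSum _ fun i _ => hf i, integral_finsetSum _ fun i _ => hf' i,
    integral_finsetSum _ fun i _ => hs hg i, integral_finsetSum _ fun i _ => hs hg' i]
  simp only [fun i => integral_finsetSum Finset.univ fun j _ => hg i j,
    fun i => integral_finsetSum Finset.univ fun j _ => hg' i j, h1, h2]

namespace FSol

theorem cv_coord_ae (h : FSol c b a A D N) (ht : 0 < t) :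
    ∀ᵐ ξ, ∀ i j, cv a t ξ i j = ∫ η, a (t, η) i * a (t, ξ - η) j := by
  have hs : ∀ᵐ ξ, sconv A t ξ < ∞ := by
    refine ae_lt_top ?_ ?_
    · have := (measurable_sconv h.fbd.meas).comp (measurable_prodMk_left (x := t))
      exact this
    · rw [lintegral_sconv h.fbd.meas]
      exact pow_ne_top (h.fbd.lintegral_ne_top h.hD ht)
  filter_upwards [hs] with ξ hξ i j
  have hi : ∀ i j, Integrable fun η => tp (a (t, η)) (a (t, ξ - η)) i j := fun i j => by
    have hm := h.measurable_coord
    refine ⟨(((hm i).comp (g := fun p => a p i) (f := fun η : E3 => (t, η)) (by fun_prop)).mul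
      ((hm j).comp (g := fun p => a p j) (f := fun η : E3 => (t, ξ - η))
        (by fun_prop))).aestronglyMeasurable, ?_⟩
    refine (lintegral_mono fun η => ?_).trans_lt hξ
    change ‖a (t, η) i * a (t, ξ - η) j‖ₑ ≤ A (t, η) * A (t, ξ - η)
    rw [enorm_mul]
    exact mul_le_mul' (h.enorm_coord_le _ i) (h.enorm_coord_le _ j)
  rw [cv, eval_integral fun i => Integrable.of_eval fun j => hi i j, eval_integral (hi i)]
  rfl

theorem ofReal_nsK (h : FSol c b a A D N) (hφ : IsTest φ) (ν : ℝ)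
    (ht : 0 < t) : ((nsK ν φ (vel a) t : ℝ) : ℂ) = ∫ ξ, ((∑ i, a (t, ξ) i * fts (nsA ν φ i) t ξ) +
      ∑ i, ∑ j, cv a t ξ i j * fts (nsB φ i j) t ξ) := by
  have hA := fun i => (nsA_cc hφ ν i).slice t
  have hB := fun i j => (nsB_cc hφ i j).slice t
  have hC := fun i j => integrable_conv (h.integrable ht i) (h.integrable ht j)
  have hcv := h.cv_coord_ae ht
  have hF : ∀ {f : E3 → ℂ} {ψ : E3 → ℝ}, Integrable f → Cc ψ →
      Integrable fun x => 𝓕 f x * (ψ x : ℂ) := fun hf hψ =>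
    hψ.integrable_ofReal.bdd_mul (continuous_fourier hf).aestronglyMeasurable
      (.of_forall fun ξ => VectorFourier.norm_fourierIntegral_le_integral_norm _ _ _ _ ξ)
  have e : ∀ x, ((nsI ν φ (vel a) (t, x) : ℝ) : ℂ) =
      (∑ i, 𝓕 (fun ξ => a (t, ξ) i) x * (nsA ν φ i (t, x) : ℂ)) +
      ∑ i, ∑ j, 𝓕 (fun ξ => ∫ η, a (t, η) i * a (t, ξ - η) j) x * (nsB φ i j (t, x) : ℂ) :=
    fun x => by
      simp only [nsI, Complex.ofReal_add, ofReal_sum, Complex.ofReal_mul, h.ofReal_vel,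
        ← fun i j => fourier_mul_eq (h.integrable ht i) (h.integrable ht j) x]
  rw [nsK, ← integral_complex_ofReal]
  simp only [e]
  have hce : ∀ i j, (fun ξ => cv a t ξ i j * fts (nsB φ i j) t ξ) =ᵐ[volume]
      fun ξ => (∫ η, a (t, η) i * a (t, ξ - η) j) * fts (nsB φ i j) t ξ := fun i j =>
    hcv.mono fun ξ hξ => by beta_reduce; rw [hξ i j]
  refine integral_sum_add_sum (fun i => hF (h.integrable ht i) (hA i))
    (fun i => (hA i).integrable_mul_ft (h.integrable ht i)) (fun i j => hF (hC i j) (hB i j))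
    (fun i j => ((hB i j).integrable_mul_ft (hC i j)).congr (hce i j).symm)
    (fun i => integral_fourier_ofReal (h.integrable ht i) (hA i)) fun i j => ?_
  rw [integral_congr_ae (hce i j)]
  exact integral_fourier_ofReal (hC i j) (hB i j)

/-- The weak formulation in time at almost every frequency. -/
theorem ae_time_pairing (hν : 0 ≤ ν) (h : FSol (4 * π ^ 2 * ν) b a A D N)
    (hb : Measurable b) (hφ : IsTest φ) :
    ∀ᵐ ξ, ∫ t in R₊, ((∑ i, a (t, ξ) i * fts (nsA ν φ i) t ξ) +
      ∑ i, ∑ j, cv a t ξ i j * fts (nsB φ i j) t ξ) =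
      -∑ i, b ξ i * ft (fun x => φ (0, x) i) ξ := by
  have hc := (isTest_iff.1 hφ).1
  have h1 : ∀ᵐ ξ, ∀ᵐ t ∂μT, a (t, ξ) = duh (4 * π ^ 2 * ν) b a (t, ξ) := by
    have hm : MeasurableSet {p : ST | a (p.1, p.2) =
        duh (4 * π ^ 2 * ν) b a (p.1, p.2)} := by
      exact measurableSet_eq_fun h.meas (measurable_duh _ hb h.meas)
    refine (Measure.ae_ae_comm hm).1 ?_
    exact (ae_restrict_mem measurableSet_Ioi).mono fun t ht => h.eq t ht
  have h2 : ∀ᵐ ξ, ∀ i, IntegrableOn (fun t => a (t, ξ) i * fts (nsA ν φ i) t ξ) (Ioi (0 : ℝ)) :=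
    ae_all_iff.2 fun i => (h.integrable_lin i (nsA_cc hφ ν i)).prod_left_ae
  filter_upwards [h1, h2, h.ae_integrableOn_nf] with ξ h1 h2 hn
  set l : ℝ := 4 * π ^ 2 * ν * ‖ξ‖ ^ 2 with hl
  have hl0 : 0 ≤ l := by positivity
  have hq : ∀ t, ∑ i, ∑ j, cv a t ξ i j * fts (nsB φ i j) t ξ =
      ∑ k, nf a t ξ k * fts (fun q => φ q k) t ξ := fun t => by
    rw [nf, sum_sy_mul (hφ.sum_mul_fts t ξ)]
    refine sum_congr rfl fun i _ => sum_congr rfl fun j _ => ?_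
    rw [← (hc i).fts_dX j]; rfl
  have hy : ∀ i, IntegrableOn (fun t => nf a t ξ i * fts (fun q => φ q i) t ξ) (Ioi (0 : ℝ)) :=
    fun i => integrableOn_mul_of_compact (hn i) ((hc i).continuous_fts ξ)
      ((hc i).hasCompactSupport_fts ξ)
  simp only [hq]
  rw [integral_add (integrable_finsetSum _ fun i _ => h2 i)
    (integrable_finsetSum _ fun i _ => hy i), integral_finsetSum _ fun i _ => h2 i,
    integral_finsetSum _ fun i _ => hy i, ← sum_add_distrib, ← Finset.sum_neg_distrib]
  refine sum_congr rfl fun i _ => ?_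
  have hd := duhamel_pairing hl0 (fun t => (hc i).hasDerivAt_fts t ξ)
    ((hc i).dT.continuous_fts ξ) ((hc i).hasCompactSupport_fts ξ) (hn i) (b ξ i)
  rw [← eq_sub_iff_add_eq]
  refine Eq.trans ?_ hd
  refine integral_congr_ae ?_
  filter_upwards [h1, ae_restrict_mem measurableSet_Ioi] with t ht ht0
  rw [hφ.fts_nsA]
  congr 1
  have hki : ∀ k, Integrable fun τ => kr (4 * π ^ 2 * ν) t τ ξ • nf a τ ξ k := fun k => by
    have hi : IntegrableOn (fun τ => ((hk (4 * π ^ 2 * ν) (t - τ) ξ : ℝ) : ℂ) * nf a τ ξ k)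
        (Ioo 0 t) := by
      refine (hn k t).bdd_mul (c := 1) ?_ ((ae_restrict_mem measurableSet_Ioo).mono fun τ hτ => ?_)
      · unfold hk; exact (show Continuous _ by fun_prop).aestronglyMeasurable
      · rw [norm_real, Real.norm_of_nonneg (hk_pos _ _ _).le]
        exact hk_le_one (mul_nonneg (show 0 ≤ 4 * π ^ 2 * ν by positivity) (sub_nonneg.2 hτ.2.le)) ξ
    refine ((integrable_indicator_iff measurableSet_Ioo).2 hi).congr (.of_forall fun τ => ?_)
    by_cases hτ : τ ∈ Ioo 0 t
    · simp only [kr, indicator_of_mem hτ, real_smul]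
    · simp only [kr, indicator_of_notMem hτ, zero_smul]
  rw [ht, duh, Pi.add_apply]
  rw [eval_integral (f := fun τ => kr (4 * π ^ 2 * ν) t τ ξ • nf a τ ξ) hki]
  congr 1
  · simp only [hk, Pi.smul_apply, real_smul, hl]
    congr 4
    ring
  · refine integral_congr_ae (.of_forall fun τ => ?_)
    simp only [kr, hk, Pi.smul_apply, real_smul, hl]
    congr 5
    ext τ
    ring_nf

/-- The weak formulation for the velocity, with the datum tested in frequency. -/
theorem weak (hν : 0 ≤ ν) (h : FSol (4 * π ^ 2 * ν) b a A D N) (hb : Measurable b) (hφ : IsTest φ) :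
    ((∫ p, nsI ν φ (vel a) p ∂μST : ℝ) : ℂ) = -∫ ξ, ∑ i, b ξ i * ft (fun x => φ (0, x) i) ξ := by
  have hi := h.bddU.integrable_nsI (mul_lt_top (by simp) h.hN.lt_top) hφ ν
  have hH : Integrable (fun p : ST => (∑ i, a p i * fts (nsA ν φ i) p.1 p.2) +
      ∑ i, ∑ j, cv a p.1 p.2 i j * fts (nsB φ i j) p.1 p.2) μST :=
    (integrable_finsetSum _ fun i _ => h.integrable_lin i (nsA_cc hφ ν i)).add
      (integrable_finsetSum _ fun i _ => integrable_finsetSum _ fun j _ =>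
        h.integrable_quad i j (nsB_cc hφ i j))
  calc ((∫ p, nsI ν φ (vel a) p ∂μST : ℝ) : ℂ)
      = ((∫ t in R₊, nsK ν φ (vel a) t : ℝ) : ℂ) := by rw [μST, integral_prod _ hi]; rfl
    _ = ∫ t in R₊, ∫ ξ, ((∑ i, a (t, ξ) i * fts (nsA ν φ i) t ξ) +
          ∑ i, ∑ j, cv a t ξ i j * fts (nsB φ i j) t ξ) := by
        rw [← integral_complex_ofReal]
        exact setIntegral_congr_fun measurableSet_Ioi fun t ht => h.ofReal_nsK hφ ν ht
    _ = ∫ ξ, ∫ t in R₊, ((∑ i, a (t, ξ) i * fts (nsA ν φ i) t ξ) +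
          ∑ i, ∑ j, cv a t ξ i j * fts (nsB φ i j) t ξ) := integral_integral_swap hH
    _ = _ := by rw [integral_congr_ae (ae_time_pairing hν h hb hφ), integral_neg]

end FSol

theorem integral_mul_pd_of_cc {f g : E3 → ℝ} {j : Fin 3} (hf : MemLp f 2 volume)
    (hg : MemLp g 2 volume) (h : ∀ ψ, Cc ψ → ∫ x, f x * pd ψ j x = -∫ x, g x * ψ x)
    (hψ : Smooth ψ) (h0 : MemLp ψ 2 volume) (h1 : MemLp (pd ψ j) 2 volume) :
    ∫ x, f x * pd ψ j x = -∫ x, g x * ψ x := by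
  obtain ⟨χ, hχ, hχ0⟩ := exists_cutoff
  let c : ℕ → ℝ := fun n => 1 / ((n : ℝ) + 1)
  have hc0 : ∀ n, 0 < c n := fun n => by positivity
  have hc1 : ∀ n, c n ≤ 1 := fun n => by
    have : (1 : ℝ) ≤ (n : ℝ) + 1 := by linarith
    exact (div_le_one (by positivity)).2 this
  have hcl : Tendsto c atTop (nhds 0) := tendsto_one_div_add_atTop_nhds_zero_nat
  obtain ⟨K0, hK0, hχb⟩ := hχ.bounded
  obtain ⟨K1, hK1, hpb⟩ := (hχ.pd j).bounded
  have hcc : ∀ n, Cc (fun x => χ (c n • x)) := fun n => by simpa using hχ.comp_affine (hc0 n).ne' 0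
  have hpd : ∀ n x, pd (fun x => χ (c n • x)) j x = c n * pd χ j (c n • x) := fun n x => by
    simpa using pd_comp_affine hχ.differentiable (c n) 0 j x
  have hcx : ∀ x : E3, Tendsto (fun n => c n • x) atTop (nhds 0) := fun x => by
    simpa using hcl.smul_const x
  have hχx : ∀ x, Tendsto (fun n => χ (c n • x)) atTop (nhds 1) := fun x =>
    hχ0 ▸ (hχ.continuous.tendsto 0).comp (hcx x)
  have hxc : ∀ n, Continuous fun x => χ (c n • x) := fun n => (hcc n).continuous
  have hxp : ∀ n, Continuous fun x => pd χ j (c n • x) := fun n =>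
    (hχ.pd j).continuous.comp (continuous_const_smul (c n))
  have hl : Tendsto (fun n => ∫ x, f x * (ψ x * (c n * pd χ j (c n • x)) + χ (c n • x) * pd ψ j x))
      atTop (nhds (∫ x, f x * pd ψ j x)) := by
    refine tendsto_integral_of_dominated_convergence
      (fun x => |f x| * (|ψ x| * K1 + K0 * |pd ψ j x|)) (fun n => ?_) ?_ (fun n => ?_) ?_
    · exact hf.1.mul (((hψ.continuous.mul (continuous_const.mul (hxp n))).add
        ((hxc n).mul (hψ.pd j).continuous)).aestronglyMeasurable)
    · have : MemLp (fun x => |ψ x| * K1 + K0 * |pd ψ j x|) 2 volume :=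
        (h0.abs.mul_const K1).add (h1.abs.const_mul K0)
      exact hf.abs.integrable_mul this
    · refine of_forall fun x => ?_
      rw [norm_eq_abs, abs_mul]
      refine mul_le_mul_of_nonneg_left ((abs_add_le _ _).trans (add_le_add ?_ ?_)) (abs_nonneg _)
      · rw [abs_mul, abs_mul, abs_of_pos (hc0 n)]
        gcongr
        calc c n * |pd χ j (c n • x)| ≤ 1 * K1 := by gcongr; exacts [hc1 n, hpb _]
          _ = K1 := one_mul _
      · rw [abs_mul]
        gcongr
        exact hχb _
    · refine of_forall fun x => ?_
      have h2 := (((hcl.mul (((hχ.pd j).continuous.tendsto 0).comp (hcx x))).const_mul (ψ x)).add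
        ((hχx x).mul_const (pd ψ j x))).const_mul (f x)
      simpa using h2
  have hr : Tendsto (fun n => -∫ x, g x * (ψ x * χ (c n • x))) atTop (nhds (-∫ x, g x * ψ x)) := by
    refine (tendsto_integral_of_dominated_convergence (fun x => |g x| * (|ψ x| * K0))
      (fun n => ?_) ?_ (fun n => ?_) ?_).neg
    · exact hg.1.mul ((hψ.continuous.mul (hxc n)).aestronglyMeasurable)
    · exact hg.abs.integrable_mul (h0.abs.mul_const K0)
    · refine of_forall fun x => ?_
      rw [norm_eq_abs, abs_mul, abs_mul]
      gcongr
      exact hχb _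
    · refine of_forall fun x => ?_
      simpa using ((hχx x).const_mul (ψ x)).const_mul (g x)
  refine tendsto_nhds_unique hl (hr.congr fun n => ?_)
  rw [← h _ (Cc.mul_left hψ (hcc n))]
  refine integral_congr_ae (.of_forall fun x => ?_)
  beta_reduce
  rw [pd_mul (hψ.differentiable (by simp)) (hcc n).differentiable, hpd]

theorem integral_lineDeriv_mul {f g : E3 → ℝ} {j : Fin 3} (hf : MemLp f 2 volume)
    (hg : MemLp g 2 volume) (h : ∀ ψ, Cc ψ → ∫ x, f x * pd ψ j x = -∫ x, g x * ψ x)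
    (k : 𝓢(E3, ℂ)) : ∫ x, (∂_{single j (1 : ℝ)} k) x * (f x : ℂ) = -∫ x, k x * (g x : ℂ) := by
  have key : ∀ L : ℂ →L[ℝ] ℝ, ∫ x, f x * L ((∂_{single j (1 : ℝ)} k) x) =
      -∫ x, g x * L (k x) := fun L => by
    have := integral_mul_pd_of_cc (ψ := fun x => L (k x)) hf hg h (L.contDiff.comp (k.smooth _))
      (L.comp_memLp' (k.memLp 2 volume))
      (by rw [pd_clm_comp]; exact L.comp_memLp' (SchwartzMap.memLp _ 2 volume))
    simpa only [pd_clm_comp] using this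
  have hi : ∀ (k : 𝓢(E3, ℂ)) {f : E3 → ℝ}, MemLp f 2 volume →
      Integrable (fun x => k x * (f x : ℂ)) := fun k _ hf =>
    (k.memLp 2 volume).integrable_mul hf.ofReal
  apply Complex.ext
  · have h1 := reCLM.integral_comp_comm (hi (∂_{single j (1 : ℝ)} k) hf)
    have h2 := reCLM.integral_comp_comm (hi k hg)
    rw [Complex.reCLM_apply] at h1 h2
    rw [Complex.neg_re, ← h1, ← h2]
    simpa [mul_comm] using key reCLM
  · have h1 := imCLM.integral_comp_comm (hi (∂_{single j (1 : ℝ)} k) hf)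
    have h2 := imCLM.integral_comp_comm (hi k hg)
    rw [Complex.imCLM_apply] at h1 h2
    rw [Complex.neg_im, ← h1, ← h2]
    simpa [mul_comm] using key imCLM

/-- `β` is the inverse Fourier transform of the square-integrable real function `f`. -/
structure IsFreq (f : E3 → ℝ) (β : E3 → ℂ) : Prop where
  meas : Measurable β
  sq : ∫⁻ ξ, ‖β ξ‖ₑ ^ 2 = ∫⁻ x, ‖f x‖ₑ ^ 2
  pair : ∀ k : 𝓢(E3, ℂ), ∫ ξ, k ξ * β ξ = ∫ x, (𝓕⁻ k) x * (f x : ℂ)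

theorem exists_isFreq {f : E3 → ℝ} (hf : MemLp f 2 volume) : ∃ β, IsFreq f β := by
  have hfc : MemLp (fun x => (f x : ℂ)) 2 volume := hf.ofReal
  let F : Lp ℂ 2 (volume : Measure E3) := hfc.toLp _
  have hF : F =ᵐ[volume] fun x => (f x : ℂ) := hfc.coeFn_toLp
  refine ⟨(𝓕⁻ F : Lp ℂ 2 (volume : Measure E3)), (Lp.stronglyMeasurable _).measurable, ?_,
    fun k => ?_⟩
  · have hn : ‖𝓕⁻ F‖ = ‖F‖ := by
      rw [← Lp.norm_fourier_eq (𝓕⁻ F), FourierTransform.fourier_fourierInv_eq]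
    have he : eLpNorm (𝓕⁻ F : Lp ℂ 2 (volume : Measure E3)) 2 volume = eLpNorm F 2 volume := by
      exact (toReal_eq_toReal_iff' (Lp.eLpNorm_ne_top _) (Lp.eLpNorm_ne_top _)).1 hn
    rw [lintegral_enorm_sq, he, eLpNorm_congr_ae hF, ← lintegral_enorm_sq]
    simp only [← ofReal_norm, norm_real]
  · rw [integral_mul_fourierInv]
    exact integral_congr_ae (hF.mono fun x hx => by beta_reduce; rw [hx])

theorem IsFreq.memLp {f : E3 → ℝ} {β : E3 → ℂ} (h : IsFreq f β) (hf : MemLp f 2 volume) :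
    MemLp β 2 volume := by
  refine ⟨h.meas.aestronglyMeasurable, ?_⟩
  have h1 := h.sq
  rw [lintegral_enorm_sq, lintegral_enorm_sq] at h1
  simpa using h1.trans_lt (pow_lt_top hf.2)

theorem IsFreq.pairing {f : E3 → ℝ} {β : E3 → ℂ} (h : IsFreq f β) (hψ : Cc ψ) :
    ∫ ξ, β ξ * ft ψ ξ = ((∫ x, f x * ψ x : ℝ) : ℂ) := by
  have := h.pair (𝓕 hψ.schw)
  rw [FourierTransform.fourierInv_fourier_eq] at this
  simp only [hψ.fourier_schw, Cc.schw_apply] at this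
  simp only [mul_comm (β _), this, ← integral_complex_ofReal, Complex.ofReal_mul,
    mul_comm (Complex.ofReal (ψ _))]

theorem IsFreq.ae_eq {f g : E3 → ℝ} {β γ : E3 → ℂ} {j : Fin 3} (hβ : IsFreq f β)
    (hγ : IsFreq g γ) (hf : MemLp f 2 volume) (hg : MemLp g 2 volume)
    (h : ∀ ψ, Cc ψ → ∫ x, f x * pd ψ j x = -∫ x, g x * ψ x) :
    ∀ᵐ ξ, γ ξ = -(2 * π * Complex.I * ξ j) * β ξ := by
  have hc : Continuous fun ξ : E3 => -(2 * π * Complex.I * ξ j : ℂ) := by fun_prop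
  refine ae_eq_of_integral_mul_cc ((hγ.memLp hg).locallyIntegrable (by norm_num)) ?_ fun ψ hψ => ?_
  · simpa only [smul_eq_mul, mul_comm] using
      ((hβ.memLp hf).locallyIntegrable (by norm_num)).smul_continuous hc
  have h1 := hγ.pair hψ.schw
  have h2 := integral_lineDeriv_mul hf hg h (𝓕⁻ hψ.schw)
  rw [SchwartzMap.lineDerivOp_fourierInv_eq, ← hβ.pair] at h2
  simp only [smul_apply, smulLeftCLM_apply_apply (F := ℂ)
    (show Function.HasTemperateGrowth (inner ℝ · (single j (1 : ℝ) : E3))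
      by fun_prop), Cc.schw_apply] at h1 h2
  rw [neg_eq_iff_eq_neg.symm, eq_comm] at h2
  calc ∫ ξ, γ ξ * (ψ ξ : ℂ) = ∫ ξ, (ψ ξ : ℂ) * γ ξ := by simp only [mul_comm]
    _ = _ := by
      rw [h1, h2, ← integral_neg]
      refine integral_congr_ae (.of_forall fun ξ => ?_)
      simp [inner_single_right]
      ring

theorem ft_neg (ψ : E3 → ℝ) (ξ : E3) : star (ft ψ (-ξ)) = ft ψ ξ := by
  simp only [ft, Real.fourier_eq']
  rw [← integral_star]
  simp [← Complex.exp_conj, map_ofNat]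

/-- Symmetrised and projected Fourier data. -/
def datum (β : Fin 3 → E3 → ℂ) (ξ : E3) (k : Fin 3) : ℂ :=
  ∑ i, (leray ξ k i : ℂ) * ((1 / 2 : ℂ) * (β i ξ + star (β i (-ξ))))

theorem measurable_datum {β : Fin 3 → E3 → ℂ} (h : ∀ i, Measurable (β i)) :
    Measurable (datum β) := by
  refine measurable_pi_lambda _ fun k => measurable_sum _ fun i _ => ?_
  have h1 := (h i).comp (measurable_neg (G := E3))
  exact (Complex.measurable_ofReal.comp (measurable_leray k i)).mul
    (((h i).add (continuous_star.measurable.comp h1)).const_mul _)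

theorem datum_neg (β : Fin 3 → E3 → ℂ) (ξ : E3) : datum β (-ξ) = star (datum β ξ) := by
  ext k
  simp [datum, leray, add_comm]

theorem dotL_datum (β : Fin 3 → E3 → ℂ) (ξ : E3) : dotL ξ (datum β ξ) = 0 := by
  simp only [dotL_apply, datum, mul_sum]
  rw [sum_comm]
  refine sum_eq_zero fun i _ => ?_
  have := congrArg (Complex.ofReal) (sum_mul_leray ξ i)
  simp only [ofReal_sum, Complex.ofReal_mul, Complex.ofReal_zero] at this
  simp only [← mul_assoc, ← sum_mul, this, zero_mul]

theorem enorm_datum_sq_le (β : Fin 3 → E3 → ℂ) (ξ : E3) :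
    ‖datum β ξ‖ₑ ^ 2 ≤ 6 * ∑ i, (‖β i ξ‖ₑ ^ 2 + ‖β i (-ξ)‖ₑ ^ 2) := by
  have h1 : ‖datum β ξ‖ ≤ ∑ i, (‖β i ξ‖ + ‖β i (-ξ)‖) := by
    refine (pi_norm_le_iff_of_nonneg (by positivity)).2 fun k => (norm_sum_le _ _).trans
      (sum_le_sum fun i _ => ?_)
    have h2 : ‖(leray ξ k i : ℂ)‖ ≤ 2 := by simpa using abs_leray_le ξ k i
    have h3 : ‖β i ξ + star (β i (-ξ))‖ ≤ ‖β i ξ‖ + ‖β i (-ξ)‖ :=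
      (norm_add_le _ _).trans_eq (by rw [norm_star])
    rw [norm_mul, norm_mul]
    calc _ ≤ 2 * (‖(1 / 2 : ℂ)‖ * (‖β i ξ‖ + ‖β i (-ξ)‖)) := by gcongr
      _ = _ := by norm_num; ring
  have h2 : ‖datum β ξ‖ ^ 2 ≤ 6 * ∑ i, (‖β i ξ‖ ^ 2 + ‖β i (-ξ)‖ ^ 2) := by
    refine (pow_le_pow_left₀ (norm_nonneg _) h1 2).trans (sq_sum_le_card_mul_sum_sq.trans ?_)
    rw [Finset.card_fin, mul_sum, mul_sum]
    refine sum_le_sum fun i _ => ?_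
    push_cast
    nlinarith [sq_nonneg (‖β i ξ‖ - ‖β i (-ξ)‖)]
  simp only [enorm_eq_nnnorm]
  exact_mod_cast h2

theorem lintegral_datum_le {β : Fin 3 → E3 → ℂ} (hβ : ∀ i, Measurable (β i)) {W : E3 → ℝ≥0∞}
    (hW : Measurable W) (hn : ∀ ξ, W (-ξ) = W ξ) :
    ∫⁻ ξ, (W ξ * ‖datum β ξ‖ₑ) ^ 2 ≤ 16 * ∑ i, ∫⁻ ξ, (W ξ * ‖β i ξ‖ₑ) ^ 2 := by
  have hm : ∀ i, Measurable fun ξ => (W ξ * ‖β i ξ‖ₑ) ^ 2 := by fun_prop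
  have he : ∀ i, ∫⁻ ξ, (W (-ξ) * ‖β i (-ξ)‖ₑ) ^ 2 = ∫⁻ ξ, (W ξ * ‖β i ξ‖ₑ) ^ 2 := fun i =>
    (Measure.measurePreserving_neg volume).lintegral_comp (hm i)
  have hs : ∀ i, Measurable fun ξ => (W ξ * ‖β i ξ‖ₑ) ^ 2 + (W (-ξ) * ‖β i (-ξ)‖ₑ) ^ 2 := by fun_prop
  calc _ ≤ ∫⁻ ξ, 6 * ∑ i, ((W ξ * ‖β i ξ‖ₑ) ^ 2 + (W (-ξ) * ‖β i (-ξ)‖ₑ) ^ 2) := by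
        refine lintegral_mono fun ξ => ?_
        calc _ = W ξ ^ 2 * ‖datum β ξ‖ₑ ^ 2 := mul_pow _ _ _
          _ ≤ W ξ ^ 2 * (6 * ∑ i, (‖β i ξ‖ₑ ^ 2 + ‖β i (-ξ)‖ₑ ^ 2)) := by
            gcongr; exact enorm_datum_sq_le β ξ
          _ = _ := by
            simp only [hn, mul_pow, ← mul_add, ← mul_sum]
            ring
    _ = 12 * ∑ i, ∫⁻ ξ, (W ξ * ‖β i ξ‖ₑ) ^ 2 := by
        rw [lintegral_const_mul _ (measurable_sum _ fun i _ => hs i),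
          lintegral_finsetSum _ fun i _ => hs i]
        simp only [fun i => lintegral_add_left (μ := (volume : Measure E3)) (hm i)
          fun ξ => (W (-ξ) * ‖β i (-ξ)‖ₑ) ^ 2, he, ← two_mul, ← mul_sum]
        grind
    _ ≤ _ := by gcongr; norm_num

theorem datum_pairing {f : E3 → E3} {β : Fin 3 → E3 → ℂ} (hf : MemLp f 2 volume)
    (hβ : ∀ i, IsFreq (fun x => f x i) (β i)) (hφ : IsTest φ) :
    ∫ ξ, ∑ i, datum β ξ i * ft (fun x => φ (0, x) i) ξ =
      ((∫ x, ∑ i, f x i * φ (0, x) i : ℝ) : ℂ) := by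
  have hc := fun i => ((isTest_iff.1 hφ).1 i).slice 0
  set F : Fin 3 → E3 → ℂ := fun i => ft (fun x => φ (0, x) i) with hF
  have hF0 : ∀ ξ, ∑ k, (ξ k : ℂ) * F k ξ = 0 := fun ξ => hφ.sum_mul_fts 0 ξ
  have hfi : ∀ i, MemLp (fun x => f x i) 2 volume := fun i => MemLp.coord hf i
  have hFm : ∀ i, MemLp (F i) 2 volume := fun i =>
    (fourier_memLp (hc i).integrable_ofReal (SchwartzMap.memLp (hc i).schw 2 volume)).1
  have hi : ∀ i, Integrable fun ξ => β i ξ * F i ξ := fun i =>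
    ((hβ i).memLp (hfi i)).integrable_mul (hFm i)
  have e : ∀ i ξ, star (β i (-ξ)) * F i ξ = star (β i (-ξ) * F i (-ξ)) := fun i ξ => by
    rw [star_mul', hF]; beta_reduce; rw [ft_neg]
  have hi' : ∀ i, Integrable fun ξ => star (β i (-ξ)) * F i ξ := fun i => by
    simp only [e]
    exact (starL' ℝ : ℂ ≃L[ℝ] ℂ).toContinuousLinearMap.integrable_comp (hi i).comp_neg
  have h1 : ∀ ξ, ∑ k, datum β ξ k * F k ξ =
      ∑ i, (1 / 2 : ℂ) * (β i ξ * F i ξ + star (β i (-ξ)) * F i ξ) := fun ξ => by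
    have h2 : ∀ i, ∑ k, (leray ξ k i : ℂ) * F k ξ = F i ξ := fun i => by
      have : ∀ k, (leray ξ k i : ℂ) * F k ξ = (if k = i then F k ξ else 0) -
          (ξ k * F k ξ) * (ξ i / (‖ξ‖ : ℂ) ^ 2) := fun k => by
        unfold leray; push_cast; split_ifs <;> push_cast <;> ring
      simp only [this, sum_sub_distrib, ← sum_mul, hF0]
      simp
    simp only [datum, sum_mul]
    rw [sum_comm]
    refine sum_congr rfl fun i _ => ?_
    conv_rhs => rw [← add_mul, ← h2 i, mul_sum, mul_sum]
    exact sum_congr rfl fun k _ => by ring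
  have hs : ∀ i, Integrable fun ξ => (1 / 2 : ℂ) * (β i ξ * F i ξ + star (β i (-ξ)) * F i ξ) := by fun_prop
  rw [integral_congr_ae (.of_forall h1), integral_finsetSum _ fun i _ => hs i,
    integral_finsetSum _ fun i _ => MemLp.integrable_mul_fun (hfi i) ((hc i).memLp (p := 2)),
    ofReal_sum]
  refine sum_congr rfl fun i _ => ?_
  have h3 := (hβ i).pairing (hc i)
  have h4 : ∫ ξ, star (β i (-ξ)) * F i ξ = ((∫ x, f x i * φ (0, x) i : ℝ) : ℂ) := by
    simp only [e]
    rw [integral_star, integral_neg_eq_self (fun ξ => β i ξ * F i ξ), h3]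
    simp
  rw [integral_const_mul, integral_add (hi i) (hi' i), h4, h3]
  ring

theorem exists_datum {f : E3 → E3} {g : E3 → E9} (hf : MemLp f 2 volume) (hg : MemLp g 2 volume)
    (h : ∀ i j ψ, Cc ψ → ∫ x, f x i * pd ψ j x = -∫ x, g x (i, j) * ψ x) :
    ∃ b : E3 → C3, Measurable b ∧ (∀ ξ, b (-ξ) = star (b ξ)) ∧
      (∀ ξ, dotL ξ (b ξ) = 0) ∧ ∫⁻ ξ, ‖b ξ‖ₑ ^ 2 ≤ (4 * eLpNorm f 2 volume) ^ 2 ∧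
      ∫⁻ ξ, (‖ξ‖ₑ * ‖b ξ‖ₑ) ^ 2 ≤ (4 * eLpNorm g 2 volume) ^ 2 ∧
      ∀ φ, IsTest φ → ∫ ξ, ∑ i, b ξ i * ft (fun x => φ (0, x) i) ξ =
        ((∫ x, ∑ i, f x i * φ (0, x) i : ℝ) : ℂ) := by
  have hfi : ∀ i, MemLp (fun x => f x i) 2 volume := fun i => MemLp.coord hf i
  have hgi : ∀ k, MemLp (fun x => g x k) 2 volume := fun k => MemLp.coord hg k
  choose β hβ using fun i => exists_isFreq (hfi i)
  choose γ hγ using fun k => exists_isFreq (hgi k)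
  have hm := fun i => (hβ i).meas
  have e4 : ∀ y : ℝ≥0∞, (4 * y) ^ 2 = 16 * y ^ 2 := by grind
  refine ⟨datum β, measurable_datum hm, datum_neg β, dotL_datum β, ?_, ?_,
    fun φ hφ => datum_pairing hf hβ hφ⟩
  · have := lintegral_datum_le hm (W := fun _ => 1) measurable_const fun _ => rfl
    simp only [one_mul] at this
    refine this.trans_eq ?_
    rw [e4, ← lintegral_enorm_sq]
    simp only [enorm_euclidean_le, (hβ _).sq]
    rw [lintegral_finsetSum' _ fun i _ => ((hfi i).1.enorm.pow_const 2)]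
  · refine (lintegral_datum_le hm measurable_enorm fun ξ => enorm_neg ξ).trans ?_
    rw [e4, ← lintegral_enorm_sq]
    simp only [enorm_euclidean_le (g _)]
    rw [lintegral_finsetSum' _ fun i _ => ((hgi i).1.enorm.pow_const 2), Fintype.sum_prod_type]
    refine mul_le_mul' le_rfl (sum_le_sum fun i _ => ?_)
    simp only [← (hγ _).sq]
    rw [← lintegral_finsetSum _ fun j _ => ((hγ (i, j)).meas.enorm.pow_const 2)]
    have hae := ae_all_iff.2 fun j => (hβ i).ae_eq (hγ (i, j)) (hfi i) (hgi (i, j)) (h i j)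
    refine lintegral_mono_ae (hae.mono fun ξ hξ => ?_)
    rw [mul_pow, enorm_euclidean_le, sum_mul]
    refine sum_le_sum fun j _ => ?_
    have h1 : 1 ≤ ‖(2 * π * Complex.I : ℂ)‖ₑ := by
      rw [← ofReal_norm, ← ofReal_one]
      refine ofReal_le_ofReal ?_
      simp only [norm_mul, Complex.norm_I, norm_real, Complex.norm_ofNat, mul_one,
        Real.norm_of_nonneg pi_pos.le]
      linarith [Real.pi_gt_three]
    have h2 : ‖ξ j‖ₑ = ‖(ξ j : ℂ)‖ₑ := by rw [← ofReal_norm, ← ofReal_norm, norm_real]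
    rw [hξ j, ← mul_pow, enorm_mul, enorm_neg, enorm_mul, h2]
    gcongr
    exact le_mul_of_one_le_left' h1

theorem exists_small_data_solution (hν : 0 < ν) (hr : r ≠ ∞) (hs : 2 ≤ s)
    (hp : 4 / 3 < r.toReal * (1 - (2 / s).toReal)) (hp' : r.toReal * (1 - (2 / s).toReal) < 4) :
    ∃ κ : ℝ, 0 < κ ∧ ∀ M δ : ℝ, 0 ≤ δ → δ * M ≤ κ → ∀ (f : E3 → E3) (g : E3 → E9),
      MemLp f 2 volume → IsDivFree f → eLpNorm f 2 volume ≤ ofReal M →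
      MemLp g 2 volume → eLpNorm g 2 volume ≤ ofReal δ →
      (∀ i j ψ, Cc ψ → ∫ x, f x i * pd ψ j x = -∫ x, g x (i, j) * ψ x) →
      ∃ w M' C', 0 ≤ C' ∧ Sol ν f w M' C' ∧ mixedNorm r s (Ioi 0) w < ∞ := by
  obtain ⟨κ, hκ, H⟩ := exists_fSol (c := 4 * π ^ 2 * ν) (by positivity)
  have hm : 0 < min κ 1 := lt_min hκ one_pos
  have hm' : min κ 1 ≠ ∞ := ((min_le_right κ 1).trans_lt one_lt_top).ne
  refine ⟨(min κ 1).toReal / 16, div_pos (toReal_pos hm.ne' hm') (by norm_num), ?_⟩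
  intro M δ hδ hκM f g hf hdiv hfM hg hgδ hw
  obtain ⟨b, hb, hbs, hbd, hb2, hbg, hbφ⟩ := exists_datum hf hg hw
  obtain ⟨a, A, D, N, hF⟩ := H b (4 * ofReal δ) (4 * ofReal M) hb
    (mul_ne_top (by simp) ofReal_ne_top) (mul_ne_top (by simp) ofReal_ne_top)
    (hbg.trans (by gcongr)) (hb2.trans (by gcongr)) (by
      calc _ = 16 * ofReal (δ * M) := by rw [ofReal_mul hδ]; ring
        _ ≤ 16 * ofReal ((min κ 1).toReal / 16) := by gcongr
        _ = min κ 1 := by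
          rw [ofReal_div_of_pos (by norm_num), ofReal_toReal hm', ofReal_ofNat,
            ENNReal.mul_div_cancel (by simp) (by simp)]
        _ ≤ κ := min_le_left _ _) hbs hbd
  obtain ⟨C, hC, hgb⟩ := hF.exists_gradBd
  refine ⟨vel a, (3 * N).toReal, C, hC, ⟨?_, hF.divFreeST, hgb, fun φ hφ => ?_⟩,
    hF.mixedNorm_lt_top hr hs hp hp'⟩
  · rw [ofReal_toReal (mul_ne_top (by simp) hF.hN)]
    exact hF.bddU
  · have := hF.weak hν.le hb hφ
    rw [hbφ φ hφ, ← Complex.ofReal_neg] at this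
    exact Complex.ofReal_injective this

lemma exponent_facts (hr : 4/3 < r) (hs : 4/3 < s)
    (h1 : 1 ≤ 5/(3*r) + 2/s) (h2 : 5/(3*r) + 2/s < 1 + 1/(3*r)) :
    r ≠ ∞ ∧ r ≠ 0 ∧ 2 ≤ s ∧ 4/3 < r.toReal * (1 - (2/s).toReal) ∧
      r.toReal * (1 - (2/s).toReal) < 4 ∧
      (5/(3*r) + 2/s).toReal = 5/3 * (1/r.toReal) + 2 * (1/s).toReal ∧
      (2/r + 3/s).toReal = 2 * (1/r.toReal) + 3 * (1/s).toReal := by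
  have hr0 : r ≠ 0 := (bot_le.trans_lt hr).ne'
  have hs0 : s ≠ 0 := (bot_le.trans_lt hs).ne'
  have hrt : r ≠ ∞ := by
    rintro rfl
    rw [mul_top (by norm_num), div_top, div_top, zero_add] at *
    rw [add_zero] at h2
    exact absurd h1 (not_le.2 h2)
  have f1 : 5 / (3 * r) ≠ ∞ := div_ne_top (by norm_num) (by simp [hr0])
  have f1' : 1 / (3 * r) ≠ ∞ := div_ne_top (by norm_num) (by simp [hr0])
  have f2 : 2 / s ≠ ∞ := div_ne_top (by norm_num) hs0
  have e1 : (5/(3*r) + 2/s).toReal = 5/3 * (1/r.toReal) + 2 * (1/s).toReal := by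
    rw [toReal_add f1 f2]; simp only [toReal_div, toReal_mul, toReal_ofNat, toReal_one]
    field_simp
  have e2 : (2/r + 3/s).toReal = 2 * (1/r.toReal) + 3 * (1/s).toReal := by
    rw [toReal_add (div_ne_top (by norm_num) hr0) (div_ne_top (by norm_num) hs0)]
    simp only [toReal_div, toReal_ofNat, toReal_one]
    ring
  have e3 : (2/s).toReal = 2 * (1/s).toReal := by
    simp only [toReal_div, toReal_ofNat, toReal_one]; ring
  have hR : 0 < r.toReal := toReal_pos hr0 hrt
  have g1 := (toReal_le_toReal one_ne_top (add_ne_top.2 ⟨f1, f2⟩)).2 h1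
  have g2 := (toReal_lt_toReal (add_ne_top.2 ⟨f1, f2⟩) (add_ne_top.2 ⟨one_ne_top, f1'⟩)).2 h2
  rw [toReal_add one_ne_top f1'] at g2
  rw [e1] at g1 g2
  have e4 : (1 / (3 * r)).toReal = 1/3 * (1/r.toReal) := by
    simp only [toReal_div, toReal_mul, toReal_ofNat, toReal_one]; field_simp
  rw [e4, toReal_one] at g2
  rw [toReal_one] at g1
  have hx : 0 < 1/r.toReal := by positivity
  have hxr : r.toReal * (1/r.toReal) = 1 := by field_simp
  refine ⟨hrt, hr0, ?_, ?_, ?_, e1, e2⟩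
  · by_contra hlt
    push Not at hlt
    have hst : s ≠ ∞ := hlt.ne_top
    have : s.toReal < 2 := by simpa using (toReal_lt_toReal hst (by norm_num)).2 hlt
    have hS := toReal_pos hs0 hst
    rw [toReal_div, toReal_one] at g2
    have : 1/2 < 1/s.toReal := one_div_lt_one_div_of_lt hS this
    linarith
  · rw [e3]
    nlinarith [mul_pos hR (show 0 < 1 - 2 * (1/s).toReal - 4/3 * (1/r.toReal) by linarith)]
  · rw [e3]
    nlinarith [mul_nonneg hR.le (show 0 ≤ 5/3 * (1/r.toReal) - (1 - 2 * (1/s).toReal) by linarith)]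

lemma sol_zero (hv : v =ᵐ[volume] 0) : Sol ν v (fun _ _ => 0) 0 0 := by
  refine ⟨⟨aestronglyMeasurable_const, .of_forall fun t => by simp⟩, fun ψ _ => by simp,
    fun f _ => by simp [gp], fun φ _ => ?_⟩
  rw [integral_congr_ae (g := fun _ => (0:ℝ)) (hv.mono fun x hx => by simp [hx])]
  simp [nsI]

lemma zero_mem_L2σ : (0 : L2E) ∈ L2σ := fun φ _ _ => by
  rw [integral_congr_ae (g := fun _ => (0:ℝ))
    ((Lp.coeFn_zero E3 2 (volume : Measure E3)).mono fun x _ => by simp)]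
  simp

/-- A non-meagre set of data with local-in-time bounds yields uniform global bounds on a ball. -/
lemma exists_uniform_ball (hν : 0 < ν) (hr : r ≠ ∞) (hr0 : r ≠ 0) (hs : 2 ≤ s)
    (hp : 4/3 < r.toReal * (1 - (2/s).toReal)) (hp' : r.toReal * (1 - (2/s).toReal) < 4)
    {S : Set L2σ} (hS : ¬ IsMeagre S)
    (h : ∀ v ∈ S, ∃ T : ℝ, 0 < T ∧ ∃ u G, IsWeakNS ν ((v : L2E) : E3 → E3) u G ∧
        mixedNorm r s (Ioo 0 T) u < ∞) :
    ∃ n : ℕ, ∃ ε : ℝ, 0 < ε ∧ ∀ v, MemLp v 2 volume → IsDivFree v →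
      eLpNorm v 2 volume ≤ ofReal ε → Good ν r s (Ioi 0) n n n v := by
  obtain ⟨n, η, hη, hloc⟩ := exists_ball_good (s := s) hr hr0 hS (I := fun n : ℕ => Ioo 0 (1 / ((n:ℝ) + 1)))
    (fun n => Ioo_subset_Ioi_self) fun v hv => by
      obtain ⟨T, hT, u, G, hu, hN⟩ := h v hv
      obtain ⟨M, C, -, -, hsol⟩ := hu.sol
      obtain ⟨n₁, h₁⟩ := exists_nat_ge (max M (max C (mixedNorm r s (Ioo 0 T) u).toReal))
      obtain ⟨n₂, h₂⟩ := exists_nat_one_div_lt hT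
      have hn : ((n₁:ℝ)) ≤ ((max n₁ n₂ : ℕ) : ℝ) := by exact_mod_cast le_max_left _ _
      have hn' : ((n₂:ℝ)) ≤ ((max n₁ n₂ : ℕ) : ℝ) := by exact_mod_cast le_max_right _ _
      simp only [max_le_iff] at h₁
      refine ⟨max n₁ n₂, u, hsol.mono (h₁.1.trans hn) (h₁.2.1.trans hn),
        (mixedNorm_mono (J := Ioo 0 T) hr (Ioo_subset_Ioo le_rfl ?_) u).trans ?_⟩
      · refine (one_div_le_one_div_of_le (by positivity) ?_).trans h₂.le
        linarith
      · rw [← ofReal_toReal hN.ne, ← ofReal_natCast]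
        exact ofReal_le_ofReal (h₁.2.2.trans hn)
  obtain ⟨κ, hκ, hsmall⟩ := exists_small_data_solution hν hr hs hp hp'
  set T : ℝ := 1 / ((n:ℝ) + 1)
  have hT : 0 < T := by positivity
  set δ : ℝ := κ / ((n:ℝ) + 1)
  have hδ : 0 < δ := by positivity
  have hδn : δ * n ≤ κ := by
    rw [div_mul_eq_mul_div, div_le_iff₀ (by positivity)]
    nlinarith
  obtain ⟨m, hm⟩ : ∃ m : ℕ, ((n:ℝ) / √2 ^ m) ^ 2 < δ ^ 2 * T := by
    obtain ⟨m, hm⟩ := pow_unbounded_of_one_lt ((n:ℝ) ^ 2 / (δ ^ 2 * T)) (one_lt_two (α := ℝ))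
    refine ⟨m, ?_⟩
    rw [div_pow, ← pow_mul, mul_comm m 2, pow_mul, sq_sqrt zero_le_two, div_lt_iff₀ (by positivity)]
    rw [div_lt_iff₀ (by positivity)] at hm
    linarith
  have hglob : ∀ v, MemLp v 2 volume → IsDivFree v → eLpNorm v 2 volume ≤ ofReal (η / 2 ^ m) →
      ∃ n : ℕ, Good ν r s (Ioi 0) n n n v := fun v hv hd hvη => by
    obtain ⟨u, hu, hN⟩ := good_half_pow hr hr0 Ioo_subset_Ioi_self n.cast_nonneg n.cast_nonneg
      hloc m v hv hd hvη
    obtain ⟨w, M', C', -, hw, hwN⟩ := hu.exists_global hr hr0 n.cast_nonneg (by positivity) hδ.le hm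
      (hN.trans_lt (natCast_lt_top n)) (hsmall n δ hδ.le hδn)
    obtain ⟨k, hk⟩ := exists_nat_ge (max M' (max C' (mixedNorm r s (Ioi 0) w).toReal))
    simp only [max_le_iff] at hk
    refine ⟨k, w, hw.mono hk.1 hk.2.1, ?_⟩
    rw [← ofReal_toReal hwN.ne, ← ofReal_natCast]
    exact ofReal_le_ofReal hk.2.2
  have : CompleteSpace L2σ := isClosed_L2σ.completeSpace_coe
  refine (exists_ball_good hr hr0 (S := ball (⟨0, zero_mem_L2σ⟩ : L2σ) (η / 2 ^ m))
    (not_isMeagre_of_isOpen Metric.isOpen_ball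
      ⟨_, Metric.mem_ball_self (by positivity)⟩) (I := fun _ => Ioi 0) (fun _ => le_rfl)
    fun v hv => hglob _ (Lp.memLp _) v.2 ?_)
  rw [mem_ball, Subtype.dist_eq, dist_zero_right] at hv
  rw [Lp.norm_def] at hv
  rw [← ofReal_toReal (Lp.eLpNorm_ne_top (v : L2E))]
  exact ofReal_le_ofReal hv.le

lemma scaling_identity {ε k A x y : ℝ} (hε : 0 < ε) (hk : 0 < k) (hA : 0 < A) (hν : 0 < ν) {l : ℝ}
    (hl : l = (ε * (k / ν) / A) ^ 2) :
    k / ν * l * (l ^ 3)⁻¹ ^ y * (k / ν * l * l)⁻¹ ^ x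
      = ε ^ (2 * (1 - 2 * x - 3 * y)) * ν ^ (3 * (5/3 * x + 2 * y - 1)) *
        (k ^ (-(3:ℝ) * (5/3 * x + 2 * y - 1)) * A ^ (2 * (2 * x + 3 * y - 1))) := by
  have hl0 : 0 < l := by rw [hl]; positivity
  have e : Real.log l = 2 * (Real.log ε + (Real.log k - Real.log ν) - Real.log A) := by
    rw [hl, Real.log_pow, log_div (by positivity) hA.ne', log_mul hε.ne' (by positivity),
      log_div hk.ne' hν.ne']
    norm_num
  apply Real.log_injOn_pos (mem_Ioi.2 (by positivity)) (mem_Ioi.2 (by positivity))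
  have hkν : 0 < k / ν := by positivity
  rw [log_mul (by positivity) (by positivity), log_mul (by positivity) (by positivity),
    log_mul (by positivity) (by positivity), log_mul (by positivity) (by positivity),
    log_mul (by positivity) (by positivity), log_mul (by positivity) (by positivity),
    Real.log_rpow (by positivity), Real.log_rpow (by positivity), Real.log_rpow hε,
    Real.log_rpow hν, Real.log_rpow hk, Real.log_rpow hA, Real.log_inv, Real.log_inv,
    log_mul (by positivity) (by positivity), log_mul (by positivity) (by positivity),
    Real.log_pow, log_div hk.ne' hν.ne', e]
  push_cast
  ring

lemma IsDivFree.comp_smul (hv : IsDivFree v) {l : ℝ} (hl : 0 < l) (a : ℝ) :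
    IsDivFree fun x => a • v (l • x) := fun φ hφ hc => by
  let ψ : E3 → ℝ := fun x => φ (l⁻¹ • x)
  have hψ : Smooth ψ := hφ.comp (contDiff_const_smul l⁻¹)
  have hψc : HasCompactSupport ψ := hc.comp_homeomorph (smulOfNeZero l⁻¹ (by positivity))
  have h := hv ψ hψ hψc
  have e : ∀ j x, pd ψ j (l • x) = l⁻¹ * pd φ j x := fun j x => by
    have h1 : HasFDerivAt ψ _ (l • x) :=
      ((hφ.differentiable (by simp)) (l⁻¹ • l • x)).hasFDerivAt.comp (l • x)
        ((hasFDerivAt_id (𝕜 := ℝ) (l • x)).const_smul l⁻¹)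
    rw [pd, h1.fderiv, pd]
    simp [smul_smul, inv_mul_cancel₀ hl.ne']
  have h2 := integral_affine hl 0 fun x => ∑ i, v x i * pd ψ i x
  rw [h, mul_zero] at h2
  simp only [add_zero, e] at h2
  have h3 : ∀ x, ∑ i, (a • v (l • x)) i * pd φ i x
      = (a * l) * ∑ i, v (l • x) i * (l⁻¹ * pd φ i x) := fun x => by
    rw [mul_sum]
    refine sum_congr rfl fun i _ => ?_
    simp only [PiLp.smul_apply, smul_eq_mul]
    field_simp
  simp only [h3]
  rw [integral_const_mul, h2, mul_zero]

lemma MemLp.comp_smul (hv : MemLp v 2 volume) {l : ℝ} (hl : 0 < l) (a : ℝ) :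
    MemLp (fun x => a • v (l • x)) 2 volume := by
  have h1 : AEStronglyMeasurable (fun x => v (l • x)) volume := hv.1.comp_quasiMeasurePreserving
      ⟨measurable_const_smul l, by
        rw [Measure.map_addHaar_smul _ hl.ne']; exact Measure.smul_absolutelyContinuous⟩
  have h2 := eLpNorm_affine hl 0 v (s := 2)
  simp only [add_zero] at h2
  refine MemLp.const_smul ⟨h1, ?_⟩ a
  rw [h2]
  exact mul_lt_top ofReal_lt_top hv.2

/-- Uniform bounds on a ball extend, by scaling, to all viscosities and data. -/
lemma Good.of_ball {ν₀ : ℝ} (hν₀ : 0 < ν₀) (hr : r ≠ ∞) (hr0 : r ≠ 0) {n ε : ℝ}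
    (hε : 0 < ε) (h : ∀ v, MemLp v 2 volume → IsDivFree v →
      eLpNorm v 2 volume ≤ ofReal ε → Good ν₀ r s (Ioi 0) n n (ofReal n) v) (hν : 0 < ν) (hv : MemLp v 2 volume) (hd : IsDivFree v) {A : ℝ} (hA : 0 < A)
    (hvA : eLpNorm v 2 volume = ofReal A) :
    Good ν r s (Ioi 0) (n / ε * A) (√(ν₀ / ν) * (n / ε * A))
      (ofReal (ε ^ (2 * (1 - 2 * (1/r.toReal) - 3 * (1/s).toReal)) *
        ν₀ ^ (3 * (5/3 * (1/r.toReal) + 2 * (1/s).toReal - 1)) *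
        (ν ^ (-(3:ℝ) * (5/3 * (1/r.toReal) + 2 * (1/s).toReal - 1)) *
          A ^ (2 * (2 * (1/r.toReal) + 3 * (1/s).toReal - 1))) * n)) v := by
  set q := ε * (ν / ν₀) / A with hq
  have hq0 : 0 < q := by positivity
  set l := q ^ 2 with hl
  have hl0 : 0 < l := by positivity
  set a := ν / ν₀ * l with ha
  have ha0 : 0 < a := by positivity
  have hnorm : eLpNorm (fun x => a⁻¹ • v (l⁻¹ • x)) 2 volume = ofReal ε := by
    have h1 := eLpNorm_affine (inv_pos.2 hl0) 0 v (s := 2)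
    simp only [add_zero] at h1
    have : (fun x => a⁻¹ • v (l⁻¹ • x)) = a⁻¹ • fun x => v (l⁻¹ • x) := rfl
    rw [this, eLpNorm_const_smul, h1, hvA, Real.enorm_eq_ofReal (by positivity),
      ← ofReal_mul (by positivity), ← ofReal_mul (by positivity)]
    congr 1
    have e2 : ((1:ℝ≥0∞) / 2).toReal = 1/2 := by simp
    rw [e2, ← sqrt_eq_rpow]
    have : (l⁻¹ ^ 3)⁻¹ = (q ^ 3) ^ 2 := by rw [hl]; field_simp
    rw [this, sqrt_sq (by positivity), ha, hl, hq]
    field_simp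
  obtain ⟨u, hu, hN⟩ := h _ (MemLp.comp_smul hv (inv_pos.2 hl0) a⁻¹)
    (hd.comp_smul (inv_pos.2 hl0) a⁻¹) hnorm.le
  have h2 := hu.rescale ha0 hl0 0
  have hqA : ν₀ * (q * A) = ε * ν := by rw [hq]; field_simp
  have e1 : ν₀ * a / l = ν := by rw [ha]; field_simp
  have e2 : (fun x => a • a⁻¹ • v (l⁻¹ • (l • x + 0))) = v := by
    funext x; simp [smul_smul, ha0.ne', hl0.ne']
  have e3 : a * √(l ^ 3)⁻¹ * n = n / ε * A := by
    have : (l ^ 3)⁻¹ = ((q ^ 3)⁻¹) ^ 2 := by rw [hl]; field_simp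
    rw [this, sqrt_sq (by positivity), ha, hl]
    field_simp
    linear_combination -n * hqA
  have e4 : √a * l⁻¹ * n = √(ν₀ / ν) * (n / ε * A) := by
    have : a = (ν₀ / ν) * (ν / ν₀ * q) ^ 2 := by rw [ha, hl]; field_simp
    rw [this, sqrt_mul (by positivity), sqrt_sq (by positivity), hl]
    field_simp
    linear_combination -n * hqA
  rw [e1, e2, e3, e4] at h2
  refine ⟨_, h2, ?_⟩
  rw [mixedNorm_rsc hr hr0 ha0 hl0]
  refine (mul_le_mul_right hN _).trans_eq ?_
  rw [← ofReal_mul (by positivity)]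
  congr 2
  have e5 : (1 / r).toReal = 1 / r.toReal := by simp
  rw [e5]
  exact scaling_identity hε hν hA hν₀ rfl

end

/-- For `1 ≤ 5/(3r) + 2/s < 1 + 1/(3r)`: local-in-time solvability in `L^r L^s` for a
non-meagre set of `L²_σ` data is equivalent to the global a priori estimate. -/
theorem stmt_7 (r s : ℝ≥0∞) (hr : 4/3 < r) (hs : 4/3 < s) (ν₀ : ℝ) (hν₀ : 0 < ν₀)
    (h1 : 1 ≤ 5/(3*r) + 2/s) (h2 : 5/(3*r) + 2/s < 1 + 1/(3*r)) :
    (¬ IsMeagre {u₀ : L2σ | ∃ T : ℝ, 0 < T ∧ ∃ u G,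
        IsWeakNS ν₀ ((u₀ : Lp E3 2 (volume : Measure E3)) : E3 → E3) u G ∧
        mixedNorm r s (Ioo 0 T) u < ∞}) ↔
    (∃ C : ℝ, 0 < C ∧ ∀ ν : ℝ, 0 < ν → ∀ u₀ : L2σ, ∃ u G,
      IsWeakNS ν ((u₀ : Lp E3 2 (volume : Measure E3)) : E3 → E3) u G ∧
      mixedNorm ∞ 2 (Ioi 0) u + ENNReal.ofReal (Real.sqrt ν) * gradL2 G
        ≤ ENNReal.ofReal (C * ‖(u₀ : Lp E3 2 (volume : Measure E3))‖) ∧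
      mixedNorm r s (Ioi 0) u
        ≤ ENNReal.ofReal (C * ν ^ (-(3:ℝ) * ((5/(3*r) + 2/s).toReal - 1)) *
            ‖(u₀ : Lp E3 2 (volume : Measure E3))‖ ^ ((2:ℝ) * ((2/r + 3/s).toReal - 1)))) := by
  obtain ⟨hrt, hr0, hs2, hp, hp', ex, ey⟩ := exponent_facts hr hs h1 h2
  rw [ex, ey]
  constructor
  · intro hS
    obtain ⟨n, ε, hε, hball⟩ := exists_uniform_ball hν₀ hrt hr0 hs2 hp hp' hS fun v hv => hv
    set K := ε ^ (2 * (1 - 2 * (1/r.toReal) - 3 * (1/s).toReal)) *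
        ν₀ ^ (3 * (5/3 * (1/r.toReal) + 2 * (1/s).toReal - 1))
    have hK : 0 ≤ K := by positivity
    set D := (n:ℝ) / ε + √ν₀ * (n / ε) with hD
    have hD0 : 0 ≤ D := by positivity
    refine ⟨D + K * n + 1, by positivity, fun ν hν v => ?_⟩
    have hvm := Lp.memLp (v : L2E)
    rcases (norm_nonneg (v : L2E)).eq_or_lt with h0 | hA
    · have hv0 : ⇑(v : L2E) =ᵐ[volume] 0 := by
        rw [norm_eq_zero.1 h0.symm]; exact Lp.coeFn_zero _ _ _
      obtain ⟨G, hG, hM, hC⟩ := (sol_zero (ν := ν) hv0).exists_isWeakNS le_rfl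
      refine ⟨_, G, hG, ?_, ?_⟩
      · rw [ofReal_zero, nonpos_iff_eq_zero] at hM hC
        rw [hM, hC]; simp
      · have hR := toReal_pos hr0 hrt
        simp [mixedNorm, hrt, hR]
    · obtain ⟨u, hu, hN⟩ := Good.of_ball hν₀ hrt hr0 hε (n := n)
        (by simpa using hball) hν hvm v.2 hA (by rw [Lp.norm_def, ofReal_toReal hvm.2.ne])
      obtain ⟨G, hG, hM, hC⟩ := hu.exists_isWeakNS (by positivity)
      refine ⟨u, G, hG, (add_le_add hM (mul_le_mul_right hC _)).trans ?_, hN.trans ?_⟩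
      · rw [← ofReal_mul (by positivity), ← ofReal_add (by positivity) (by positivity),
          ← mul_assoc √ν, ← sqrt_mul hν.le, mul_div_cancel₀ _ hν.ne', ← mul_assoc √ν₀, ← add_mul]
        refine ofReal_le_ofReal (mul_le_mul_of_nonneg_right ?_ hA.le)
        rw [← hD]
        linarith [mul_nonneg hK (n.cast_nonneg (α := ℝ))]
      · refine ofReal_le_ofReal ?_
        rw [mul_right_comm, mul_assoc (D + K * n + 1)]
        exact mul_le_mul_of_nonneg_right (by linarith) (by positivity)
  · rintro ⟨C, -, h⟩
    have : CompleteSpace L2σ := isClosed_L2σ.completeSpace_coe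
    have : Nonempty L2σ := ⟨⟨0, zero_mem_L2σ⟩⟩
    refine fun hm => not_isMeagre_of_isOpen (X := L2σ) isOpen_univ univ_nonempty
      (hm.mono fun v _ => ?_)
    obtain ⟨u, G, hG, -, hN⟩ := h ν₀ hν₀ v
    exact ⟨1, one_pos, u, G, hG,
      (mixedNorm_mono hrt Ioo_subset_Ioi_self u).trans_lt (hN.trans_lt ofReal_lt_top)⟩
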